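/- There exist real constants c_3(C_6) > 0, c_4(C_6), c_5(C_6) such that #F_ℚ(C_6; X) = c_3(C_6) X^{1/3} + c_4(C_6) X^{1/4} + c_5(C_6) X^{1/5} + O(X^{1/6} (log X)^5) as X → ∞. -/

import Mathlib

open scoped Classical

/-- The absolute value of the discriminant of a finite intermediate field of
`AlgebraicClosure ℚ / ℚ` (junk value `0` if the field is not finite over `ℚ`). -/
noncomputable def absDisc (L : IntermediateField ℚ (AlgebraicClosure ℚ)) : ℕ :=
  if h : FiniteDimensional ℚ L then
    letI := h
    letI : NumberField L := ⟨⟩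
    (NumberField.discr L).natAbs
  else 0

/-- `#F_ℚ(G; X)`: the number of field extensions `L/ℚ` inside a fixed algebraic
closure of `ℚ` that are Galois over `ℚ` with `Gal(L/ℚ) ≅ G` and `|disc(L/ℚ)| ≤ X`. -/
noncomputable def galoisCount (G : Type) [Group G] (X : ℝ) : ℕ :=
  Nat.card {L : IntermediateField ℚ (AlgebraicClosure ℚ) //
    FiniteDimensional ℚ L ∧ IsGalois ℚ L ∧ Nonempty ((L ≃ₐ[ℚ] L) ≃* G) ∧
      (absDisc L : ℝ) ≤ X}

namespace CSix

open IntermediateField hiding mem_inf natCast_mem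
open Finset hiding pi uIcc_of_le mem_inf
noncomputable section

open Complex (mul_re sub_re one_re add_re add_im ofReal_re ofReal_im I_re I_im sub_im one_im
  mul_im norm_I norm_real reCLM re_ofReal_mul ofReal_pow imCLM I_sq)
open Real (pi cos sin pi_pos cos_two_mul abs_cos_le_one norm_eq_abs sqrt_pos mul_self_sqrt
  le_sqrt_of_sq_le sqrt_le_iff sq_sqrt rpow_neg sqrt_eq_rpow rpow_natCast rpow_mul sqrt_le_sqrt
  one_le_sqrt sqrt_nonneg sqrt_le_one pi_gt_three sqrt_div sqrt_mul sqrt_sq div_rpow rpow_add_one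
  rpow_le_rpow_of_nonpos one_le_rpow norm_of_nonneg mul_rpow rpow_add rpow_one_add' rpow_nonneg
  log_le_log log_pow hasDerivAt_rpow_const rpow_pos_of_pos rpow_le_rpow_of_exponent_le one_rpow
  rpow_zero rpow_one rpow_le_rpow log_nonneg log_rpow exp_pos log_exp log)
open Nat (cast_nonneg cast_le le_ceil lt_floor_add_one floor_le cast_one le_floor_iff le_floor
  floor_lt floor_natCast prime_three prime_iff_prime_int prime_two Coprime le_of_dvd card_zmod
  card_congr subtype_card)
open Set (Ioo uIoc_of_le uIcc uIcc_of_le mem_setOf_eq Ioi InjOn)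
open Int (fract)
open Or (inl inr)
open Filter (Eventually Tendsto atTop)
open intervalIntegral (integral_of_le integral_eq_sub_of_hasDerivAt
  integral_add_adjacent_intervals integral_congr integral_comp_neg)
open Measurable (aestronglyMeasurable)
open Function (uncurry onFun Injective Surjective)
open ContinuousOn (rpow_const intervalIntegrable)
open Module (Basis finrank finrank_pos)
open ZMod (natCast_eq_natCast_iff natCast_zmod_val)
open Finsupp (prod_of_support_subset)
open PowerSeries (coeff_mul coeff_mk coeff_C_mul coeff_succ_mul_X HasSubst subst_X
  coeff_subst_X_pow coeff_C)
open Polynomial (natDegree coeff_add coeff_X_pow_mul' aeval aeval_X)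
open Ideal (absNorm span)
open MonoidHom (mem_ker range_eq_top range_eq_map one_comp ker_one)
open Subgroup (zpowers mem_inf)
open InfiniteGalois (fixedField_fixingSubgroup)
open Multiplicative (ofAdd toAdd)

/-- The additive character `x ↦ exp (2πix)`. -/
def ee (x:ℝ) : ℂ := Complex.exp ((2*pi*x:ℝ)*Complex.I)

lemma norm_ee (x:ℝ) : ‖ee x‖ = 1 := Complex.norm_exp_ofReal_mul_I _

lemma ee_add (x y:ℝ) : ee (x+y) = ee x*ee y := by
  simp only [ee]
  rw [← Complex.exp_add]
  push_cast
  ring_nf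

lemma ee_re (x:ℝ) : (ee x).re = cos (2*pi*x) := Complex.exp_ofReal_mul_I_re _

lemma ee_im (x:ℝ) : (ee x).im = sin (2*pi*x) := Complex.exp_ofReal_mul_I_im _

lemma ee_int (k:ℤ) : ee k = 1 := by
  rw [ee]
  have := Complex.exp_int_mul_two_pi_mul_I k
  rw [← this]
  push_cast
  ring_nf

/-- Half the cotangent of `πx`. -/
def halfCot (x:ℝ) : ℝ := cos (pi*x)/(2*sin (pi*x))

lemma sin_pi_mul_ge {x δ : ℝ} (hδ : 0 ≤ δ) (h1 : δ ≤ x) (h2 : x ≤ 1-δ) : 2*δ ≤ sin (pi*x) := by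
  have hpi := pi_pos
  rcases le_total x (1/2) with h | h
  · have := Real.mul_le_sin (x := pi*x) (by nlinarith) (by nlinarith)
    have h3 : 2/pi*(pi*x) = 2*x := by field_simp
    linarith
  · have := Real.mul_le_sin (x := pi*(1-x)) (by nlinarith) (by nlinarith)
    have h3 : 2/pi*(pi*(1-x)) = 2*(1-x) := by field_simp
    have h4 : sin (pi*(1-x)) = sin (pi*x) := by rw [mul_sub, mul_one, Real.sin_pi_sub]
    linarith

lemma one_sub_ee_mul {x : ℝ} (h : sin (pi*x) ≠ 0) : (1-ee x)*(1/2+halfCot x*Complex.I) = 1 := by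
  have h2 : 2*pi*x = 2*(pi*x) := by ring
  have hsc := Real.sin_sq_add_cos_sq (pi*x)
  have h12 : (1/2:ℂ) = ((1/2:ℝ):ℂ) := by push_cast; rfl
  rw [h12]
  apply Complex.ext
  · simp only [mul_re, sub_re, one_re, add_re, add_im, ofReal_re, ofReal_im, I_re, I_im, sub_im,
      one_im, mul_im, ee_re, ee_im, h2, cos_two_mul, Real.sin_two_mul,
      halfCot]
    field_simp
    ring
  · simp only [mul_re, sub_re, one_re, add_re, add_im, ofReal_re, ofReal_im, I_re, I_im, sub_im,
      one_im, mul_im, ee_re, ee_im, h2, cos_two_mul, Real.sin_two_mul,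
      halfCot]
    field_simp
    linear_combination (-2)*cos (pi*x)*hsc

lemma halfCot_anti {x y : ℝ} (hx : 0 < x) (hxy : x ≤ y) (hy : y < 1) : halfCot y ≤ halfCot x := by
  have hpi := pi_pos
  have hsx : 0 < sin (pi*x) := Real.sin_pos_of_pos_of_lt_pi (by positivity) (by nlinarith)
  have hsy : 0 < sin (pi*y) := Real.sin_pos_of_pos_of_lt_pi (by nlinarith) (by nlinarith)
  have hd : 0 ≤ sin (pi*y-pi*x) :=
    Real.sin_nonneg_of_nonneg_of_le_pi (by nlinarith) (by nlinarith)
  rw [Real.sin_sub] at hd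
  rw [halfCot, halfCot, div_le_div_iff₀ (by positivity) (by positivity)]
  nlinarith

lemma abs_halfCot_le {x δ : ℝ} (hδ : 0 < δ) (h1 : δ ≤ x) (h2 : x ≤ 1-δ) :
    |halfCot x| ≤ 1/(4*δ) := by
  have hs := sin_pi_mul_ge hδ.le h1 h2
  have hs0 : 0 < sin (pi*x) := by linarith
  rw [halfCot, abs_div, abs_of_pos (by positivity : 0 < 2*sin (pi*x)),
    div_le_div_iff₀ (by positivity) (by positivity)]
  nlinarith [abs_cos_le_one (pi*x), abs_nonneg (cos (pi*x))]

lemma halfCot_sub_int (x:ℝ) (k:ℤ) : ee (x-k) = ee x := by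
  have : ee x = ee (x-k)*ee k := by rw [← ee_add]; ring_nf
  rw [this, ee_int, mul_one]

/-- **Kuzmin–Landau inequality.** -/
lemma kuzmin_landau (f : ℕ → ℝ) (N:ℕ) {δ : ℝ} (hδ : 0 < δ) (k:ℤ)
    (hmono : ∀ n, n+1 < N → f (n+1)-f n ≤ f (n+2)-f (n+1))
    (hl : ∀ n < N, k+δ ≤ f (n+1)-f n) (hu : ∀ n < N, f (n+1)-f n ≤ k+1-δ) :
    ‖∑ n ∈ range N, ee (f n)‖ ≤ 2/δ := by
  rcases N with _ | N
  · simp; positivity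
  set g : ℕ → ℝ := fun n => f (n+1)-f n-k with hg
  have hg1 : ∀ n < N+1, δ ≤ g n := fun n hn => by have := hl n hn; simp only [hg]; linarith
  have hg2 : ∀ n < N+1, g n ≤ 1-δ := fun n hn => by have := hu n hn; simp only [hg]; linarith
  have hδ2 : δ ≤ 1/2 := by have := hg1 0 (by omega); have := hg2 0 (by omega); linarith
  have hgm : ∀ n < N, g n ≤ g (n+1) := fun n hn => by
    have := hmono n (by omega)
    simp only [hg]
    linarith
  set c : ℕ → ℂ := fun n => 1/2+halfCot (g n)*Complex.I with hc
  have hu1 : ∀ n < N+1, ee (f n) = (ee (f n)-ee (f (n+1)))*c n := by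
    intro n hn
    have hs : sin (pi*g n) ≠ 0 := by
      have := sin_pi_mul_ge hδ.le (hg1 n hn) (hg2 n hn)
      linarith
    have h1 := one_sub_ee_mul hs
    have h2 : ee (f (n+1)) = ee (f n)*ee (g n) := by
      rw [hg, halfCot_sub_int, ← ee_add]
      ring_nf
    rw [h2]
    simp only [hc]
    linear_combination (-ee (f n))*h1
  have habel : ∀ M : ℕ, ∑ n ∈ range (M+1), (ee (f n)-ee (f (n+1)))*c n
      = c 0*ee (f 0)-c M*ee (f (M+1))
        + ∑ n ∈ range M, ee (f (n+1))*(c (n+1)-c n) := by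
    intro M
    induction M with
    | zero => simp; ring
    | succ M ih =>
      rw [sum_range_succ, ih, sum_range_succ]
      ring
  rw [sum_congr rfl (fun n hn => hu1 n (mem_range.mp hn)), habel]
  have hcn : ∀ n < N+1, ‖c n‖ ≤ 1/2+1/(4*δ) := by
    intro n hn
    refine (norm_add_le _ _).trans ?_
    have := abs_halfCot_le hδ (hg1 n hn) (hg2 n hn)
    have h12 : ‖(1/2:ℂ)‖ = 1/2 := by norm_num
    rw [h12, norm_mul, norm_I, mul_one, norm_real, norm_eq_abs]
    linarith
  have hdiff : ∀ n < N, ‖ee (f (n+1))*(c (n+1)-c n)‖ ≤ halfCot (g n)-halfCot (g (n+1)) := by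
    intro n hn
    rw [norm_mul, norm_ee, one_mul]
    have : c (n+1)-c n = ((halfCot (g (n+1))-halfCot (g n):ℝ):ℂ)*Complex.I := by
      simp only [hc]; push_cast; ring
    rw [this, norm_mul, norm_I, mul_one, norm_real, norm_eq_abs, abs_sub_comm, abs_of_nonneg]
    have := halfCot_anti (by linarith [hg1 n (by omega)]) (hgm n hn) (by linarith [hg2 (n+1) (by omega)])
    linarith
  have hsum : ‖∑ n ∈ range N, ee (f (n+1))*(c (n+1)-c n)‖ ≤ halfCot (g 0)-halfCot (g N) := by
    refine (norm_sum_le _ _).trans ?_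
    refine (sum_le_sum (fun n hn => hdiff n (mem_range.mp hn))).trans ?_
    rw [sum_range_sub']
  have h0 := abs_halfCot_le hδ (hg1 0 (by omega)) (hg2 0 (by omega))
  have hN := abs_halfCot_le hδ (hg1 N (by omega)) (hg2 N (by omega))
  have h3 : ‖c 0*ee (f 0)-c N*ee (f (N+1))
      + ∑ n ∈ range N, ee (f (n+1))*(c (n+1)-c n)‖ ≤ ‖c 0‖ + ‖c N‖ +
        (halfCot (g 0)-halfCot (g N)) := by
    refine (norm_add_le _ _).trans (add_le_add ((norm_sub_le _ _).trans ?_) hsum)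
    rw [norm_mul, norm_mul, norm_ee, norm_ee, mul_one, mul_one]
  have h5 : (1:ℝ) ≤ 1/(2*δ) := by
    rw [le_div_iff₀ (by positivity)]
    linarith
  have h6 : 1/(2*δ) = 2*(1/(4*δ)) := by field_simp; norm_num
  have h7 : 2/δ = 8*(1/(4*δ)) := by field_simp; norm_num
  have := hcn 0 (by omega)
  have := hcn N (by omega)
  rw [abs_le] at h0 hN
  linarith [h0.1, h0.2, hN.1, hN.2]

lemma filter_mono_eq_Ico (g : ℕ → ℝ) (M:ℕ) (hg : ∀ m n, m ≤ n → n < M → g m ≤ g n)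
    {I : Set ℝ} [DecidablePred fun n => g n ∈ I] (hI : I.OrdConnected) :
    ∃ a L : ℕ, a+L ≤ M ∧ (range M).filter (fun n => g n ∈ I) = Ico a (a+L) := by
  set s := (range M).filter (fun n => g n ∈ I) with hs
  rcases s.eq_empty_or_nonempty with h | h
  · exact ⟨0, 0, by simp, by simp [h]⟩
  · have ha := mem_filter.mp (s.min'_mem h)
    have hb := mem_filter.mp (s.max'_mem h)
    have hab : s.min' h ≤ s.max' h := s.min'_le _ (s.max'_mem h)
    have hbM := mem_range.mp hb.1
    refine ⟨s.min' h, s.max' h-s.min' h+1, by omega, ?_⟩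
    have h1 : s.min' h+(s.max' h-s.min' h+1) = s.max' h+1 := by omega
    rw [h1]
    ext n
    rw [mem_Ico]
    constructor
    · intro hn
      exact ⟨s.min'_le _ hn, Nat.lt_succ_of_le (s.le_max' _ hn)⟩
    · intro hn
      refine mem_filter.mpr ⟨mem_range.mpr (by omega), ?_⟩
      exact hI.out ha.2 hb.2 ⟨hg _ _ hn.1 (by omega), hg _ _ (by omega) hbM⟩

lemma card_filter_short (g : ℕ → ℝ) (M:ℕ) {lam δ : ℝ} (hlam : 0 < lam) (hδ : 0 ≤ δ)
    (hg : ∀ m n, m ≤ n → n < M → lam*(n-m:ℝ) ≤ g n-g m) {I : Set ℝ}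
    [DecidablePred fun n => g n ∈ I] (hI : I.OrdConnected)
    (hI2 : ∀ x ∈ I, ∀ y ∈ I, y-x ≤ δ) :
    (((range M).filter (fun n => g n ∈ I)).card:ℝ) ≤ δ/lam+1 := by
  have hm : ∀ m n, m ≤ n → n < M → g m ≤ g n := fun m n h1 h2 => by
    have h3 := hg m n h1 h2
    have h4 : (m:ℝ) ≤ n := mod_cast h1
    nlinarith
  obtain ⟨a, L, haL, h⟩ := filter_mono_eq_Ico g M hm hI
  rw [h]
  simp only [Nat.card_Ico, add_tsub_cancel_left]
  rcases L with _ | L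
  · simp; positivity
  · have h1 : a ∈ (range M).filter (fun n => g n ∈ I) := by rw [h]; simp
    have h2 : a+L ∈ (range M).filter (fun n => g n ∈ I) := by rw [h]; simp
    have h3 := hI2 _ (mem_filter.mp h1).2 _ (mem_filter.mp h2).2
    have h4 := hg a (a+L) (by omega) (by omega)
    push_cast at h4 ⊢
    have h5 : (L:ℝ) ≤ δ/lam := by
      rw [le_div_iff₀ hlam]
      nlinarith
    linarith

/-- **van der Corput's second derivative test**, in terms of second differences. -/
lemma van_der_corput (f : ℕ → ℝ) (N:ℕ) {lam c : ℝ} (hlam : 0 < lam) (hc : 1 ≤ c)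
    (h1 : ∀ n, n+2 ≤ N → lam ≤ f (n+2)-2*f (n+1)+f n)
    (h2 : ∀ n, n+2 ≤ N → f (n+2)-2*f (n+1)+f n ≤ c*lam) :
    ‖∑ n ∈ range N, ee (f n)‖ ≤ 12*(c*N*lam+1)/√lam := by
  have hsq : 0 < √lam := sqrt_pos.mpr hlam
  have hsq2 : √lam*√lam = lam := mul_self_sqrt hlam.le
  have triv : ∀ s : Finset ℕ, ‖∑ n ∈ s, ee (f n)‖ ≤ s.card := fun s =>
    (norm_sum_le _ _).trans (by simp [norm_ee])
  have hN0 : (0:ℝ) ≤ N := cast_nonneg N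
  rcases le_or_gt (1/4) lam with hl | hl
  · refine (triv _).trans ?_
    rw [card_range, le_div_iff₀ hsq]
    have h3 : √lam ≤ 2*lam := by nlinarith
    have h4 : N*√lam ≤ N*(2*lam) := mul_le_mul_of_nonneg_left h3 hN0
    nlinarith [mul_nonneg (mul_nonneg (sub_nonneg.mpr hc) hN0) hlam.le, mul_nonneg hN0 hlam.le]
  have hδ : √lam ≤ 1/2 := by rw [sqrt_le_iff]; norm_num; linarith
  have hinv : 2 ≤ 1/√lam := by rw [le_div_iff₀ hsq]; linarith
  rcases N with _ | M
  · simp; positivity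
  rw [sum_range_succ]
  set g : ℕ → ℝ := fun n => f (n+1)-f n with hgdef
  have hstep1 : ∀ n, n+1 < M → lam ≤ g (n+1)-g n := fun n hn => by
    have := h1 n (by omega)
    simp only [hgdef]
    linarith
  have hstep2 : ∀ n, n+1 < M → g (n+1)-g n ≤ c*lam := fun n hn => by
    have := h2 n (by omega)
    simp only [hgdef]
    linarith
  have hg1 : ∀ m n, m ≤ n → n < M → lam*(n-m:ℝ) ≤ g n-g m := by
    intro m n hmn
    induction n, hmn using Nat.le_induction with
    | base => intro _; simp
    | succ n hmn ih =>
      intro hn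
      have := ih (by omega)
      have := hstep1 n hn
      push_cast
      linarith
  have hg2 : ∀ n, n < M → g n-g 0 ≤ c*lam*n := by
    intro n
    induction n with
    | zero => intro _; simp
    | succ n ih =>
      intro hn
      have := ih (by omega)
      have := hstep2 n hn
      push_cast
      linarith
  have hm : ∀ m n, m ≤ n → n < M → g m ≤ g n := fun m n h1 h2 => by
    have h3 := hg1 m n h1 h2
    have h4 : (m:ℝ) ≤ n := mod_cast h1
    nlinarith
  have key : ∀ k : ℤ, ‖∑ n ∈ (range M).filter (fun n => ⌊g n⌋ = k), ee (f n)‖ ≤ 5/√lam := by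
    intro k
    have hlow := card_filter_short g M hlam hsq.le hg1 (I := Set.Ico (k:ℝ) (k+√lam))
      Set.ordConnected_Ico (fun x hx y hy => by linarith [hx.1, hy.2])
    have hhigh := card_filter_short g M hlam hsq.le hg1 (I := Ioo (k+1-√lam:ℝ) (k+1))
      Set.ordConnected_Ioo (fun x hx y hy => by linarith [hx.1, hy.2])
    have hmid : ‖∑ n ∈ (range M).filter
        (fun n => g n ∈ Set.Icc (k+√lam:ℝ) (k+1-√lam)), ee (f n)‖ ≤ 2/√lam := by
      obtain ⟨a, L, haL, h⟩ := filter_mono_eq_Ico g M hm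
        (I := Set.Icc (k+√lam:ℝ) (k+1-√lam)) Set.ordConnected_Icc
      have hmem : ∀ n < L, g (a+n) ∈ Set.Icc (k+√lam:ℝ) (k+1-√lam) := by
        intro n hn
        have : a+n ∈ (range M).filter
            (fun n => g n ∈ Set.Icc (k+√lam:ℝ) (k+1-√lam)) := by
          rw [h, mem_Ico]; omega
        exact (mem_filter.mp this).2
      rw [h, sum_Ico_eq_sum_range, add_tsub_cancel_left]
      refine kuzmin_landau (fun n => f (a+n)) L hsq k ?_ ?_ ?_
      · intro n hn
        exact hm (a+n) (a+n+1) (by omega) (by omega)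
      · intro n hn
        exact (hmem n hn).1
      · intro n hn
        exact (hmem n hn).2
    have hsplit : (range M).filter (fun n => ⌊g n⌋ = k) =
        ((range M).filter (fun n => g n ∈ Set.Ico (k:ℝ) (k+√lam)) ∪
        (range M).filter (fun n => g n ∈ Ioo (k+1-√lam:ℝ) (k+1))) ∪
        (range M).filter (fun n => g n ∈ Set.Icc (k+√lam:ℝ) (k+1-√lam)) := by
      ext n
      simp only [mem_filter, mem_union, Set.mem_Ico, Set.mem_Ioo, Set.mem_Icc, Int.floor_eq_iff]
      constructor
      · rintro ⟨h, h3, h4⟩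
        rcases lt_or_ge (g n) (k+√lam) with h5 | h5
        · exact inl (inl ⟨h, h3, h5⟩)
        · rcases le_or_gt (g n) (k+1-√lam) with h6 | h6
          · exact inr ⟨h, h5, h6⟩
          · exact inl (inr ⟨h, h6, h4⟩)
      · rintro ((⟨h, h3, h4⟩ | ⟨h, h3, h4⟩) | ⟨h, h3, h4⟩)
        · exact ⟨h, h3, by linarith⟩
        · exact ⟨h, by linarith, h4⟩
        · exact ⟨h, by linarith, by linarith⟩
    rw [hsplit, sum_union, sum_union]
    · have e1 := triv ((range M).filter (fun n => g n ∈ Set.Ico (k:ℝ) (k+√lam)))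
      have e2 := triv ((range M).filter (fun n => g n ∈ Ioo (k+1-√lam:ℝ) (k+1)))
      refine (norm_add_le _ _).trans ?_
      refine (add_le_add ((norm_add_le _ _).trans (add_le_add (e1.trans hlow) (e2.trans hhigh)))
        hmid).trans ?_
      have h3 : √lam/lam = 1/√lam := by rw [div_eq_div_iff hlam.ne' hsq.ne']; linarith
      rw [h3]
      have h4 : 5/√lam = 5*(1/√lam) := by ring
      have h5 : 2/√lam = 2*(1/√lam) := by ring
      rw [h4, h5]
      linarith
    · rw [disjoint_filter]
      intro n _ h3 h4
      simp only [Set.mem_Ico, Set.mem_Ioo] at h3 h4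
      linarith [h3.2, h4.1]
    · rw [disjoint_union_left, disjoint_filter, disjoint_filter]
      refine ⟨fun n _ h3 h4 => ?_, fun n _ h3 h4 => ?_⟩
      · simp only [Set.mem_Ico, Set.mem_Icc] at h3 h4
        linarith [h3.2, h4.1]
      · simp only [Set.mem_Ioo, Set.mem_Icc] at h3 h4
        linarith [h3.1, h4.2]
  have hmain : ‖∑ n ∈ range M, ee (f n)‖ ≤ (c*M*lam+2)*(5/√lam) := by
    rcases M with _ | M
    · simp; positivity
    have hmaps : ∀ n ∈ range (M+1), ⌊g n⌋ ∈ Icc ⌊g 0⌋ ⌊g M⌋ := by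
      intro n hn
      have hn := mem_range.mp hn
      rw [mem_Icc]
      exact ⟨Int.floor_le_floor (hm 0 n (by omega) hn),
        Int.floor_le_floor (hm n M (by omega) (by omega))⟩
    rw [← sum_fiberwise_of_maps_to hmaps]
    refine (norm_sum_le _ _).trans ((sum_le_sum fun k _ => key k).trans ?_)
    rw [sum_const, nsmul_eq_mul]
    refine mul_le_mul_of_nonneg_right ?_ (by positivity)
    rw [Int.card_Icc]
    have h3 := hg2 M (by omega)
    have h4 : ⌊g 0⌋ ≤ ⌊g M⌋ := Int.floor_le_floor (hm 0 M (by omega) (by omega))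
    have h5 : (((⌊g M⌋ + 1-⌊g 0⌋).toNat:ℤ):ℝ) = ⌊g M⌋ + 1-⌊g 0⌋ := by
      rw [Int.toNat_of_nonneg (by omega)]; push_cast; ring
    rw [Int.cast_natCast] at h5
    rw [h5]
    have := Int.floor_le (g M)
    have := Int.lt_floor_add_one (g 0)
    push_cast
    nlinarith
  refine (norm_add_le _ _).trans ?_
  rw [norm_ee]
  push_cast
  have h3 : 12*(c*(M+1)*lam+1)/√lam = 12*(c*(M+1)*lam+1)*(1/√lam) := by ring
  have h4 : (c*M*lam+2)*(5/√lam) = 5*(c*M*lam+2)*(1/√lam) := by ring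
  rw [h3]
  rw [h4] at hmain
  have h6 : 0 ≤ c*M*lam := by positivity
  have h7 : 0 ≤ c*lam := by positivity
  nlinarith [mul_nonneg h6 (by positivity : (0:ℝ) ≤ 1/√lam), mul_nonneg h7 (by positivity : (0:ℝ) ≤ 1/√lam)]

section
open MeasureTheory

/-- Joint bounds for a family of radii `ρ` in `[ρ₀, 2ρ₀]` and its exponential integrals. -/
structure PhaseBound {α : Type*} [MeasurableSpace α] (μ : Measure α) (ρ : α → ℝ)
    (r P₀ P Q:ℝ) : Prop where
  meas : Measurable ρ
  pos : 0 < r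
  P₀_nonneg : 0 ≤ P₀
  P_nonneg : 0 ≤ P
  Q_nonneg : 0 ≤ Q
  lower : ∀ a, r ≤ ρ a
  upper : ∀ a, ρ a ≤ 2*r
  bound : ∀ j ≤ 2, ∀ y : ℝ, 0 < y → ‖∫ a, ((ρ a^j:ℝ):ℂ)*ee (y*ρ a) ∂μ‖ ≤
    r^j*(P₀+P*√(y*r)+Q/(1+y*r))

section
variable {α : Type*} [MeasurableSpace α] {μ : Measure α} [IsFiniteMeasure μ] {ρ : α → ℝ}
  {r P₀ P Q : ℝ}

lemma PhaseBound.integrable_pow_mul (h : PhaseBound μ ρ r P₀ P Q) (j:ℕ) {g : α → ℝ}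
    (hg : Measurable g) {C : ℝ} (hC : ∀ a, |g a| ≤ C) :
    Integrable (fun a => ρ a^j*g a) μ := by
  refine Integrable.of_bound (C := (2*r)^j*C)
    ((h.meas.pow_const j).mul hg).aestronglyMeasurable (.of_forall fun a => ?_)
  have := h.pos
  have h1 := h.lower a
  have h2 := h.upper a
  rw [norm_eq_abs, abs_mul, abs_pow, abs_of_pos (by linarith : 0 < ρ a)]
  have := hC a
  have := (abs_nonneg _).trans this
  gcongr
  · linarith

lemma PhaseBound.cos_le (h : PhaseBound μ ρ r P₀ P Q) {j : ℕ} (hj : j ≤ 2) {y : ℝ} (hy : 0 < y) :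
    |∫ a, ρ a^j*cos (2*pi*(y*ρ a)) ∂μ| ≤ r^j*(P₀+P*√(y*r)+Q/(1+y*r)) := by
  refine le_trans ?_ (h.bound j hj y hy)
  have hi : Integrable (fun a => ((ρ a^j:ℝ):ℂ)*ee (y*ρ a)) μ := by
    refine Integrable.of_bound (C := (2*r)^j) ?_ (.of_forall fun a => ?_)
    · have := h.meas
      unfold ee
      fun_prop
    · have := h.pos
      have h1 := h.lower a
      have h2 := h.upper a
      rw [norm_mul, norm_ee, mul_one, norm_real, norm_eq_abs, abs_pow,
        abs_of_pos (by linarith : 0 < ρ a)]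
      gcongr
      linarith
  have := Complex.abs_re_le_norm (∫ a, ((ρ a^j:ℝ):ℂ)*ee (y*ρ a) ∂μ)
  rw [← Complex.reCLM_apply, ← reCLM.integral_comp_comm hi] at this
  simpa [re_ofReal_mul, ee_re, ← ofReal_pow] using this

lemma PhaseBound.sin_le (h : PhaseBound μ ρ r P₀ P Q) {j : ℕ} (hj : j ≤ 2) {y : ℝ} (hy : 0 < y) :
    |∫ a, ρ a^j*sin (2*pi*(y*ρ a)) ∂μ| ≤ r^j*(P₀+P*√(y*r)+Q/(1+y*r)) := by
  refine le_trans ?_ (h.bound j hj y hy)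
  have hi : Integrable (fun a => ((ρ a^j:ℝ):ℂ)*ee (y*ρ a)) μ := by
    refine Integrable.of_bound (C := (2*r)^j) ?_ (.of_forall fun a => ?_)
    · have := h.meas
      unfold ee
      fun_prop
    · have := h.pos
      have h1 := h.lower a
      have h2 := h.upper a
      rw [norm_mul, norm_ee, mul_one, norm_real, norm_eq_abs, abs_pow,
        abs_of_pos (by linarith : 0 < ρ a)]
      gcongr
      linarith
  have := Complex.abs_im_le_norm (∫ a, ((ρ a^j:ℝ):ℂ)*ee (y*ρ a) ∂μ)
  rw [← Complex.imCLM_apply, ← imCLM.integral_comp_comm hi] at this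
  simpa [Complex.im_ofReal_mul, ee_im, ← ofReal_pow] using this

lemma PhaseBound.measurable_inner (h : PhaseBound μ ρ r P₀ P Q) {w : ℝ → ℝ} (hw : Measurable w)
    (X a b:ℝ) (hab : a ≤ b) :
    Measurable fun s => ∫ v in a..b, w v*cos (2*pi*(X*v*ρ s)) := by
  simp only [integral_of_le hab]
  refine StronglyMeasurable.measurable ?_
  refine StronglyMeasurable.integral_prod_right' (f := fun z : α × ℝ =>
    w z.2*cos (2*pi*(X*z.2*ρ z.1))) ?_
  have := h.meas
  exact Measurable.stronglyMeasurable (by fun_prop)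

lemma PhaseBound.integral_cos_le (h : PhaseBound μ ρ r P₀ P Q) {j : ℕ} {w g : ℝ → ℝ}
    {X a b M : ℝ} (hw : Measurable w) (hab : a ≤ b) (hM : ∀ v ∈ Set.Ioc a b, |w v| ≤ M)
    (hg : IntervalIntegrable g volume a b)
    (hb : ∀ v ∈ Set.Ioc a b, |w v| * |∫ s, ρ s^j*cos (2*pi*(X*v*ρ s)) ∂μ| ≤ g v) :
    |∫ s, ρ s^j*(∫ v in a..b, w v*cos (2*pi*(X*v*ρ s))) ∂μ| ≤ ∫ v in a..b, g v := by
  have hmeas := h.meas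
  have e : ∀ s, ρ s^j*(∫ v in a..b, w v*cos (2*pi*(X*v*ρ s))) =
      ∫ v in a..b, w v*(ρ s^j*cos (2*pi*(X*v*ρ s))) := by
    intro s
    rw [← intervalIntegral.integral_const_mul]
    congr 1; ext v; ring
  simp only [e]
  rw [← intervalIntegral_integral_swap (f := fun v s =>
    w v*(ρ s^j*cos (2*pi*(X*v*ρ s))))]
  · simp only [integral_const_mul]
    rw [← norm_eq_abs]
    refine intervalIntegral.norm_integral_le_of_norm_le hab (.of_forall fun v hv => ?_) hg
    rw [norm_mul]
    exact hb v hv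
  · rw [uIoc_of_le hab]
    refine Integrable.of_bound (C := M*(2*r)^j) ?_ ?_
    · exact aestronglyMeasurable (by unfold uncurry; fun_prop)
    · have : ∀ᵐ z ∂((volume.restrict (Set.Ioc a b)).prod μ), z.1 ∈ Set.Ioc a b :=
        Measure.quasiMeasurePreserving_fst.ae (ae_restrict_mem measurableSet_Ioc)
      filter_upwards [this] with z hz
      have hr := h.pos
      have h1 := h.lower z.2
      have h2 := h.upper z.2
      have h3 := hM z.1 hz
      have h4 := (abs_nonneg _).trans h3
      simp only [uncurry, norm_mul, norm_eq_abs, abs_pow, abs_of_pos (by linarith : 0 < ρ z.2)]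
      have := abs_cos_le_one (2*pi*(X*z.1*ρ z.2))
      have : ρ z.2^j*|cos (2*pi*(X*z.1*ρ z.2))| ≤ (2*r)^j*1 := by gcongr; linarith
      rw [mul_one] at this
      gcongr
      have : 0 < ρ z.2 := by linarith
      positivity

end

/-- The Fourier transform at a frequency of length `X` of the disc of radius `ρ`. -/
def discFT (ρ X:ℝ) : ℝ := 4*ρ^2*∫ v in (0:ℝ)..1, √(1-v^2)*cos (2*pi*(X*v*ρ))

lemma integral_sqrt_mul_cos (ω:ℝ) {b : ℝ} (hb0 : 0 ≤ b) (hb : b < 1) :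
    ω^2*∫ v in (0:ℝ)..b, √(1-v^2)*cos (ω*v) = ω*√(1-b^2)*sin (ω*b)-b/√(1-b^2)*cos (ω*b) +
      ∫ v in (0:ℝ)..b, 1/√(1-v^2)^3*cos (ω*v) := by
  have hpos : ∀ v ∈ uIcc 0 b, 0 < 1-v^2 := by
    intro v hv
    rw [uIcc_of_le hb0] at hv
    nlinarith [hv.1, hv.2]
  have hs : ContinuousOn (fun v : ℝ => √(1-v^2)) (uIcc 0 b) := by fun_prop
  have hne : ∀ v ∈ uIcc 0 b, √(1-v^2) ≠ 0 := fun v hv =>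
    (sqrt_pos.2 (hpos v hv)).ne'
  have hc1 : ContinuousOn (fun v : ℝ => √(1-v^2)*cos (ω*v)) (uIcc 0 b) := by fun_prop
  have hc2 : ContinuousOn (fun v : ℝ => 1/√(1-v^2)^3*cos (ω*v))
      (uIcc 0 b) := by
    refine ContinuousOn.mul (continuousOn_const.div (hs.pow 3) fun v hv => pow_ne_zero _ (hne v hv)) ?_
    fun_prop
  have key : ∫ v in (0:ℝ)..b, (ω^2*(√(1-v^2)*cos (ω*v))-1/√(1-v^2)^3*cos (ω*v)) =
      (ω*√(1-b^2)*sin (ω*b)-b/√(1-b^2)*cos (ω*b)) -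
      (ω*√(1-0^2)*sin (ω*0)-0/√(1-0^2)*cos (ω*0)) := by
    refine integral_eq_sub_of_hasDerivAt (f := fun v =>
      ω*√(1-v^2)*sin (ω*v)-v/√(1-v^2)*cos (ω*v)) ?_ ?_
    · intro v hv
      have h1 : HasDerivAt (fun v : ℝ => √(1-v^2)) (-(2*v)/(2*√(1-v^2))) v := by
        refine HasDerivAt.sqrt ?_ (hpos v hv).ne'
        simpa using (hasDerivAt_pow 2 v).const_sub 1
      have h0 : HasDerivAt (fun v : ℝ => ω*v) ω v := by simpa using (hasDerivAt_id v).const_mul ω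
      have := ((h1.const_mul ω).mul h0.sin).sub (((hasDerivAt_id v).div h1 (hne v hv)).mul h0.cos)
      refine this.congr_deriv ?_
      have hsq := sq_sqrt (hpos v hv).le
      simp only [Pi.div_apply, id]
      generalize √(1-v^2) = s at *
      have hv2 : v^2 = 1-s^2 := by linarith
      field_simp
      ring_nf
      rw [hv2]
      ring
    · exact ((hc1.const_smul (ω^2)).sub hc2).intervalIntegrable
  rw [intervalIntegral.integral_sub (hc1.intervalIntegrable.const_mul (ω^2))
    hc2.intervalIntegrable, intervalIntegral.integral_const_mul] at key
  simp at key
  simp only [one_div]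
  linarith

section
variable {α : Type*} [MeasurableSpace α] {μ : Measure α} [IsFiniteMeasure μ] {ρ : α → ℝ}
  {r P₀ P Q : ℝ}

lemma discFT_split {ρ X b : ℝ} (hX : 0 < X) (hb0 : 0 ≤ b) (hb : b < 1) :
    discFT ρ X = 4*(ρ^2*∫ v in b..1, √(1-v^2)*cos (2*pi*(X*v*ρ))) +
      2/(pi*X)*√(1-b^2)*(ρ^1*sin (2*pi*(X*b*ρ))) -
      1/(pi^2*X^2)*(b/√(1-b^2)) * (ρ^0*cos (2*pi*(X*b*ρ))) +
      1/(pi^2*X^2) * (ρ^0*∫ v in (0:ℝ)..b, 1/√(1-v^2)^3*cos (2*pi*(X*v*ρ))) := by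
  have key := integral_sqrt_mul_cos (2*pi*X*ρ) hb0 hb
  have e : ∀ v, 2*pi*(X*v*ρ) = 2*pi*X*ρ*v := fun v => by ring
  have hi : ∀ a b : ℝ, IntervalIntegrable (fun v => √(1-v^2)*cos (2*pi*X*ρ*v)) volume a b :=
    fun a b => (by fun_prop : Continuous _).intervalIntegrable _ _
  have hsplit := integral_add_adjacent_intervals (hi 0 b) (hi b 1)
  unfold discFT
  simp only [e, ← hsplit]
  generalize (∫ v in b..1, √(1-v^2)*cos (2*pi*X*ρ*v)) = I1 at *
  generalize (∫ v in (0:ℝ)..b, √(1-v^2)*cos (2*pi*X*ρ*v)) = I2 at *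
  generalize (∫ v in (0:ℝ)..b, 1/√(1-v^2)^3*cos (2*pi*X*ρ*v)) = I3 at *
  have hs : 0 < √(1-b^2) := sqrt_pos.2 (by nlinarith)
  generalize √(1-b^2) = s at *
  field_simp at key ⊢
  linear_combination key

lemma integral_lincomb_four {f₁ f₂ f₃ f₄ : α → ℝ} {c₁ c₂ c₃ c₄ : ℝ} (h₁ : Integrable f₁ μ)
    (h₂ : Integrable f₂ μ) (h₃ : Integrable f₃ μ) (h₄ : Integrable f₄ μ) :
    ∫ a, (c₁*f₁ a+c₂*f₂ a-c₃*f₃ a+c₄*f₄ a) ∂μ =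
      c₁*∫ a, f₁ a ∂μ+c₂*∫ a, f₂ a ∂μ-c₃*∫ a, f₃ a ∂μ+c₄*∫ a, f₄ a ∂μ := by
  have e := integral_add (((h₁.const_mul c₁).add (h₂.const_mul c₂)).sub (h₃.const_mul c₃))
    (h₄.const_mul c₄)
  have e' := integral_sub ((h₁.const_mul c₁).add (h₂.const_mul c₂)) (h₃.const_mul c₃)
  have e'' := integral_add (h₁.const_mul c₁) (h₂.const_mul c₂)
  simp only [Pi.add_apply, Pi.sub_apply] at e e' e''
  rw [e, e', e'']
  simp only [integral_const_mul]

/-- The majorant used for the bulk part of the disc transform. -/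
lemma bulk_weight_le {t v : ℝ} (ht : 1 ≤ t) (hv0 : 0 < v) (hv : v < 1) :
    1/√(1-v^2)^3*(1/(1+t*v)) ≤ 2/t*(1-v)^(-(3/2):ℝ)+1/√t*v^(-(1/2):ℝ) := by
  have h1v : 0 < 1-v := by linarith
  have e1 : (1-v)^(-(3/2):ℝ) = 1/√(1-v)^3 := by
    rw [rpow_neg h1v.le, sqrt_eq_rpow, ← rpow_natCast, ← rpow_mul h1v.le]
    norm_num
  have e2 : v^(-(1/2):ℝ) = 1/√v := by rw [rpow_neg hv0.le, sqrt_eq_rpow]; simp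
  rw [e1, e2]
  have hs : √(1-v) ≤ √(1-v^2) := sqrt_le_sqrt (by nlinarith)
  rcases le_total (1/2) v with h | h
  · have : 1/(1+t*v) ≤ 2/t := by rw [div_le_div_iff₀ (by positivity) (by positivity)]; nlinarith
    have h2 : 1/√(1-v^2)^3*(1/(1+t*v)) ≤ 1/√(1-v)^3*(2/t) := by gcongr
    have : 0 ≤ 1/√t*(1/√v) := by positivity
    linarith
  · have h4 : (0.8:ℝ) ≤ √(1-v^2) := by apply le_sqrt_of_sq_le; nlinarith
    have h3 : 1/√(1-v^2)^3 ≤ 2 := by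
      calc 1/√(1-v^2)^3 ≤ 1/0.8^3 := by gcongr
        _ ≤ 2 := by norm_num
    have h5 : 1/(1+t*v) ≤ 1/(2*(√t*√v)) := by
      have e3 := sq_sqrt (by linarith : 0 ≤ t)
      have e4 := sq_sqrt hv0.le
      gcongr
      nlinarith [sq_nonneg (√t*√v-1)]
    have h6 : 1/√(1-v^2)^3*(1/(1+t*v)) ≤ 2*(1/(2*(√t*√v))) := by gcongr
    have h7 : 2*(1/(2*(√t*√v))) = 1/√t*(1/√v) := by
      field_simp
    have : 0 ≤ 2/t*(1/√(1-v)^3) := by positivity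
    linarith

lemma integral_one_sub_rpow {b : ℝ} (hb0 : 0 ≤ b) (hb : b < 1) :
    IntervalIntegrable (fun v : ℝ => (1-v)^(-(3/2):ℝ)) volume 0 b ∧
    ∫ v in (0:ℝ)..b, (1-v)^(-(3/2):ℝ) ≤ 2/√(1-b) := by
  have hc : ContinuousOn (fun v : ℝ => (1-v)^(-(3/2):ℝ)) (uIcc 0 b) := by
    refine rpow_const (by fun_prop) fun v hv => inl ?_
    rw [uIcc_of_le hb0] at hv
    linarith [hv.2]
  refine ⟨hc.intervalIntegrable, ?_⟩
  rw [intervalIntegral.integral_comp_sub_left (fun v => v^(-(3/2):ℝ)),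
    integral_rpow (inr ⟨by norm_num, ?_⟩)]
  · have : √(1-b) = (1-b)^(1/2:ℝ) := sqrt_eq_rpow _
    have e : (1-b)^(-(1/2):ℝ) = 1/√(1-b) := by rw [rpow_neg (by linarith), this]; simp
    norm_num at e ⊢
    rw [e]
    ring_nf
    simp
  · rw [uIcc_of_le (by linarith)]
    intro h
    linarith [h.1]

set_option maxHeartbeats 2000000 in
/-- The Fourier transform of discs, averaged over a family of radii. -/
lemma PhaseBound.discFT_le (h : PhaseBound μ ρ r P₀ P Q) {X : ℝ} (hX : 1 ≤ X*r) :
    |∫ s, discFT (ρ s) X ∂μ| ≤ 100/X^2*(P₀*√(X*r)+P*(X*r)+Q/√(X*r)) := by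
  have hr := h.pos
  have hX0 : 0 < X := by
    by_contra hX0
    nlinarith
  have hP₀ := h.P₀_nonneg
  have hP := h.P_nonneg
  have hQ := h.Q_nonneg
  obtain ⟨t, ht⟩ : ∃ t, t = X*r := ⟨_, rfl⟩
  rw [← ht] at hX ⊢
  have ht0 : 0 < t := by linarith
  have hst : 1 ≤ √t := by rw [one_le_sqrt]; exact hX
  have htt := mul_self_sqrt ht0.le
  obtain ⟨b, hbt⟩ : ∃ b, b = 1-1/(2*t) := ⟨_, rfl⟩
  have ht2 : 1/(2*t) ≤ 1/2 := by gcongr; linarith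
  have ht2' : 0 < 1/(2*t) := by positivity
  have hb2 : 1/2 ≤ b := by linarith
  have hb0 : 0 ≤ b := by linarith
  have hb1 : b < 1 := by linarith
  have h1b : 1-b = 1/(2*t) := by linarith
  -- the bound for `G (t v)`
  obtain ⟨G, hG⟩ : ∃ G, G = P₀+P*√t+2*Q/t := ⟨_, rfl⟩
  have hG0 : 0 ≤ G := by rw [hG]; positivity
  have hGv : ∀ v, b ≤ v → v ≤ 1 → P₀+P*√(X*v*r)+Q/(1+X*v*r) ≤ G := by
    intro v hv1 hv2
    have e : X*v*r = t*v := by rw [ht]; ring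
    rw [e, hG]
    have h1 : √(t*v) ≤ √t := sqrt_le_sqrt (by nlinarith)
    have h2 : Q/(1+t*v) ≤ 2*Q/t := by
      rw [div_le_div_iff₀ (by nlinarith) ht0]
      nlinarith [mul_nonneg hQ ht0.le, mul_nonneg (mul_nonneg hQ ht0.le) (by linarith : 0 ≤ v-1/2)]
    have := mul_le_mul_of_nonneg_left h1 hP
    linarith
  have hGt : √t*G ≤ 2*(P₀*√t+P*t+Q/√t) := by
    have e : √t*(2*Q/t) = 2*(Q/√t) := by
      rw [mul_div_assoc', mul_div_assoc', div_eq_div_iff ht0.ne' (by positivity)]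
      linear_combination 2*Q*htt
    rw [hG, mul_add, mul_add, e]
    have : 0 ≤ P₀*√t := by positivity
    have : 0 ≤ P*t := by positivity
    nlinarith
  have hsb1 : √(1-b^2) ≤ 1/√t := by
    apply sqrt_le_iff.2 ⟨by positivity, ?_⟩
    rw [div_pow, sq_sqrt ht0.le]
    have : 1-b^2 ≤ 2*(1-b) := by nlinarith
    rw [h1b] at this
    calc _ ≤ _ := this
      _ = _ := by field_simp
  have hsb2 : 1/(2*√t) ≤ √(1-b^2) := by
    apply le_sqrt_of_sq_le
    rw [div_pow, mul_pow, sq_sqrt ht0.le]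
    have : 1-b ≤ 1-b^2 := by nlinarith
    rw [h1b] at this
    refine le_trans ?_ this
    rw [one_pow]
    gcongr
    norm_num
  obtain ⟨S, hS⟩ : ∃ S, S = P₀*√t+P*t+Q/√t := ⟨_, rfl⟩
  rw [← hS] at hGt ⊢
  -- the four parts
  have hw1 : Measurable (fun v : ℝ => √(1-v^2)) := by fun_prop
  have hw2 : Measurable (fun v : ℝ => 1/√(1-v^2)^3) := by fun_prop
  have p1 : |∫ s, ρ s^2*(∫ v in b..1, √(1-v^2) * cos (2*pi*(X*v*ρ s))) ∂μ| ≤ 1/X^2*S := by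
    refine (h.integral_cos_le (M := 1) (g := fun _ => 1/√t*(r^2*G)) hw1 hb1.le ?_
      (by simp) ?_).trans ?_
    · intro v hv
      rw [abs_of_nonneg (sqrt_nonneg _)]
      refine sqrt_le_one.2 ?_
      nlinarith [hv.1, hv.2]
    · intro v hv
      have := h.cos_le (j := 2) le_rfl (y := X*v) (by nlinarith [hv.1])
      rw [abs_of_nonneg (sqrt_nonneg _)]
      refine mul_le_mul ?_ (this.trans ?_) (abs_nonneg _) (by positivity)
      · refine le_trans (sqrt_le_sqrt ?_) hsb1
        nlinarith [hv.1, hv.2]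
      · exact mul_le_mul_of_nonneg_left (hGv v hv.1.le hv.2) (by positivity)
    · rw [intervalIntegral.integral_const, smul_eq_mul, h1b]
      have : r^2 = t*t/X^2 := by rw [ht]; field_simp
      rw [this]
      have e : 1/(2*t)*(1/√t*(t*t/X^2*G)) = 1/X^2*(√t*G/2) := by
        have : t = √t*√t := htt.symm
        field_simp
        rw [sq_sqrt ht0.le]
      rw [e]
      gcongr
      linarith
  have p2 : |2/(pi*X)*√(1-b^2) * ∫ s, (ρ s^1*sin (2*pi*(X*b*ρ s))) ∂μ| ≤ 2/X^2*S := by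
    have := h.sin_le (j := 1) (by norm_num) (y := X*b) (by nlinarith)
    have h2 := this.trans (mul_le_mul_of_nonneg_left (hGv b le_rfl hb1.le) (by positivity))
    rw [abs_mul, abs_of_nonneg (by positivity)]
    have hpi : 2/(pi*X) ≤ 1/X := by
      rw [div_le_div_iff₀ (by positivity) hX0]; nlinarith [pi_gt_three]
    calc _ ≤ 1/X*(1/√t)*(r^1*G) := by gcongr
      _ = 1/X^2*(√t*G) := by
        have : r = √t*√t/X := by rw [htt, ht]; field_simp
        rw [this]; field_simp
      _ ≤ 1/X^2*(2*S) := by gcongr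
      _ = _ := by ring
  have hpi2 : 1/(pi^2*X^2) ≤ 1/X^2 := by
    gcongr
    exact le_mul_of_one_le_left (by positivity) (by nlinarith [pi_gt_three])
  have p3 : |1/(pi^2*X^2)*(b/√(1-b^2)) * ∫ s, (ρ s^0*cos (2*pi*(X*b*ρ s))) ∂μ| ≤ 4/X^2*S := by
    have := h.cos_le (j := 0) (by norm_num) (y := X*b) (by nlinarith)
    have h2 := this.trans (mul_le_mul_of_nonneg_left (hGv b le_rfl hb1.le) (by positivity))
    rw [abs_mul, abs_of_nonneg (by positivity)]
    have h3 : b/√(1-b^2) ≤ 1/(1/(2*√t)) := by gcongr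
    calc _ ≤ 1/X^2*(1/(1/(2*√t)))*(r^0*G) := by gcongr
      _ = 1/X^2*(2*(√t*G)) := by field_simp
      _ ≤ 1/X^2*(2*(2*S)) := by gcongr
      _ = _ := by ring
  obtain ⟨hi1, hI1⟩ := integral_one_sub_rpow hb0 hb1
  have hi2 : IntervalIntegrable (fun v : ℝ => v^(-(1/2):ℝ)) volume 0 b :=
    intervalIntegral.intervalIntegrable_rpow' (by norm_num)
  have hI2 : ∫ v in (0:ℝ)..b, v^(-(1/2):ℝ) ≤ 2 := by
    rw [integral_rpow (inl (by norm_num))]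
    have : b^(1/2:ℝ) ≤ 1 := Real.rpow_le_one hb0 hb1.le (by norm_num)
    norm_num at this ⊢
    linarith
  have p4 : |1/(pi^2*X^2)*∫ s, (ρ s^0*∫ v in (0:ℝ)..b,
      1/√(1-v^2)^3*cos (2*pi*(X*v*ρ s))) ∂μ| ≤ 14/X^2*S := by
    rw [abs_mul, abs_of_nonneg (by positivity)]
    have := h.integral_cos_le (j := 0) (M := (2*√t)^3) (X := X)
      (g := fun v => G*(1-v)^(-(3/2):ℝ)+Q/√t*v^(-(1/2):ℝ)) hw2 hb0 ?_
      ((hi1.const_mul _).add (hi2.const_mul _)) ?_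
    · rw [intervalIntegral.integral_add (hi1.const_mul _) (hi2.const_mul _),
        intervalIntegral.integral_const_mul, intervalIntegral.integral_const_mul] at this
      have h3 : 2/√(1-b) ≤ 4*√t := by
        rw [h1b, sqrt_div zero_le_one, Real.sqrt_one, div_div_eq_mul_div, div_one,
          sqrt_mul (by norm_num)]
        have : √2 ≤ 2 := by rw [Real.sqrt_le_left] <;> norm_num
        nlinarith
      have hQS : Q/√t ≤ S := by
        rw [hS]
        have : 0 ≤ P₀*√t := by positivity
        have : 0 ≤ P*t := by positivity
        linarith
      calc _ ≤ 1/X^2*(G*(4*√t)+Q/√t*2) := by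
            gcongr
            refine this.trans ?_
            gcongr
            exact hI1.trans h3
        _ = 1/X^2*(4*(√t*G)+Q/√t*2) := by ring
        _ ≤ 1/X^2*(4*(2*S)+S*2) := by gcongr
        _ ≤ _ := by
          have : 0 ≤ 1/X^2*S := by
            have : 0 ≤ S := by rw [hS]; positivity
            positivity
          linear_combination 4*this
    · intro v hv
      rw [abs_of_nonneg (by positivity)]
      have : 1/(2*√t) ≤ √(1-v^2) := hsb2.trans (sqrt_le_sqrt (by nlinarith [hv.1, hv.2]))
      calc _ ≤ 1/(1/(2*√t))^3 := by gcongr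
        _ = _ := by field_simp
    · intro v hv
      have hv1 : v < 1 := hv.2.trans_lt hb1
      rw [abs_of_nonneg (by positivity)]
      have := h.cos_le (j := 0) (by norm_num) (y := X*v) (mul_pos hX0 hv.1)
      have e : X*v*r = t*v := by rw [ht]; ring
      rw [e, pow_zero, one_mul] at this
      have h1 : √(t*v) ≤ √t := sqrt_le_sqrt (by nlinarith [hv.1])
      have hw := bulk_weight_le hX hv.1 hv1
      have h1v : 0 < 1-v := by linarith
      have e1 : (1-v)^(-(3/2):ℝ) = 1/√(1-v)^3 := by
        rw [rpow_neg h1v.le, sqrt_eq_rpow, ← rpow_natCast, ← rpow_mul h1v.le]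
        norm_num
      have hw' : 1/√(1-v^2)^3 ≤ (1-v)^(-(3/2):ℝ) := by
        rw [e1]
        have : 0 < √(1-v) := sqrt_pos.2 h1v
        gcongr
        nlinarith [hv.1]
      calc _ ≤ 1/√(1-v^2)^3*(P₀+P*√t+Q*(1/(1+t*v))) := by
            gcongr
            refine this.trans ?_
            rw [mul_one_div]
            gcongr
        _ = 1/√(1-v^2)^3*(P₀+P*√t)+Q*(1/√(1-v^2)^3*(1/(1+t*v))) := by ring
        _ ≤ (1-v)^(-(3/2):ℝ)*(P₀+P*√t) +
            Q*(2/t*(1-v)^(-(3/2):ℝ)+1/√t*v^(-(1/2):ℝ)) := by gcongr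
        _ = _ := by rw [hG]; ring
  -- assembling
  have i1 : Integrable (fun s => ρ s^2*(∫ v in b..1, √(1-v^2) *
      cos (2*pi*(X*v*ρ s)))) μ := by
    refine h.integrable_pow_mul 2 (h.measurable_inner hw1 X b 1 hb1.le) (C := 1*|1-b|) fun s => ?_
    rw [← norm_eq_abs]
    refine intervalIntegral.norm_integral_le_of_norm_le_const fun v hv => ?_
    rw [norm_mul, norm_eq_abs, norm_eq_abs, abs_of_nonneg (sqrt_nonneg _)]
    refine mul_le_one₀ ?_ (abs_nonneg _) (abs_cos_le_one _)
    refine sqrt_le_one.2 ?_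
    nlinarith [sq_nonneg v]
  have i2 : Integrable (fun s => ρ s^1*sin (2*pi*(X*b*ρ s))) μ :=
    h.integrable_pow_mul 1 (by have := h.meas; fun_prop) fun s => Real.abs_sin_le_one _
  have i3 : Integrable (fun s => ρ s^0*cos (2*pi*(X*b*ρ s))) μ :=
    h.integrable_pow_mul 0 (by have := h.meas; fun_prop) fun s => abs_cos_le_one _
  have i4 : Integrable (fun s => ρ s^0*∫ v in (0:ℝ)..b,
      1/√(1-v^2)^3*cos (2*pi*(X*v*ρ s))) μ := by
    refine h.integrable_pow_mul 0 (h.measurable_inner hw2 X 0 b hb0)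
      (C := (2*√t)^3*|b-0|) fun s => ?_
    rw [← norm_eq_abs]
    refine intervalIntegral.norm_integral_le_of_norm_le_const fun v hv => ?_
    rw [uIoc_of_le hb0] at hv
    rw [norm_mul, norm_eq_abs, norm_eq_abs, abs_of_nonneg (by positivity)]
    have : 1/(2*√t) ≤ √(1-v^2) := hsb2.trans (sqrt_le_sqrt (by nlinarith [hv.1, hv.2]))
    have h2 : 1/√(1-v^2)^3 ≤ (2*√t)^3 := by
      calc _ ≤ 1/(1/(2*√t))^3 := by gcongr
        _ = _ := by field_simp
    calc _ ≤ (2*√t)^3*1 := by gcongr; exact abs_cos_le_one _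
      _ = _ := mul_one _
  have e : ∫ s, discFT (ρ s) X ∂μ = _ :=
    integral_congr_ae (.of_forall fun s => discFT_split hX0 hb0 hb1)
  rw [integral_lincomb_four i1 i2 i3 i4] at e
  rw [e]
  have hS0 : 0 ≤ S := by rw [hS]; positivity
  have hSX : 0 ≤ 1/X^2*S := by positivity
  rw [abs_le] at *
  have q : ∀ k : ℝ, k/X^2*S = k*(1/X^2*S) := fun k => by ring
  rw [q] at p2 p3 p4 ⊢
  constructor <;> linarith [p1.1, p1.2, p2.1, p2.2, p3.1, p3.2, p4.1, p4.2]

end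

/-- The periodised second Bernoulli polynomial. -/
def perB (x:ℝ) : ℝ := fract x^2-fract x+1/6

lemma perB_eq {x : ℝ} (n:ℤ) (h0 : n ≤ x) (h1 : x ≤ n+1) :
    perB x = (x-n)^2-(x-n)+1/6 := by
  rcases h1.lt_or_eq with h | h
  · have : fract x = x-n := by
      rw [Int.fract_eq_iff]
      exact ⟨by linarith, by linarith, n, by ring⟩
    rw [perB, this]
  · have : fract x = 0 := by
      rw [h, Int.fract_eq_iff]
      exact ⟨le_rfl, by norm_num, n+1, by push_cast; ring⟩
    rw [perB, this, h]; ring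

lemma hasSum_perB (x:ℝ) :
    HasSum (fun n : ℤ => 1/(n:ℂ)^2*ee (n*x)) ((2*pi^2*perB x:ℝ):ℂ) := by
  have := hasSum_one_div_pow_mul_fourier_mul_bernoulliFun (k := 2) le_rfl (x := fract x)
    ⟨Int.fract_nonneg x, (Int.fract_lt_one x).le⟩
  convert this using 2
  · rename_i n
    rw [fourier_coe_apply]
    have e : ee (n*x) = ee (n*fract x) := by
      have : (n:ℝ)*x = n*fract x+((n*⌊x⌋:ℤ):ℝ) := by
        push_cast
        rw [← mul_add, Int.fract_add_floor]
      rw [this, ee_add, ee_int, mul_one]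
    rw [e, ee]
    congr 2
    push_cast
    ring
  · simp only [perB, bernoulliFun_two]
    push_cast
    rw [mul_pow, I_sq, Nat.factorial_two]
    push_cast
    ring

/-- The periodised triangular kernel of half-width `h` and mass one. -/
def tent (h x:ℝ) : ℝ := 1+(perB x-(perB (x+h)+perB (x-h))/2)/h^2

/-- Fourier coefficients of the triangular kernel. -/
def tentCoeff (h:ℝ) (k:ℤ) : ℝ := if k = 0 then 1 else sin (pi*k*h)^2/(pi*k*h)^2

lemma hasSum_tent {h : ℝ} (hh : 0 < h) (x:ℝ) :
    HasSum (fun k : ℤ => (tentCoeff h k:ℂ)*ee (k*x)) ((tent h x:ℝ):ℂ) := by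
  have H := (hasSum_perB x).sub (((hasSum_perB (x+h)).add (hasSum_perB (x-h))).div_const 2)
  have H2 := (H.div_const (2*pi^2*h^2:ℂ)).add (hasSum_ite_eq (0:ℤ) (1:ℂ))
  have hπ := pi_pos
  have hπ' : (pi:ℂ) ≠ 0 := mod_cast hπ.ne'
  have hh' : (h:ℂ) ≠ 0 := mod_cast hh.ne'
  have ev : ((tent h x:ℝ):ℂ) = (((2*pi^2*perB x:ℝ):ℂ) -
      (((2*pi^2*perB (x+h):ℝ):ℂ)+((2*pi^2*perB (x-h):ℝ):ℂ))/2) /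
      (2*pi^2*h^2:ℂ)+1 := by
    rw [tent]
    push_cast
    field_simp
    ring
  rw [show ((tent h x:ℝ):ℂ) = _ from ev]
  refine (congrArg (HasSum · _) (funext fun k => ?_)).mpr H2
  unfold tentCoeff
  split_ifs with hk
  · subst hk
    simp [ee]
  · have hk' : (k:ℂ) ≠ 0 := mod_cast hk
    have e1 : ee (k*(x+h))+ee (k*(x-h)) = ee (k*x)*(2*(1-2*sin (pi*k*h)^2:ℝ)) := by
      rw [mul_add, mul_sub, sub_eq_add_neg, ee_add, ee_add, ← mul_add]
      congr 1
      have : (1-2*sin (pi*k*h)^2) = cos (2*pi*(k*h)) := by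
        rw [show 2*pi*(k*h) = 2*(pi*k*h) by ring, cos_two_mul,
          Real.cos_sq']
        ring
      rw [this, ee, ee, Complex.ofReal_cos, Complex.two_cos]
      push_cast
      congr 2 <;> ring
    have e2 : 1/(k:ℂ)^2*ee (k*(x+h))+1/(k:ℂ)^2*ee (k*(x-h)) =
      1/(k:ℂ)^2*(ee (k*x)*(2*(1-2*sin (pi*k*h)^2:ℝ))) := by
      rw [← mul_add, e1]
    rw [e2]
    push_cast
    field_simp
    ring

lemma tentCoeff_nonneg (h:ℝ) (k:ℤ) : 0 ≤ tentCoeff h k := by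
  unfold tentCoeff; split_ifs <;> positivity

lemma tentCoeff_le_one {h : ℝ} (k:ℤ) : tentCoeff h k ≤ 1 := by
  unfold tentCoeff
  split_ifs with hk
  · exact le_rfl
  · refine div_le_one_of_le₀ ?_ (sq_nonneg _)
    exact sq_le_sq.2 Real.abs_sin_le_abs

lemma tentCoeff_le {h : ℝ} (hh : 0 < h) {k : ℤ} (hk : k ≠ 0) : tentCoeff h k ≤ 1/(k*h)^2 := by
  unfold tentCoeff
  rw [if_neg hk]
  have : (0:ℝ) < (k*h)^2 := by
    positivity
  refine div_le_div₀ zero_le_one (Real.sin_sq_le_one _) this ?_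
  · rw [mul_assoc, mul_pow pi]
    have hp : 1 ≤ pi^2 := by nlinarith [pi_gt_three]
    exact le_mul_of_one_le_left this.le hp

lemma tent_add_int (h x:ℝ) (n:ℤ) : tent h (x+n) = tent h x := by
  have : ∀ y, perB (y+n) = perB y := fun y => by simp [perB]
  rw [tent, tent, this, show x+n+h = x+h+n by ring, show x+n-h = x-h+n by ring,
    this, this]

lemma tent_eq_of_abs_le {h x : ℝ} (hh : 0 < h) (hh2 : h ≤ 1/4) (hx : |x| ≤ h) :
    tent h x = (h - |x|)/h^2 := by
  have h2 := abs_le.1 hx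
  have e1 : perB (x+h) = (x+h)^2-(x+h)+1/6 := by
    rw [perB_eq 0 (by push_cast; linarith) (by push_cast; linarith)]; push_cast; ring
  have e2 : perB (x-h) = (x-h+1)^2-(x-h+1)+1/6 := by
    rw [perB_eq (-1) (by push_cast; linarith) (by push_cast; linarith)]; push_cast; ring
  have e3 : perB x = x^2 - |x| + 1/6 := by
    rcases le_total 0 x with hx0 | hx0
    · rw [perB_eq 0 (by push_cast; linarith) (by push_cast; linarith), abs_of_nonneg hx0]
      push_cast; ring
    · rw [perB_eq (-1) (by push_cast; linarith) (by push_cast; linarith), abs_of_nonpos hx0]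
      push_cast; ring
  rw [tent, e1, e2, e3]
  field_simp
  ring

lemma tent_eq_zero {h x : ℝ} (hh : 0 < h) (hx : h ≤ x) (hx2 : x ≤ 1-h) : tent h x = 0 := by
  rw [tent, perB_eq (x := x) 0 (by push_cast; linarith) (by push_cast; linarith),
    perB_eq (x := x+h) 0 (by push_cast; linarith) (by push_cast; linarith),
    perB_eq (x := x-h) 0 (by push_cast; linarith) (by push_cast; linarith)]
  field_simp
  ring

lemma tent_eq_max {h : ℝ} (hh : 0 < h) (hh2 : h ≤ 1/4) (x:ℝ) :
    tent h x = max 0 ((h - |x-round x|)/h^2) := by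
  have e : tent h x = tent h (x-round x) := by
    rw [← tent_add_int h (x-round x) (round x), sub_add_cancel]
  have hr := abs_le.1 (abs_sub_round x)
  rw [e]
  generalize x-round x = y at *
  rcases le_total |y| h with hy | hy
  · rw [tent_eq_of_abs_le hh hh2 hy, max_eq_right]
    exact div_nonneg (by linarith) (sq_nonneg _)
  · rw [max_eq_left (div_nonpos_of_nonpos_of_nonneg (by linarith) (sq_nonneg _))]
    rcases le_total 0 y with h0 | h0
    · rw [abs_of_nonneg h0] at hy
      exact tent_eq_zero hh hy (by linarith)
    · rw [abs_of_nonpos h0] at hy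
      rw [← tent_add_int h y 1]
      push_cast
      exact tent_eq_zero hh (by linarith) (by linarith)

lemma tent_nonneg {h : ℝ} (hh : 0 < h) (hh2 : h ≤ 1/4) (x:ℝ) : 0 ≤ tent h x := by
  rw [tent_eq_max hh hh2]; exact le_max_left _ _

lemma abs_sub_round_le_of_tent_ne_zero {h : ℝ} (hh : 0 < h) (hh2 : h ≤ 1/4) {x : ℝ}
    (hx : tent h x ≠ 0) : |x-round x| < h := by
  by_contra hc
  push Not at hc
  rw [tent_eq_max hh hh2, max_eq_left] at hx
  · exact hx rfl
  · exact div_nonpos_of_nonpos_of_nonneg (by linarith) (sq_nonneg _)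

lemma measurable_tent (h:ℝ) : Measurable (tent h) := by
  have : Measurable perB := by unfold perB; fun_prop
  unfold tent; fun_prop

lemma tent_le {h : ℝ} (hh : 0 < h) (hh2 : h ≤ 1/4) (x:ℝ) : tent h x ≤ 1/h := by
  rw [tent_eq_max hh hh2]
  refine max_le (by positivity) ?_
  rw [div_le_div_iff₀ (by positivity) hh]
  nlinarith [abs_nonneg (x-round x)]

lemma integral_tent {h : ℝ} (hh : 0 < h) (hh2 : h ≤ 1/4) (n:ℤ) :
    ∫ x in Set.Icc (n-h) (n+h), tent h x = 1 := by
  rw [integral_Icc_eq_integral_Ioc, ← integral_of_le (by linarith)]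
  have e : ∫ x in (n-h)..(n+h), tent h x = ∫ x in (-h)..h, tent h x := by
    rw [show (n:ℝ)-h = -h+n by ring, show (n:ℝ)+h = h+n by ring,
      ← intervalIntegral.integral_comp_add_right]
    simp only [tent_add_int]
  rw [e]
  have e2 : ∫ x in (-h)..h, tent h x = ∫ x in (-h)..h, (h - |x|)/h^2 := by
    refine integral_congr fun x hx => ?_
    rw [uIcc_of_le (by linarith)] at hx
    exact tent_eq_of_abs_le hh hh2 (abs_le.2 hx)
  have hc : Continuous fun x : ℝ => (h - |x|)/h^2 := by fun_prop
  rw [e2, ← integral_add_adjacent_intervals (b := 0)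
    (hc.intervalIntegrable _ _) (hc.intervalIntegrable _ _)]
  have e3 : ∫ x in (-h)..0, (h - |x|)/h^2 = ∫ x in (-h)..0, (h+x)/h^2 := by
    refine integral_congr fun x hx => ?_
    rw [uIcc_of_le (by linarith)] at hx
    simp only [abs_of_nonpos hx.2, sub_neg_eq_add]
  have e4 : ∫ x in (0:ℝ)..h, (h - |x|)/h^2 = ∫ x in (0:ℝ)..h, (h-x)/h^2 := by
    refine integral_congr fun x hx => ?_
    rw [uIcc_of_le (by linarith)] at hx
    simp only [abs_of_nonneg hx.1]
  rw [e3, e4, intervalIntegral.integral_div, intervalIntegral.integral_div,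
    intervalIntegral.integral_add (by simp) (by simp), intervalIntegral.integral_sub (by simp) (by simp)]
  simp
  field_simp
  ring

/-- The embedding of the plane as `ℝ + ℝ ω` in `ℂ`, whose norm form is `x² + xy + y²`. -/
def eis (p : ℝ × ℝ) : ℂ := ⟨p.1+p.2/2, √3/2*p.2⟩

lemma norm_eis_sq (p : ℝ × ℝ) : ‖eis p‖^2 = p.1^2+p.1*p.2+p.2^2 := by
  rw [← Complex.normSq_eq_norm_sq, Complex.normSq_apply]
  simp only [eis]
  have := mul_self_sqrt (by norm_num : (0:ℝ) ≤ 3)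
  linear_combination p.2^2/4*this

lemma eis_add (p q : ℝ × ℝ) : eis (p+q) = eis p+eis q := by
  apply Complex.ext <;> simp [eis] <;> ring

lemma norm_eis_le {p : ℝ × ℝ} {h : ℝ} (hh : 0 ≤ h) (h1 : |p.1| ≤ h) (h2 : |p.2| ≤ h) :
    ‖eis p‖ ≤ 2*h := by
  refine abs_le_of_sq_le_sq' ?_ (by positivity) |>.2
  rw [norm_eis_sq]
  nlinarith [sq_abs p.1, sq_abs p.2, abs_nonneg p.1, abs_nonneg p.2, abs_mul p.1 p.2,
    le_abs_self (p.1*p.2), mul_le_mul h1 h2 (abs_nonneg _) hh]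

/-- Lattice points of the Eisenstein norm form. -/
def latSet (x:ℝ) : Set (ℤ × ℤ) := {v | (v.1:ℝ)^2+v.1*v.2+(v.2:ℝ)^2 ≤ x}

lemma latSet_finite (x:ℝ) : (latSet x).Finite := by
  refine Set.Finite.subset ((Set.finite_Icc (-⌈2*|x|⌉) ⌈2*|x|⌉).prod
    (Set.finite_Icc (-⌈2*|x|⌉) ⌈2*|x|⌉)) ?_
  rintro ⟨a, b⟩ h
  simp only [latSet, mem_setOf_eq] at h
  have hx : x ≤ |x| := le_abs_self x
  have key : ∀ c : ℤ, (c:ℝ)^2 ≤ 2*|x| → c ∈ Set.Icc (-⌈2*|x|⌉) ⌈2*|x|⌉ := by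
    intro c hc
    have h1 : ((c^2:ℤ):ℝ) ≤ (⌈2*|x|⌉:ℤ) := by push_cast; exact hc.trans (Int.le_ceil _)
    have h1 : c^2 ≤ ⌈2*|x|⌉ := mod_cast h1
    constructor <;> nlinarith [sq_nonneg c, Int.le_self_sq c, Int.le_self_sq (-c)]
  refine ⟨key a ?_, key b ?_⟩ <;> nlinarith [sq_nonneg ((a:ℝ)+2*b), sq_nonneg (2*(a:ℝ)+b)]

/-- The number of lattice points `x² + xy + y² ≤ t`. -/
def latN (t:ℝ) : ℕ := (latSet_finite t).toFinset.card

/-- The smoothed lattice point count. -/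
def smoothN (h ρ:ℝ) : ℝ := ∫ p in {p : ℝ × ℝ | ‖eis p‖ ≤ ρ}, tent h p.1*tent h p.2

lemma measurable_eis : Measurable eis := by
  have : eis = fun p : ℝ × ℝ => ((p.1+p.2/2:ℝ):ℂ)+((√3/2*p.2:ℝ):ℂ)*Complex.I := by
    ext p
    apply Complex.ext <;> simp [eis]
  rw [this]
  fun_prop

lemma measurableSet_eisDisc (ρ:ℝ) : MeasurableSet {p : ℝ × ℝ | ‖eis p‖ ≤ ρ} :=
  measurableSet_le measurable_eis.norm measurable_const

lemma abs_le_two_mul_norm_eis (p : ℝ × ℝ) : |p.1| ≤ 2*‖eis p‖ ∧ |p.2| ≤ 2*‖eis p‖ := by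
  have := norm_eis_sq p
  constructor <;> refine abs_le_of_sq_le_sq ?_ (by positivity) <;> rw [mul_pow, this] <;>
  nlinarith [sq_nonneg (p.1+p.2), sq_nonneg (p.1), sq_nonneg p.2]

lemma eisDisc_subset (ρ:ℝ) : {p : ℝ × ℝ | ‖eis p‖ ≤ ρ} ⊆
    Set.Icc (-(2*ρ)) (2*ρ) ×ˢ Set.Icc (-(2*ρ)) (2*ρ) := by
  intro p hp
  simp only [mem_setOf_eq] at hp
  have := abs_le_two_mul_norm_eis p
  exact ⟨abs_le.1 (this.1.trans (by linarith)), abs_le.1 (this.2.trans (by linarith))⟩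

lemma volume_eisDisc_lt_top (ρ:ℝ) : volume {p : ℝ × ℝ | ‖eis p‖ ≤ ρ} < ⊤ :=
  (measure_mono (eisDisc_subset ρ)).trans_lt (isCompact_Icc.prod isCompact_Icc).measure_lt_top

lemma integrableOn_tent {h : ℝ} (hh : 0 < h) (hh2 : h ≤ 1/4) {s : Set (ℝ × ℝ)} (hs : volume s < ⊤) :
    IntegrableOn (fun p : ℝ × ℝ => tent h p.1*tent h p.2) s := by
  refine Measure.integrableOn_of_bounded (M := 1/h*(1/h)) hs.ne ?_ ?_
  · have := measurable_tent h
    exact aestronglyMeasurable (by fun_prop)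
  · refine Eventually.of_forall fun p => ?_
    rw [norm_eq_abs, abs_of_nonneg (mul_nonneg (tent_nonneg hh hh2 _) (tent_nonneg hh hh2 _))]
    exact mul_le_mul (tent_le hh hh2 _) (tent_le hh hh2 _) (tent_nonneg hh hh2 _) (by positivity)

/-- The box of half-width `h` around a lattice point. -/
def latBox (h:ℝ) (v : ℤ × ℤ) : Set (ℝ × ℝ) :=
  Set.Icc (v.1-h) (v.1+h) ×ˢ Set.Icc (v.2-h) (v.2+h)

lemma integral_latBox {h : ℝ} (hh : 0 < h) (hh2 : h ≤ 1/4) (v : ℤ × ℤ) :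
    ∫ p in latBox h v, tent h p.1*tent h p.2 = 1 := by
  rw [latBox, Measure.volume_eq_prod, setIntegral_prod_mul, integral_tent hh hh2,
    integral_tent hh hh2, one_mul]

lemma integral_biUnion_latBox {h : ℝ} (hh : 0 < h) (hh2 : h ≤ 1/4) (S : Finset (ℤ × ℤ)) :
    ∫ p in ⋃ v ∈ S, latBox h v, tent h p.1*tent h p.2 = S.card := by
  rw [integral_biUnion_finset]
  · simp [integral_latBox hh hh2]
  · exact fun v _ => measurableSet_Icc.prod measurableSet_Icc
  · intro v _ w _ hvw
    rw [onFun, Set.disjoint_left]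
    rintro p ⟨⟨h1, h2⟩, h3, h4⟩ ⟨⟨h5, h6⟩, h7, h8⟩
    apply hvw
    have key : ∀ (a b:ℤ) (x:ℝ), (a:ℝ)-h ≤ x → x ≤ a+h → b-h ≤ x → x ≤ b+h → a = b := by
      intro a b x q1 q2 q3 q4
      have e1 : (a:ℝ) < b+1 := by linarith
      have e2 : (b:ℝ) < a+1 := by linarith
      have e1 : a < b+1 := mod_cast e1
      have e2 : b < a+1 := mod_cast e2
      omega
    exact Prod.ext (key _ _ _ h1 h2 h5 h6) (key _ _ _ h3 h4 h7 h8)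
  · exact fun v _ => integrableOn_tent hh hh2 (isCompact_Icc.prod isCompact_Icc).measure_lt_top

lemma latN_le_smoothN {h ρ t : ℝ} (hh : 0 < h) (hh2 : h ≤ 1/4)
    (ht : √t+2*h ≤ ρ) : latN t ≤ smoothN h ρ := by
  rw [latN, ← integral_biUnion_latBox hh hh2, smoothN]
  refine setIntegral_mono_set (integrableOn_tent hh hh2 (volume_eisDisc_lt_top ρ))
    (.of_forall fun p => mul_nonneg (tent_nonneg hh hh2 _) (tent_nonneg hh hh2 _))
    (HasSubset.Subset.eventuallyLE ?_)
  intro p hp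
  simp only [Set.mem_iUnion, Set.Finite.mem_toFinset] at hp
  obtain ⟨v, hv, ⟨h1, h2⟩, h3, h4⟩ := hp
  have e : eis p = eis ((v.1:ℝ), (v.2:ℝ))+eis (p.1-v.1, p.2-v.2) := by
    rw [← eis_add]; congr 1; ext <;> simp
  have n1 : ‖eis ((v.1:ℝ), (v.2:ℝ))‖ ≤ √t := by
    refine le_sqrt_of_sq_le ?_
    rw [norm_eis_sq]; exact hv
  have n2 : ‖eis (p.1-v.1, p.2-v.2)‖ ≤ 2*h :=
    norm_eis_le hh.le (abs_le.2 ⟨by simp; linarith, by simp; linarith⟩)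
      (abs_le.2 ⟨by simp; linarith, by simp; linarith⟩)
  simp only [mem_setOf_eq]
  rw [e]
  linarith [norm_add_le (eis ((v.1:ℝ), (v.2:ℝ))) (eis (p.1-v.1, p.2-v.2))]

lemma smoothN_le_latN {h ρ t : ℝ} (hh : 0 < h) (hh2 : h ≤ 1/4)
    (ht : ρ+2*h ≤ √t) (ht0 : 0 ≤ t) : smoothN h ρ ≤ latN t := by
  rw [latN, ← integral_biUnion_latBox hh hh2, smoothN]
  set D := {p : ℝ × ℝ | ‖eis p‖ ≤ ρ}
  set B := ⋃ v ∈ (latSet_finite t).toFinset, latBox h v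
  have hBf : volume B < ⊤ := measure_biUnion_lt_top (finite_toSet _)
    fun v _ => (isCompact_Icc.prod isCompact_Icc).measure_lt_top
  have hnn : ∀ p : ℝ × ℝ, 0 ≤ tent h p.1*tent h p.2 := fun p =>
    mul_nonneg (tent_nonneg hh hh2 _) (tent_nonneg hh hh2 _)
  have hsub : ∀ p ∈ D, tent h p.1*tent h p.2 ≠ 0 → p ∈ B := by
    intro p hp h0
    have h1 := (abs_sub_round_le_of_tent_ne_zero hh hh2 (left_ne_zero_of_mul h0)).le
    have h2 := (abs_sub_round_le_of_tent_ne_zero hh hh2 (right_ne_zero_of_mul h0)).le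
    simp only [B, Set.mem_iUnion, Set.Finite.mem_toFinset]
    refine ⟨(round p.1, round p.2), ?_, ?_⟩
    · have e : eis ((round p.1:ℝ), (round p.2:ℝ)) =
          eis p+eis (round p.1-p.1, round p.2-p.2) := by
        rw [← eis_add]; congr 1; ext <;> simp
      have n2 : ‖eis (round p.1-p.1, round p.2-p.2)‖ ≤ 2*h :=
        norm_eis_le hh.le (by rw [abs_sub_comm]; exact h1) (by rw [abs_sub_comm]; exact h2)
      have n3 := norm_add_le (eis p) (eis (round p.1-p.1, round p.2-p.2))
      rw [← e] at n3
      have hp' : ‖eis p‖ ≤ ρ := hp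
      have n4 : ‖eis ((round p.1:ℝ), (round p.2:ℝ))‖ ≤ √t := by linarith
      have n5 := norm_eis_sq ((round p.1:ℝ), (round p.2:ℝ))
      show (round p.1:ℝ)^2+round p.1*round p.2+(round p.2:ℝ)^2 ≤ t
      simp only at n5
      rw [← n5, ← sq_sqrt ht0]
      gcongr
    · rw [abs_le] at h1 h2
      exact ⟨⟨by simp; linarith, by simp; linarith⟩, by simp; linarith, by simp; linarith⟩
  have e : ∫ p in D, tent h p.1*tent h p.2 = ∫ p in D ∩ B, tent h p.1*tent h p.2 := by
    refine (setIntegral_eq_of_subset_of_forall_diff_eq_zero (measurableSet_eisDisc ρ)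
      Set.inter_subset_left fun p hp => ?_)
    by_contra h0
    exact hp.2 ⟨hp.1, hsub p hp.1 h0⟩
  rw [e]
  exact setIntegral_mono_set (integrableOn_tent hh hh2 hBf)
    (Eventually.of_forall hnn) (HasSubset.Subset.eventuallyLE Set.inter_subset_right)

lemma integral_round_disc (ρ R:ℝ) (hρ : 0 ≤ ρ) :
    ∫ p : ℝ × ℝ in {p : ℝ × ℝ | p.1^2+p.2^2 ≤ ρ^2}, cos (2*pi*(R*p.1)) = discFT ρ R := by
  have hm : MeasurableSet {p : ℝ × ℝ | p.1^2+p.2^2 ≤ ρ^2} :=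
    measurableSet_le (by fun_prop) (by fun_prop)
  rw [← integral_indicator hm, Measure.volume_eq_prod, integral_prod]
  · have e : ∀ x : ℝ, ∫ y : ℝ, Set.indicator {p : ℝ × ℝ | p.1^2+p.2^2 ≤ ρ^2}
        (fun p => cos (2*pi*(R*p.1))) (x, y) =
        2*√(ρ^2-x^2)*cos (2*pi*(R*x)) := by
      intro x
      have e1 : (fun y : ℝ => Set.indicator {p : ℝ × ℝ | p.1^2+p.2^2 ≤ ρ^2}
        (fun p => cos (2*pi*(R*p.1))) (x, y)) =
        Set.indicator {y : ℝ | y^2 ≤ ρ^2-x^2} (fun _ => cos (2*pi*(R*x))) := by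
        ext y
        simp only [Set.indicator, mem_setOf_eq]
        congr 1
        rw [eq_iff_iff]
        constructor <;> intro <;> linarith
      rw [e1, integral_indicator (measurableSet_le (by fun_prop) (by fun_prop)), setIntegral_const,
        smul_eq_mul]
      congr 1
      rcases le_or_gt 0 (ρ^2-x^2) with h | h
      · have : {y : ℝ | y^2 ≤ ρ^2-x^2} = Set.Icc (-√(ρ^2-x^2)) (√(ρ^2-x^2)) := by
          ext y
          simp only [mem_setOf_eq, Set.mem_Icc]
          rw [← abs_le, Real.le_sqrt (abs_nonneg y), sq_abs]
          exact h
        rw [this, Real.volume_real_Icc_of_le (by linarith [sqrt_nonneg (ρ^2-x^2)])]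
        ring
      · have : {y : ℝ | y^2 ≤ ρ^2-x^2} = ∅ := by
          ext y
          simp only [mem_setOf_eq, Set.mem_empty_iff_false, iff_false]
          nlinarith [sq_nonneg y]
        rw [this, Real.sqrt_eq_zero_of_nonpos h.le]
        simp
    simp only [e]
    have hsup : ∀ x ∉ Set.Icc (-ρ) ρ, 2*√(ρ^2-x^2)*cos (2*pi*(R*x)) = 0 := by
      intro x hx
      have : ρ^2-x^2 ≤ 0 := by
        rw [Set.mem_Icc, ← abs_le, not_le] at hx
        nlinarith [sq_abs x, abs_nonneg x]
      rw [Real.sqrt_eq_zero_of_nonpos this]; simp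
    have hc : Continuous fun x => 2*√(ρ^2-x^2)*cos (2*pi*(R*x)) := by fun_prop
    rw [← setIntegral_eq_integral_of_forall_compl_eq_zero hsup, integral_Icc_eq_integral_Ioc,
      ← integral_of_le (by linarith),
      ← integral_add_adjacent_intervals (b := 0)
      (hc.intervalIntegrable _ _) (hc.intervalIntegrable _ _)]
    have e2 : ∫ x in (-ρ)..0, 2*√(ρ^2-x^2)*cos (2*pi*(R*x)) =
        ∫ x in (0:ℝ)..ρ, 2*√(ρ^2-x^2)*cos (2*pi*(R*x)) := by
      have := integral_comp_neg (fun x => 2*√(ρ^2-x^2)*cos (2*pi*(R*x))) (a := -ρ) (b := 0)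
      rw [neg_neg, neg_zero] at this
      rw [← this]
      refine integral_congr fun x _ => ?_
      simp only [neg_sq, mul_neg, Real.cos_neg]
    rw [e2]
    have e3 : ∫ x in (0:ℝ)..ρ, 2*√(ρ^2-x^2)*cos (2*pi*(R*x)) =
        ρ*∫ v in (0:ℝ)..1, 2*√(ρ^2-(ρ*v)^2)*cos (2*pi*(R*(ρ*v))) := by
      have := intervalIntegral.mul_integral_comp_mul_left
        (f := fun x => 2*√(ρ^2-x^2)*cos (2*pi*(R*x))) (c := ρ) (a := 0)
        (b := 1)
      rw [this, mul_zero, mul_one]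
    rw [e3, discFT]
    have e4 : ∀ v, 2*√(ρ^2-(ρ*v)^2)*cos (2*pi*(R*(ρ*v))) =
        (2*ρ)*(√(1-v^2)*cos (2*pi*(R*v*ρ))) := by
      intro v
      rw [show ρ^2-(ρ*v)^2 = ρ^2*(1-v^2) by ring, sqrt_mul (sq_nonneg _),
        sqrt_sq hρ]
      ring_nf
    simp only [e4, intervalIntegral.integral_const_mul]
    ring
  · rw [integrable_indicator_iff hm]
    refine Measure.integrableOn_of_bounded (M := 1) ?_ ?_ ?_
    · refine ((measure_mono (t := Set.Icc (-ρ) ρ ×ˢ Set.Icc (-ρ) ρ) ?_).trans_lt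
        (isCompact_Icc.prod isCompact_Icc).measure_lt_top).ne
      rintro ⟨x, y⟩ hp
      simp only [mem_setOf_eq] at hp
      exact ⟨abs_le.1 (abs_le_of_sq_le_sq (by nlinarith) hρ),
        abs_le.1 (abs_le_of_sq_le_sq (by nlinarith) hρ)⟩
    · exact Continuous.aestronglyMeasurable (by fun_prop)
    · exact Eventually.of_forall fun p => abs_cos_le_one _

/-- The dual norm of a frequency. -/
def dualNorm (k l:ℝ) : ℝ := √(4/3*(k^2-k*l+l^2))

lemma dualNorm_sq (k l:ℝ) : dualNorm k l^2 = 4/3*(k^2-k*l+l^2) :=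
  sq_sqrt (by nlinarith [sq_nonneg (k-l), sq_nonneg (k+l)])

lemma integral_eisDisc_of_isometry {ρ R a b c d : ℝ} (hρ : 0 ≤ ρ) (h1 : a^2+c^2 = 1)
    (h2 : b^2+d^2 = 1) (h3 : a*b+c*d = 1/2) :
    ∫ p in {p : ℝ × ℝ | ‖eis p‖ ≤ ρ}, cos (2*pi*(R*(a*p.1+b*p.2))) = 2/√3*discFT ρ R := by
  set f : (ℝ × ℝ) →ₗ[ℝ] (ℝ × ℝ) := Matrix.toLin (Basis.finTwoProd ℝ) (Basis.finTwoProd ℝ) !![a, b; c, d]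
  have hf : ∀ p, f p = (a*p.1+b*p.2, c*p.1+d*p.2) := fun p => by
    simp [f, Matrix.toLin_finTwoProd_apply]
  have hdet : LinearMap.det f = a*d-b*c := by simp [f, LinearMap.det_toLin, Matrix.det_fin_two]
  have hdet2 : (a*d-b*c)^2 = 3/4 := by
    linear_combination (b^2+d^2)*h1+h2-(a*b+c*d+1/2)*h3
  have hdet0 : LinearMap.det f ≠ 0 := by rw [hdet]; intro h; rw [h] at hdet2; norm_num at hdet2
  have hdetabs : |(a*d-b*c)⁻¹| = 2/√3 := by
    have e : |a*d-b*c| = √3/2 := by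
      rw [← Real.sqrt_sq_eq_abs, hdet2, sqrt_div (by norm_num)]
      congr 1
      rw [show (4:ℝ) = 2^2 by norm_num, sqrt_sq (by norm_num)]
    rw [abs_inv, e, inv_div]
  have hmap := Measure.map_linearMap_addHaar_eq_smul_addHaar (volume : Measure (ℝ × ℝ)) hdet0
  rw [hdet, hdetabs] at hmap
  have hm : MeasurableSet {p : ℝ × ℝ | p.1^2+p.2^2 ≤ ρ^2} :=
    measurableSet_le (by fun_prop) (by fun_prop)
  have hcont : Continuous f := f.continuous_of_finiteDimensional
  rw [← integral_round_disc ρ R hρ]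
  have hpre : {p : ℝ × ℝ | ‖eis p‖ ≤ ρ} = f ⁻¹' {p : ℝ × ℝ | p.1^2+p.2^2 ≤ ρ^2} := by
    ext p
    simp only [mem_setOf_eq, Set.mem_preimage, hf]
    rw [← sq_le_sq₀ (norm_nonneg _) hρ, norm_eis_sq]
    have : p.1^2+p.1*p.2+p.2^2 = (a*p.1+b*p.2)^2+(c*p.1+d*p.2)^2 := by
      linear_combination -p.1^2*h1-p.2^2*h2-2*p.1*p.2*h3
    rw [this]
  have e := setIntegral_map (μ := (volume : Measure (ℝ × ℝ)))
    (f := fun q : ℝ × ℝ => cos (2*pi*(R*q.1))) (g := f) hm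
    (Continuous.aestronglyMeasurable (by fun_prop)) hcont.aemeasurable
  rw [hmap, Measure.restrict_smul, integral_smul_measure, ENNReal.toReal_ofReal (by positivity),
    smul_eq_mul] at e
  rw [e, hpre]
  simp only [hf]

lemma integral_eisDisc_cos {ρ : ℝ} (hρ : 0 ≤ ρ) (k l:ℝ) :
    ∫ p in {p : ℝ × ℝ | ‖eis p‖ ≤ ρ}, cos (2*pi*(k*p.1+l*p.2)) =
      2/√3*discFT ρ (dualNorm k l) := by
  have hR := dualNorm_sq k l
  have hs := sq_sqrt (by norm_num : (0:ℝ) ≤ 3)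
  by_cases h : dualNorm k l = 0
  · rw [h, ← integral_eisDisc_of_isometry (a := 1) (b := 1/2) (c := 0) (d := √3/2) hρ
      (by norm_num) (by rw [div_pow (√3), hs]; norm_num) (by norm_num)]
    rw [h] at hR
    have hk : k = 0 := by nlinarith [sq_nonneg (k-2*l), sq_nonneg k]
    have hl : l = 0 := by nlinarith [sq_nonneg (l-2*k), sq_nonneg l]
    simp [hk, hl]
  · rw [← integral_eisDisc_of_isometry (a := k/dualNorm k l) (b := l/dualNorm k l)
      (c := -(2*l-k)/(√3*dualNorm k l)) (d := (2*k-l)/(√3*dualNorm k l)) hρ]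
    · congr 1; ext p; congr 2; field_simp
    · field_simp
      rw [hR, hs]; ring
    · field_simp
      rw [hR, hs]; ring
    · field_simp
      rw [hR, hs]; ring

lemma discFT_zero (ρ:ℝ) : discFT ρ 0 = pi*ρ^2 := by
  have h : ∫ v in (-1:ℝ)..1, √(1-v^2) = pi/2 := integral_sqrt_one_sub_sq
  have hc : Continuous fun v : ℝ => √(1-v^2) := by fun_prop
  rw [← integral_add_adjacent_intervals (b := 0)
      (hc.intervalIntegrable _ _) (hc.intervalIntegrable _ _)] at h
  have := integral_comp_neg (fun v : ℝ => √(1-v^2)) (a := -1) (b := 0)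
  rw [neg_neg, neg_zero] at this
  simp only [neg_sq] at this
  simp only [discFT, zero_mul, mul_zero, Real.cos_zero, mul_one]
  rw [this] at h
  linear_combination 2*ρ^2*h

lemma abs_discFT_le (ρ X:ℝ) : |discFT ρ X| ≤ 4*ρ^2 := by
  rw [discFT, abs_mul, abs_of_nonneg (by positivity)]
  have : |∫ v in (0:ℝ)..1, √(1-v^2)*cos (2*pi*(X*v*ρ))| ≤ 1*|(1:ℝ)-0| := by
    rw [← norm_eq_abs]
    refine intervalIntegral.norm_integral_le_of_norm_le_const fun v hv => ?_
    rw [norm_mul, norm_eq_abs, norm_eq_abs, abs_of_nonneg (sqrt_nonneg _)]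
    refine mul_le_one₀ ?_ (abs_nonneg _) (abs_cos_le_one _)
    exact sqrt_le_one.2 (by nlinarith [sq_nonneg v])
  norm_num at this
  nlinarith [sq_nonneg ρ]

/-- `x ^ (1-s)` grows at least as fast as its derivative predicts. -/
lemma rpow_neg_le_sub {s : ℝ} (hs0 : 0 ≤ s) (hs : s < 1) (n:ℕ) :
    ((n:ℝ)+1)^(-s) ≤ (((n:ℝ)+1)^(1-s)-(n:ℝ)^(1-s))/(1-s) := by
  have hn : (0:ℝ) < n+1 := by positivity
  rw [le_div_iff₀ (by linarith)]
  have h := rpow_one_add_le_one_add_mul_self (s := -1/((n:ℝ)+1)) (p := 1-s)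
    (by rw [le_div_iff₀ hn]; linarith [(cast_nonneg n : (0:ℝ) ≤ n)]) (by linarith) (by linarith)
  have e : 1 + -1/((n:ℝ)+1) = n/(n+1) := by field_simp; ring
  rw [e, div_rpow (by positivity) hn.le, div_le_iff₀ (by positivity)] at h
  have e2 : ((n:ℝ)+1)^(1-s) = ((n:ℝ)+1)^(-s)*(n+1) := by
    rw [show 1-s = -s+1 by ring, rpow_add_one hn.ne']
  have e3 : (1+(1-s)*(-1/((n:ℝ)+1)))*((n:ℝ)+1)^(1-s) =
      ((n:ℝ)+1)^(1-s)-(1-s)*((n:ℝ)+1)^(-s) := by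
    rw [e2]; field_simp
    ring
  rw [e3] at h
  linarith

/-- `max 1 |k|`, the size of an integer frequency. -/
def freq (k:ℤ) : ℝ := max 1 |(k:ℝ)|

lemma one_le_freq (k:ℤ) : 1 ≤ freq k := le_max_left _ _

lemma freq_natCast_add_one (n:ℕ) : freq ((n:ℤ)+1) = n+1 := by
  rw [freq]
  push_cast
  rw [abs_of_nonneg (by positivity), max_eq_right]
  linarith [(cast_nonneg n : (0:ℝ) ≤ n)]

lemma freq_neg (k:ℤ) : freq (-k) = freq k := by simp [freq]

lemma tentCoeff_neg (h:ℝ) (k:ℤ) : tentCoeff h (-k) = tentCoeff h k := by simp [tentCoeff]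

lemma tentCoeff_summand_partial {s : ℝ} (hs0 : 0 ≤ s) (hs : s < 1) {K : ℕ} (hK : 0 < K) (n:ℕ) :
    ∑ k ∈ range n, tentCoeff (1/K) ((k:ℤ)+1)*freq ((k:ℤ)+1)^(-s) ≤
      (1/(1-s)+1)*(K:ℝ)^(1-s) := by
  have hK0 : (0:ℝ) < K := mod_cast hK
  set F : ℕ → ℝ := fun k => tentCoeff (1/K) ((k:ℤ)+1)*freq ((k:ℤ)+1)^(-s)
  have p1 : ∀ n, n ≤ K → ∑ k ∈ range n, F k ≤ (n:ℝ)^(1-s)/(1-s) := by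
    intro n
    induction n with
    | zero => intro _; simp; positivity
    | succ n ih =>
      intro hn
      rw [sum_range_succ]
      have h1 := ih (by omega)
      have h2 : F n ≤ ((n:ℝ)+1)^(-s) := by
        simp only [F, freq_natCast_add_one]
        refine mul_le_of_le_one_left (by positivity) (tentCoeff_le_one _)
      have h3 := rpow_neg_le_sub hs0 hs n
      rw [sub_div] at h3
      push_cast
      linarith
  have hKK : (K:ℝ)^(-s)*K^2*(1/K) = (K:ℝ)^(1-s) := by
    rw [sub_eq_neg_add, rpow_add_one hK0.ne']; field_simp
  have p2 : ∀ m, ∑ k ∈ range (K+m), F k ≤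
      (K:ℝ)^(1-s)/(1-s)+(K:ℝ)^(-s)*K^2*(1/K-1/(K+m)) := by
    intro m
    induction m with
    | zero => simpa using p1 K le_rfl
    | succ m ih =>
      rw [← add_assoc, sum_range_succ]
      have hkm : (0:ℝ) < K+m := by positivity
      have h2 : F (K+m) ≤ (K:ℝ)^(-s)*K^2*(1/(K+m)-1/(K+m+1)) := by
        simp only [F, freq_natCast_add_one]
        have h3 := tentCoeff_le (h := 1/(K:ℝ)) (by positivity) (k := ((K+m:ℕ):ℤ)+1) (by omega)
        have h4 : (((K+m:ℕ):ℝ)+1)^(-s) ≤ (K:ℝ)^(-s) :=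
          rpow_le_rpow_of_nonpos hK0 (by push_cast; linarith [(cast_nonneg m : (0:ℝ) ≤ m)])
            (by linarith)
        have h5 : 1/(((((K+m:ℕ):ℤ)+1:ℤ):ℝ)*(1/(K:ℝ)))^2 ≤
            K^2*(1/(K+m)-1/(K+m+1)) := by
          have e : 1/(((((K+m:ℕ):ℤ)+1:ℤ):ℝ)*(1/(K:ℝ)))^2 =
            K^2*(1/((K:ℝ)+m+1)^2) := by
            push_cast; field_simp
          rw [e]
          gcongr
          rw [div_sub_div _ _ hkm.ne' (by positivity), div_le_div_iff₀ (by positivity) (by positivity)]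
          nlinarith
        calc _ ≤ K^2*(1/(K+m)-1/(K+m+1))*(K:ℝ)^(-s) :=
              mul_le_mul (h3.trans h5) h4 (by positivity) (le_trans (by positivity) h5)
          _ = _ := by ring
      push_cast
      rw [← add_assoc (K:ℝ)]
      linarith
  have hmono : ∑ k ∈ range n, F k ≤ ∑ k ∈ range (K+n), F k := by
    refine sum_le_sum_of_subset_of_nonneg (range_mono (by omega)) fun k _ _ => ?_
    have := one_le_freq ((k:ℤ)+1)
    exact mul_nonneg (tentCoeff_nonneg _ _) (by positivity)
  have h6 : (K:ℝ)^(-s)*K^2*(1/K-1/(K+n)) ≤ (K:ℝ)^(1-s) := by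
    rw [← hKK]
    gcongr
    have : (0:ℝ) ≤ 1/(K+n) := by positivity
    linarith
  calc _ ≤ _ := hmono
    _ ≤ _ := p2 n
    _ ≤ _ := by rw [add_mul, one_mul, one_div_mul_eq_div]; linarith

lemma hasSum_int_of_even {f : ℤ → ℝ} (hf : ∀ k, f (-k) = f k) (hf0 : ∀ k, 0 ≤ f k) {C : ℝ}
    (hC : ∀ n, ∑ k ∈ range n, f ((k:ℤ)+1) ≤ C) :
    Summable f ∧ ∑' k, f k ≤ f 0+2*C := by
  have hs : Summable fun k : ℕ => f ((k:ℤ)+1) := summable_of_sum_range_le (fun k => hf0 _) hC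
  have hle : ∑' k : ℕ, f ((k:ℤ)+1) ≤ C := Real.tsum_le_of_sum_range_le (fun k => hf0 _) hC
  have h1 : HasSum (fun n : ℕ => f n) (f 0+∑' k : ℕ, f ((k:ℤ)+1)) := by
    have h := hs.hasSum
    have h' := (hasSum_nat_add_iff (f := fun n : ℕ => f n) (g := ∑' k : ℕ, f ((k:ℤ)+1)) 1).1
      (by simpa using h)
    simpa [add_comm] using h'
  have h2 : HasSum (fun n : ℕ => f (-((n:ℤ)+1))) (∑' k : ℕ, f ((k:ℤ)+1)) := by
    simpa only [hf] using hs.hasSum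
  have h3 := HasSum.of_nat_of_neg_add_one h1 h2
  refine ⟨h3.summable, ?_⟩
  rw [h3.tsum_eq]
  linarith

lemma tentCoeff_tsum_le {s : ℝ} (hs0 : 0 ≤ s) (hs : s < 1) {K : ℕ} (hK : 0 < K) :
    Summable (fun k : ℤ => tentCoeff (1/K) k*freq k^(-s)) ∧
    ∑' k : ℤ, tentCoeff (1/K) k*freq k^(-s) ≤ (2/(1-s)+3)*(K:ℝ)^(1-s) := by
  have hK0 : (1:ℝ) ≤ K := mod_cast hK
  have h := hasSum_int_of_even (f := fun k : ℤ => tentCoeff (1/K) k*freq k^(-s))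
    (fun k => by simp only [freq_neg, tentCoeff_neg])
    (fun k => by
      have := one_le_freq k
      exact mul_nonneg (tentCoeff_nonneg _ _) (by positivity))
    (tentCoeff_summand_partial hs0 hs hK)
  refine ⟨h.1, h.2.trans ?_⟩
  have h1 : (1:ℝ) ≤ (K:ℝ)^(1-s) := one_le_rpow hK0 (by linarith)
  have h2 : tentCoeff (1/K) 0*freq 0^(-s) = 1 := by simp [tentCoeff, freq]
  rw [h2]
  have : 2*((1/(1-s)+1)*(K:ℝ)^(1-s)) = 2/(1-s)*K^(1-s)+2*K^(1-s) := by ring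
  rw [this, add_mul]
  linarith

lemma tentCoeff_tsum_le' : ∃ C : ℝ, 0 < C ∧ ∀ h : ℝ,
    Summable (fun k : ℤ => tentCoeff h k*freq k^(-(5/4):ℝ)) ∧
    ∑' k : ℤ, tentCoeff h k*freq k^(-(5/4):ℝ) ≤ C := by
  have hsum : Summable fun n : ℕ => ((n:ℝ)+1)^(-(5/4):ℝ) := by
    have := (summable_nat_add_iff 1).2 (Real.summable_nat_rpow (p := -(5/4)) |>.2 (by norm_num))
    simpa using this
  refine ⟨1+2*∑' n : ℕ, ((n:ℝ)+1)^(-(5/4):ℝ), by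
    have : 0 ≤ ∑' n : ℕ, ((n:ℝ)+1)^(-(5/4):ℝ) := tsum_nonneg fun n => by positivity
    linarith, fun h => ?_⟩
  have h := hasSum_int_of_even (f := fun k : ℤ => tentCoeff h k*freq k^(-(5/4):ℝ))
    (C := ∑' n : ℕ, ((n:ℝ)+1)^(-(5/4):ℝ))
    (fun k => by simp only [freq_neg, tentCoeff_neg])
    (fun k => by
      have := one_le_freq k
      exact mul_nonneg (tentCoeff_nonneg _ _) (by positivity))
    (fun n => by
      refine le_trans (sum_le_sum fun k _ => ?_) (hsum.sum_le_tsum _ fun k _ => by positivity)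
      rw [freq_natCast_add_one]
      exact mul_le_of_le_one_left (by positivity) (tentCoeff_le_one _))
  refine ⟨h.1, h.2.trans ?_⟩
  simp [tentCoeff, freq]

lemma freq_mul_le {k l : ℤ} (h : (k, l) ≠ 0) : freq k*freq l ≤ dualNorm k l^2 := by
  rw [dualNorm_sq]
  have key : ∀ k : ℤ, k ≠ 0 → (1:ℝ) ≤ (k:ℝ)^2 ∧ freq k = |(k:ℝ)| := by
    intro k hk
    have h1 : (1:ℝ) ≤ |(k:ℝ)| := mod_cast Int.one_le_abs hk
    exact ⟨by nlinarith [sq_abs (k:ℝ)], max_eq_right h1⟩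
  by_cases hk : k = 0
  · have hl : l ≠ 0 := fun hl => h (by simp [hk, hl])
    obtain ⟨h1, h2⟩ := key l hl
    have h0 : freq 0 = 1 := by simp [freq]
    subst hk
    rw [h0, h2]; push_cast
    nlinarith [sq_abs (l:ℝ), sq_nonneg (|(l:ℝ)| - 1)]
  · obtain ⟨h1, h2⟩ := key k hk
    by_cases hl : l = 0
    · have h0 : freq 0 = 1 := by simp [freq]
      subst hl
      rw [h0, h2]; push_cast
      nlinarith [sq_abs (k:ℝ), sq_nonneg (|(k:ℝ)| - 1)]
    · obtain ⟨h3, h4⟩ := key l hl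
      rw [h2, h4, ← abs_mul]
      refine abs_le.2 ⟨?_, ?_⟩ <;> nlinarith [sq_nonneg ((k:ℝ)-l), sq_nonneg ((k:ℝ)+l)]

lemma summable_tentCoeff {K : ℕ} (hK : 0 < K) : Summable (tentCoeff (1/K)) := by
  simpa using (tentCoeff_tsum_le (s := 0) le_rfl one_pos hK).1

lemma hasSum_tent_mul_tent {K : ℕ} (hK : 0 < K) (p : ℝ × ℝ) :
    HasSum (fun v : ℤ × ℤ => tentCoeff (1/K) v.1*tentCoeff (1/K) v.2 *
      cos (2*pi*(v.1*p.1+v.2*p.2))) (tent (1/K) p.1*tent (1/K) p.2) := by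
  have hK0 : (0:ℝ) < 1/K := by positivity
  have hs := summable_tentCoeff hK
  set F : ℝ → ℤ → ℂ := fun x k => (tentCoeff (1/K) k:ℂ)*ee (k*x) with hF
  have hn : ∀ (x:ℝ) (k:ℤ), ‖F x k‖ = tentCoeff (1/K) k := by
    intro x k
    rw [hF, norm_mul, norm_ee, mul_one, norm_real, norm_of_nonneg (tentCoeff_nonneg _ _)]
  have hsn : ∀ x, Summable fun k => ‖F x k‖ := fun x => by simpa only [hn] using hs
  have hsum := summable_mul_of_summable_norm (hsn p.1) (hsn p.2)
  have h1 : HasSum (F p.1) _ := hasSum_tent hK0 p.1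
  have h2 : HasSum (F p.2) _ := hasSum_tent hK0 p.2
  have H := Complex.hasSum_re (h1.mul h2 hsum)
  rw [← Complex.ofReal_mul, ofReal_re] at H
  refine (congrArg (HasSum · _) (funext fun v => ?_)).mpr H
  have : F p.1 v.1*F p.2 v.2 = ((tentCoeff (1/K) v.1*tentCoeff (1/K) v.2:ℝ):ℂ) *
      ee (v.1*p.1+v.2*p.2) := by
    rw [ee_add]; simp only [hF]; push_cast; ring
  rw [this, re_ofReal_mul, ee_re]

lemma hasSum_smoothN {K : ℕ} (hK : 0 < K) {ρ : ℝ} (hρ : 0 ≤ ρ) :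
    HasSum (fun v : ℤ × ℤ => tentCoeff (1/K) v.1*tentCoeff (1/K) v.2 *
      (2/√3*discFT ρ (dualNorm v.1 v.2))) (smoothN (1/K) ρ) := by
  have hs := summable_tentCoeff hK
  have hs2 := hs.mul_of_nonneg hs (tentCoeff_nonneg _) (tentCoeff_nonneg _)
  set D := {p : ℝ × ℝ | ‖eis p‖ ≤ ρ}
  have : IsFiniteMeasure (volume.restrict D) := ⟨by
    rw [Measure.restrict_apply_univ]; exact volume_eisDisc_lt_top ρ⟩
  have hInt : ∀ v : ℤ × ℤ, Integrable (fun p : ℝ × ℝ => tentCoeff (1/K) v.1*tentCoeff (1/K) v.2 *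
      cos (2*pi*(v.1*p.1+v.2*p.2))) (volume.restrict D) := by
    intro v
    refine Integrable.of_bound (C := tentCoeff (1/K) v.1*tentCoeff (1/K) v.2)
      (aestronglyMeasurable (by fun_prop)) (.of_forall fun p => ?_)
    have h0 := mul_nonneg (tentCoeff_nonneg (1/K) v.1) (tentCoeff_nonneg (1/K) v.2)
    rw [norm_mul, norm_of_nonneg h0]
    exact mul_le_of_le_one_right h0 (abs_cos_le_one _)
  have H := hasSum_integral_of_summable_integral_norm hInt (by
    refine Summable.of_nonneg_of_le (fun v => integral_nonneg fun p => norm_nonneg _) (fun v => ?_)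
      (hs2.mul_right ((volume.restrict D).real Set.univ))
    have h0 := mul_nonneg (tentCoeff_nonneg (1/K) v.1) (tentCoeff_nonneg (1/K) v.2)
    refine (integral_mono (hInt v).norm (integrable_const
      (tentCoeff (1/K) v.1*tentCoeff (1/K) v.2)) fun p => ?_).trans ?_
    · simp only [norm_mul, norm_of_nonneg (tentCoeff_nonneg _ _)]
      exact mul_le_of_le_one_right h0 (abs_cos_le_one _)
    · simp [mul_comm])
  have e1 : ∀ p : ℝ × ℝ, ∑' v : ℤ × ℤ, tentCoeff (1/K) v.1*tentCoeff (1/K) v.2 *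
      cos (2*pi*(v.1*p.1+v.2*p.2)) = tent (1/K) p.1*tent (1/K) p.2 :=
    fun p => (hasSum_tent_mul_tent hK p).tsum_eq
  simp only [e1, integral_const_mul] at H
  refine (congrArg (HasSum · _) (funext fun v => ?_)).mpr H
  rw [integral_eisDisc_cos hρ]

lemma freq_rpow_le {k l : ℤ} (h : (k, l) ≠ 0) {s : ℝ} (hs : 0 ≤ s) :
    1/(dualNorm k l)^(2*s) ≤ freq k^(-s)*freq l^(-s) := by
  have h1 := freq_mul_le h
  have hk := one_le_freq k
  have hl := one_le_freq l
  have h0 : 0 ≤ dualNorm k l := sqrt_nonneg _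
  rw [← mul_rpow (by linarith) (by linarith), rpow_mul h0, one_div, ← rpow_neg (by positivity)]
  have : (dualNorm k l)^(2:ℝ) = dualNorm k l^2 := by norm_cast
  rw [this]
  exact rpow_le_rpow_of_nonpos (by nlinarith) h1 (by linarith)

lemma one_le_dualNorm {k l : ℤ} (h : (k, l) ≠ 0) : 1 ≤ dualNorm k l := by
  have h1 := freq_mul_le h
  have hk := one_le_freq k
  have hl := one_le_freq l
  have : 0 ≤ dualNorm k l := sqrt_nonneg _
  nlinarith

section
variable {α : Type*} [MeasurableSpace α] {μ : Measure α} [IsFiniteMeasure μ] {ρ : α → ℝ}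
  {r P₀ P Q : ℝ}

lemma PhaseBound.integrable_discFT (h : PhaseBound μ ρ r P₀ P Q) (X:ℝ) :
    Integrable (fun s => discFT (ρ s) X) μ := by
  have hm := h.measurable_inner (w := fun v => √(1-v^2)) (by fun_prop) X 0 1 zero_le_one
  refine Integrable.of_bound (C := 16*r^2) (aestronglyMeasurable ?_)
    (.of_forall fun s => (abs_discFT_le _ _).trans ?_)
  · exact ((h.meas.pow_const 2).const_mul 4).mul hm
  · nlinarith [h.lower s, h.upper s, h.pos]

lemma PhaseBound.hasSum_integral_smoothN (h : PhaseBound μ ρ r P₀ P Q) {K : ℕ} (hK : 0 < K) :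
    HasSum (fun v : ℤ × ℤ => tentCoeff (1/K) v.1*tentCoeff (1/K) v.2 *
      (2/√3*∫ s, discFT (ρ s) (dualNorm v.1 v.2) ∂μ)) (∫ s, smoothN (1/K) (ρ s) ∂μ) := by
  have hr := h.pos
  have hs := summable_tentCoeff hK
  have hs2 := hs.mul_of_nonneg hs (tentCoeff_nonneg _) (tentCoeff_nonneg _)
  have hInt : ∀ v : ℤ × ℤ, Integrable (fun s => tentCoeff (1/K) v.1*tentCoeff (1/K) v.2 *
      (2/√3*discFT (ρ s) (dualNorm v.1 v.2))) μ := fun v =>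
    ((h.integrable_discFT _).const_mul _).const_mul _
  have H := hasSum_integral_of_summable_integral_norm hInt (by
    refine Summable.of_nonneg_of_le (fun v => integral_nonneg fun p => norm_nonneg _) (fun v => ?_)
      (hs2.mul_right (2/√3*(16*r^2)*μ.real Set.univ))
    have h0 := mul_nonneg (tentCoeff_nonneg (1/K) v.1) (tentCoeff_nonneg (1/K) v.2)
    refine (integral_mono (hInt v).norm (integrable_const
      (tentCoeff (1/K) v.1*tentCoeff (1/K) v.2*(2/√3*(16*r^2)))) fun s => ?_).trans ?_
    · simp only [norm_mul, norm_of_nonneg (tentCoeff_nonneg _ _)]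
      refine mul_le_mul_of_nonneg_left ?_ h0
      rw [norm_of_nonneg (by positivity)]
      refine mul_le_mul_of_nonneg_left ((abs_discFT_le _ _).trans ?_) (by positivity)
      nlinarith [h.lower s, h.upper s, h.pos]
    · simp only [integral_const, smul_eq_mul]
      exact le_of_eq (by ring))
  have e1 : ∀ s, ∑' v : ℤ × ℤ, tentCoeff (1/K) v.1*tentCoeff (1/K) v.2 *
      (2/√3*discFT (ρ s) (dualNorm v.1 v.2)) = smoothN (1/K) (ρ s) :=
    fun s => (hasSum_smoothN hK (hr.le.trans (h.lower s))).tsum_eq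
  simpa only [e1, integral_const_mul] using H

lemma PhaseBound.integrable_sq (h : PhaseBound μ ρ r P₀ P Q) : Integrable (fun s => ρ s^2) μ := by
  simpa using h.integrable_pow_mul 2 (g := fun _ => 1) measurable_const (C := 1) (by simp)

lemma hasSum_mul_self {f : ℤ → ℝ} (hf : Summable f) (h0 : ∀ k, 0 ≤ f k) :
    HasSum (fun v : ℤ × ℤ => f v.1*f v.2) ((∑' k, f k)*∑' k, f k) :=
  hf.hasSum.mul hf.hasSum (hf.mul_of_nonneg hf h0 h0)

end

/-- The averaged smoothed lattice point discrepancy. -/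
lemma exists_smoothN_bound : ∃ C : ℝ, 0 < C ∧ ∀ {α : Type} [MeasurableSpace α] (μ : Measure α)
    [IsFiniteMeasure μ] (ρ : α → ℝ) (r P₀ P Q:ℝ), PhaseBound μ ρ r P₀ P Q → 1 ≤ r →
    ∀ K : ℕ, 0 < K →
    |∫ s, smoothN (1/K) (ρ s) ∂μ-2*pi/√3*∫ s, ρ s^2 ∂μ| ≤ C*(P₀*√r*√K+P*r*K+Q/√r) := by
  obtain ⟨C', hC', hC⟩ := tentCoeff_tsum_le'
  refine ⟨200*(121+49+C'^2), by positivity, ?_⟩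
  intro α _ μ _ ρ r P₀ P Q h hr K hK
  have hP₀ := h.P₀_nonneg
  have hP := h.P_nonneg
  have hQ := h.Q_nonneg
  have hK1 : (1:ℝ) ≤ K := mod_cast hK
  have H := hasSum_ite_sub_hasSum (h.hasSum_integral_smoothN hK) 0
  set w : ℝ → ℤ → ℝ := fun s k => tentCoeff (1/K) k*freq k^(-s) with hw
  have hw0 : ∀ s k, 0 ≤ w s k := fun s k => by
    have := one_le_freq k
    exact mul_nonneg (tentCoeff_nonneg _ _) (by positivity)
  have a1 := tentCoeff_tsum_le (s := 3/4) (by norm_num) (by norm_num) hK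
  have a2 := tentCoeff_tsum_le (s := 1/2) (by norm_num) (by norm_num) hK
  have a3 := hC (1/K)
  have G := (((hasSum_mul_self (f := w (3/4)) a1.1 (hw0 _)).mul_left (200*(P₀*√r))).add
    ((hasSum_mul_self (f := w (1/2)) a2.1 (hw0 _)).mul_left (200*(P*r)))).add
    ((hasSum_mul_self (f := w (5/4)) a3.1 (hw0 _)).mul_left (200*(Q/√r)))
  have key := H.norm_le_of_bounded G (fun v => ?_)
  · have e0 : tentCoeff (1/(K:ℝ)) (0 : ℤ × ℤ).1*tentCoeff (1/K) (0 : ℤ × ℤ).2 *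
      (2/√3*∫ s, discFT (ρ s) (dualNorm ((0 : ℤ × ℤ).1:ℤ) ((0 : ℤ × ℤ).2:ℤ)) ∂μ) =
      2*pi/√3*∫ s, ρ s^2 ∂μ := by
      have : dualNorm ((0:ℤ):ℝ) ((0:ℤ):ℝ) = 0 := by simp [dualNorm]
      simp only [Prod.fst_zero, Prod.snd_zero]
      rw [this]
      simp only [discFT_zero, integral_const_mul, tentCoeff]
      simp only [if_true]
      ring
    rw [e0] at key
    refine key.trans ?_
    have sq_le : ∀ {a b : ℝ}, 0 ≤ a → a ≤ b → a*a ≤ b*b := fun h1 h2 =>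
      mul_le_mul h2 h2 h1 (h1.trans h2)
    have b1 := sq_le (tsum_nonneg (hw0 (3/4))) a1.2
    have b2 := sq_le (tsum_nonneg (hw0 (1/2))) a2.2
    have b3 := sq_le (tsum_nonneg (hw0 (5/4))) a3.2
    have c1 : (2/(1-3/4)+3)*(K:ℝ)^((1:ℝ)-3/4)*((2/(1-3/4)+3)*(K:ℝ)^((1:ℝ)-3/4))
        = 121*√K := by
      have : (K:ℝ)^((1:ℝ)-3/4)*(K:ℝ)^((1:ℝ)-3/4) = √K := by
        rw [← rpow_add (by linarith), sqrt_eq_rpow]; norm_num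
      rw [← this]; ring
    have c2 : (2/(1-1/2)+3)*(K:ℝ)^((1:ℝ)-1/2)*((2/(1-1/2)+3)*(K:ℝ)^((1:ℝ)-1/2))
        = 49*K := by
      have : (K:ℝ)^((1:ℝ)-1/2)*(K:ℝ)^((1:ℝ)-1/2) = K := by
        rw [← rpow_add (by linarith)]; norm_num
      nth_rw 3 [← this]; ring
    rw [c1] at b1
    rw [c2] at b2
    have d1 : 0 ≤ P₀*√r*√K := by positivity
    have d2 : 0 ≤ P*r*K := by positivity
    have d3 : 0 ≤ Q/√r := by positivity
    have f1 := mul_le_mul_of_nonneg_left b1 (by positivity : 0 ≤ 200*(P₀*√r))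
    have f2 := mul_le_mul_of_nonneg_left b2 (by positivity : 0 ≤ 200*(P*r))
    have f3 := mul_le_mul_of_nonneg_left b3 (by positivity : 0 ≤ 200*(Q/√r))
    refine (add_le_add (add_le_add f1 f2) f3).trans ?_
    nlinarith
  · by_cases hv : v = 0
    · simp only [hv, if_true, norm_zero]
      have := fun s => hw0 s (0:ℤ)
      have h3 := this (3/4)
      have h4 := this (1/2)
      have h5 := this (5/4)
      simp only [Prod.fst_zero, Prod.snd_zero]
      positivity
    · rw [if_neg hv]
      have hv' : (v.1, v.2) ≠ 0 := hv
      have hR := one_le_dualNorm hv'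
      set R := dualNorm v.1 v.2
      have hJ := h.discFT_le (X := R) (by nlinarith)
      have q1 := freq_rpow_le hv' (s := 3/4) (by norm_num)
      have q2 := freq_rpow_le hv' (s := 1/2) (by norm_num)
      have q3 := freq_rpow_le hv' (s := 5/4) (by norm_num)
      have hRp : 0 < R := by linarith
      have hrp : 0 < r := by linarith
      have E1 : 100/R^2*(P₀*√(R*r)+P*(R*r)+Q/√(R*r)) =
          100*(P₀*√r*(1/R^(2*(3/4):ℝ))+P*r*(1/R^(2*(1/2):ℝ))+Q/√r*(1/R^(2*(5/4):ℝ))) := by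
        have r1 : R^(2*(3/4):ℝ) = R*√R := by
          rw [sqrt_eq_rpow, ← rpow_one_add' hRp.le (by norm_num)]; norm_num
        have r2 : R^(2*(1/2):ℝ) = R := by norm_num
        have r3 : R^(2*(5/4):ℝ) = R*R*√R := by
          rw [sqrt_eq_rpow, mul_assoc, ← rpow_one_add' hRp.le (by norm_num),
            ← rpow_one_add' hRp.le (by norm_num)]; norm_num
        rw [r1, r2, r3, sqrt_mul hRp.le]
        have hsq : √R^2 = R := sq_sqrt hRp.le
        rw [← hsq, sqrt_sq (by positivity)]
        field_simp
      rw [E1] at hJ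
      have t1 := tentCoeff_nonneg (1/K) v.1
      have t2 := tentCoeff_nonneg (1/K) v.2
      rw [norm_mul, norm_mul, norm_mul, norm_of_nonneg t1, norm_of_nonneg t2,
        norm_of_nonneg (by positivity : 0 ≤ 2/√3), norm_eq_abs]
      have h3 : 2/√3 ≤ 2 := by
        refine div_le_self (by norm_num) ?_
        rw [one_le_sqrt]; norm_num
      have hle : |∫ s, discFT (ρ s) R ∂μ| ≤ 100*(P₀*√r*(freq v.1^(-(3/4:ℝ))*freq v.2^(-(3/4:ℝ))) +
            P*r*(freq v.1^(-(1/2:ℝ))*freq v.2^(-(1/2:ℝ))) +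
            Q/√r*(freq v.1^(-(5/4:ℝ))*freq v.2^(-(5/4:ℝ)))) := by
        refine hJ.trans ?_
        gcongr
      calc _ ≤ tentCoeff (1/K) v.1*tentCoeff (1/K) v.2*(2*_) := by
            refine mul_le_mul_of_nonneg_left (mul_le_mul h3 hle (abs_nonneg _) (by norm_num)) (by positivity)
        _ = _ := by simp only [hw]; ring

/-- The density of the Eisenstein lattice. -/
def eisDens : ℝ := 2*pi/√3

/-- The lattice point discrepancy of the form `x² + xy + y²`. -/
def latE (t:ℝ) : ℝ := latN t-eisDens*t

lemma eisDens_pos : 0 < eisDens := by unfold eisDens; positivity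

lemma latN_mono : Monotone latN := fun s t h => by
  unfold latN
  refine card_le_card fun v hv => ?_
  simp only [Set.Finite.mem_toFinset] at hv ⊢
  exact le_trans hv h

lemma measurable_latN : Measurable fun t => (latN t:ℝ) :=
  Monotone.measurable fun _ _ h => cast_le.2 (latN_mono h)

lemma exists_latE_bound : ∃ C : ℝ, 0 < C ∧ ∀ {α : Type} [MeasurableSpace α] (μ : Measure α)
    [IsFiniteMeasure μ] (Z : α → ℝ) (r P₀ P Q:ℝ) (K:ℕ), (∀ s, 0 ≤ Z s) →
    PhaseBound μ (fun s => √(Z s)+2*(1/K)) r P₀ P Q →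
    PhaseBound μ (fun s => √(Z s)-2*(1/K)) r P₀ P Q → 1 ≤ r → 4 ≤ K →
    |∫ s, latE (Z s) ∂μ| ≤ C*(μ.real Set.univ*r/K+P₀*√r*√K+P*r*K+Q/√r) := by
  obtain ⟨C, hC, H⟩ := exists_smoothN_bound
  refine ⟨C+8*eisDens, by have := eisDens_pos; positivity, ?_⟩
  intro α _ μ _ Z r P₀ P Q K hZ hp hm hr hK
  have hc := eisDens_pos
  have hP₀ := hp.P₀_nonneg
  have hP := hp.P_nonneg
  have hQ := hp.Q_nonneg
  have hK4 : (4:ℝ) ≤ K := mod_cast hK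
  have hh : 0 < 1/(K:ℝ) := by positivity
  have hh2 : 1/(K:ℝ) ≤ 1/4 := one_div_le_one_div_of_le (by norm_num) hK4
  have Hp := abs_le.1 (H μ _ r P₀ P Q hp hr K (by omega))
  have Hm := abs_le.1 (H μ _ r P₀ P Q hm hr K (by omega))
  set h := 1/(K:ℝ) with hdef
  have hmeas : Measurable fun s => √(Z s) := by simpa using hp.meas.sub_const (2*h)
  have hZe : ∀ s, √(Z s)^2 = Z s := fun s => sq_sqrt (hZ s)
  have hZm : Measurable Z := by
    have := hmeas.pow_const 2
    simpa only [hZe] using this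
  have hsq : ∀ s, √(Z s) ≤ 2*r := fun s => by linarith [hp.upper s]
  have hZb : ∀ s, Z s ≤ 4*r^2 := fun s => by rw [← hZe]; nlinarith [hsq s, sqrt_nonneg (Z s)]
  have iZ : Integrable Z μ := Integrable.of_bound (C := 4*r^2) hZm.aestronglyMeasurable
    (.of_forall fun s => by rw [norm_of_nonneg (hZ s)]; exact hZb s)
  have iN : Integrable (fun s => (latN (Z s):ℝ)) μ :=
    Integrable.of_bound (C := latN (4*r^2)) (measurable_latN.comp hZm).aestronglyMeasurable
      (.of_forall fun s => by
        rw [norm_of_nonneg (by positivity)]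
        exact cast_le.2 (latN_mono (hZb s)))
  have eE : ∫ s, latE (Z s) ∂μ = ∫ s, (latN (Z s):ℝ) ∂μ-eisDens*∫ s, Z s ∂μ := by
    unfold latE
    rw [integral_sub iN (iZ.const_mul _), integral_const_mul]
  have iS : ∀ ρ : α → ℝ, PhaseBound μ ρ r P₀ P Q → Integrable (fun s => smoothN h (ρ s)) μ := by
    intro ρ hρ
    have hmono : Monotone (smoothN h) := by
      intro a b hab
      refine setIntegral_mono_set (integrableOn_tent hh hh2 (volume_eisDisc_lt_top b))
        (.of_forall fun p =>
          mul_nonneg (tent_nonneg hh hh2 _) (tent_nonneg hh hh2 _))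
        (HasSubset.Subset.eventuallyLE fun p hp => le_trans hp hab)
    refine Integrable.of_bound (C := smoothN h (2*r))
      (hmono.measurable.comp hρ.meas).aestronglyMeasurable (.of_forall fun s => ?_)
    rw [norm_of_nonneg]
    · exact hmono (hρ.upper s)
    · exact integral_nonneg fun p => mul_nonneg (tent_nonneg hh hh2 _) (tent_nonneg hh hh2 _)
  have u1 : ∫ s, (latN (Z s):ℝ) ∂μ ≤ ∫ s, smoothN h (√(Z s)+2*h) ∂μ :=
    integral_mono iN (iS _ hp) fun s => latN_le_smoothN hh hh2 le_rfl
  have u2 : ∫ s, smoothN h (√(Z s)-2*h) ∂μ ≤ ∫ s, (latN (Z s):ℝ) ∂μ :=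
    integral_mono (iS _ hm) iN fun s => smoothN_le_latN hh hh2 (by linarith) (hZ s)
  have q1 : ∫ s, (√(Z s)+2*h)^2 ∂μ ≤ ∫ s, Z s ∂μ+8*(μ.real Set.univ*r/K) := by
    have : ∫ s, (√(Z s)+2*h)^2 ∂μ ≤ ∫ s, (Z s+8*(r*h)) ∂μ := by
      refine integral_mono hp.integrable_sq (iZ.add (integrable_const _)) fun s => ?_
      have := hp.upper s
      have := hZe s
      simp only
      nlinarith
    rw [integral_add iZ (integrable_const _), integral_const, smul_eq_mul] at this
    refine this.trans (le_of_eq ?_)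
    rw [hdef]; ring
  have q2 : ∫ s, Z s ∂μ-8*(μ.real Set.univ*r/K) ≤ ∫ s, (√(Z s)-2*h)^2 ∂μ := by
    have : ∫ s, (Z s-8*(r*h)) ∂μ ≤ ∫ s, (√(Z s)-2*h)^2 ∂μ := by
      refine integral_mono (iZ.sub (integrable_const _)) hm.integrable_sq fun s => ?_
      have := hsq s
      have := hZe s
      simp only
      nlinarith
    rw [integral_sub iZ (integrable_const _), integral_const, smul_eq_mul] at this
    refine le_trans (le_of_eq ?_) this
    rw [hdef]; ring
  have hM : 0 ≤ μ.real Set.univ*r/K := by positivity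
  have hd1 : 0 ≤ P₀*√r*√K := by positivity
  have hd2 : 0 ≤ P*r*K := by positivity
  have hd3 : 0 ≤ Q/√r := by positivity
  rw [eE]
  change -_ ≤ _-eisDens*_ ∧ _-eisDens*_ ≤ _ at Hp
  change -_ ≤ _-eisDens*_ ∧ _-eisDens*_ ≤ _ at Hm
  refine abs_le.2 ⟨?_, ?_⟩ <;> nlinarith [Hp.1, Hp.2, Hm.1, Hm.2]

lemma exists_latE_le_of_le (T:ℝ) : ∃ C : ℝ, 0 < C ∧ ∀ t, 0 ≤ t → t ≤ T → |latE t| ≤ C := by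
  have hc := eisDens_pos
  refine ⟨latN T+eisDens*|T| + 1, by positivity, fun t h0 ht => ?_⟩
  have h1 : (latN t:ℝ) ≤ latN T := cast_le.2 (latN_mono ht)
  have h2 : eisDens*t ≤ eisDens*|T| := mul_le_mul_of_nonneg_left (ht.trans (le_abs_self T)) hc.le
  have h4 : 0 ≤ eisDens*t := by positivity
  unfold latE
  refine abs_le.2 ⟨?_, ?_⟩ <;> linarith

/-- Voronoi's exponent for the individual lattice point discrepancy. -/
lemma exists_latE_pointwise : ∃ C : ℝ, 0 < C ∧ ∀ x, 1 ≤ x → |latE x| ≤ C*x^((1:ℝ)/3) := by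
  obtain ⟨C, hC, H⟩ := exists_latE_bound
  obtain ⟨C', hC', H'⟩ := exists_latE_le_of_le 9
  refine ⟨C*100+C', by positivity, fun x hx => ?_⟩
  have hx0 : 0 ≤ x := by linarith
  have h1 : 1 ≤ x^((1:ℝ)/3) := one_le_rpow hx (by norm_num)
  rcases le_or_gt x 9 with h9 | h9
  · refine (H' x hx0 h9).trans ?_
    nlinarith
  have hs3 : 3 ≤ √x := le_sqrt_of_sq_le (by norm_num; linarith)
  set K : ℕ := ⌈4*x^((1:ℝ)/6)⌉₊ with hK
  have h6 : 1 ≤ x^((1:ℝ)/6) := one_le_rpow hx (by norm_num)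
  have hK1 : 4*x^((1:ℝ)/6) ≤ K := le_ceil _
  have hK2 : (K:ℝ) ≤ 5*x^((1:ℝ)/6) := by
    have := Nat.ceil_lt_add_one (a := 4*x^((1:ℝ)/6)) (by positivity)
    rw [← hK] at this; linarith
  have hK4' : (4:ℝ) ≤ K := by linarith
  have hK4 : 4 ≤ K := mod_cast hK4'
  have hh : 0 < 1/(K:ℝ) := by positivity
  have hh2 : 1/(K:ℝ) ≤ 1/4 := one_div_le_one_div_of_le (by norm_num) hK4'
  set h := 1/(K:ℝ) with hdef
  set r := √x-2*h with hr
  have pb : ∀ ρ : ℝ, r ≤ ρ → ρ ≤ 2*r →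
      PhaseBound (Measure.dirac ()) (fun _ : Unit => ρ) r 4 0 0 := by
    intro ρ h1 h2
    refine ⟨measurable_const, by linarith, by norm_num, le_rfl, le_rfl, fun _ => h1, fun _ => h2, ?_⟩
    intro j hj y hy
    have hr0 : 0 < r := by linarith
    have hρ0 : 0 ≤ ρ := by linarith
    rw [integral_dirac, norm_mul, norm_ee, mul_one, norm_real, norm_of_nonneg (by positivity)]
    simp only [zero_mul, zero_div, add_zero]
    calc ρ^j ≤ (2*r)^j := by gcongr
      _ = r^j*2^j := by rw [mul_pow]; ring
      _ ≤ r^j*2^2 := by gcongr; norm_num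
      _ = _ := by norm_num
  have key := H (Measure.dirac ()) (fun _ => x) r 4 0 0 K (fun _ => hx0)
    (pb _ (by linarith) (by linarith)) (pb _ (by linarith) (by linarith)) (by linarith) hK4
  rw [integral_dirac] at key
  simp only [probReal_univ, one_mul, zero_mul, zero_div, add_zero] at key
  refine key.trans ?_
  have hsx : √x = x^((1:ℝ)/2) := sqrt_eq_rpow x
  have e1 : r/K ≤ x^((1:ℝ)/3) := by
    rw [div_le_iff₀ (by linarith)]
    have : x^((1:ℝ)/3)*x^((1:ℝ)/6) = √x := by rw [hsx, ← rpow_add (by linarith)]; norm_num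
    nlinarith
  have e2 : √r*√K ≤ 3*x^((1:ℝ)/3) := by
    rw [← sqrt_mul (by linarith)]
    refine sqrt_le_iff.2 ⟨by positivity, ?_⟩
    have : (x^((1:ℝ)/3))^2 = √x*x^((1:ℝ)/6) := by
      rw [hsx, ← rpow_add (by linarith), ← rpow_natCast, ← rpow_mul hx0]; norm_num
    rw [mul_pow, this]
    have hrx : r ≤ √x := by linarith
    calc r*K ≤ √x*(5*x^((1:ℝ)/6)) := by gcongr
      _ ≤ _ := by nlinarith [mul_nonneg (sqrt_nonneg x) (by linarith : 0 ≤ x^((1:ℝ)/6))]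
  nlinarith [mul_le_mul_of_nonneg_left e1 hC.le, mul_le_mul_of_nonneg_left e2 hC.le,
    mul_nonneg hC'.le (by linarith : 0 ≤ x^((1:ℝ)/3)), mul_nonneg hC.le (by linarith : 0 ≤ x^((1:ℝ)/3))]

lemma ee_hasDerivAt {f : ℝ → ℝ} {f' x : ℝ} (hf : HasDerivAt f f' x) :
    HasDerivAt (fun t => ee (f t)) (2*pi*Complex.I*f'*ee (f x)) x := by
  have h1 : HasDerivAt (fun t => ((2*pi*f t:ℝ):ℂ)) ((2*pi*f':ℝ):ℂ) x :=
    (hf.const_mul (2*pi)).ofReal_comp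
  have h2 := (h1.mul_const Complex.I).cexp
  unfold ee
  refine h2.congr_deriv ?_
  push_cast; ring

/-- First derivative test for the radial phases. -/
lemma norm_integral_sqrt_phase_le {u v y c : ℝ} (hu : 0 < u) (huv : u ≤ v) (hy : 0 < y)
    (hc : 0 ≤ √u+c) (j:ℕ) :
    ‖∫ t in u..v, (((√t+c)^j:ℝ):ℂ)*ee (y*(√t+c))‖ ≤ (√v+c)^j*(2*√v)/(pi*y) := by
  have hpi := pi_pos
  have pos : ∀ t ∈ uIcc u v, 0 < t := fun t ht => by
    rw [uIcc_of_le huv] at ht; exact hu.trans_le ht.1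
  set g : ℝ → ℝ := fun t => (√t+c)^j*(2*√t) with hg
  set g' : ℝ → ℝ := fun t => (j*(√t+c)^(j-1)*(1/(2*√t)))*(2*√t) +
    (√t+c)^j*(2*(1/(2*√t))) with hg'
  have dsq : ∀ t ∈ uIcc u v, HasDerivAt (fun t => √t) (1/(2*√t)) t := fun t ht =>
    Real.hasDerivAt_sqrt (pos t ht).ne'
  have dg : ∀ t ∈ uIcc u v, HasDerivAt g (g' t) t := fun t ht =>
    (((dsq t ht).add_const c).pow j).mul ((dsq t ht).const_mul 2)
  have hcont : ContinuousOn (fun t : ℝ => 1/(2*√t)) (uIcc u v) := by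
    refine ContinuousOn.div continuousOn_const (by fun_prop) fun t ht => ?_
    have := sqrt_pos.2 (pos t ht); positivity
  have hg'c : ContinuousOn g' (uIcc u v) := by
    refine ContinuousOn.add (ContinuousOn.mul (ContinuousOn.mul (by fun_prop) hcont) (by fun_prop))
      (ContinuousOn.mul (by fun_prop) (ContinuousOn.mul continuousOn_const hcont))
  have hi : IntervalIntegrable g' volume u v := hg'c.intervalIntegrable
  have hcs : ∀ t, u ≤ t → 0 ≤ √t+c := fun t ht => by have := sqrt_le_sqrt ht; linarith
  have hg'0 : ∀ t ∈ Set.Icc u v, 0 ≤ g' t := fun t ht => by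
    have := hcs t ht.1
    simp only [hg']; positivity
  have dE : ∀ t ∈ uIcc u v, HasDerivAt (fun t => ee (y*(√t+c)))
      (2*pi*Complex.I*(y*(1/(2*√t)):ℝ)*ee (y*(√t+c))) t := fun t ht =>
    ee_hasDerivAt (((dsq t ht).add_const c).const_mul y)
  have hee : Continuous ee := by unfold ee; fun_prop
  have IBP := intervalIntegral.integral_mul_deriv_eq_deriv_mul (u := fun t => ((g t:ℝ):ℂ))
    (u' := fun t => ((g' t:ℝ):ℂ)) (fun t ht => (dg t ht).ofReal_comp) dE
    (Complex.continuous_ofReal.comp_continuousOn hg'c).intervalIntegrable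
    (intervalIntegrable (by
      refine ContinuousOn.mul (ContinuousOn.mul continuousOn_const
        (Complex.continuous_ofReal.comp_continuousOn (continuousOn_const.mul hcont))) ?_
      exact hee.comp_continuousOn (by fun_prop)))
  have e1 : ∫ t in u..v, ((g t:ℝ):ℂ) * (2*pi*Complex.I*(y*(1/(2*√t)):ℝ)*ee (y*(√t+c))) =
      (2*pi*Complex.I*y) * ∫ t in u..v, (((√t+c)^j:ℝ):ℂ)*ee (y*(√t+c)) := by
    rw [← intervalIntegral.integral_const_mul]
    refine integral_congr fun t ht => ?_
    have : (√t:ℂ) ≠ 0 := mod_cast (sqrt_pos.2 (pos t ht)).ne'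
    simp only [hg]
    push_cast
    field_simp
  rw [e1] at IBP
  have n1 : ‖(2*pi*Complex.I*y:ℂ)‖ = 2*pi*y := by simp [abs_of_pos hpi, abs_of_pos hy]
  have n2 : ‖∫ t in u..v, ((g' t:ℝ):ℂ)*ee (y*(√t+c))‖ ≤ g v-g u := by
    rw [← integral_eq_sub_of_hasDerivAt dg hi]
    refine intervalIntegral.norm_integral_le_of_norm_le huv (.of_forall fun t ht => ?_) hi
    rw [norm_mul, norm_ee, mul_one, norm_real, norm_of_nonneg (hg'0 t ⟨ht.1.le, ht.2⟩)]
  have gn : ∀ t, u ≤ t → 0 ≤ g t := fun t ht => by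
    have := hcs t ht
    simp only [hg]; positivity
  have n3 : ∀ t, u ≤ t → ‖((g t:ℝ):ℂ)*ee (y*(√t+c))‖ = g t := fun t ht => by
    rw [norm_mul, norm_ee, mul_one, norm_real, norm_of_nonneg (gn t ht)]
  have := congrArg norm IBP
  rw [norm_mul, n1] at this
  have n4 := (norm_sub_le _ _).trans (add_le_add (norm_sub_le (((g v:ℝ):ℂ)*ee (y*(√v+c)))
    (((g u:ℝ):ℂ)*ee (y*(√u+c)))) n2)
  rw [n3 v huv, n3 u le_rfl] at n4
  rw [← this] at n4
  rw [le_div_iff₀ (by positivity)]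
  simp only [hg] at n4
  nlinarith

set_option maxHeartbeats 1000000 in
/-- Mean value of the lattice point discrepancy over a short dyadic range. -/
lemma exists_integral_latE_dyadic : ∃ C : ℝ, 0 < C ∧ ∀ u v, 9 ≤ u → u ≤ v → v ≤ 2*u →
    |∫ t in u..v, latE t| ≤ C*u^((3:ℝ)/4) := by
  obtain ⟨C, hC, H⟩ := exists_latE_bound
  refine ⟨C*100, by positivity, fun u v hu huv hv2 => ?_⟩
  have hu0 : 0 < u := by linarith
  have hs3 : 3 ≤ √u := le_sqrt_of_sq_le (by norm_num; linarith)
  set K : ℕ := ⌈4*u^((3:ℝ)/4)⌉₊ with hK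
  have h6 : 1 ≤ u^((3:ℝ)/4) := one_le_rpow (by linarith) (by norm_num)
  have hK1 : 4*u^((3:ℝ)/4) ≤ K := le_ceil _
  have hK4' : (4:ℝ) ≤ K := by linarith
  have hK4 : 4 ≤ K := mod_cast hK4'
  have hh : 0 < 1/(K:ℝ) := by positivity
  have hh2 : 1/(K:ℝ) ≤ 1/4 := one_div_le_one_div_of_le (by norm_num) hK4'
  set h := 1/(K:ℝ) with hdef
  set r := √u-2*h with hr
  have hr0 : 0 < r := by linarith
  have hsu : √u^2 = u := sq_sqrt hu0.le
  have hvs : √v ≤ 2*√u-3/2 := by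
    refine sqrt_le_iff.2 ⟨by linarith, ?_⟩
    nlinarith
  set cl : ℝ → ℝ := fun t => max u (min t v) with hcl
  have hclu : ∀ t, u ≤ cl t := fun t => le_max_left _ _
  have hclv : ∀ t, cl t ≤ v := fun t => max_le huv (min_le_right _ _)
  have hcle : ∀ t ∈ Set.Ioc u v, cl t = t := fun t ht => by
    simp only [hcl]; rw [min_eq_left ht.2, max_eq_right ht.1.le]
  have pb : ∀ c : ℝ, |c| ≤ 2*h → PhaseBound (volume.restrict (Set.Ioc u v))
      (fun t => √(cl t)+c) r 0 0 (64*r^2) := by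
    intro c hc
    have hc' := abs_le.1 hc
    have low : ∀ t, r ≤ √(cl t)+c := fun t => by have := sqrt_le_sqrt (hclu t); linarith
    have upp : ∀ t, √(cl t)+c ≤ 2*r := fun t => by have := sqrt_le_sqrt (hclv t); linarith
    refine ⟨by fun_prop, hr0, le_rfl, le_rfl, by positivity, low, upp, ?_⟩
    intro j hj y hy
    have e0 : ∫ t in Set.Ioc u v, (((√(cl t)+c)^j:ℝ):ℂ)*ee (y*(√(cl t)+c)) =
        ∫ t in u..v, (((√t+c)^j:ℝ):ℂ)*ee (y*(√t+c)) := by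
      rw [integral_of_le huv]
      refine setIntegral_congr_fun measurableSet_Ioc fun t ht => ?_
      simp only [hcle t ht]
    rw [e0]
    have hpow : ∀ x, 0 ≤ x → x ≤ 2*r → x^j ≤ 4*r^j := fun x h0 h1 => by
      calc x^j ≤ (2*r)^j := by gcongr
        _ = 2^j*r^j := by rw [mul_pow]
        _ ≤ 2^2*r^j := by gcongr; norm_num
        _ = _ := by norm_num
    have hrj : 0 < r^j := by positivity
    have goal1 : r^j*(0+0*√(y*r)+64*r^2/(1+y*r)) = 64*r^j*r^2/(1+y*r) := by ring
    rw [goal1, le_div_iff₀ (by positivity)]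
    rcases le_total (y*r) 1 with ht | ht
    · have b : ‖∫ t in u..v, (((√t+c)^j:ℝ):ℂ)*ee (y*(√t+c))‖ ≤ 4*r^j*|v-u| := by
        refine intervalIntegral.norm_integral_le_of_norm_le_const fun t ht => ?_
        rw [uIoc_of_le huv] at ht
        have h1 := low t
        have h2 := upp t
        rw [hcle t ht] at h1 h2
        have h3 : 0 ≤ √t+c := by linarith
        rw [norm_mul, norm_ee, mul_one, norm_real, norm_of_nonneg (by positivity)]
        exact hpow _ h3 h2
      rw [abs_of_nonneg (by linarith)] at b
      have : v-u ≤ 4*r^2 := by nlinarith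
      calc _ ≤ 4*r^j*(4*r^2)*(1+y*r) := by gcongr; exact b.trans (by gcongr)
        _ ≤ 4*r^j*(4*r^2)*2 := by gcongr; linarith
        _ ≤ _ := by nlinarith [mul_pos hrj (by positivity : 0 < r^2)]
    · have hsv0 := low u
      have e1 : cl u = u := by simp [hcl, huv]
      have e2 : cl v = v := by simp [hcl, huv]
      rw [e1] at hsv0
      have b := norm_integral_sqrt_phase_le hu0 huv hy (by linarith : 0 ≤ √u+c) j
      have h2 := upp v
      have h1 := low v
      rw [e2] at h1 h2
      have b2 : (√v+c)^j*(2*√v)/(pi*y) ≤ 4*r^j*(2*(2*r))/(2*y) := by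
        have := hpow _ (by linarith) h2
        have : √v ≤ 2*r := by linarith
        have := pi_gt_three
        gcongr
        linarith
      calc _ ≤ 4*r^j*(2*(2*r))/(2*y)*(1+y*r) := by gcongr; exact b.trans b2
        _ ≤ 4*r^j*(2*(2*r))/(2*y)*(2*(y*r)) := by gcongr; linarith
        _ = 16*(r^j*r^2) := by field_simp; ring
        _ ≤ _ := by nlinarith [mul_pos hrj (by positivity : 0 < r^2)]
  have key := H (volume.restrict (Set.Ioc u v)) cl r 0 0 (64*r^2) K
    (fun t => by linarith [hclu t]) (pb _ (by rw [abs_of_pos (by linarith)]))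
    (by simpa only [sub_eq_add_neg] using pb (-(2*h)) (by rw [abs_neg, abs_of_pos (by linarith)]))
    (by linarith) hK4
  have e0 : ∫ t in Set.Ioc u v, latE (cl t) = ∫ t in u..v, latE t := by
    rw [integral_of_le huv]
    refine setIntegral_congr_fun measurableSet_Ioc fun t ht => ?_
    simp only [hcle t ht]
  rw [e0] at key
  refine key.trans ?_
  rw [measureReal_restrict_apply_univ, Real.volume_real_Ioc_of_le huv]
  simp only [zero_mul, add_zero]
  have hsx : √u = u^((1:ℝ)/2) := sqrt_eq_rpow u
  have hru : r ≤ √u := by linarith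
  have p34 : u*√u = u^((3:ℝ)/4)*u^((3:ℝ)/4) := by
    rw [hsx, ← rpow_add hu0, ← rpow_one_add' hu0.le (by norm_num)]; norm_num
  have e1 : (v-u)*r/K ≤ u^((3:ℝ)/4) := by
    rw [div_le_iff₀ (by linarith)]
    calc (v-u)*r ≤ u*√u := by gcongr; linarith
      _ = _ := p34
      _ ≤ _ := by gcongr; linarith
  have e2 : 64*r^2/√r ≤ 64*u^((3:ℝ)/4) := by
    rw [mul_div_assoc]
    gcongr
    have hsr := sqrt_pos.2 hr0
    rw [div_le_iff₀ hsr]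
    have h1 : √r*√r = r := mul_self_sqrt hr0.le
    have h2 : u^((3:ℝ)/4) = √u*√(√u) := by
      rw [hsx, sqrt_eq_rpow, ← rpow_mul hu0.le, ← rpow_add hu0]; norm_num
    have h3 : √r ≤ √(√u) := sqrt_le_sqrt hru
    rw [h2]
    calc r^2 = r*√r*√r := by rw [mul_assoc, h1]; ring
      _ ≤ √u*√(√u)*√r := by gcongr
  nlinarith

lemma intervalIntegrable_latE (a b:ℝ) : IntervalIntegrable latE volume a b := by
  have h1 : Monotone fun t => (latN t:ℝ) := fun _ _ h => cast_le.2 (latN_mono h)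
  exact h1.intervalIntegrable.sub (Continuous.intervalIntegrable (by fun_prop) _ _)

lemma exists_integral_latE_le : ∃ C : ℝ, 0 < C ∧ ∀ x, 1 ≤ x →
    |∫ t in (1:ℝ)..x, latE t| ≤ C*x^((3:ℝ)/4) := by
  obtain ⟨C, hC, H⟩ := exists_integral_latE_dyadic
  obtain ⟨C', hC', H'⟩ := exists_latE_le_of_le 9
  have small : ∀ x, 1 ≤ x → x ≤ 9 → |∫ t in (1:ℝ)..x, latE t| ≤ 8*C' := fun x h1 h9 => by
    have := intervalIntegral.norm_integral_le_of_norm_le_const (a := 1) (b := x) (f := latE) (C := C')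
      fun t ht => by
        rw [uIoc_of_le h1] at ht
        exact H' t (by linarith [ht.1]) (ht.2.trans h9)
    refine this.trans ?_
    rw [abs_of_nonneg (by linarith)]; nlinarith
  have big : ∀ n : ℕ, ∀ x, 9 ≤ x → x ≤ 9*2^n → |∫ t in (9:ℝ)..x, latE t| ≤ 3*C*x^((3:ℝ)/4) := by
    intro n
    induction n with
    | zero =>
      intro x h1 h2
      have : x = 9 := by simp at h2; linarith
      subst this; simp; positivity
    | succ n ih =>
      intro x h1 h2
      have hx : 0 < x := by linarith
      rcases le_or_gt x 18 with h18 | h18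
      · refine (H 9 x le_rfl h1 (by linarith)).trans ?_
        have : (9:ℝ)^((3:ℝ)/4) ≤ x^((3:ℝ)/4) := by gcongr
        nlinarith [rpow_nonneg hx.le ((3:ℝ)/4)]
      · have a := ih (x/2) (by linarith) (by rw [pow_succ] at h2; linarith)
        have b := H (x/2) x (by linarith) (by linarith) (by linarith)
        rw [← integral_add_adjacent_intervals (b := x/2)
          (intervalIntegrable_latE _ _) (intervalIntegrable_latE _ _)]
        refine (abs_add_le _ _).trans ((add_le_add a b).trans ?_)
        have e : (x/2)^((3:ℝ)/4) ≤ x^((3:ℝ)/4)*(3/4) := by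
          rw [div_rpow hx.le (by norm_num), div_eq_mul_inv]
          gcongr
          rw [inv_le_comm₀ (by positivity) (by norm_num)]
          rw [Real.le_rpow_iff_log_le (by norm_num) (by norm_num)] 
          have h4 : log (3/4)⁻¹*4 ≤ log 2*3 := by
            have e1 : log ((3/4)⁻¹^4) ≤ log (2^3) := log_le_log (by norm_num) (by norm_num)
            rw [log_pow, log_pow] at e1
            push_cast at e1; linarith
          linarith
        nlinarith
  refine ⟨8*C'+3*C, by positivity, fun x hx => ?_⟩
  have hx1 : 1 ≤ x^((3:ℝ)/4) := one_le_rpow hx (by norm_num)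
  rcases le_total x 9 with h9 | h9
  · refine (small x hx h9).trans ?_
    nlinarith
  · obtain ⟨n, hn⟩ := pow_unbounded_of_one_lt x (by norm_num : (1:ℝ) < 2)
    have a := big n x h9 (by nlinarith)
    have b := small 9 (by norm_num) le_rfl
    rw [← integral_add_adjacent_intervals (b := 9)
      (intervalIntegrable_latE _ _) (intervalIntegrable_latE _ _)]
    refine (abs_add_le _ _).trans ((add_le_add b a).trans ?_)
    nlinarith

lemma norm_sum_mul_le_of_antitone {w : ℕ → ℝ} {z : ℕ → ℂ} {B : ℝ} (N:ℕ)
    (hw : ∀ n, n+1 < N → w (n+1) ≤ w n) (hw0 : ∀ n < N, 0 ≤ w n)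
    (hz : ∀ n ≤ N, ‖∑ k ∈ range n, z k‖ ≤ B) (hB : 0 ≤ B) :
    ‖∑ k ∈ range N, (w k:ℂ)*z k‖ ≤ w 0*B ∨ N = 0 := by
  rcases Nat.eq_zero_or_pos N with h0 | h0
  · exact inr h0
  left
  have key : ∀ n, n < N → ‖∑ k ∈ range (n+1), (w k:ℂ)*z k -
      w n*∑ k ∈ range (n+1), z k‖ ≤ (w 0-w n)*B := by
    intro n
    induction n with
    | zero => intro _; simp
    | succ n ih =>
      intro hn
      have h1 := ih (by omega)
      have h2 := hw n hn
      have e : ∑ k ∈ range (n+1+1), (w k:ℂ)*z k -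
          w (n+1)*∑ k ∈ range (n+1+1), z k =
          (∑ k ∈ range (n+1), (w k:ℂ)*z k-w n*∑ k ∈ range (n+1), z k) +
          ((w n-w (n+1):ℝ):ℂ)*∑ k ∈ range (n+1), z k := by
        rw [sum_range_succ, sum_range_succ _ (n+1)]; push_cast; ring
      rw [e]
      refine (norm_add_le _ _).trans ?_
      rw [norm_mul, norm_real, norm_of_nonneg (by linarith)]
      have h3 := mul_le_mul_of_nonneg_left (hz (n+1) (by omega)) (by linarith : 0 ≤ w n-w (n+1))
      nlinarith
  have h1 := key (N-1) (by omega)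
  rw [Nat.sub_add_cancel h0] at h1
  have h2 := hw0 (N-1) (by omega)
  have h3 : ‖(w (N-1):ℂ)*∑ k ∈ range N, z k‖ ≤ w (N-1)*B := by
    rw [norm_mul, norm_real, norm_of_nonneg h2]
    exact mul_le_mul_of_nonneg_left (hz N le_rfl) h2
  have h4 := norm_add_le (∑ k ∈ range N, (w k:ℂ)*z k -
      w (N-1)*∑ k ∈ range N, z k) (w (N-1)*∑ k ∈ range N, z k)
  rw [sub_add_cancel] at h4
  nlinarith

/-- First differences of a negative power. -/
lemma rpow_neg_diff {θ a : ℝ} (hθ : 0 < θ) (ha : 0 < a) :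
    θ*(a+1)^(-θ-1) ≤ a^(-θ)-(a+1)^(-θ) ∧ a^(-θ)-(a+1)^(-θ) ≤ θ*a^(-θ-1) := by
  obtain ⟨c, hc, he⟩ := exists_hasDerivAt_eq_slope (fun t : ℝ => t^(-θ))
    (fun t => -θ*t^(-θ-1)) (lt_add_one a)
    (fun t ht => (Real.continuousAt_rpow_const t _ (inl (ha.trans_le ht.1).ne')).continuousWithinAt)
    (fun t ht => hasDerivAt_rpow_const (inl (ha.trans ht.1).ne'))
  rw [add_sub_cancel_left, div_one] at he
  have h1 : (a+1)^(-θ-1) ≤ c^(-θ-1) :=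
    rpow_le_rpow_of_nonpos (ha.trans hc.1) hc.2.le (by linarith)
  have h2 : c^(-θ-1) ≤ a^(-θ-1) := rpow_le_rpow_of_nonpos ha hc.1.le (by linarith)
  constructor <;> nlinarith

/-- Second differences of a negative power. -/
lemma rpow_neg_diff_two {θ a : ℝ} (hθ : 0 < θ) (ha : 0 < a) :
    θ*(θ+1)*(a+2)^(-θ-2) ≤ (a+2)^(-θ)-2*(a+1)^(-θ)+a^(-θ) ∧
      (a+2)^(-θ)-2*(a+1)^(-θ)+a^(-θ) ≤ θ*(θ+1)*a^(-θ-2) := by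
  obtain ⟨c, hc, he⟩ := exists_hasDerivAt_eq_slope (fun t : ℝ => (t+1)^(-θ)-t^(-θ))
    (fun t => -θ*(t+1)^(-θ-1) - -θ*t^(-θ-1)) (lt_add_one a)
    (fun t ht => by
      have h0 := ha.trans_le ht.1
      refine ContinuousAt.continuousWithinAt (ContinuousAt.sub ?_ ?_)
      · exact ContinuousAt.rpow_const (by fun_prop) (inl (by positivity))
      · exact Real.continuousAt_rpow_const t _ (inl h0.ne'))
    (fun t ht => by
      have h0 := ha.trans ht.1
      refine HasDerivAt.sub ?_ (hasDerivAt_rpow_const (inl h0.ne'))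
      have := ((hasDerivAt_id t).add_const 1).rpow_const (p := -θ) (inl (by simp; positivity))
      simpa using this)
  rw [add_sub_cancel_left, div_one] at he
  have hc0 := ha.trans hc.1
  obtain ⟨d, hd, hd'⟩ := exists_hasDerivAt_eq_slope (fun t : ℝ => t^(-θ-1))
    (fun t => (-θ-1)*t^(-θ-1-1)) (lt_add_one c)
    (fun t ht => (Real.continuousAt_rpow_const t _ (inl (hc0.trans_le ht.1).ne')).continuousWithinAt)
    (fun t ht => hasDerivAt_rpow_const (inl (hc0.trans ht.1).ne'))
  rw [add_sub_cancel_left, div_one, show -θ-1-1 = -θ-2 by ring] at hd'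
  have h1 : (a+2)^(-θ-2) ≤ d^(-θ-2) :=
    rpow_le_rpow_of_nonpos (hc0.trans hd.1) (by linarith [hd.2, hc.2]) (by linarith)
  have h2 : d^(-θ-2) ≤ a^(-θ-2) :=
    rpow_le_rpow_of_nonpos ha (by linarith [hd.1, hc.1]) (by linarith)
  have e : (a+2)^(-θ)-2*(a+1)^(-θ)+a^(-θ) = θ*(θ+1)*d^(-θ-2) := by
    rw [show a+1+1 = a+2 by ring] at he
    have : θ*(θ+1)*d^(-θ-2) = -θ*((-θ-1)*d^(-θ-2)) := by ring
    rw [this, hd']; linarith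
  have h3 : 0 < θ*(θ+1) := by positivity
  rw [e]
  constructor <;> nlinarith

/-- Exponential sums with phase a negative power. -/
lemma norm_sum_rpow_phase_le {θ : ℝ} (hθ1 : 3/10 ≤ θ) (hθ2 : θ ≤ 3/8) {A N : ℕ} (hA : 1 ≤ A)
    (hN : N ≤ A) {y τ : ℝ} (hτ : 0 < τ) (hy1 : τ ≤ y*(A:ℝ)^(-θ)) (hy2 : y*(A:ℝ)^(-θ) ≤ 2*τ)
    (c:ℝ) :
    ‖∑ n ∈ range N, ee (y*((A:ℝ)+1+n)^(-θ)+c)‖ ≤ 400*√τ+400*A/(1+τ) := by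
  have hA0 : (0:ℝ) < A := mod_cast hA
  have hy : 0 < y := by
    by_contra h
    push Not at h
    have := rpow_pos_of_pos hA0 (-θ)
    nlinarith
  have p3 : ((3:ℝ)*A)^(-θ-2) ≥ 1/27*A^(-θ-2) := by
    rw [mul_rpow (by norm_num) hA0.le]
    gcongr
    have : (3:ℝ)^(-3:ℝ) ≤ 3^(-θ-2) := rpow_le_rpow_of_exponent_le (by norm_num) (by linarith)
    refine le_trans (le_of_eq ?_) this
    norm_num
  have p2 : ((3:ℝ)*A)^(-θ-1) ≥ 1/9*A^(-θ-1) := by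
    rw [mul_rpow (by norm_num) hA0.le]
    gcongr
    have : (3:ℝ)^(-2:ℝ) ≤ 3^(-θ-1) := rpow_le_rpow_of_exponent_le (by norm_num) (by linarith)
    refine le_trans (le_of_eq ?_) this
    norm_num
  have a1 : (A:ℝ)^(-θ-1) = A^(-θ)/A := by rw [Real.rpow_sub_one hA0.ne']
  have a2 : (A:ℝ)^(-θ-2) = A^(-θ)/A^2 := by
    rw [show -θ-2 = -θ-(2:ℕ) by norm_num, Real.rpow_sub_natCast hA0.ne']
  set S := (A:ℝ)^(-θ) with hS
  have hS0 : 0 < S := by positivity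
  set f : ℕ → ℝ := fun n => y*((A:ℝ)+1+n)^(-θ)+c with hf
  have hn0 : ∀ n : ℕ, (0:ℝ) ≤ n := fun n => n.cast_nonneg
  have d1 : ∀ n : ℕ, n < N → τ/(30*A) ≤ f n-f (n+1) ∧ f n-f (n+1) ≤ τ/A := by
    intro n hn
    have hnN : (n:ℝ)+1 ≤ A := mod_cast (by omega : n+1 ≤ A)
    have h := rpow_neg_diff (θ := θ) (a := (A:ℝ)+1+n) (by linarith) (by positivity)
    have e : f n-f (n+1) = y*(((A:ℝ)+1+n)^(-θ)-((A:ℝ)+1+n+1)^(-θ)) := by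
      simp only [hf]; push_cast; ring_nf
    rw [e]
    have h1 : ((3:ℝ)*A)^(-θ-1) ≤ ((A:ℝ)+1+n+1)^(-θ-1) :=
      rpow_le_rpow_of_nonpos (by positivity) (by linarith) (by linarith)
    have h2 : ((A:ℝ)+1+n)^(-θ-1) ≤ (A:ℝ)^(-θ-1) :=
      rpow_le_rpow_of_nonpos hA0 (by linarith [hn0 n]) (by linarith)
    rw [a1] at p2 h2
    constructor
    · calc τ/(30*A) ≤ (y*S)/(30*A) := by gcongr
        _ = y*(3/10*(1/9*(S/A))) := by field_simp; norm_num
        _ ≤ y*(θ*(1/9*(S/A))) := by gcongr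
        _ ≤ y*(θ*((A:ℝ)+1+n+1)^(-θ-1)) := by gcongr; exact p2.le.trans h1
        _ ≤ _ := by gcongr; exact h.1
    · calc _ ≤ y*(θ*((A:ℝ)+1+n)^(-θ-1)) := by gcongr; exact h.2
        _ ≤ y*(3/8*(S/A)) := by gcongr
        _ = 3/8*(y*S)/A := by ring
        _ ≤ 3/8*(2*τ)/A := by gcongr
        _ ≤ _ := by gcongr; linarith
  have d2 : ∀ n : ℕ, n+2 ≤ N → τ/(100*A^2) ≤ f (n+2)-2*f (n+1)+f n ∧
      f (n+2)-2*f (n+1)+f n ≤ 110*(τ/(100*A^2)) := by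
    intro n hn
    have hnN : (n:ℝ)+2 ≤ A := mod_cast (by omega : n+2 ≤ A)
    have h := rpow_neg_diff_two (θ := θ) (a := (A:ℝ)+1+n) (by linarith) (by positivity)
    have e : f (n+2)-2*f (n+1)+f n = y*(((A:ℝ)+1+n+2)^(-θ) -
        2*((A:ℝ)+1+n+1)^(-θ)+((A:ℝ)+1+n)^(-θ)) := by
      simp only [hf]; push_cast; ring_nf
    rw [e]
    have h1 : ((3:ℝ)*A)^(-θ-2) ≤ ((A:ℝ)+1+n+2)^(-θ-2) :=
      rpow_le_rpow_of_nonpos (by positivity) (by linarith) (by linarith)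
    have h2 : ((A:ℝ)+1+n)^(-θ-2) ≤ (A:ℝ)^(-θ-2) :=
      rpow_le_rpow_of_nonpos hA0 (by linarith [hn0 n]) (by linarith)
    rw [a2] at p3 h2
    have t1 : 39/100 ≤ θ*(θ+1) := by nlinarith
    have t2 : θ*(θ+1) ≤ 33/64 := by nlinarith
    constructor
    · calc τ/(100*A^2) ≤ (y*S)/(100*A^2) := by gcongr
        _ = y*(27/100*(1/27*(S/A^2))) := by field_simp
        _ ≤ y*(θ*(θ+1)*(1/27*(S/A^2))) := by gcongr; linarith
        _ ≤ y*(θ*(θ+1)*((A:ℝ)+1+n+2)^(-θ-2)) := by gcongr; exact p3.le.trans h1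
        _ ≤ _ := by gcongr; exact h.1
    · calc _ ≤ y*(θ*(θ+1)*((A:ℝ)+1+n)^(-θ-2)) := by gcongr; exact h.2
        _ ≤ y*(33/64*(S/A^2)) := by gcongr
        _ = 33/64*(y*S)/A^2 := by ring
        _ ≤ 33/64*(2*τ)/A^2 := by gcongr
        _ = 33/32*(τ/A^2) := by ring
        _ ≤ 11/10*(τ/A^2) := mul_le_mul_of_nonneg_right (by norm_num) (by positivity)
        _ = _ := by field_simp; norm_num
  have triv : ‖∑ n ∈ range N, ee (f n)‖ ≤ A := by
    refine (norm_sum_le _ _).trans ?_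
    simp only [norm_ee, sum_const, card_range, nsmul_eq_mul, mul_one]
    exact_mod_cast hN
  have hsτ : 0 < √τ := sqrt_pos.2 hτ
  have hss : √τ*√τ = τ := mul_self_sqrt hτ.le
  rcases le_total τ (A/2) with hcase | hcase
  · have : ‖∑ n ∈ range N, ee (f n)‖ ≤ 400*A/(1+τ) := by
      rw [le_div_iff₀ (by positivity)]
      rcases le_total τ 1 with h1 | h1
      · nlinarith
      · have kl := kuzmin_landau f N (δ := τ/(30*A)) (by positivity) (-1) (fun n hn => by
            have := (d2 n (by omega)).1
            have : 0 < τ/(100*(A:ℝ)^2) := by positivity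
            linarith)
          (fun n hn => by
            have := (d1 n hn).2
            have h2 : τ/(A:ℝ) ≤ 1/2 := by rw [div_le_iff₀ hA0]; linarith
            have h3 : τ/(30*(A:ℝ)) ≤ 1/2 := by rw [div_le_iff₀ (by positivity)]; linarith
            push_cast; linarith)
          (fun n hn => by
            have := (d1 n hn).1
            push_cast; linarith)
        have e : 2/(τ/(30*(A:ℝ))) = 60*A/τ := by field_simp; norm_num
        rw [e] at kl
        calc _ ≤ 60*A/τ*(1+τ) := by gcongr
          _ ≤ 60*A/τ*(2*τ) := by gcongr; linarith
          _ = 120*A := by field_simp; norm_num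
          _ ≤ _ := by linarith
    linarith
  · have vc := van_der_corput f N (lam := τ/(100*A^2)) (c := 110) (by positivity) (by norm_num)
      (fun n hn => (d2 n hn).1) (fun n hn => (d2 n hn).2)
    have e1 : √(τ/(100*(A:ℝ)^2)) = √τ/(10*A) := by
      rw [sqrt_div hτ.le, show 100*(A:ℝ)^2 = (10*A)^2 by ring, sqrt_sq (by positivity)]
    rw [e1] at vc
    have : ‖∑ n ∈ range N, ee (f n)‖ ≤ 400*√τ := by
      refine vc.trans ?_
      rw [div_le_iff₀ (by positivity)]
      have e2 : 400*√τ*(√τ/(10*A)) = 40*τ/A := by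
        rw [show 400*√τ*(√τ/(10*A)) = 40*(√τ*√τ)/A by field_simp; norm_num, hss]
      rw [e2]
      have : 110*(N:ℝ)*(τ/(100*A^2)) ≤ 11/10*(τ/A) := by
        calc 110*(N:ℝ)*(τ/(100*A^2)) ≤ 110*A*(τ/(100*A^2)) := by gcongr
          _ = _ := by field_simp; norm_num
      have h1 : 1 ≤ 2*(τ/A) := by rw [← mul_div_assoc, le_div_iff₀ hA0]; linarith
      rw [mul_div_assoc]
      linarith
    have : 0 ≤ 400*(A:ℝ)/(1+τ) := by positivity
    linarith

lemma phaseBound_rpow {θ : ℝ} (hθ1 : 3/10 ≤ θ) (hθ2 : θ ≤ 3/8) {Cc : ℝ} (hC : 0 < Cc) {A N : ℕ}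
    (hA : 1 ≤ A) (hN : N ≤ A) {S d : ℝ} (hS : S = Cc*(A:ℝ)^(-θ)) (hS4 : 4 ≤ S)
    (hd : |d| ≤ 1/2) :
    PhaseBound (Measure.count : Measure (Fin N))
      (fun n => Cc*((A:ℝ)+1+(n:ℕ))^(-θ)+d) (5/8*S) 0 1600 (1600*A) := by
  have hA0 : (0:ℝ) < A := mod_cast hA
  obtain ⟨hd1, hd2⟩ := abs_le.1 hd
  have low : ∀ n, n < N → 3/4*S ≤ Cc*((A:ℝ)+1+(n:ℕ))^(-θ) := fun n hn => by
    have h1 : (A:ℝ)+1+n ≤ 2*A := by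
      have : ((n+1:ℕ):ℝ) ≤ A := mod_cast (by omega)
      push_cast at this; linarith
    have h2 : (2*(A:ℝ))^(-θ) ≤ ((A:ℝ)+1+n)^(-θ) :=
      rpow_le_rpow_of_nonpos (by positivity) h1 (by linarith)
    rw [mul_rpow (by norm_num) hA0.le] at h2
    have h3 : (3:ℝ)/4 ≤ (2:ℝ)^(-θ) := by
      have h4 : (2:ℝ)^(-(3:ℝ)/8) ≤ (2:ℝ)^(-θ) :=
        rpow_le_rpow_of_exponent_le (by norm_num) (by linarith)
      refine le_trans ?_ h4
      have h5 : (0:ℝ) ≤ (2:ℝ)^(-(3:ℝ)/8) := by positivity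
      by_contra! hlt
      have h6 : ((2:ℝ)^(-(3:ℝ)/8))^8 < (3/4)^8 := pow_lt_pow_left₀ hlt h5 (by norm_num)
      rw [← rpow_natCast, ← rpow_mul (by norm_num)] at h6
      norm_num at h6
    rw [hS]; nlinarith
  have high : ∀ n : ℕ, Cc*((A:ℝ)+1+(n:ℕ))^(-θ) ≤ S := fun n => by
    rw [hS]
    refine mul_le_mul_of_nonneg_left (rpow_le_rpow_of_nonpos hA0 ?_ (by linarith)) hC.le
    linarith
  refine ⟨measurable_of_finite _, by linarith, le_rfl, by norm_num, by positivity,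
    fun n => by have := low n n.2; linarith, fun n => by have := high n; linarith, ?_⟩
  intro j hj y hy
  rw [integral_count, Fin.sum_univ_eq_sum_range
    (fun n => (((Cc*((A:ℝ)+1+n)^(-θ)+d)^j:ℝ):ℂ) *
      ee (y*(Cc*((A:ℝ)+1+n)^(-θ)+d))) N]
  set τ := y*(5/8*S) with hτ
  have hτ0 : 0 < τ := by positivity
  have hB : (0:ℝ) ≤ 400*√τ+400*A/(1+τ) := by positivity
  have w0 : ∀ n : ℕ, n < N → (Cc*((A:ℝ)+1+n)^(-θ)+d)^j ≤ 4*(5/8*S)^j := fun n h0 => by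
    have h1 := low n h0
    have h2 := high n
    have h3 : (Cc*((A:ℝ)+1+n)^(-θ)+d)^j ≤ (2*(5/8*S))^j :=
      pow_le_pow_left₀ (by linarith) (by linarith) j
    refine h3.trans ?_
    rw [mul_pow]
    refine mul_le_mul_of_nonneg_right ?_ (by positivity)
    calc (2:ℝ)^j ≤ 2^2 := pow_le_pow_right₀ (by norm_num) hj
      _ = 4 := by norm_num
  rcases Nat.eq_zero_or_pos N with h0 | h0
  · subst h0
    simp only [range_zero, sum_empty, norm_zero]
    positivity
  rcases norm_sum_mul_le_of_antitone (w := fun n => (Cc*((A:ℝ)+1+n)^(-θ)+d)^j)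
    (z := fun n => ee (y*(Cc*((A:ℝ)+1+n)^(-θ)+d)))
    (B := 400*√τ+400*A/(1+τ)) N
    (fun n hn => by
      have h1 := low (n+1) hn
      refine pow_le_pow_left₀ (by linarith) ?_ j
      have : ((A:ℝ)+1+(n+1:ℕ))^(-θ) ≤ ((A:ℝ)+1+n)^(-θ) :=
        rpow_le_rpow_of_nonpos (by positivity) (by push_cast; linarith) (by linarith)
      nlinarith)
    (fun n hn => by have h1 := low n hn; exact pow_nonneg (by linarith) j)
    (fun n hn => by
      have := norm_sum_rpow_phase_le hθ1 hθ2 hA (hn.trans hN) (y := y*Cc) hτ0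
        (by rw [mul_assoc, ← hS, hτ]; nlinarith) (by rw [mul_assoc, ← hS, hτ]; nlinarith) (y*d)
      refine le_trans (le_of_eq ?_) this
      congr 1
      refine sum_congr rfl fun k _ => ?_
      congr 1; ring) hB with h | h
  · refine h.trans ?_
    calc _ ≤ 4*(5/8*S)^j*(400*√τ+400*A/(1+τ)) := mul_le_mul_of_nonneg_right (w0 0 h0) hB
      _ = _ := by ring
  · omega

/-- Square-root cancellation in `∑ latE (V / n ^ 3) ^ (1 / q)` over a dyadic block. -/
lemma exists_sum_latE_le : ∃ C : ℝ, 0 < C ∧ ∀ {θ : ℝ}, 3/10 ≤ θ → θ ≤ 3/8 → ∀ {Cc : ℝ}, 0 < Cc →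
    ∀ {A N : ℕ}, 1 ≤ A → N ≤ A →
    |∑ n ∈ range N, latE ((Cc*((A:ℝ)+1+n)^(-θ))^2)| ≤
      C*(Cc*(A:ℝ)^(-θ)*√A+A/√(Cc*(A:ℝ)^(-θ))) := by
  obtain ⟨C1, hC1, H1⟩ := exists_latE_le_of_le 16
  obtain ⟨C2, hC2, H2⟩ := exists_latE_bound
  refine ⟨2*C1+10000*C2, by positivity, ?_⟩
  intro θ hθ1 hθ2 Cc hC A N hA hN
  have hA0 : (0:ℝ) < A := mod_cast hA
  have hA1 : (1:ℝ) ≤ A := mod_cast hA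
  have hNA : (N:ℝ) ≤ A := mod_cast hN
  obtain ⟨S, hS⟩ : ∃ S, S = Cc*(A:ℝ)^(-θ) := ⟨_, rfl⟩
  rw [← hS]
  have hS0 : 0 < S := by rw [hS]; positivity
  have hsS := sqrt_pos.2 hS0
  have hsA1 : 1 ≤ √(A:ℝ) := one_le_sqrt.2 hA1
  have hss : √(A:ℝ)*√(A:ℝ) = A := mul_self_sqrt hA0.le
  rcases le_total S 4 with h4 | h4
  · have hle : ∀ n ∈ range N, |latE ((Cc*((A:ℝ)+1+n)^(-θ))^2)| ≤ C1 := fun n hn => by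
      refine H1 _ (by positivity) ?_
      have h1 : ((A:ℝ)+1+n)^(-θ) ≤ (A:ℝ)^(-θ) := by
        refine rpow_le_rpow_of_nonpos hA0 ?_ (by linarith)
        linarith
      have h2 : Cc*((A:ℝ)+1+n)^(-θ) ≤ 4 :=
        ((mul_le_mul_of_nonneg_left h1 hC.le).trans hS.ge).trans h4
      have h3 := pow_le_pow_left₀ (by positivity) h2 2
      linarith
    have h5 : √S ≤ 2 := by rw [Real.sqrt_le_left (by norm_num)]; linarith
    have h6 : (A:ℝ) ≤ 2*(A/√S) := by rw [← mul_div_assoc, le_div_iff₀ hsS]; nlinarith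
    calc _ ≤ ∑ n ∈ range N, |latE ((Cc*((A:ℝ)+1+n)^(-θ))^2)| := abs_sum_le_sum_abs _ _
      _ ≤ N*C1 := by
          refine (sum_le_card_nsmul _ _ _ hle).trans ?_
          simp
      _ ≤ (2*(A/√S))*C1 := by gcongr; linarith
      _ = (2*C1)*(A/√S) := by ring
      _ ≤ _ := by
          apply mul_le_mul <;> first | positivity | skip
          · linarith
          · have : 0 ≤ S*√(A:ℝ) := by positivity
            linarith
  · set K := ⌈4*√(A:ℝ)⌉₊ with hK
    have hK1 : 4*√(A:ℝ) ≤ K := le_ceil _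
    have hK2 : (K:ℝ) ≤ 5*√(A:ℝ) := by
      have := (Nat.ceil_lt_add_one (show 0 ≤ 4*√(A:ℝ) by positivity)).le
      rw [← hK] at this; linarith
    have hK4 : (4:ℝ) ≤ K := by linarith
    have hK0 : (0:ℝ) < K := by linarith
    have hh : 2*(1/(K:ℝ)) ≤ 1/2 := by rw [mul_one_div, div_le_iff₀ hK0]; linarith
    have sq : ∀ n : Fin N, √((Cc*((A:ℝ)+1+(n:ℕ))^(-θ))^2) = Cc*((A:ℝ)+1+(n:ℕ))^(-θ) :=
      fun n => sqrt_sq (by positivity)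
    have main := H2 (Measure.count : Measure (Fin N)) (fun n => (Cc*((A:ℝ)+1+(n:ℕ))^(-θ))^2)
      (5/8*S) 0 1600 (1600*A) K (fun n => by positivity)
      (by
        simp only [sq]
        exact phaseBound_rpow hθ1 hθ2 hC hA hN hS h4 (by rw [abs_of_pos (by positivity)]; exact hh))
      (by
        simp only [sq, sub_eq_add_neg]
        exact phaseBound_rpow hθ1 hθ2 hC hA hN hS h4
          (by rw [abs_neg, abs_of_pos (by positivity)]; exact hh))
      (by linarith) (mod_cast hK4)
    rw [integral_count, Fin.sum_univ_eq_sum_range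
      (fun n => latE ((Cc*((A:ℝ)+1+n)^(-θ))^2)) N] at main
    refine main.trans ?_
    have hu : (Measure.count : Measure (Fin N)).real Set.univ = N := by
      simp [Measure.real, Measure.count_univ]
    rw [hu]
    have e1 : N*(5/8*S)/(K:ℝ) ≤ S*√(A:ℝ) := by
      rw [div_le_iff₀ hK0]
      calc N*(5/8*S) ≤ A*S := by nlinarith
        _ = S*√(A:ℝ)*√(A:ℝ) := by rw [mul_assoc, hss]; ring
        _ ≤ _ := by gcongr; linarith
    have e2 : 1600*(5/8*S)*(K:ℝ) ≤ 5000*(S*√(A:ℝ)) := by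
      calc 1600*(5/8*S)*(K:ℝ) ≤ 1600*(5/8*S)*(5*√(A:ℝ)) := by gcongr
        _ = _ := by ring
    have e3 : 1600*A/√(5/8*S) ≤ 3200*(A/√S) := by
      have : √S/2 ≤ √(5/8*S) := by
        apply le_sqrt_of_sq_le
        rw [div_pow, sq_sqrt hS0.le]; linarith
      calc 1600*A/√(5/8*S) ≤ 1600*A/(√S/2) := by gcongr
        _ = _ := by field_simp; norm_num
    have p1 : 0 ≤ S*√(A:ℝ) := by positivity
    have p2 : 0 ≤ A/√S := by positivity
    calc _ ≤ C2*(S*√(A:ℝ)+0+5000*(S*√(A:ℝ))+3200*(A/√S)) := by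
          have : (0:ℝ)*√(5/8*S)*√(K:ℝ) = 0 := by ring
          rw [this]; gcongr
      _ ≤ C2*(10000*(S*√(A:ℝ)+A/√S)) := by gcongr; linarith
      _ ≤ _ := by
          rw [← mul_assoc]
          refine mul_le_mul_of_nonneg_right ?_ (by positivity)
          linarith

/-- The remainder of the summatory function of `c` with respect to `κ t`. -/
def sumRem (c : ℕ → ℝ) (κ t:ℝ) : ℝ := ∑ k ∈ Icc 0 ⌊t⌋₊, c k-κ*t

lemma intervalIntegrable_sum_floor (c : ℕ → ℝ) (a b:ℝ) :
    IntervalIntegrable (fun t : ℝ => ∑ k ∈ Icc 0 ⌊t⌋₊, c k) volume a b := by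
  have : (fun t : ℝ => ∑ k ∈ Icc 0 ⌊t⌋₊, c k) = fun t =>
      (∑ k ∈ Icc 0 ⌊t⌋₊, max (c k) 0)-∑ k ∈ Icc 0 ⌊t⌋₊, max (-c k) 0 := by
    funext t
    rw [← sum_sub_distrib]
    exact sum_congr rfl fun k _ => by
      rcases le_total (c k) 0 with h | h
      · rw [max_eq_right h, max_eq_left (by linarith)]; ring
      · rw [max_eq_left h, max_eq_right (by linarith)]; ring
  rw [this]
  have mono : ∀ f : ℕ → ℝ, (∀ k, 0 ≤ f k) → Monotone fun t : ℝ => ∑ k ∈ Icc 0 ⌊t⌋₊, f k :=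
    fun f hf s t hst => sum_le_sum_of_subset_of_nonneg
      (Icc_subset_Icc_right (Nat.floor_mono hst)) fun k _ _ => hf k
  exact (mono _ fun k => le_max_right _ _).intervalIntegrable.sub
    (mono _ fun k => le_max_right _ _).intervalIntegrable

lemma intervalIntegrable_sumRem (c : ℕ → ℝ) (κ a b:ℝ) :
    IntervalIntegrable (sumRem c κ) volume a b :=
  (intervalIntegrable_sum_floor c a b).sub (Continuous.intervalIntegrable (by fun_prop) _ _)

lemma sumRem_right_cont (c : ℕ → ℝ) (κ:ℝ) {x : ℝ} (hx : 0 ≤ x) :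
    ContinuousWithinAt (sumRem c κ) (Ioi x) x := by
  have h1 : ContinuousWithinAt (fun t : ℝ => ∑ k ∈ Icc 0 ⌊x⌋₊, c k-κ*t) (Ioi x) x := by fun_prop
  refine h1.congr_of_eventuallyEq ?_ rfl
  have : Set.Iio ((⌊x⌋₊:ℝ)+1) ∈ nhdsWithin x (Ioi x) :=
    mem_nhdsWithin_of_mem_nhds (Iio_mem_nhds (lt_floor_add_one x))
  filter_upwards [this, self_mem_nhdsWithin] with t ht1 ht2
  have : ⌊t⌋₊ = ⌊x⌋₊ := by
    rw [Nat.floor_eq_iff (hx.trans ht2.le)]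
    exact ⟨(floor_le hx).trans ht2.le, ht1⟩
  simp only [sumRem, this]

lemma exists_integral_rpow_mul_sumRem (c : ℕ → ℝ) (κ:ℝ) {C η s : ℝ} (hs : 0 < s) (hη : η < s+1)
    (hC : 0 ≤ C) (hF : ∀ x, 1 ≤ x → |∫ t in (1:ℝ)..x, sumRem c κ t| ≤ C*x^η) :
    ∃ J K : ℝ, 0 < K ∧ ∀ x, 1 ≤ x →
      |(∫ t in (1:ℝ)..x, t^(-s-1)*sumRem c κ t)-J| ≤ K*x^(η-s-1) := by
  set F : ℝ → ℝ := fun x => ∫ t in (1:ℝ)..x, sumRem c κ t with hFd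
  have hFc : Continuous F := intervalIntegral.continuous_primitive (intervalIntegrable_sumRem c κ) 1
  set g : ℝ → ℝ := fun t => t^(-s-2)*F t with hg
  have gb : ∀ t, 1 ≤ t → |g t| ≤ C*t^(η-s-2) := fun t ht => by
    have t0 : 0 < t := by linarith
    rw [hg, abs_mul, abs_of_nonneg (by positivity)]
    calc _ ≤ t^(-s-2)*(C*t^η) := by gcongr; exact hF t ht
      _ = _ := by rw [show η-s-2 = (-s-2)+η by ring, rpow_add t0]; ring
  have gc : ContinuousOn g (Set.Ici 1) := by
    refine ContinuousOn.mul (rpow_const continuousOn_id fun t ht => inl ?_)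
      hFc.continuousOn
    have : (1:ℝ) ≤ t := ht
    simp; linarith
  have dom : IntegrableOn (fun t : ℝ => C*t^(η-s-2)) (Ioi 1) :=
    (integrableOn_Ioi_rpow_of_lt (by linarith) one_pos).const_mul C
  have gi : IntegrableOn g (Ioi 1) := by
    refine Integrable.mono' dom
      ((gc.mono Set.Ioi_subset_Ici_self).aestronglyMeasurable measurableSet_Ioi) ?_
    filter_upwards [self_mem_ae_restrict measurableSet_Ioi] with t ht
    exact gb t (le_of_lt ht)
  refine ⟨(s+1)*∫ t in Ioi (1:ℝ), g t, C+(s+1)*(C/(s+1-η))+1, ?_, ?_⟩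
  · have : 0 ≤ C/(s+1-η) := div_nonneg hC (by linarith)
    positivity
  intro x hx
  have x0 : 0 < x := by linarith
  have pos : ∀ t ∈ uIcc 1 x, 0 < t := fun t ht => by rw [uIcc_of_le hx] at ht; linarith [ht.1]
  have IBP := intervalIntegral.integral_mul_deriv_eq_deriv_mul_of_hasDeriv_right
    (u := fun t : ℝ => t^(-s-1)) (v := F) (u' := fun t => (-s-1)*t^(-s-1-1))
    (v' := sumRem c κ) (a := 1) (b := x)
    (rpow_const continuousOn_id fun t ht => inl (pos t ht).ne')
    hFc.continuousOn
    (fun t ht => by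
      rw [min_eq_left hx] at ht
      exact (hasDerivAt_rpow_const (inl (by linarith [ht.1]))).hasDerivWithinAt)
    (fun t ht => by
      rw [min_eq_left hx] at ht
      refine HasDerivWithinAt.mono (intervalIntegral.integral_hasDerivWithinAt_right
        (s := Set.Ici t) (t := Ioi t) (intervalIntegrable_sumRem c κ 1 t) ?_
        (sumRem_right_cont c κ (by linarith [ht.1]))) Set.Ioi_subset_Ici_self
      refine ⟨Set.Ioc t (t+1), Ioc_mem_nhdsGT (by linarith), ?_⟩
      exact (intervalIntegrable_iff_integrableOn_Ioc_of_le (by linarith)).1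
        (intervalIntegrable_sumRem c κ t (t+1)) |>.aestronglyMeasurable)
    (intervalIntegrable (by
      exact continuousOn_const.mul (rpow_const continuousOn_id fun t ht => inl (pos t ht).ne')))
    (intervalIntegrable_sumRem c κ 1 x)
  have e1 : (∫ t in (1:ℝ)..x, (-s-1)*t^(-s-1-1)*F t) = -(s+1)*∫ t in (1:ℝ)..x, g t := by
    rw [← intervalIntegral.integral_const_mul]
    refine integral_congr fun t _ => ?_
    simp only [hg]
    rw [show -s-1-1 = -s-2 by ring]; ring
  have F1 : F 1 = 0 := by simp [hFd]
  have split := intervalIntegral.integral_Ioi_sub_Ioi gi hx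
  rw [IBP, e1, F1, ← split]
  have tail : |∫ t in Ioi x, g t| ≤ C/(s+1-η)*x^(η-s-1) := by
    have := norm_integral_le_of_norm_le (μ := volume.restrict (Ioi x)) (f := g)
      (dom.mono_set (Set.Ioi_subset_Ioi hx)) (by
        filter_upwards [self_mem_ae_restrict measurableSet_Ioi] with t ht
        exact gb t (hx.trans (le_of_lt ht)))
    refine this.trans (le_of_eq ?_)
    rw [integral_const_mul, integral_Ioi_rpow_of_lt (by linarith) x0,
      show η-s-2+1 = η-s-1 by ring]
    have : s+1-η ≠ 0 := by linarith
    have : η-s-1 ≠ 0 := by linarith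
    field_simp
    ring
  have bd : |x^(-s-1)*F x| ≤ C*x^(η-s-1) := by
    rw [abs_mul, abs_of_nonneg (by positivity)]
    calc _ ≤ x^(-s-1)*(C*x^η) := by gcongr; exact hF x hx
      _ = _ := by rw [show η-s-1 = (-s-1)+η by ring, rpow_add x0]; ring
  have eq : x^(-s-1)*F x-1^(-s-1)*0 - -(s+1)*((∫ t in Ioi (1:ℝ), g t) - ∫ t in Ioi x, g t) -
      (s+1)*(∫ t in Ioi (1:ℝ), g t) =
      x^(-s-1)*F x-(s+1)*∫ t in Ioi x, g t := by ring
  rw [eq]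
  refine (abs_sub _ _).trans ?_
  rw [abs_mul (s+1), abs_of_pos (by linarith : 0 < s+1)]
  have : 0 < x^(η-s-1) := by positivity
  have t2 := mul_le_mul_of_nonneg_left tail (by linarith : 0 ≤ s+1)
  linarith

/-- Asymptotics of `∑ c k k⁻ˢ` from the average of the remainder of `∑ c k`. -/
lemma exists_sum_rpow_asymp (c : ℕ → ℝ) (κ:ℝ) {C η s : ℝ} (hs : 0 < s) (hs1 : s ≠ 1)
    (hη : η < s+1) (hC : 0 ≤ C)
    (hF : ∀ x, 1 ≤ x → |∫ t in (1:ℝ)..x, sumRem c κ t| ≤ C*x^η) :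
    ∃ J K : ℝ, 0 < K ∧ ∀ x, 1 ≤ x → |∑ k ∈ Icc 1 ⌊x⌋₊, c k*(k:ℝ)^(-s) -
      (J+κ*x^(1-s)/(1-s)+sumRem c κ x*x^(-s))| ≤ K*x^(η-s-1) := by
  obtain ⟨J, K, hK, H⟩ := exists_integral_rpow_mul_sumRem c κ hs hη hC hF
  have hs1' : 1-s ≠ 0 := fun h => hs1 (by linarith)
  refine ⟨c 1-(c 0+c 1)-s*κ/(1-s)+s*J, s*K, by positivity, fun x hx => ?_⟩
  have x0 : 0 < x := by linarith
  have pos : ∀ t ∈ Set.Icc 1 x, 0 < t := fun t ht => by linarith [ht.1]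
  have A := sum_mul_eq_sub_sub_integral_mul (f := fun t : ℝ => t^(-s)) c zero_le_one hx
    (fun t ht => (hasDerivAt_rpow_const (inl (pos t ht).ne')).differentiableAt)
    (by
      refine IntegrableOn.congr_fun (f := fun t : ℝ => -s*t^(-s-1)) ?_
        (fun t ht => (hasDerivAt_rpow_const (inl (pos t ht).ne')).deriv.symm) measurableSet_Icc
      refine ContinuousOn.integrableOn_Icc ?_
      exact continuousOn_const.mul (rpow_const continuousOn_id fun t ht => inl (pos t ht).ne'))
  rw [← integral_of_le hx] at A
  have e1 : ∑ k ∈ Icc 1 ⌊x⌋₊, c k*(k:ℝ)^(-s) = c 1+∑ k ∈ Ioc ⌊(1:ℝ)⌋₊ ⌊x⌋₊, (k:ℝ)^(-s)*c k := by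
    have h1 : 1 ≤ ⌊x⌋₊ := (Nat.one_le_floor_iff _).mpr hx
    rw [Icc_eq_cons_Ioc h1, sum_cons, Nat.floor_one]
    simp only [cast_one, one_rpow, mul_one]
    congr 1
    exact sum_congr rfl fun k _ => mul_comm _ _
  have e2 : (∫ t in (1:ℝ)..x, deriv (fun t : ℝ => t^(-s)) t*∑ k ∈ Icc 0 ⌊t⌋₊, c k) =
      -s*(κ*((x^(1-s)-1)/(1-s))) + -s*∫ t in (1:ℝ)..x, t^(-s-1)*sumRem c κ t := by
    have i1 : IntervalIntegrable (fun t : ℝ => t^(-s-1)*sumRem c κ t) volume 1 x :=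
      (intervalIntegrable_sumRem c κ 1 x).continuousOn_mul
        (rpow_const continuousOn_id fun t ht => inl (by
          rw [uIcc_of_le hx] at ht; exact (pos t ht).ne'))
    have i2 : IntervalIntegrable (fun t : ℝ => t^(-s)) volume 1 x :=
      intervalIntegrable (rpow_const continuousOn_id fun t ht => inl (by
          rw [uIcc_of_le hx] at ht; exact (pos t ht).ne'))
    have i3 : ∫ t in (1:ℝ)..x, t^(-s) = (x^(1-s)-1)/(1-s) := by
      rw [integral_rpow (inr ⟨fun h => hs1 (by linarith), fun h => by
        rw [uIcc_of_le hx] at h; linarith [h.1]⟩)]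
      rw [show -s+1 = 1-s by ring, one_rpow]
    rw [← i3, ← intervalIntegral.integral_const_mul, ← intervalIntegral.integral_const_mul,
      ← intervalIntegral.integral_const_mul, ← intervalIntegral.integral_add
      ((i2.const_mul κ).const_mul _) (i1.const_mul _)]
    refine integral_congr fun t ht => ?_
    rw [uIcc_of_le hx] at ht
    have t0 := pos t ht
    rw [(hasDerivAt_rpow_const (inl t0.ne')).deriv]
    have : t^(-s) = t^(-s-1)*t := by rw [Real.rpow_sub_one t0.ne']; field_simp
    rw [this, sumRem]; ring
  have e3 : x^(1-s) = x^(-s)*x := by rw [show (1-s) = -s+1 by ring, rpow_add_one x0.ne']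
  have e4 : ∑ k ∈ Icc 0 ⌊(1:ℝ)⌋₊, c k = c 0+c 1 := by rw [Nat.floor_one]; simp [sum_Icc_succ_top]
  rw [e1, A, e2, e4]
  have := H x hx
  have key : c 1+(x^(-s)*∑ k ∈ Icc 0 ⌊x⌋₊, c k-1^(-s)*(c 0+c 1) -
      (-s*(κ*((x^(1-s)-1)/(1-s))) + -s*∫ t in (1:ℝ)..x, t^(-s-1)*sumRem c κ t)) -
      (c 1-(c 0+c 1)-s*κ/(1-s)+s*J+κ*x^(1-s)/(1-s)+sumRem c κ x*x^(-s)) =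
      s*((∫ t in (1:ℝ)..x, t^(-s-1)*sumRem c κ t)-J) := by
    rw [one_rpow, sumRem]
    have h : s*κ*x^(1-s)/(1-s)+κ*x*x^(-s) = κ*x^(1-s)/(1-s) := by
      rw [e3]; field_simp; ring
    linear_combination h
  rw [key, abs_mul, abs_of_pos hs, mul_assoc]
  exact mul_le_mul_of_nonneg_left this hs.le

/-- One sixth of the density of the Eisenstein lattice. -/
def kap : ℝ := eisDens/6

lemma kap_pos : 0 < kap := by have := eisDens_pos; unfold kap; positivity

/-- One sixth of the number of representations by `x² + xy + y²`. -/
def rr (n:ℕ) : ℝ := (latN n-latN ((n:ℝ)-1))/6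

def Es (x:ℝ) : ℝ := latE x/6

lemma rr_nonneg (n:ℕ) : 0 ≤ rr n := by
  have : (latN ((n:ℝ)-1):ℝ) ≤ latN n := cast_le.2 (latN_mono (by linarith))
  unfold rr; linarith

lemma latN_of_neg {t : ℝ} (ht : t < 0) : latN t = 0 := by
  rw [latN, card_eq_zero, Set.Finite.toFinset_eq_empty, Set.eq_empty_iff_forall_notMem]
  rintro ⟨a, b⟩ h
  simp only [latSet, mem_setOf_eq] at h
  nlinarith [sq_nonneg ((a:ℝ)+b), sq_nonneg (a:ℝ), sq_nonneg (b:ℝ)]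

lemma latN_zero : latN 0 = 1 := by
  rw [latN, card_eq_one]
  refine ⟨(0, 0), ?_⟩
  ext ⟨a, b⟩
  simp only [Set.Finite.mem_toFinset, latSet, mem_setOf_eq, mem_singleton, Prod.mk.injEq]
  constructor
  · intro h
    have ha : (a:ℝ) = 0 := by nlinarith [sq_nonneg ((a:ℝ)+2*b), sq_nonneg (a:ℝ)]
    have hb : (b:ℝ) = 0 := by nlinarith [sq_nonneg (b:ℝ)]
    exact ⟨mod_cast ha, mod_cast hb⟩
  · rintro ⟨rfl, rfl⟩; simp

lemma latN_floor {x : ℝ} (hx : 0 ≤ x) : latN x = latN (⌊x⌋₊:ℝ) := by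
  refine le_antisymm ?_ (latN_mono (floor_le hx))
  unfold latN
  refine card_le_card fun ⟨a, b⟩ h => ?_
  simp only [Set.Finite.mem_toFinset, latSet, mem_setOf_eq] at h ⊢
  have h1 : ((a^2+a*b+b^2:ℤ):ℝ) ≤ x := by push_cast; exact h
  have h2 : a^2+a*b+b^2 ≤ ⌊x⌋ := Int.le_floor.2 h1
  rw [← Int.natCast_floor_eq_floor hx] at h2
  exact_mod_cast h2

lemma sum_rr_floor {x : ℝ} (hx : 0 ≤ x) : ∑ k ∈ Icc 0 ⌊x⌋₊, rr k = latN x/6 := by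
  have : ∀ N : ℕ, ∑ k ∈ Icc 0 N, rr k = latN (N:ℝ)/6 := fun N => by
    induction N with
    | zero => simp [rr, latN_of_neg]
    | succ n ih =>
      rw [sum_Icc_succ_top (by omega), ih, rr]
      push_cast; ring_nf
  rw [this, ← latN_floor hx]

lemma sumRem_rr {x : ℝ} (hx : 0 ≤ x) : sumRem rr kap x = Es x := by
  rw [sumRem, sum_rr_floor hx, Es, latE, kap]; ring

/-- The partial sums of `∑ rr n n⁻ˢ`. -/
def rrSum (s x:ℝ) : ℝ := ∑ n ∈ Icc 1 ⌊x⌋₊, rr n*(n:ℝ)^(-s)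

lemma exists_rrSum_asymp {s : ℝ} (hs : 0 < s) (hs1 : s ≠ 1) : ∃ J K : ℝ, 0 < K ∧ ∀ x, 1 ≤ x →
    |rrSum s x-(J+kap*x^(1-s)/(1-s)+Es x*x^(-s))| ≤ K*x^(-1/4-s) := by
  obtain ⟨C, hC, H⟩ := exists_integral_latE_le
  obtain ⟨J, K, hK, H2⟩ := exists_sum_rpow_asymp rr kap (C := C/6) (η := 3/4) hs hs1 (by linarith)
    (by positivity) (fun x hx => by
      have : ∫ t in (1:ℝ)..x, sumRem rr kap t = (∫ t in (1:ℝ)..x, latE t)/6 := by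
        rw [← intervalIntegral.integral_div]
        refine integral_congr fun t ht => ?_
        rw [uIcc_of_le hx] at ht
        exact sumRem_rr (by linarith [ht.1])
      rw [this, abs_div, abs_of_pos (by norm_num : (0:ℝ) < 6)]
      have := H x hx
      linarith)
  refine ⟨J, K, hK, fun x hx => ?_⟩
  have := H2 x hx
  rw [sumRem_rr (by linarith)] at this
  rwa [show -1/4-s = 3/4-s-1 by ring]

lemma rrSum_zero {x : ℝ} (hx : 0 ≤ x) : rrSum 0 x = kap*x-1/6+Es x := by
  have h := sumRem_rr hx
  rw [sumRem, Icc_eq_cons_Ioc (Nat.zero_le _), sum_cons] at h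
  have e : rr 0 = 1/6 := by simp [rr, latN_zero, latN_of_neg]
  have : rrSum 0 x = ∑ k ∈ Ioc 0 ⌊x⌋₊, rr k := by
    unfold rrSum
    simp only [neg_zero, rpow_zero, mul_one]
    rfl
  rw [this]; linarith

lemma rrSum_of_lt_one {s x : ℝ} (hx : x < 1) : rrSum s x = 0 := by
  rw [rrSum, Nat.floor_eq_zero.2 hx]; simp

lemma exists_Es_le : ∃ C : ℝ, 0 < C ∧ ∀ x, 1 ≤ x → |Es x| ≤ C*x^((1:ℝ)/3) := by
  obtain ⟨C, hC, H⟩ := exists_latE_pointwise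
  refine ⟨C, hC, fun x hx => ?_⟩
  have := H x hx
  rw [Es, abs_div, abs_of_pos (by norm_num : (0:ℝ) < 6)]
  have : 0 ≤ |latE x| := abs_nonneg _
  linarith

lemma exists_rrSum_le {u : ℝ} (hu : u < 1) : ∃ K : ℝ, 0 < K ∧ ∀ x, 0 ≤ x →
    rrSum u x ≤ K*x^(1-u) := by
  obtain ⟨C, hC, H⟩ := exists_Es_le
  have key : ∃ K : ℝ, 0 < K ∧ ∀ x, 1 ≤ x → rrSum u x ≤ K*x^(1-u) := by
    have p13 : ∀ x : ℝ, 1 ≤ x → x^((1:ℝ)/3) ≤ x := fun x hx => by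
      nth_rw 2 [← rpow_one x]
      exact rpow_le_rpow_of_exponent_le hx (by norm_num)
    rcases le_or_gt u 0 with h0 | h0
    · refine ⟨kap+C, by have := kap_pos; positivity, fun x hx => ?_⟩
      have x0 : 0 < x := by linarith
      have h1 : rrSum u x ≤ rrSum 0 x*x^(-u) := by
        rw [rrSum, rrSum, sum_mul]
        refine sum_le_sum fun n hn => ?_
        rw [mem_Icc, le_floor_iff x0.le] at hn
        simp only [neg_zero, rpow_zero, mul_one]
        exact mul_le_mul_of_nonneg_left
          (rpow_le_rpow (by positivity) hn.2 (by linarith)) (rr_nonneg n)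
      refine h1.trans ?_
      rw [rrSum_zero x0.le, show 1-u = 1 + -u by ring, rpow_add x0, rpow_one, ← mul_assoc]
      refine mul_le_mul_of_nonneg_right ?_ (by positivity)
      have := (abs_le.1 (H x hx)).2
      have := p13 x hx
      nlinarith
    · obtain ⟨J, K, hK, H2⟩ := exists_rrSum_asymp h0 hu.ne
      have h1u : 0 < 1-u := by linarith
      refine ⟨|J| + kap/(1-u)+C+K, by have := kap_pos; positivity, fun x hx => ?_⟩
      have x0 : 0 < x := by linarith
      have h2 := (abs_le.1 (H2 x hx)).2
      have h3 : Es x*x^(-u) ≤ C*x^(1-u) := by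
        rw [show 1-u = 1 + -u by ring, rpow_add x0, rpow_one, ← mul_assoc]
        refine mul_le_mul_of_nonneg_right ?_ (by positivity)
        exact (le_abs_self _).trans ((H x hx).trans (mul_le_mul_of_nonneg_left (p13 x hx) hC.le))
      have h4 : x^(-1/4-u) ≤ x^(1-u) := rpow_le_rpow_of_exponent_le hx (by linarith)
      have h5 : 1 ≤ x^(1-u) := one_le_rpow hx h1u.le
      have h6 : J ≤ |J| * x^(1-u) := (le_abs_self J).trans (le_mul_of_one_le_right (abs_nonneg J) h5)
      have h7 : kap*x^(1-u)/(1-u) = kap/(1-u)*x^(1-u) := by ring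
      have h8 := mul_le_mul_of_nonneg_left h4 hK.le
      rw [h7] at h2
      linarith
  obtain ⟨K, hK, H2⟩ := key
  refine ⟨K, hK, fun x hx => ?_⟩
  rcases lt_or_ge x 1 with h1 | h1
  · rw [rrSum_of_lt_one h1]; positivity
  · exact H2 x h1

/-- `∑ n⁻ᵘ` over `n ≤ x`. -/
lemma exists_sum_rpow_neg {u : ℝ} (hu : 0 < u) (hu1 : u ≠ 1) : ∃ J K : ℝ, 0 < K ∧ ∀ x, 1 ≤ x →
    |∑ n ∈ Icc 1 ⌊x⌋₊, (n:ℝ)^(-u)-(J+x^(1-u)/(1-u))| ≤ K*x^(-u) := by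
  have e : ∀ t : ℝ, 0 ≤ t → |sumRem (fun _ => 1) 1 t| ≤ 1 := fun t ht => by
    have h1 := floor_le ht
    have h2 := lt_floor_add_one t
    simp only [sumRem, sum_const, Nat.card_Icc, nsmul_eq_mul, mul_one]
    push_cast
    rw [abs_le]; constructor <;> linarith
  obtain ⟨J, K, hK, H⟩ := exists_sum_rpow_asymp (fun _ => 1) 1 (C := 1) (η := 1) hu hu1 (by linarith)
    (by norm_num) (fun x hx => by
      have := intervalIntegral.norm_integral_le_of_norm_le_const (a := 1) (b := x)
        (f := sumRem (fun _ => 1) 1) (C := 1) fun t ht => by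
          rw [uIoc_of_le hx] at ht
          exact e t (by linarith [ht.1])
      rw [norm_eq_abs, abs_of_nonneg (by linarith : 0 ≤ x-1)] at this
      rw [rpow_one]; linarith)
  refine ⟨J, K+1, by positivity, fun x hx => ?_⟩
  have h := H x hx
  have x0 : 0 < x := by linarith
  simp only [one_mul] at h
  have h2 : |sumRem (fun _ => 1) 1 x*x^(-u)| ≤ x^(-u) := by
    rw [abs_mul, abs_of_pos (by positivity : 0 < x^(-u))]
    exact mul_le_of_le_one_left (by positivity) (e x x0.le)
  rw [show 1-u-1 = -u by ring] at h
  have h3 := abs_le.1 h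
  have h4 := abs_le.1 h2
  rw [abs_le]
  constructor <;> linarith

end

/-- Pairs `(b, c)` of positive integers with `b⁴c⁵ ≤ V`. -/
def pairs (V:ℝ) : Finset (ℕ × ℕ) :=
  (Icc 1 ⌊V⌋₊ ×ˢ Icc 1 ⌊V⌋₊).filter fun p => (p.1:ℝ)^4*(p.2:ℝ)^5 ≤ V

lemma mem_pairs {V : ℝ} {p : ℕ × ℕ} :
    p ∈ pairs V ↔ 1 ≤ p.1 ∧ 1 ≤ p.2 ∧ (p.1:ℝ)^4*(p.2:ℝ)^5 ≤ V := by
  obtain ⟨b, c⟩ := p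
  simp only [pairs, mem_filter, mem_product, mem_Icc]
  constructor
  · rintro ⟨⟨⟨h1, _⟩, h2, _⟩, h⟩; exact ⟨h1, h2, h⟩
  · rintro ⟨h1, h2, h⟩
    have hb : (1:ℝ) ≤ b := mod_cast h1
    have hc : (1:ℝ) ≤ c := mod_cast h2
    have b4 : (b:ℝ) ≤ (b:ℝ)^4 := le_self_pow₀ hb (by norm_num)
    have c5 : (c:ℝ) ≤ (c:ℝ)^5 := le_self_pow₀ hc (by norm_num)
    have h3 : (b:ℝ) ≤ V := by nlinarith
    have h4 : (c:ℝ) ≤ V := by nlinarith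
    exact ⟨⟨⟨h1, le_floor h3⟩, h2, le_floor h4⟩, h⟩

lemma le_root_iff {q : ℕ} (hq : q ≠ 0) {W c : ℝ} (hW : 0 ≤ W) (hc : 0 ≤ c) :
    c ≤ W^((1:ℝ)/q) ↔ c^q ≤ W := by
  rw [one_div, Real.le_rpow_inv_iff_of_pos hc hW (by positivity), rpow_natCast]

lemma le_root5_iff {V b c : ℝ} (hV : 0 ≤ V) (hb : 0 < b) (hc : 0 ≤ c) :
    c ≤ (V/b^4)^((1:ℝ)/5) ↔ b^4*c^5 ≤ V := by
  have := le_root_iff (q := 5) (by norm_num) (W := V/b^4) (by positivity) hc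
  rw [le_div_iff₀ (by positivity), mul_comm] at this
  exact_mod_cast this

lemma le_root4_iff {V b c : ℝ} (hV : 0 ≤ V) (hc : 0 < c) (hb : 0 ≤ b) :
    b ≤ (V/c^5)^((1:ℝ)/4) ↔ b^4*c^5 ≤ V := by
  have := le_root_iff (q := 4) (by norm_num) (W := V/c^5) (by positivity) hb
  rw [le_div_iff₀ (by positivity)] at this
  exact_mod_cast this

/-- The hyperbola method for `b⁴c⁵ ≤ β⁹`. -/
lemma sum_pairs (f g : ℕ → ℝ) {β : ℝ} (hβ : 0 ≤ β) : ∑ p ∈ pairs (β^9), f p.1*g p.2 =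
      ∑ b ∈ Icc 1 ⌊β⌋₊, f b*∑ c ∈ Icc 1 ⌊(β^9/(b:ℝ)^4)^((1:ℝ)/5)⌋₊, g c +
      ∑ c ∈ Icc 1 ⌊β⌋₊, g c*∑ b ∈ Icc 1 ⌊(β^9/(c:ℝ)^5)^((1:ℝ)/4)⌋₊, f b -
      (∑ b ∈ Icc 1 ⌊β⌋₊, f b)*∑ c ∈ Icc 1 ⌊β⌋₊, g c := by
  have hV : 0 ≤ β^9 := by positivity
  set P1 := (pairs (β^9)).filter fun p => (p.1:ℝ) ≤ β with hP1
  set P2 := (pairs (β^9)).filter fun p => (p.2:ℝ) ≤ β with hP2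
  have hu : P1 ∪ P2 = pairs (β^9) := by
    rw [hP1, hP2, ← filter_or, filter_true_of_mem]
    intro p hp
    rw [mem_pairs] at hp
    by_contra! h
    have h1 := pow_lt_pow_left₀ h.1 hβ (n := 4) (by norm_num)
    have h2 := pow_lt_pow_left₀ h.2 hβ (n := 5) (by norm_num)
    have h3 := mul_lt_mul'' h1 h2 (by positivity) (by positivity)
    have h4 : β^4*β^5 = β^9 := by ring
    linarith [hp.2.2]
  have hi : P1 ∩ P2 = Icc 1 ⌊β⌋₊ ×ˢ Icc 1 ⌊β⌋₊ := by
    ext ⟨b, c⟩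
    simp only [hP1, hP2, mem_inter, mem_filter, mem_pairs, mem_product, mem_Icc, le_floor_iff hβ]
    constructor
    · rintro ⟨⟨⟨h1, h2, h3⟩, h4⟩, _, h5⟩; exact ⟨⟨h1, h4⟩, h2, h5⟩
    · rintro ⟨⟨h1, h4⟩, h2, h5⟩
      have : (b:ℝ)^4*(c:ℝ)^5 ≤ β^9 := by
        calc (b:ℝ)^4*(c:ℝ)^5 ≤ β^4*β^5 := by gcongr
          _ = _ := by ring
      exact ⟨⟨⟨h1, h2, this⟩, h4⟩, ⟨h1, h2, this⟩, h5⟩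
  have s1 : ∑ p ∈ P1, f p.1*g p.2 = ∑ b ∈ Icc 1 ⌊β⌋₊,
      f b*∑ c ∈ Icc 1 ⌊(β^9/(b:ℝ)^4)^((1:ℝ)/5)⌋₊, g c := by
    rw [sum_finset_product P1 (Icc 1 ⌊β⌋₊) (fun b => Icc 1 ⌊(β^9/(b:ℝ)^4)^((1:ℝ)/5)⌋₊)]
    · refine sum_congr rfl fun b _ => ?_
      rw [mul_sum]
    · rintro ⟨b, c⟩
      simp only [hP1, mem_filter, mem_pairs, mem_Icc, le_floor_iff hβ]
      rcases Nat.eq_zero_or_pos b with h0 | h0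
      · simp [h0]
      · rw [le_floor_iff (by positivity), le_root5_iff hV (mod_cast h0) (by positivity)]
        tauto
  have s2 : ∑ p ∈ P2, f p.1*g p.2 = ∑ c ∈ Icc 1 ⌊β⌋₊,
      g c*∑ b ∈ Icc 1 ⌊(β^9/(c:ℝ)^5)^((1:ℝ)/4)⌋₊, f b := by
    rw [sum_finset_product_right P2 (Icc 1 ⌊β⌋₊) (fun c => Icc 1 ⌊(β^9/(c:ℝ)^5)^((1:ℝ)/4)⌋₊)]
    · refine sum_congr rfl fun b _ => ?_
      rw [mul_sum]
      exact sum_congr rfl fun c _ => mul_comm _ _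
    · rintro ⟨b, c⟩
      simp only [hP2, mem_filter, mem_pairs, mem_Icc, le_floor_iff hβ]
      rcases Nat.eq_zero_or_pos c with h0 | h0
      · simp [h0]
      · rw [le_floor_iff (by positivity), le_root4_iff hV (mod_cast h0) (by positivity)]
        tauto
  have s3 : ∑ p ∈ P1 ∩ P2, f p.1*g p.2 = (∑ b ∈ Icc 1 ⌊β⌋₊, f b)*∑ c ∈ Icc 1 ⌊β⌋₊, g c := by
    rw [hi, sum_product, sum_mul_sum]
  have := sum_union_inter (s₁ := P1) (s₂ := P2) (f := fun p : ℕ × ℕ => f p.1*g p.2)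
  rw [hu, s1, s2, s3] at this
  linarith

/-- The weighted sum of the remainders arising in the hyperbola method. -/
def remSum (β:ℝ) : ℝ := ∑ b ∈ Icc 1 ⌊β⌋₊, rr b*Es ((β^9/(b:ℝ)^4)^((1:ℝ)/5)) +
  ∑ c ∈ Icc 1 ⌊β⌋₊, rr c*Es ((β^9/(c:ℝ)^5)^((1:ℝ)/4))

/-- `J` and `K` are the constants in the asymptotics of `rrSum s`. -/
def RRAsymp (s J K:ℝ) : Prop := 0 < K ∧ ∀ x, 1 ≤ x →
    |rrSum s x-(J+kap*x^(1-s)/(1-s)+Es x*x^(-s))| ≤ K*x^(-1/4-s)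

lemma RRAsymp.eq {s J K : ℝ} (h : RRAsymp s J K) {x : ℝ} (hx : 1 ≤ x) : ∃ δ, |δ| ≤ K ∧
    rrSum s x = J+kap*x^(1-s)/(1-s)+Es x*x^(-s)+δ*x^(-1/4-s) := by
  have x0 : 0 < x^(-1/4-s) := rpow_pos_of_pos (by linarith) _
  refine ⟨(rrSum s x-(J+kap*x^(1-s)/(1-s)+Es x*x^(-s)))/x^(-1/4-s), ?_, ?_⟩
  · rw [abs_div, abs_of_pos x0, div_le_iff₀ x0]; exact h.2 x hx
  · field_simp; ring

lemma root5_rpow {β b : ℝ} (hβ : 0 < β) (hb : 0 < b) (e:ℝ) :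
    ((β^9/b^4)^((1:ℝ)/5))^e = β^(9*e/5)*b^(-4*e/5) := by
  rw [← rpow_mul (by positivity), div_rpow (by positivity) (by positivity),
    ← rpow_natCast, ← rpow_natCast, ← rpow_mul hβ.le, ← rpow_mul hb.le,
    div_eq_mul_inv, ← rpow_neg hb.le]
  congr 2 <;> push_cast <;> ring

lemma root4_rpow {β b : ℝ} (hβ : 0 < β) (hb : 0 < b) (e:ℝ) :
    ((β^9/b^5)^((1:ℝ)/4))^e = β^(9*e/4)*b^(-5*e/4) := by
  rw [← rpow_mul (by positivity), div_rpow (by positivity) (by positivity),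
    ← rpow_natCast, ← rpow_natCast, ← rpow_mul hβ.le, ← rpow_mul hb.le,
    div_eq_mul_inv, ← rpow_neg hb.le]
  congr 2 <;> push_cast <;> ring

lemma exists_pairs_asymp {C45 C54 K45 K54 : ℝ} (h45 : RRAsymp (4/5) C45 K45)
    (h54 : RRAsymp (5/4) C54 K54) : ∃ K : ℝ, 0 < K ∧ ∀ β, 1 ≤ β →
    |∑ p ∈ pairs (β^9), rr p.1*rr p.2-(kap*C45*β^((9:ℝ)/5)+kap*C54*β^((9:ℝ)/4) +
      remSum β)| ≤ K*β^((3:ℝ)/4) := by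
  obtain ⟨C, hC, HE⟩ := exists_Es_le
  have hk := kap_pos
  have hK45 := h45.1
  have hK54 := h54.1
  refine ⟨kap*K45+kap*K54+C^2+1, by positivity, fun β hβ => ?_⟩
  have β0 : 0 < β := by linarith
  have hsum := sum_pairs rr rr β0.le
  have T0 : ∀ x : ℝ, 0 ≤ x → ∑ b ∈ Icc 1 ⌊x⌋₊, rr b = kap*x-1/6+Es x := fun x hx => by
    rw [← rrSum_zero hx]; simp [rrSum]
  have mem1 : ∀ b ∈ Icc 1 ⌊β⌋₊, (0:ℝ) < b := fun b hb => by
    have := (mem_Icc.1 hb).1; exact_mod_cast this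
  have s1 : ∑ b ∈ Icc 1 ⌊β⌋₊, rr b * ∑ c ∈ Icc 1 ⌊(β^9/(b:ℝ)^4)^((1:ℝ)/5)⌋₊, rr c =
      kap*β^((9:ℝ)/5)*rrSum (4/5) β-1/6*(kap*β-1/6+Es β) +
      ∑ b ∈ Icc 1 ⌊β⌋₊, rr b*Es ((β^9/(b:ℝ)^4)^((1:ℝ)/5)) := by
    rw [← T0 β β0.le, rrSum, mul_sum, mul_sum, ← sum_sub_distrib, ← sum_add_distrib]
    refine sum_congr rfl fun b hb => ?_
    rw [T0 _ (by positivity)]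
    have := root5_rpow β0 (mem1 b hb) 1
    rw [rpow_one] at this
    rw [this, show (9:ℝ)*1/5 = 9/5 by norm_num, show (-4:ℝ)*1/5 = -(4/5) by norm_num]
    ring
  have s2 : ∑ b ∈ Icc 1 ⌊β⌋₊, rr b * ∑ c ∈ Icc 1 ⌊(β^9/(b:ℝ)^5)^((1:ℝ)/4)⌋₊, rr c =
      kap*β^((9:ℝ)/4)*rrSum (5/4) β-1/6*(kap*β-1/6+Es β) +
      ∑ b ∈ Icc 1 ⌊β⌋₊, rr b*Es ((β^9/(b:ℝ)^5)^((1:ℝ)/4)) := by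
    rw [← T0 β β0.le, rrSum, mul_sum, mul_sum, ← sum_sub_distrib, ← sum_add_distrib]
    refine sum_congr rfl fun b hb => ?_
    rw [T0 _ (by positivity)]
    have := root4_rpow β0 (mem1 b hb) 1
    rw [rpow_one] at this
    rw [this, show (9:ℝ)*1/4 = 9/4 by norm_num, show (-5:ℝ)*1/4 = -(5/4) by norm_num]
    ring
  rw [s1, s2, T0 β β0.le] at hsum
  obtain ⟨d1, hd1, e1⟩ := h45.eq hβ
  obtain ⟨d2, hd2, e2⟩ := h54.eq hβ
  have m : ∀ a b c : ℝ, a+b = c → β^a*β^b = β^c := fun a b c h => by rw [← rpow_add β0, h]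
  have m1 := m (9/5) (1-4/5) 2 (by norm_num)
  have m2 := m (9/5) (-(4/5)) 1 (by norm_num)
  have m3 := m (9/5) (-1/4-4/5) (3/4) (by norm_num)
  have m4 := m (9/4) (1-5/4) 2 (by norm_num)
  have m5 := m (9/4) (-(5/4)) 1 (by norm_num)
  have m6 := m (9/4) (-1/4-5/4) (3/4) (by norm_num)
  have b2 : β^(2:ℝ) = β^2 := by rw [← rpow_natCast]; norm_num
  rw [rpow_one] at m2 m5
  rw [b2] at m1 m4
  have key : ∑ p ∈ pairs (β^9), rr p.1*rr p.2 -
      (kap*C45*β^((9:ℝ)/5)+kap*C54*β^((9:ℝ)/4)+remSum β) =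
      (kap*d1+kap*d2)*β^((3:ℝ)/4)-Es β^2+1/36 := by
    rw [hsum, e1, e2, remSum]
    linear_combination (kap^2/(1-4/5))*m1+kap*Es β*m2+kap*d1*m3 +
      (kap^2/(1-5/4))*m4+kap*Es β*m5+kap*d2*m6
  rw [key]
  have hE : Es β^2 ≤ C^2*β^((3:ℝ)/4) := by
    have h1 := pow_le_pow_left₀ (abs_nonneg _) (HE β hβ) 2
    rw [sq_abs, mul_pow, ← rpow_natCast (β^_), ← rpow_mul β0.le] at h1
    refine h1.trans (mul_le_mul_of_nonneg_left ?_ (by positivity))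
    exact rpow_le_rpow_of_exponent_le hβ (by norm_num)
  have h1 : 1 ≤ β^((3:ℝ)/4) := one_le_rpow hβ (by norm_num)
  have h2 : |(kap*d1+kap*d2)*β^((3:ℝ)/4)| ≤ (kap*K45+kap*K54)*β^((3:ℝ)/4) := by
    rw [abs_mul, abs_of_pos (by positivity : 0 < β^((3:ℝ)/4))]
    refine mul_le_mul_of_nonneg_right ?_ (by positivity)
    refine (abs_add_le _ _).trans ?_
    rw [abs_mul, abs_mul, abs_of_pos hk]
    gcongr
  have h3 := abs_le.1 h2
  have h4 := sq_nonneg (Es β)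
  rw [abs_le]
  constructor <;> linarith

lemma one_le_root5 {β b : ℝ} (hβ : 1 ≤ β) (hb : 0 < b) (hbβ : b ≤ β) : 1 ≤ (β^9/b^4)^((1:ℝ)/5) := by
  refine one_le_rpow ?_ (by norm_num)
  rw [one_le_div (by positivity)]
  exact (pow_le_pow_left₀ hb.le hbβ 4).trans (pow_le_pow_right₀ hβ (by norm_num))

lemma one_le_root4 {β b : ℝ} (hβ : 1 ≤ β) (hb : 0 < b) (hbβ : b ≤ β) : 1 ≤ (β^9/b^5)^((1:ℝ)/4) := by
  refine one_le_rpow ?_ (by norm_num)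
  rw [one_le_div (by positivity)]
  exact (pow_le_pow_left₀ hb.le hbβ 5).trans (pow_le_pow_right₀ hβ (by norm_num))

lemma mem_Icc_floor {β : ℝ} (hβ : 0 ≤ β) {b : ℕ} (hb : b ∈ Icc 1 ⌊β⌋₊) : (0:ℝ) < b ∧ (b:ℝ) ≤ β := by
  rw [mem_Icc, le_floor_iff hβ] at hb
  exact ⟨mod_cast hb.1, hb.2⟩

lemma exists_weighted_sum5 {C53 K53 : ℝ} (h53 : RRAsymp (5/3) C53 K53) :
    ∃ K : ℝ, 0 < K ∧ ∀ β, 1 ≤ β →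
    |∑ b ∈ Icc 1 ⌊β⌋₊, rr b*(b:ℝ)^(-(4/3):ℝ)*rrSum (5/3) ((β^9/(b:ℝ)^4)^((1:ℝ)/5)) -
      (C53*rrSum (4/3) β-3/2*kap*β^(-6/5:ℝ)*rrSum (4/5) β +
        β^(-3:ℝ)*∑ b ∈ Icc 1 ⌊β⌋₊, rr b*Es ((β^9/(b:ℝ)^4)^((1:ℝ)/5)))| ≤
      K*β^(-9/4:ℝ) := by
  obtain ⟨K, hK, HK⟩ := exists_rrSum_le (u := -(1/5)) (by norm_num)
  have h0 := h53.1
  refine ⟨K53*K, by positivity, fun β hβ => ?_⟩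
  have β0 : 0 < β := by linarith
  have key : ∑ b ∈ Icc 1 ⌊β⌋₊, rr b*(b:ℝ)^(-(4/3):ℝ)*rrSum (5/3) ((β^9/(b:ℝ)^4)^((1:ℝ)/5)) -
      (C53*rrSum (4/3) β-3/2*kap*β^(-6/5:ℝ)*rrSum (4/5) β +
        β^(-3:ℝ)*∑ b ∈ Icc 1 ⌊β⌋₊, rr b*Es ((β^9/(b:ℝ)^4)^((1:ℝ)/5))) =
      ∑ b ∈ Icc 1 ⌊β⌋₊, (rr b*(b:ℝ)^(-(4/3):ℝ)*rrSum (5/3) ((β^9/(b:ℝ)^4)^((1:ℝ)/5)) -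
      (C53*(rr b*(b:ℝ)^(-(4/3):ℝ))-3/2*kap*β^(-6/5:ℝ)*(rr b*(b:ℝ)^(-(4/5):ℝ)) +
        β^(-3:ℝ)*(rr b*Es ((β^9/(b:ℝ)^4)^((1:ℝ)/5))))) := by
    rw [sum_sub_distrib, sum_add_distrib, sum_sub_distrib, rrSum, rrSum, mul_sum, mul_sum, mul_sum]
  rw [key]
  refine (abs_sum_le_sum_abs _ _).trans ?_
  have : ∑ b ∈ Icc 1 ⌊β⌋₊, K53*β^(-69/20:ℝ)*(rr b*(b:ℝ)^(-(-(1/5)):ℝ)) ≤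
      K53*K*β^(-9/4:ℝ) := by
    rw [← mul_sum]
    refine (mul_le_mul_of_nonneg_left (HK β β0.le) (by positivity)).trans (le_of_eq ?_)
    have : β^(-69/20:ℝ)*β^(1 - -(1/5):ℝ) = β^(-9/4:ℝ) := by rw [← rpow_add β0]; norm_num
    linear_combination K53*K*this
  refine (sum_le_sum fun b hb => ?_).trans this
  obtain ⟨b0, bβ⟩ := mem_Icc_floor β0.le hb
  have hr := rr_nonneg b
  obtain ⟨d, hd, e⟩ := h53.eq (one_le_root5 hβ b0 bβ)
  rw [e, root5_rpow β0 b0, root5_rpow β0 b0, root5_rpow β0 b0]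
  have m : ∀ x y z : ℝ, x+y = z → (b:ℝ)^x*(b:ℝ)^y = (b:ℝ)^z := fun x y z h => by
    rw [← rpow_add b0, h]
  have m1 := m (-(4/3)) (-4*(1-5/3)/5) (-(4/5)) (by norm_num)
  have m2 := m (-(4/3)) (-4*(-(5/3))/5) 0 (by norm_num)
  have m3 := m (-(4/3)) (-4*(-1/4-5/3)/5) (-(-(1/5))) (by norm_num)
  rw [rpow_zero] at m2
  have e1 : (9*(1-5/3)/5:ℝ) = -6/5 := by norm_num
  have e2 : (9*(-(5/3))/5:ℝ) = -3 := by norm_num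
  have e3 : (9*(-1/4-5/3)/5:ℝ) = -69/20 := by norm_num
  rw [e1, e2, e3]
  have : rr b*(b:ℝ)^(-(4/3):ℝ) * (C53+kap*(β^(-6/5:ℝ)*(b:ℝ)^(-4*(1-5/3)/5:ℝ))/(1-5/3) +
            Es ((β^9/(b:ℝ)^4)^((1:ℝ)/5))*(β^(-3:ℝ)*(b:ℝ)^(-4*(-(5/3))/5:ℝ)) +
          d*(β^(-69/20:ℝ)*(b:ℝ)^(-4*(-1/4-5/3)/5:ℝ))) -
      (C53*(rr b*(b:ℝ)^(-(4/3):ℝ))-3/2*kap*β^(-6/5:ℝ)*(rr b*(b:ℝ)^(-(4/5):ℝ)) +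
        β^(-3:ℝ)*(rr b*Es ((β^9/(b:ℝ)^4)^((1:ℝ)/5)))) =
      d*(β^(-69/20:ℝ)*(rr b*(b:ℝ)^(-(-(1/5)):ℝ))) := by
    linear_combination rr b*kap*β^(-6/5:ℝ)/(1-5/3)*m1 +
      rr b*Es ((β^9/(b:ℝ)^4)^((1:ℝ)/5))*β^(-3:ℝ)*m2+rr b*d*β^(-69/20:ℝ)*m3
  rw [this, abs_mul, mul_assoc, abs_of_nonneg (by positivity :
    0 ≤ β^(-69/20:ℝ)*(rr b*(b:ℝ)^(-(-(1/5)):ℝ)))]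
  exact mul_le_mul_of_nonneg_right hd (by positivity)

lemma exists_weighted_sum4 {C43 K43 : ℝ} (h43 : RRAsymp (4/3) C43 K43) :
    ∃ K : ℝ, 0 < K ∧ ∀ β, 1 ≤ β →
    |∑ b ∈ Icc 1 ⌊β⌋₊, rr b*(b:ℝ)^(-(5/3):ℝ)*rrSum (4/3) ((β^9/(b:ℝ)^5)^((1:ℝ)/4)) -
      (C43*rrSum (5/3) β-3*kap*β^(-3/4:ℝ)*rrSum (5/4) β +
        β^(-3:ℝ)*∑ b ∈ Icc 1 ⌊β⌋₊, rr b*Es ((β^9/(b:ℝ)^5)^((1:ℝ)/4)))| ≤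
      K*β^(-9/4:ℝ) := by
  obtain ⟨K, hK, HK⟩ := exists_rrSum_le (u := -(5/16)) (by norm_num)
  have h0 := h43.1
  refine ⟨K43*K, by positivity, fun β hβ => ?_⟩
  have β0 : 0 < β := by linarith
  have key : ∑ b ∈ Icc 1 ⌊β⌋₊, rr b*(b:ℝ)^(-(5/3):ℝ)*rrSum (4/3) ((β^9/(b:ℝ)^5)^((1:ℝ)/4)) -
      (C43*rrSum (5/3) β-3*kap*β^(-3/4:ℝ)*rrSum (5/4) β +
        β^(-3:ℝ)*∑ b ∈ Icc 1 ⌊β⌋₊, rr b*Es ((β^9/(b:ℝ)^5)^((1:ℝ)/4))) =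
      ∑ b ∈ Icc 1 ⌊β⌋₊, (rr b*(b:ℝ)^(-(5/3):ℝ)*rrSum (4/3) ((β^9/(b:ℝ)^5)^((1:ℝ)/4)) -
      (C43*(rr b*(b:ℝ)^(-(5/3):ℝ))-3*kap*β^(-3/4:ℝ)*(rr b*(b:ℝ)^(-(5/4):ℝ)) +
        β^(-3:ℝ)*(rr b*Es ((β^9/(b:ℝ)^5)^((1:ℝ)/4))))) := by
    rw [sum_sub_distrib, sum_add_distrib, sum_sub_distrib, rrSum, rrSum, mul_sum, mul_sum, mul_sum]
  rw [key]
  refine (abs_sum_le_sum_abs _ _).trans ?_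
  have : ∑ b ∈ Icc 1 ⌊β⌋₊, K43*β^(-57/16:ℝ)*(rr b*(b:ℝ)^(-(-(5/16)):ℝ)) ≤
      K43*K*β^(-9/4:ℝ) := by
    rw [← mul_sum]
    refine (mul_le_mul_of_nonneg_left (HK β β0.le) (by positivity)).trans (le_of_eq ?_)
    have : β^(-57/16:ℝ)*β^(1 - -(5/16):ℝ) = β^(-9/4:ℝ) := by rw [← rpow_add β0]; norm_num
    linear_combination K43*K*this
  refine (sum_le_sum fun b hb => ?_).trans this
  obtain ⟨b0, bβ⟩ := mem_Icc_floor β0.le hb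
  have hr := rr_nonneg b
  obtain ⟨d, hd, e⟩ := h43.eq (one_le_root4 hβ b0 bβ)
  rw [e, root4_rpow β0 b0, root4_rpow β0 b0, root4_rpow β0 b0]
  have m : ∀ x y z : ℝ, x+y = z → (b:ℝ)^x*(b:ℝ)^y = (b:ℝ)^z := fun x y z h => by
    rw [← rpow_add b0, h]
  have m1 := m (-(5/3)) (-5*(1-4/3)/4) (-(5/4)) (by norm_num)
  have m2 := m (-(5/3)) (-5*(-(4/3))/4) 0 (by norm_num)
  have m3 := m (-(5/3)) (-5*(-1/4-4/3)/4) (-(-(5/16))) (by norm_num)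
  rw [rpow_zero] at m2
  have e1 : (9*(1-4/3)/4:ℝ) = -3/4 := by norm_num
  have e2 : (9*(-(4/3))/4:ℝ) = -3 := by norm_num
  have e3 : (9*(-1/4-4/3)/4:ℝ) = -57/16 := by norm_num
  rw [e1, e2, e3]
  have : rr b*(b:ℝ)^(-(5/3):ℝ) * (C43+kap*(β^(-3/4:ℝ)*(b:ℝ)^(-5*(1-4/3)/4:ℝ))/(1-4/3) +
            Es ((β^9/(b:ℝ)^5)^((1:ℝ)/4))*(β^(-3:ℝ)*(b:ℝ)^(-5*(-(4/3))/4:ℝ)) +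
          d*(β^(-57/16:ℝ)*(b:ℝ)^(-5*(-1/4-4/3)/4:ℝ))) -
      (C43*(rr b*(b:ℝ)^(-(5/3):ℝ))-3*kap*β^(-3/4:ℝ)*(rr b*(b:ℝ)^(-(5/4):ℝ)) +
        β^(-3:ℝ)*(rr b*Es ((β^9/(b:ℝ)^5)^((1:ℝ)/4)))) =
      d*(β^(-57/16:ℝ)*(rr b*(b:ℝ)^(-(-(5/16)):ℝ))) := by
    linear_combination rr b*kap*β^(-3/4:ℝ)/(1-4/3)*m1 +
      rr b*Es ((β^9/(b:ℝ)^5)^((1:ℝ)/4))*β^(-3:ℝ)*m2+rr b*d*β^(-57/16:ℝ)*m3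
  rw [this, abs_mul, mul_assoc, abs_of_nonneg (by positivity :
    0 ≤ β^(-57/16:ℝ)*(rr b*(b:ℝ)^(-(-(5/16)):ℝ)))]
  exact mul_le_mul_of_nonneg_right hd (by positivity)

lemma abs_mul_rpow_le {β c K e e' : ℝ} (hβ : 1 ≤ β) (hc : |c| ≤ K) (he : e ≤ e') :
    |c*β^e| ≤ K*β^e' := by
  have β0 : 0 < β := by linarith
  rw [abs_mul, abs_of_pos (rpow_pos_of_pos β0 e)]
  exact mul_le_mul hc (rpow_le_rpow_of_exponent_le hβ he) (by positivity) ((abs_nonneg _).trans hc)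

/-- The sum `∑ r(b) r(c) b^{-4/3} c^{-5/3}` over the pairs with `b⁴c⁵ ≤ V`. -/
def pairSum (V:ℝ) : ℝ :=
  ∑ p ∈ pairs V, rr p.1*(p.1:ℝ)^(-(4/3):ℝ)*(rr p.2*(p.2:ℝ)^(-(5/3):ℝ))

set_option maxHeartbeats 1000000 in
lemma exists_pairSum_asymp {C45 C54 C43 C53 K45 K54 K43 K53 : ℝ}
    (h45 : RRAsymp (4/5) C45 K45) (h54 : RRAsymp (5/4) C54 K54)
    (h43 : RRAsymp (4/3) C43 K43) (h53 : RRAsymp (5/3) C53 K53) :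
    ∃ K : ℝ, 0 < K ∧ ∀ β, 1 ≤ β →
    |pairSum (β^9)-(C43*C53-3/2*kap*C45*β^(-6/5:ℝ) -
      3*kap*C54*β^(-3/4:ℝ)+β^(-3:ℝ)*remSum β)| ≤ K*β^(-9/4:ℝ) := by
  obtain ⟨C, hC, HE⟩ := exists_Es_le
  obtain ⟨Ka, hKa, Ha⟩ := exists_weighted_sum5 h53
  obtain ⟨Kb, hKb, Hb⟩ := exists_weighted_sum4 h43
  have hk := kap_pos
  have p45 := h45.1
  have p54 := h54.1
  have p43 := h43.1
  have p53 := h53.1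
  refine ⟨Ka+Kb+3/2*kap*K45+3*kap*K54+C^2+3*kap*K53+3/2*kap*K43 +
    C*K53+C*K43+K43*K53, by positivity, fun β hβ => ?_⟩
  have β0 : 0 < β := by linarith
  have hsum := sum_pairs (fun b => rr b*(b:ℝ)^(-(4/3):ℝ))
    (fun b => rr b*(b:ℝ)^(-(5/3):ℝ)) β0.le
  replace Ha := Ha β hβ
  replace Hb := Hb β hβ
  obtain ⟨d1, hd1, e1⟩ := h45.eq hβ
  obtain ⟨d2, hd2, e2⟩ := h54.eq hβ
  obtain ⟨d3, hd3, e3⟩ := h43.eq hβ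
  obtain ⟨d4, hd4, e4⟩ := h53.eq hβ
  obtain ⟨ε, hε, eε⟩ : ∃ ε, |ε| ≤ C ∧ Es β = ε*β^((1:ℝ)/3) := by
    have x0 : 0 < β^((1:ℝ)/3) := by positivity
    refine ⟨Es β/β^((1:ℝ)/3), ?_, by field_simp⟩
    rw [abs_div, abs_of_pos x0, div_le_iff₀ x0]; exact HE β hβ
  simp only [← rrSum.eq_def] at hsum
  change pairSum (β^9) = _ at hsum
  have hsum' : pairSum (β^9) = ∑ b ∈ Icc 1 ⌊β⌋₊, rr b*(b:ℝ)^(-(4/3):ℝ)*rrSum (5/3) ((β^9/(b:ℝ)^4)^((1:ℝ)/5)) +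
    ∑ b ∈ Icc 1 ⌊β⌋₊, rr b*(b:ℝ)^(-(5/3):ℝ)*rrSum (4/3) ((β^9/(b:ℝ)^5)^((1:ℝ)/4))-rrSum (4/3) β*rrSum (5/3) β := hsum
  set S1 := ∑ b ∈ Icc 1 ⌊β⌋₊, rr b*(b:ℝ)^(-(4/3):ℝ)*rrSum (5/3) ((β^9/(b:ℝ)^4)^((1:ℝ)/5))
  set S2 := ∑ b ∈ Icc 1 ⌊β⌋₊, rr b*(b:ℝ)^(-(5/3):ℝ)*rrSum (4/3) ((β^9/(b:ℝ)^5)^((1:ℝ)/4))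
  have m : ∀ a b c : ℝ, a+b = c → β^a*β^b = β^c := fun a b c h => by rw [← rpow_add β0, h]
  set M1 := C53*rrSum (4/3) β-3/2*kap*β^(-6/5:ℝ)*rrSum (4/5) β +
        β^(-3:ℝ)*∑ b ∈ Icc 1 ⌊β⌋₊, rr b*Es ((β^9/(b:ℝ)^4)^((1:ℝ)/5)) with hM1
  set M2 := C43*rrSum (5/3) β-3*kap*β^(-3/4:ℝ)*rrSum (5/4) β +
        β^(-3:ℝ)*∑ b ∈ Icc 1 ⌊β⌋₊, rr b*Es ((β^9/(b:ℝ)^5)^((1:ℝ)/4)) with hM2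
  have a1 := m (-6/5) (1-4/5) (-1) (by norm_num)
  have a2 := m (-6/5) (-(4/5)) (-2) (by norm_num)
  have a3 := m (-6/5) (-1/4-4/5) (-9/4) (by norm_num)
  have a4 := m (-3/4) (1-5/4) (-1) (by norm_num)
  have a5 := m (-3/4) (-(5/4)) (-2) (by norm_num)
  have a6 := m (-3/4) (-1/4-5/4) (-9/4) (by norm_num)
  have b1 := m (1-4/3) (1-5/3) (-1) (by norm_num)
  have b2 := m (1-4/3) (-(5/3)) (-2) (by norm_num)
  have b3 := m (1-4/3) (-1/4-5/3) (-9/4) (by norm_num)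
  have b4 := m (-(4/3)) (1-5/3) (-2) (by norm_num)
  have b7 := m (-1/4-4/3) (1-5/3) (-9/4) (by norm_num)
  have c1 : β^((1:ℝ)/3)*β^(-(4/3):ℝ)*(β^((1:ℝ)/3)*β^(-(5/3):ℝ)) = β^(-7/3:ℝ) := by
    rw [m _ _ (-1) (by norm_num), m _ _ (-4/3) (by norm_num), m _ _ (-7/3) (by norm_num)]
  have c2 : β^((1:ℝ)/3)*β^(-(4/3):ℝ)*β^(-1/4-5/3:ℝ) = β^(-35/12:ℝ) := by
    rw [m _ _ (-1) (by norm_num), m _ _ (-35/12) (by norm_num)]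
  have c3 : β^(-1/4-4/3:ℝ)*(β^((1:ℝ)/3)*β^(-(5/3):ℝ)) = β^(-35/12:ℝ) := by
    rw [m _ _ (-4/3) (by norm_num), m _ _ (-35/12) (by norm_num)]
  have c4 := m (-1/4-4/3) (-1/4-5/3) (-7/2) (by norm_num)
  have key : pairSum (β^9)-(C43*C53-3/2*kap*C45*β^(-6/5:ℝ) -
      3*kap*C54*β^(-3/4:ℝ)+β^(-3:ℝ)*remSum β) =
      (S1-M1)+(S2-M2)+(-(3/2*kap*d1))*β^(-9/4:ℝ)+(-(3*kap*d2))*β^(-9/4:ℝ)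
      + (-ε^2)*β^(-7/3:ℝ)+(3*kap*d4)*β^(-9/4:ℝ)+(3/2*kap*d3)*β^(-9/4:ℝ)
      + (- (ε*d4))*β^(-35/12:ℝ)+(-(ε*d3))*β^(-35/12:ℝ)+(-(d3*d4))*β^(-7/2:ℝ) := by
    have t1 : M1+M2-rrSum (4/3) β*rrSum (5/3) β = C43*C53-(rrSum (4/3) β-C43)*(rrSum (5/3) β-C53)
       - 3/2*kap*β^(-6/5:ℝ)*rrSum (4/5) β-3*kap*β^(-3/4:ℝ)*rrSum (5/4) β
       + β^(-3:ℝ)*remSum β := by rw [hM1, hM2, remSum]; ring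
    have t2 : 3/2*kap*β^(-6/5:ℝ)*rrSum (4/5) β = 3/2*kap*C45*β^(-6/5:ℝ)
        + 15/2*kap^2*β^(-1:ℝ)+3/2*kap*Es β*β^(-2:ℝ)+3/2*kap*d1*β^(-9/4:ℝ) := by
      rw [e1]; linear_combination 15/2*kap^2*a1+3/2*kap*Es β*a2+3/2*kap*d1*a3
    have t3 : 3*kap*β^(-3/4:ℝ)*rrSum (5/4) β = 3*kap*C54*β^(-3/4:ℝ)
        - 12*kap^2*β^(-1:ℝ)+3*kap*Es β*β^(-2:ℝ)+3*kap*d2*β^(-9/4:ℝ) := by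
      rw [e2]; linear_combination -12*kap^2*a4+3*kap*Es β*a5+3*kap*d2*a6
    have t4 : (rrSum (4/3) β-C43)*(rrSum (5/3) β-C53) = 9/2*kap^2*β^(-1:ℝ)
        - 9/2*kap*Es β*β^(-2:ℝ)-3*kap*d4*β^(-9/4:ℝ)-3/2*kap*d3*β^(-9/4:ℝ)
        + ε^2*β^(-7/3:ℝ)+ε*d4*β^(-35/12:ℝ)+ε*d3*β^(-35/12:ℝ)+d3*d4*β^(-7/2:ℝ) := by
      rw [e3, e4, eε]
      linear_combination 9/2*kap^2*b1-3*kap*ε*β^((1:ℝ)/3)*b2-3*kap*d4*b3 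
        - 3/2*kap*ε*β^((1:ℝ)/3)*b4-3/2*kap*d3*b7+ε^2*c1+ε*d4*c2+ε*d3*c3
        + d3*d4*c4
    rw [hsum']
    linear_combination t1-t2-t3-t4
  rw [key]
  have am : ∀ {x y X Y : ℝ}, |x| ≤ X → |y| ≤ Y → |x*y| ≤ X*Y := fun hx hy => by
    rw [abs_mul]; exact mul_le_mul hx hy (abs_nonneg _) ((abs_nonneg _).trans hx)
  have ak : ∀ c : ℝ, 0 ≤ c → |c*kap| ≤ c*kap := fun c hc => by rw [abs_of_nonneg (by positivity)]
  have l1 := abs_mul_rpow_le (e := -9/4) (e' := -9/4) hβ ((abs_neg _).trans_le (am (ak (3/2) (by norm_num)) hd1)) le_rfl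
  have l2 := abs_mul_rpow_le (e := -9/4) (e' := -9/4) hβ ((abs_neg _).trans_le (am (ak 3 (by norm_num)) hd2)) le_rfl
  have l3 : |(-ε^2)*β^(-7/3:ℝ)| ≤ C^2*β^(-9/4:ℝ) := by
    refine abs_mul_rpow_le hβ ?_ (by norm_num)
    rw [abs_neg, abs_pow]; exact pow_le_pow_left₀ (abs_nonneg _) hε 2
  have l4 := abs_mul_rpow_le (e := -9/4) (e' := -9/4) hβ (am (ak 3 (by norm_num)) hd4) le_rfl
  have l5 := abs_mul_rpow_le (e := -9/4) (e' := -9/4) hβ (am (ak (3/2) (by norm_num)) hd3) le_rfl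
  have l6 := abs_mul_rpow_le (e := -35/12) (e' := -9/4) hβ ((abs_neg _).trans_le (am hε hd4)) (by norm_num)
  have l7 := abs_mul_rpow_le (e := -35/12) (e' := -9/4) hβ ((abs_neg _).trans_le (am hε hd3)) (by norm_num)
  have l8 := abs_mul_rpow_le (e := -7/2) (e' := -9/4) hβ ((abs_neg _).trans_le (am hd3 hd4)) (by norm_num)
  rw [abs_le] at Ha Hb l1 l2 l3 l4 l5 l6 l7 l8 ⊢
  constructor <;> linarith

/-- The sum of `r(b) r(c)` over `b⁴c⁵ ≤ V`. -/
def pairCount (V:ℝ) : ℝ := ∑ p ∈ pairs V, rr p.1*rr p.2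

/-- The sum of `r(b) r(c)` over `a³b⁴c⁵ ≤ Y`. -/
def tripleCount (Y:ℝ) : ℝ := ∑ a ∈ Icc 1 ⌊Y⌋₊, pairCount (Y/(a:ℝ)^3)

lemma mul_rpow_neg_third_pow {η a : ℝ} (ha : 0 < a) : (η*a^(-1/3:ℝ))^9 = η^9/a^3 := by
  have : (a^(-1/3:ℝ))^9 = (a^3)⁻¹ := by
    rw [← rpow_natCast, ← rpow_mul ha.le, ← rpow_natCast a 3, ← rpow_neg ha.le]
    norm_num
  rw [mul_pow, this, div_eq_mul_inv]

lemma le_cubeRoot_iff {η a b c : ℝ} (hη : 0 < η) (ha : 0 ≤ a) (hb : 0 < b) (hc : 0 < c) :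
    a ≤ η^3*(b^(-(4/3):ℝ)*c^(-(5/3):ℝ)) ↔ a^3*(b^4*c^5) ≤ η^9 := by
  have h1 : (b^(-(4/3):ℝ))^3 = (b^4)⁻¹ := by
    rw [← rpow_natCast, ← rpow_mul hb.le, ← rpow_natCast b 4, ← rpow_neg hb.le]
    norm_num
  have h2 : (c^(-(5/3):ℝ))^3 = (c^5)⁻¹ := by
    rw [← rpow_natCast, ← rpow_mul hc.le, ← rpow_natCast c 5, ← rpow_neg hc.le]
    norm_num
  rw [← pow_le_pow_iff_left₀ ha (by positivity) (n := 3) (by norm_num), mul_pow, mul_pow, h1, h2,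
    ← mul_inv, ← div_eq_mul_inv, le_div_iff₀ (by positivity), ← pow_mul]

lemma tripleCount_eq {η : ℝ} (hη : 1 ≤ η) :
    tripleCount (η^9) = ∑ a ∈ Icc 1 ⌊η⌋₊, pairCount (η^9/(a:ℝ)^3) +
      ∑ p ∈ pairs (η^6), rr p.1*rr p.2 *
        ((⌊η^3*((p.1:ℝ)^(-(4/3):ℝ)*(p.2:ℝ)^(-(5/3):ℝ))⌋₊:ℝ)-(⌊η⌋₊:ℝ)) := by
  have η0 : 0 < η := by linarith
  have hle : ⌊η⌋₊ ≤ ⌊η^9⌋₊ := Nat.floor_le_floor (le_self_pow₀ hη (by norm_num))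
  have hsplit : Icc 1 ⌊η^9⌋₊ = Icc 1 ⌊η⌋₊ ∪ Ioc ⌊η⌋₊ ⌊η^9⌋₊ := by
    ext a; simp only [mem_Icc, mem_union, mem_Ioc]; omega
  have hdis : Disjoint (Icc 1 ⌊η⌋₊) (Ioc ⌊η⌋₊ ⌊η^9⌋₊) := by
    rw [disjoint_left]; intro a; simp only [mem_Icc, mem_Ioc]; omega
  rw [tripleCount, hsplit, sum_union hdis]
  congr 1
  simp only [pairCount]
  rw [sum_comm' (t' := pairs (η^6)) (s' := fun p => Ioc ⌊η⌋₊
    ⌊η^3*((p.1:ℝ)^(-(4/3):ℝ)*(p.2:ℝ)^(-(5/3):ℝ))⌋₊)]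
  · refine sum_congr rfl fun p hp => ?_
    rw [mem_pairs] at hp
    have h1 : (0:ℝ) < p.1 := mod_cast hp.1
    have h2 : (0:ℝ) < p.2 := mod_cast hp.2.1
    have h3 : ⌊η⌋₊ ≤ ⌊η^3*((p.1:ℝ)^(-(4/3):ℝ)*(p.2:ℝ)^(-(5/3):ℝ))⌋₊ := by
      refine Nat.floor_le_floor ?_
      rw [le_cubeRoot_iff η0 η0.le h1 h2]
      calc _ ≤ η^3*η^6 := by gcongr; exact hp.2.2
        _ = _ := by ring
    rw [sum_const, Nat.card_Ioc, nsmul_eq_mul, Nat.cast_sub h3]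
    ring
  · rintro a p
    simp only [mem_Ioc, mem_pairs, floor_lt η0.le]
    constructor
    · rintro ⟨⟨ha, -⟩, h1, h2, h⟩
      have h1' : (0:ℝ) < p.1 := mod_cast h1
      have h2' : (0:ℝ) < p.2 := mod_cast h2
      have a0 : (0:ℝ) < a := η0.trans ha
      rw [le_div_iff₀ (by positivity)] at h
      refine ⟨⟨ha, ?_⟩, h1, h2, ?_⟩
      · rw [le_floor_iff (by positivity), le_cubeRoot_iff η0 a0.le h1' h2']
        linarith
      · have h3 : η^3 ≤ (a:ℝ)^3 := by gcongr
        have h4 : η^3*((p.1:ℝ)^4*(p.2:ℝ)^5) ≤ η^3*η^6 :=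
          calc _ ≤ (a:ℝ)^3*((p.1:ℝ)^4*(p.2:ℝ)^5) := by gcongr
            _ ≤ η^9 := by linarith
            _ = _ := by ring
        exact le_of_mul_le_mul_left h4 (by positivity)
    · rintro ⟨⟨ha, h3⟩, h1, h2, h⟩
      have h1' : (0:ℝ) < p.1 := mod_cast h1
      have h2' : (0:ℝ) < p.2 := mod_cast h2
      have a0 : (0:ℝ) < a := η0.trans ha
      rw [le_floor_iff (by positivity), le_cubeRoot_iff η0 a0.le h1' h2'] at h3
      refine ⟨⟨ha, ?_⟩, h1, h2, ?_⟩
      · rw [le_floor_iff (by positivity)]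
        have a1 : (1:ℝ) ≤ a := hη.trans ha.le
        have e1 : (a:ℝ) ≤ (a:ℝ)^3 := le_self_pow₀ a1 (by norm_num)
        have e2 : (1:ℝ) ≤ (p.1:ℝ)^4*(p.2:ℝ)^5 := by
          exact_mod_cast Nat.mul_pos (pow_pos h1 4) (pow_pos h2 5)
        nlinarith
      · rw [le_div_iff₀ (by positivity)]; linarith

/-- A generic form of the remainders arising in `remSum`. -/
def blockTerm (θ η:ℝ) (a:ℕ) : ℝ := ∑ b ∈ Icc 1 ⌊η*(a:ℝ)^(-1/3:ℝ)⌋₊,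
    rr b*Es ((η^(3*θ)*(b:ℝ)^(-(3*θ-1/2))*(a:ℝ)^(-θ))^2)

lemma remSum_eq_blockTerm {η : ℝ} (hη : 0 < η) {a : ℕ} (ha : 1 ≤ a) :
    remSum (η*(a:ℝ)^(-1/3:ℝ)) = blockTerm (3/10) η a+blockTerm (3/8) η a := by
  have a0 : (0:ℝ) < a := mod_cast ha
  have p0 : 0 < η*(a:ℝ)^(-1/3:ℝ) := by positivity
  unfold remSum blockTerm
  congr 1
  · refine sum_congr rfl fun b hb => ?_
    have b0 := (mem_Icc_floor p0.le hb).1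
    have := root5_rpow p0 b0 1
    rw [rpow_one] at this
    rw [this, mul_rpow hη.le (by positivity), mul_pow, mul_pow, ← rpow_mul a0.le]
    simp only [← rpow_natCast, ← rpow_mul hη.le, ← rpow_mul a0.le, ← rpow_mul b0.le]
    norm_num
    left; congr 1; ring
  · refine sum_congr rfl fun b hb => ?_
    have b0 := (mem_Icc_floor p0.le hb).1
    have := root4_rpow p0 b0 1
    rw [rpow_one] at this
    rw [this, mul_rpow hη.le (by positivity), mul_pow, mul_pow, ← rpow_mul a0.le]
    simp only [← rpow_natCast, ← rpow_mul hη.le, ← rpow_mul a0.le, ← rpow_mul b0.le]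
    norm_num
    left; congr 1; ring

lemma le_mul_rpow_neg_third_iff {η a b : ℝ} (hη : 0 < η) (ha : 0 < a) (hb : 0 < b) :
    b ≤ η*a^(-1/3:ℝ) ↔ a ≤ (η/b)^3 := by
  have e : (η*a^(-1/3:ℝ))^3 = η^3/a := by
    have : (a^(-1/3:ℝ))^3 = a⁻¹ := by
      rw [← rpow_natCast, ← rpow_mul ha.le, ← Real.rpow_neg_one]; norm_num
    rw [mul_pow, this, div_eq_mul_inv]
  rw [← pow_le_pow_iff_left₀ hb.le (by positivity) (n := 3) (by norm_num), e, div_pow,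
    le_div_iff₀ ha, le_div_iff₀ (by positivity), mul_comm]

lemma exists_block_le {θ : ℝ} (h1 : 3/10 ≤ θ) (h2 : θ ≤ 3/8) : ∃ C : ℝ, 0 < C ∧ ∀ η, 1 ≤ η →
    ∀ A M : ℕ, 1 ≤ A → (A:ℝ) ≤ η → M ≤ 2*A →
    |∑ a ∈ Ico (A+1) (M+1), blockTerm θ η a| ≤ C*η^((3:ℝ)/2) := by
  obtain ⟨C, hC, HC⟩ := exists_sum_latE_le
  obtain ⟨K, hK, HK⟩ := exists_rrSum_le (u := 3*θ-1/2) (by linarith)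
  obtain ⟨L, hL, HL⟩ := exists_rrSum_le (u := -((3*θ-1/2)/2)) (by linarith)
  refine ⟨C*K+C*L, by positivity, fun η hη A M hA hAη hM => ?_⟩
  have η0 : 0 < η := by linarith
  have A0 : (0:ℝ) < A := mod_cast hA
  set B := ⌊η*(A:ℝ)^(-1/3:ℝ)⌋₊ with hB
  set u := 3*θ-1/2 with hu
  have swap : ∑ a ∈ Ico (A+1) (M+1), blockTerm θ η a =
      ∑ b ∈ Icc 1 B, rr b*∑ a ∈ Ico (A+1) (min M ⌊(η/b)^3⌋₊ + 1),
        Es ((η^(3*θ)*(b:ℝ)^(-u)*(a:ℝ)^(-θ))^2) := by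
    simp only [blockTerm, mul_sum]
    refine sum_comm' fun a b => ?_
    simp only [mem_Ico, mem_Icc]
    constructor
    · rintro ⟨⟨ha, haM⟩, hb, hb'⟩
      have a0 : (0:ℝ) < a := mod_cast (by omega : 0 < a)
      have b0 : (0:ℝ) < b := mod_cast hb
      have hAa : (A:ℝ) ≤ a := mod_cast (by omega : A ≤ a)
      rw [le_floor_iff (by positivity)] at hb'
      have hb2 := (le_mul_rpow_neg_third_iff η0 a0 b0).1 hb'
      have hb3 := (le_mul_rpow_neg_third_iff η0 A0 b0).2 (hAa.trans hb2)
      have := le_floor hb2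
      exact ⟨⟨ha, by omega⟩, hb, le_floor hb3⟩
    · rintro ⟨⟨ha, haM⟩, hb, hb'⟩
      have a0 : (0:ℝ) < a := mod_cast (by omega : 0 < a)
      have b0 : (0:ℝ) < b := mod_cast hb
      have h3 : a ≤ ⌊(η/b)^3⌋₊ := by omega
      rw [le_floor_iff (by positivity), ← le_mul_rpow_neg_third_iff η0 a0 b0] at h3
      exact ⟨⟨ha, by omega⟩, hb, le_floor h3⟩
  rw [swap]
  refine (abs_sum_le_sum_abs _ _).trans ?_
  have bound : ∀ b ∈ Icc 1 B, |rr b*∑ a ∈ Ico (A+1) (min M ⌊(η/b)^3⌋₊ + 1),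
        Es ((η^(3*θ)*(b:ℝ)^(-u)*(a:ℝ)^(-θ))^2)| ≤
      C*η^(3*θ)*(A:ℝ)^(1/2-θ)*(rr b*(b:ℝ)^(-u)) +
      C*η^(-(3*θ/2))*(A:ℝ)^(1+θ/2)*(rr b*(b:ℝ)^(-(-(u/2)))) := by
    intro b hb
    have b0 : (0:ℝ) < b := mod_cast (mem_Icc.1 hb).1
    have hr := rr_nonneg b
    have c0 : 0 < η^(3*θ)*(b:ℝ)^(-u) := by positivity
    rw [sum_Ico_eq_sum_range, abs_mul, abs_of_nonneg hr]
    have h3 := HC h1 h2 c0 (A := A) (N := min M ⌊(η/b)^3⌋₊ + 1-(A+1)) hA (by omega)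
    have h4 : ∑ k ∈ range (min M ⌊(η/b)^3⌋₊ + 1-(A+1)),
        Es ((η^(3*θ)*(b:ℝ)^(-u)*((A+1+k:ℕ):ℝ)^(-θ))^2) =
        (∑ n ∈ range (min M ⌊(η/b)^3⌋₊ + 1-(A+1)),
        latE ((η^(3*θ)*(b:ℝ)^(-u)*((A:ℝ)+1+n)^(-θ))^2))/6 := by
      rw [sum_div]
      refine sum_congr rfl fun n _ => ?_
      push_cast; rfl
    rw [h4, abs_div, abs_of_pos (by norm_num : (0:ℝ) < 6)]
    have h5 : ∀ x y : ℝ, 0 ≤ x → x ≤ y → rr b*(x/6) ≤ rr b*y := fun x y hx hxy =>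
      mul_le_mul_of_nonneg_left (by linarith) hr
    refine (h5 _ _ (abs_nonneg _) h3).trans (le_of_eq ?_)
    have e1 : (A:ℝ)^(-θ)*√(A:ℝ) = (A:ℝ)^(1/2-θ) := by
      rw [sqrt_eq_rpow, ← rpow_add A0]; congr 1; ring
    have e2 : (A:ℝ)/√(η^(3*θ)*(b:ℝ)^(-u)*(A:ℝ)^(-θ)) =
        η^(-(3*θ/2))*(A:ℝ)^(1+θ/2)*(b:ℝ)^(-(-(u/2))) := by
      rw [sqrt_eq_rpow, mul_rpow c0.le (by positivity), mul_rpow (by positivity) (by positivity),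
        ← rpow_mul η0.le, ← rpow_mul b0.le, ← rpow_mul A0.le, div_eq_mul_inv, mul_inv, mul_inv,
        ← rpow_neg η0.le, ← rpow_neg b0.le, ← rpow_neg A0.le, rpow_add A0, rpow_one]
      have f1 : -(3*θ*(1/2)) = -(3*θ/2) := by ring
      have f2 : -(-u*(1/2)) = -(-(u/2)) := by ring
      have f3 : -(-θ*(1/2)) = θ/2 := by ring
      rw [f1, f2, f3]; ring
    rw [e2]
    linear_combination rr b*C*(η^(3*θ)*(b:ℝ)^(-u))*e1
  refine (sum_le_sum bound).trans ?_
  rw [sum_add_distrib, ← mul_sum, ← mul_sum]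
  have g1 := HK (η*(A:ℝ)^(-1/3:ℝ)) (by positivity)
  have g2 := HL (η*(A:ℝ)^(-1/3:ℝ)) (by positivity)
  rw [rrSum, ← hB] at g1 g2
  have m1 : C*η^(3*θ)*(A:ℝ)^(1/2-θ)*∑ b ∈ Icc 1 B, rr b*(b:ℝ)^(-u) ≤ C*K*η^((3:ℝ)/2) := by
    refine (mul_le_mul_of_nonneg_left g1 (by positivity)).trans (le_of_eq ?_)
    rw [mul_rpow η0.le (by positivity), ← rpow_mul A0.le]
    have f1 : η^(3*θ)*η^(1-u) = η^((3:ℝ)/2) := by rw [← rpow_add η0]; congr 1; rw [hu]; ring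
    have f2 : (A:ℝ)^(1/2-θ)*(A:ℝ)^(-1/3*(1-u)) = 1 := by
      rw [← rpow_add A0, show 1/2-θ + -1/3*(1-u) = 0 by rw [hu]; ring, rpow_zero]
    linear_combination C*K*(η^(3*θ)*η^(1-u))*f2+C*K*f1
  have m2 : C*η^(-(3*θ/2))*(A:ℝ)^(1+θ/2) *
      ∑ b ∈ Icc 1 B, rr b*(b:ℝ)^(-(-(u/2))) ≤ C*L*η^((3:ℝ)/2) := by
    refine (mul_le_mul_of_nonneg_left g2 (by positivity)).trans ?_
    rw [mul_rpow η0.le (by positivity), ← rpow_mul A0.le]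
    have f1 : η^(-(3*θ/2))*η^(1 - -(u/2)) = η^((3:ℝ)/4) := by
      rw [← rpow_add η0]; congr 1; rw [hu]; ring
    have f2 : (A:ℝ)^(1+θ/2)*(A:ℝ)^(-1/3*(1 - -(u/2))) = (A:ℝ)^((3:ℝ)/4) := by
      rw [← rpow_add A0]; congr 1; rw [hu]; ring
    have f3 : (A:ℝ)^((3:ℝ)/4) ≤ η^((3:ℝ)/4) := rpow_le_rpow A0.le hAη (by norm_num)
    have f4 : η^((3:ℝ)/4)*η^((3:ℝ)/4) = η^((3:ℝ)/2) := by rw [← rpow_add η0]; norm_num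
    calc _ = C*L*((η^(-(3*θ/2))*η^(1 - -(u/2))) *
          ((A:ℝ)^(1+θ/2)*(A:ℝ)^(-1/3*(1 - -(u/2))))) := by ring
      _ = C*L*(η^((3:ℝ)/4)*(A:ℝ)^((3:ℝ)/4)) := by rw [f1, f2]
      _ ≤ C*L*(η^((3:ℝ)/4)*η^((3:ℝ)/4)) := by gcongr
      _ = _ := by rw [f4]
  linarith

lemma exists_blockTerm_one_le {θ : ℝ} (h1 : 3/10 ≤ θ) (h2 : θ ≤ 3/8) : ∃ C : ℝ, 0 < C ∧
    ∀ η, 1 ≤ η → |blockTerm θ η 1| ≤ C*η^((3:ℝ)/2) := by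
  obtain ⟨C, hC, HE⟩ := exists_Es_le
  obtain ⟨K, hK, HK⟩ := exists_rrSum_le (u := (3*θ-1/2)*2/3) (by linarith)
  refine ⟨C*K, by positivity, fun η hη => ?_⟩
  have η0 : 0 < η := by linarith
  simp only [blockTerm, cast_one, one_rpow, mul_one]
  refine (abs_sum_le_sum_abs _ _).trans ?_
  have bound : ∀ b ∈ Icc 1 ⌊η⌋₊, |rr b*Es ((η^(3*θ)*(b:ℝ)^(-(3*θ-1/2)))^2)| ≤
      C*η^(2*θ)*(rr b*(b:ℝ)^(-((3*θ-1/2)*2/3))) := by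
    intro b hb
    obtain ⟨b0, bη⟩ := mem_Icc_floor η0.le hb
    have hr := rr_nonneg b
    have x1 : 1 ≤ η^(3*θ)*(b:ℝ)^(-(3*θ-1/2)) := by
      have e1 : (b:ℝ)^(3*θ-1/2) ≤ η^(3*θ) := (rpow_le_rpow b0.le bη (by linarith)).trans
          (rpow_le_rpow_of_exponent_le hη (by linarith))
      rw [rpow_neg b0.le, ← div_eq_mul_inv, one_le_div (by positivity)]; exact e1
    have e := HE _ (one_le_pow₀ x1 (n := 2))
    rw [abs_mul, abs_of_nonneg hr]
    refine (mul_le_mul_of_nonneg_left e hr).trans (le_of_eq ?_)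
    rw [← rpow_natCast (η^(3*θ)*_), ← rpow_mul (by positivity),
      mul_rpow (by positivity) (by positivity), ← rpow_mul η0.le, ← rpow_mul b0.le]
    have f1 : 3*θ*(((2:ℕ):ℝ)*(1/3)) = 2*θ := by push_cast; ring
    have f2 : -(3*θ-1/2)*(((2:ℕ):ℝ)*(1/3)) = -((3*θ-1/2)*2/3) := by push_cast; ring
    rw [f1, f2]; ring
  refine (sum_le_sum bound).trans ?_
  rw [← mul_sum]
  refine (mul_le_mul_of_nonneg_left (HK η η0.le) (by positivity)).trans ?_
  calc C*η^(2*θ)*(K*η^(1-(3*θ-1/2)*2/3)) = C*K*(η^(2*θ)*η^(1-(3*θ-1/2)*2/3)) := by ring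
    _ = C*K*η^((4:ℝ)/3) := by rw [← rpow_add η0]; congr 2; ring
    _ ≤ C*K*η^((3:ℝ)/2) := by
      have := rpow_le_rpow_of_exponent_le hη (by norm_num : (4:ℝ)/3 ≤ 3/2)
      gcongr

/-- Dyadic summation: a logarithmic loss. -/
lemma exists_sum_blockTerm_le {θ : ℝ} (h1 : 3/10 ≤ θ) (h2 : θ ≤ 3/8) : ∃ C : ℝ, 0 < C ∧
    ∀ η, 1 ≤ η → |∑ a ∈ Icc 1 ⌊η⌋₊, blockTerm θ η a| ≤ C*(η^((3:ℝ)/2)*(1+log η)) := by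
  obtain ⟨C, hC, HC⟩ := exists_block_le h1 h2
  obtain ⟨D, hD, HD⟩ := exists_blockTerm_one_le h1 h2
  refine ⟨(C+D)*4, by positivity, fun η hη => ?_⟩
  have η0 : 0 < η := by linarith
  have main : ∀ k m : ℕ, 1 ≤ m → (m:ℝ) ≤ η → m ≤ 2^k →
      |∑ a ∈ Icc 1 m, blockTerm θ η a| ≤ (C+D)*η^((3:ℝ)/2)*(k+1) := by
    have p0 : 0 < η^((3:ℝ)/2) := by positivity
    intro k
    induction k with
    | zero =>
      intro m h1 _ h3
      have : m = 1 := by simp at h3; omega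
      subst this
      have := HD η hη
      simp only [Icc_self, sum_singleton, Nat.cast_zero, zero_add, mul_one]
      nlinarith
    | succ k ih =>
      intro m h1 h2 h3
      by_cases hm : m ≤ 2^k
      · refine (ih m h1 h2 hm).trans ?_
        push_cast
        have : 0 < (C+D)*η^((3:ℝ)/2) := by positivity
        linarith
      · push Not at hm
        have hs : Icc 1 m = Icc 1 (2^k) ∪ Ico (2^k+1) (m+1) := by
          ext a; simp only [mem_Icc, mem_union, mem_Ico]
          have := Nat.one_le_two_pow (n := k); omega
        have hd : Disjoint (Icc 1 (2^k)) (Ico (2^k+1) (m+1)) := by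
          rw [disjoint_left]; intro a; simp only [mem_Icc, mem_Ico]; omega
        rw [hs, sum_union hd]
        have hk : ((2^k:ℕ):ℝ) ≤ η := le_trans (mod_cast hm.le) h2
        have i1 := ih (2^k) Nat.one_le_two_pow hk le_rfl
        have i2 := HC η hη (2^k) m Nat.one_le_two_pow hk (by rw [pow_succ] at h3; omega)
        refine (abs_add_le _ _).trans ?_
        push_cast
        nlinarith
  have hfl : 1 ≤ ⌊η⌋₊ := le_floor (by simpa using hη)
  have hpow : ⌊η⌋₊ < 2^(Nat.log 2 ⌊η⌋₊ + 1) := Nat.lt_pow_succ_log_self (by norm_num) _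
  have := main _ _ hfl (floor_le η0.le) hpow.le
  refine this.trans ?_
  have hlog : (Nat.log 2 ⌊η⌋₊:ℝ)*log 2 ≤ log η := by
    rw [← log_pow]
    refine log_le_log (by positivity) ?_
    have := Nat.pow_log_le_self 2 (x := ⌊η⌋₊) (by omega)
    have h' : ((2^Nat.log 2 ⌊η⌋₊:ℕ):ℝ) ≤ ⌊η⌋₊ := mod_cast this
    push_cast at h'
    exact h'.trans (floor_le η0.le)
  have hl2 : 1/2 < log 2 := by have := Real.log_two_gt_d9; linarith
  have : ((Nat.log 2 ⌊η⌋₊ + 1:ℕ):ℝ)+1 ≤ 4*(1+log η) := by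
    push_cast
    nlinarith
  calc _ ≤ (C+D)*η^((3:ℝ)/2)*(4*(1+log η)) := by gcongr
    _ = _ := by ring

lemma exists_sum_remSum_le : ∃ C : ℝ, 0 < C ∧ ∀ η, 1 ≤ η →
    |∑ a ∈ Icc 1 ⌊η⌋₊, remSum (η*(a:ℝ)^(-1/3:ℝ))| ≤ C*(η^((3:ℝ)/2)*(1+log η)) := by
  obtain ⟨C, hC, HC⟩ := exists_sum_blockTerm_le (θ := 3/10) (by norm_num) (by norm_num)
  obtain ⟨D, hD, HD⟩ := exists_sum_blockTerm_le (θ := 3/8) (by norm_num) (by norm_num)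
  refine ⟨C+D, by positivity, fun η hη => ?_⟩
  rw [sum_congr rfl fun a ha => remSum_eq_blockTerm (by linarith) (mem_Icc.1 ha).1,
    sum_add_distrib, add_mul]
  exact (abs_add_le _ _).trans (add_le_add (HC η hη) (HD η hη))

lemma exists_powSum_asymp {u : ℝ} (hu : 0 < u) (hu1 : u ≠ 1) : ∃ J K : ℝ, 0 < K ∧ ∀ x, 1 ≤ x →
    ∃ δ, |δ| ≤ K ∧ ∑ n ∈ Icc 1 ⌊x⌋₊, (n:ℝ)^(-u) = J+x^(1-u)/(1-u)+δ*x^(-u) := by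
  obtain ⟨J, K, hK, h⟩ := exists_sum_rpow_neg hu hu1
  refine ⟨J, K, hK, fun x hx => ?_⟩
  have x0 : 0 < x^(-u) := rpow_pos_of_pos (by linarith) _
  refine ⟨(∑ n ∈ Icc 1 ⌊x⌋₊, (n:ℝ)^(-u)-(J+x^(1-u)/(1-u)))/x^(-u), ?_, ?_⟩
  · rw [abs_div, abs_of_pos x0, div_le_iff₀ x0]; exact h x hx
  · field_simp; ring

/-- The contribution of `a ≤ η` to `tripleCount (η ^ 9)`. -/
lemma exists_sum_pairCount_asymp {C45 C54 K45 K54 : ℝ}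
    (h45 : RRAsymp (4/5) C45 K45) (h54 : RRAsymp (5/4) C54 K54) :
    ∃ J35 J34 K : ℝ, 0 < K ∧ ∀ η, 1 ≤ η →
    |∑ a ∈ Icc 1 ⌊η⌋₊, pairCount (η^9/(a:ℝ)^3)-(kap*C45*(J35*η^((9:ℝ)/5)+5/2*η^((11:ℝ)/5)) +
       kap*C54*(J34*η^((9:ℝ)/4)+4*η^((5:ℝ)/2)))| ≤
       K*(η^((3:ℝ)/2)*(1+log η)) := by
  obtain ⟨K, hK, HK⟩ := exists_pairs_asymp h45 h54
  obtain ⟨J35, K35, hK35, H35⟩ := exists_powSum_asymp (u := 3/5) (by norm_num) (by norm_num)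
  obtain ⟨J34, K34, hK34, H34⟩ := exists_powSum_asymp (u := 3/4) (by norm_num) (by norm_num)
  obtain ⟨J14, K14, hK14, H14⟩ := exists_powSum_asymp (u := 1/4) (by norm_num) (by norm_num)
  obtain ⟨R, hR, HR⟩ := exists_sum_remSum_le
  refine ⟨J35, J34, |kap*C45| * K35 + |kap*C54| * K34+R+K*(|J14| + 4/3+K14),
    by positivity, fun η hη => ?_⟩
  have η0 : 0 < η := by linarith
  have hl : 0 ≤ log η := log_nonneg hη
  obtain ⟨d1, hd1, e1⟩ := H35 η hη
  obtain ⟨d2, hd2, e2⟩ := H34 η hη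
  obtain ⟨d3, hd3, e3⟩ := H14 η hη
  replace HR := HR η hη
  have m : ∀ a b c : ℝ, a+b = c → η^a*η^b = η^c := fun a b c h => by rw [← rpow_add η0, h]
  have q : ∀ a ∈ Icc 1 ⌊η⌋₊, |pairCount (η^9/(a:ℝ)^3)-(kap*C45*η^((9:ℝ)/5)*(a:ℝ)^(-(3/5):ℝ) +
       kap*C54*η^((9:ℝ)/4)*(a:ℝ)^(-(3/4):ℝ)+remSum (η*(a:ℝ)^(-1/3:ℝ)))| ≤
       K*η^((3:ℝ)/4)*(a:ℝ)^(-(1/4):ℝ) := by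
    intro a ha
    obtain ⟨a0, aη⟩ := mem_Icc_floor η0.le ha
    have a1 : (1:ℝ) ≤ a := mod_cast (mem_Icc.1 ha).1
    have hβ : 1 ≤ η*(a:ℝ)^(-1/3:ℝ) := by
      rw [le_mul_rpow_neg_third_iff η0 a0 one_pos, div_one]
      exact aη.trans (le_self_pow₀ hη (by norm_num))
    have h := HK _ hβ
    rw [mul_rpow_neg_third_pow a0] at h
    simp only [mul_rpow η0.le (rpow_nonneg a0.le _), ← rpow_mul a0.le] at h
    have f1 : (-1/3*(9/5):ℝ) = -(3/5) := by norm_num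
    have f2 : (-1/3*(9/4):ℝ) = -(3/4) := by norm_num
    have f3 : (-1/3*(3/4):ℝ) = -(1/4) := by norm_num
    rw [f1, f2, f3] at h
    rw [pairCount, mul_assoc (kap*C45), mul_assoc (kap*C54), mul_assoc K]
    exact h
  have q2 := (abs_sum_le_sum_abs _ _).trans (sum_le_sum q)
  rw [sum_sub_distrib, sum_add_distrib, sum_add_distrib, ← mul_sum,
    ← mul_sum, ← mul_sum, e1, e2, e3] at q2
  have a1 := m (9/5) (1-3/5) (11/5) (by norm_num)
  have a2 := m (9/5) (-(3/5)) (6/5) (by norm_num)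
  have a3 := m (9/4) (1-3/4) (5/2) (by norm_num)
  have a4 := m (9/4) (-(3/4)) (3/2) (by norm_num)
  have a5 := m (3/4) (1-1/4) (3/2) (by norm_num)
  have a6 := m (3/4) (-(1/4)) (1/2) (by norm_num)
  have t1 : |(kap*C45*d1)*η^((6:ℝ)/5)| ≤ |kap*C45| * K35*η^((3:ℝ)/2) := by
    refine abs_mul_rpow_le hη ?_ (by norm_num)
    rw [abs_mul]; gcongr
  have t2 : |(kap*C54*d2)*η^((3:ℝ)/2)| ≤ |kap*C54| * K34*η^((3:ℝ)/2) := by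
    refine abs_mul_rpow_le hη ?_ le_rfl
    rw [abs_mul]; gcongr
  have t3 : K*η^((3:ℝ)/4)*(J14+η^(1-1/4:ℝ)/(1-1/4)+d3*η^(-(1/4):ℝ)) ≤
      K*(|J14| + 4/3+K14)*η^((3:ℝ)/2) := by
    have u1 := abs_le.1 (abs_mul_rpow_le (e := 3/4) (e' := 3/2) hη (le_refl |J14|) (by norm_num))
    have u2 := abs_le.1 (abs_mul_rpow_le (e := 1/2) (e' := 3/2) hη hd3 (by norm_num))
    have : η^((3:ℝ)/4)*(J14+η^(1-1/4:ℝ)/(1-1/4)+d3*η^(-(1/4):ℝ)) =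
      J14*η^((3:ℝ)/4)+4/3*η^((3:ℝ)/2)+d3*η^((1:ℝ)/2) := by
      linear_combination 4/3*a5+d3*a6
    rw [mul_assoc, mul_assoc, this]
    refine mul_le_mul_of_nonneg_left ?_ hK.le
    linarith
  have p1 : η^((3:ℝ)/2) ≤ η^((3:ℝ)/2)*(1+log η) := by nlinarith
  have key : ∑ a ∈ Icc 1 ⌊η⌋₊, pairCount (η^9/(a:ℝ)^3) -
      (kap*C45*(J35*η^((9:ℝ)/5)+5/2*η^((11:ℝ)/5))+kap*C54*(J34*η^((9:ℝ)/4)+4*η^((5:ℝ)/2))) =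
     (∑ a ∈ Icc 1 ⌊η⌋₊, pairCount (η^9/(a:ℝ)^3) -
      (kap*C45*η^((9:ℝ)/5)*(J35+η^(1-3/5:ℝ)/(1-3/5)+d1*η^(-(3/5):ℝ)) +
       kap*C54*η^((9:ℝ)/4)*(J34+η^(1-3/4:ℝ)/(1-3/4)+d2*η^(-(3/4):ℝ)) +
       ∑ a ∈ Icc 1 ⌊η⌋₊, remSum (η*(a:ℝ)^(-1/3:ℝ)))) +
      (kap*C45*d1)*η^((6:ℝ)/5)+(kap*C54*d2)*η^((3:ℝ)/2) +
      ∑ a ∈ Icc 1 ⌊η⌋₊, remSum (η*(a:ℝ)^(-1/3:ℝ)) := by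
    linear_combination kap*C45*(5/2)*a1+kap*C45*d1*a2+kap*C54*4*a3+kap*C54*d2*a4
  rw [key]
  have q3 := q2.trans t3
  have bnd : ∀ c : ℝ, 0 ≤ c → c*η^((3:ℝ)/2) ≤ c*(η^((3:ℝ)/2)*(1+log η)) :=
    fun c hc => mul_le_mul_of_nonneg_left p1 hc
  have b1 := bnd (|kap*C45| * K35) (by positivity)
  have b2 := bnd (|kap*C54| * K34) (by positivity)
  have b3 := bnd (K*(|J14| + 4/3+K14)) (by positivity)
  rw [abs_le] at q3 t1 t2 HR ⊢
  constructor <;> linarith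

theorem exists_tripleCount_asymp : ∃ c3 c4 c5 K : ℝ, 0 < K ∧ ∀ η, 1 ≤ η →
    |tripleCount (η^9)-(c3*η^3+c4*η^((9:ℝ)/4)+c5*η^((9:ℝ)/5))| ≤
       K*(η^((3:ℝ)/2)*(1+log η)) := by
  obtain ⟨C45, K45, h45⟩ := exists_rrSum_asymp (s := 4/5) (by norm_num) (by norm_num)
  obtain ⟨C54, K54, h54⟩ := exists_rrSum_asymp (s := 5/4) (by norm_num) (by norm_num)
  obtain ⟨C43, K43, h43⟩ := exists_rrSum_asymp (s := 4/3) (by norm_num) (by norm_num)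
  obtain ⟨C53, K53, h53⟩ := exists_rrSum_asymp (s := 5/3) (by norm_num) (by norm_num)
  obtain ⟨J35, J34, K1, hK1, H1⟩ := exists_sum_pairCount_asymp h45 h54
  obtain ⟨K2, hK2, H2⟩ := exists_pairSum_asymp h45 h54 h43 h53
  obtain ⟨K3, hK3, H3⟩ := exists_pairs_asymp h45 h54
  obtain ⟨K4, hK4, H4⟩ := exists_blockTerm_one_le (θ := 3/10) (by norm_num) (by norm_num)
  obtain ⟨K5, hK5, H5⟩ := exists_blockTerm_one_le (θ := 3/8) (by norm_num) (by norm_num)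
  refine ⟨C43*C53, kap*C54*J34, kap*C45*J35, K1+K2+K3 +
    2*(|kap*C45| + |kap*C54| + K4+K5+K3), by positivity, fun η hη => ?_⟩
  have η0 : 0 < η := by linarith
  have hl : 0 ≤ log η := log_nonneg hη
  set β := η^((2:ℝ)/3) with hβ
  have β1 : 1 ≤ β := one_le_rpow hη (by norm_num)
  have hr : ∀ e : ℝ, β^e = η^(2/3*e) := fun e => by rw [hβ, ← rpow_mul η0.le]
  have hβ9 : β^9 = η^6 := by rw [← rpow_natCast, hr, ← rpow_natCast]; norm_num
  replace H1 := H1 η hη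
  replace H2 := H2 β β1
  replace H3 := H3 β β1
  replace H4 := H4 β β1
  replace H5 := H5 β β1
  have hrem : remSum β = blockTerm (3/10) β 1+blockTerm (3/8) β 1 := by
    have := remSum_eq_blockTerm (η := β) (by linarith) (a := 1) le_rfl
    simpa using this
  change |pairCount (β^9)-_| ≤ _ at H3
  rw [hβ9] at H2 H3
  rw [hr, hr, hr, hr, show (2/3*(-6/5):ℝ) = -4/5 by norm_num,
    show (2/3*(-3/4):ℝ) = -1/2 by norm_num, show (2/3*(-3):ℝ) = -2 by norm_num,
    show (2/3*(-9/4):ℝ) = -3/2 by norm_num] at H2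
  rw [hr, hr, hr, show (2/3*(9/5):ℝ) = 6/5 by norm_num,
    show (2/3*(9/4):ℝ) = 3/2 by norm_num, show (2/3*(3/4):ℝ) = 1/2 by norm_num] at H3
  rw [hr, show (2/3*(3/2):ℝ) = 1 by norm_num] at H4 H5
  have m : ∀ a b c : ℝ, a+b = c → η^a*η^b = η^c := fun a b c h => by rw [← rpow_add η0, h]
  have e3 : η^(3:ℝ) = η^3 := by rw [← rpow_natCast]; norm_num
  have a1 := m 3 (-4/5) (11/5) (by norm_num)
  have a2 := m 3 (-1/2) (5/2) (by norm_num)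
  have a3 := m 3 (-2) 1 (by norm_num)
  have a4 := m 3 (-3/2) (3/2) (by norm_num)
  have b1 := m 1 (6/5) (11/5) (by norm_num)
  have b2 := m 1 (3/2) (5/2) (by norm_num)
  have b3 := m 1 (1/2) (3/2) (by norm_num)
  rw [e3] at a1 a2 a3 a4
  rw [rpow_one] at a3 b1 b2 b3 H4 H5
  set w : ℕ × ℕ → ℝ := fun p => rr p.1*rr p.2 with hw
  set x : ℕ × ℕ → ℝ := fun p => η^3*((p.1:ℝ)^(-(4/3):ℝ)*(p.2:ℝ)^(-(5/3):ℝ)) with hx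
  have w0 : ∀ p, 0 ≤ w p := fun p => mul_nonneg (rr_nonneg _) (rr_nonneg _)
  have hT := tripleCount_eq hη
  set S := ∑ a ∈ Icc 1 ⌊η⌋₊, pairCount (η^9/(a:ℝ)^3)
  change _ = S+∑ p ∈ pairs (η^6), w p*((⌊x p⌋₊:ℝ)-(⌊η⌋₊:ℝ)) at hT
  have hfloor : |∑ p ∈ pairs (η^6), w p*((⌊x p⌋₊:ℝ)-(⌊η⌋₊:ℝ)) -
      (η^3*pairSum (η^6)-η*pairCount (η^6))| ≤ 2*pairCount (η^6) := by
    have : ∑ p ∈ pairs (η^6), w p*((⌊x p⌋₊:ℝ)-(⌊η⌋₊:ℝ)) -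
      (η^3*pairSum (η^6)-η*pairCount (η^6)) =
      ∑ p ∈ pairs (η^6), w p*(((⌊x p⌋₊:ℝ)-x p)-((⌊η⌋₊:ℝ)-η)) := by
      rw [pairSum, pairCount, mul_sum, mul_sum, ← sum_sub_distrib, ← sum_sub_distrib]
      refine sum_congr rfl fun p _ => ?_
      simp only [hw, hx]; ring
    rw [this, pairCount, mul_sum]
    refine (abs_sum_le_sum_abs _ _).trans (sum_le_sum fun p _ => ?_)
    rw [abs_mul, abs_of_nonneg (w0 p), mul_comm]
    refine mul_le_mul_of_nonneg_right ?_ (w0 p)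
    have x0 : 0 ≤ x p := by positivity
    have f1 := floor_le x0
    have f2 := lt_floor_add_one (x p)
    have f3 := floor_le η0.le
    have f4 := lt_floor_add_one η
    rw [abs_le]; constructor <;> linarith
  have p0 : 0 < η^((3:ℝ)/2) := by positivity
  have p1 : η^((3:ℝ)/2) ≤ η^((3:ℝ)/2)*(1+log η) := by nlinarith
  have pη : η ≤ η^((3:ℝ)/2) := by
    simpa using rpow_le_rpow_of_exponent_le hη (by norm_num : (1:ℝ) ≤ 3/2)
  have pc : pairCount (η^6) ≤ (|kap*C45| + |kap*C54| + K4+K5+K3)*η^((3:ℝ)/2) := by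
    have u1 := abs_le.1 (abs_mul_rpow_le (e := 6/5) (e' := 3/2) hη (le_refl |kap*C45|) (by norm_num))
    have u2 := abs_le.1 (abs_mul_rpow_le (e := 3/2) (e' := 3/2) hη (le_refl |kap*C54|) (by norm_num))
    have u3 : η^((1:ℝ)/2) ≤ η^((3:ℝ)/2) := rpow_le_rpow_of_exponent_le hη (by norm_num)
    have v1 := (abs_le.1 H3).2
    have v4 := (abs_le.1 H4).2
    have v5 := (abs_le.1 H5).2
    have v6 := mul_le_mul_of_nonneg_left u3 hK3.le
    have v7 := mul_le_mul_of_nonneg_left pη hK4.le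
    have v8 := mul_le_mul_of_nonneg_left pη hK5.le
    rw [hrem] at v1
    linarith
  have η3 : 0 < η^3 := by positivity
  have H2' : |η^3*(pairSum (η^6)-(C43*C53-3/2*kap*C45*η^(-4/5:ℝ) -
      3*kap*C54*η^(-1/2:ℝ)+η^(-2:ℝ)*remSum β))| ≤ K2*η^((3:ℝ)/2) := by
    rw [abs_mul, abs_of_pos η3]
    refine (mul_le_mul_of_nonneg_left H2 η3.le).trans (le_of_eq ?_)
    linear_combination K2*a4
  have H3' : |η*(pairCount (η^6)-(kap*C45*η^((6:ℝ)/5)+kap*C54*η^((3:ℝ)/2) +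
      remSum β))| ≤ K3*η^((3:ℝ)/2) := by
    rw [abs_mul, abs_of_pos η0]
    refine (mul_le_mul_of_nonneg_left H3 η0.le).trans (le_of_eq ?_)
    linear_combination K3*b3
  have bnd : ∀ c : ℝ, 0 ≤ c → c*η^((3:ℝ)/2) ≤ c*(η^((3:ℝ)/2)*(1+log η)) :=
    fun c hc => mul_le_mul_of_nonneg_left p1 hc
  have n1 := bnd K2 hK2.le
  have n2 := bnd K3 hK3.le
  have n3 := bnd (|kap*C45| + |kap*C54| + K4+K5+K3) (by positivity)
  have key : tripleCount (η^9)-(C43*C53*η^3+kap*C54*J34*η^((9:ℝ)/4)+kap*C45*J35*η^((9:ℝ)/5)) =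
      (S-(kap*C45*(J35*η^((9:ℝ)/5)+5/2*η^((11:ℝ)/5)) +
       kap*C54*(J34*η^((9:ℝ)/4)+4*η^((5:ℝ)/2)))) +
      (∑ p ∈ pairs (η^6), w p*((⌊x p⌋₊:ℝ)-(⌊η⌋₊:ℝ)) -
      (η^3*pairSum (η^6)-η*pairCount (η^6))) +
      η^3*(pairSum (η^6)-(C43*C53-3/2*kap*C45*η^(-4/5:ℝ) -
      3*kap*C54*η^(-1/2:ℝ)+η^(-2:ℝ)*remSum β)) -
      η*(pairCount (η^6)-(kap*C45*η^((6:ℝ)/5)+kap*C54*η^((3:ℝ)/2) +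
      remSum β)) := by
    rw [hT]
    linear_combination -3/2*kap*C45*a1-3*kap*C54*a2+remSum β*a3-kap*C45*b1-kap*C54*b2
  rw [key]
  rw [abs_le] at H1 H2' H3' hfloor ⊢
  constructor <;> linarith

/-- The size of the error terms before convolution. -/
def errSize (Y:ℝ) : ℝ := if 1 ≤ Y then Y^((1:ℝ)/6)*(1+log Y) else Y^((1:ℝ)/5)

lemma errSize_nonneg {Y : ℝ} (hY : 0 < Y) : 0 ≤ errSize Y := by
  unfold errSize
  split_ifs with h
  · have := log_nonneg h; positivity
  · positivity

lemma exists_sum_rpow_le {u : ℝ} (hu : 1 < u) : ∃ C : ℝ, 0 < C ∧ ∀ s : Finset ℕ,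
    ∑ d ∈ s, (d:ℝ)^(-u) ≤ C := by
  have hs := Real.summable_nat_rpow (p := -u) |>.2 (by linarith)
  exact ⟨∑' n : ℕ, (n:ℝ)^(-u)+1, by positivity, fun s =>
    (hs.sum_le_tsum s fun _ _ => by positivity).trans (by linarith)⟩

/-- Tail bound for `∑ d^{-6/5}`. -/
lemma exists_sum_tail_le : ∃ C : ℝ, 0 < C ∧ ∀ y : ℝ, 1 ≤ y → ∀ N : ℕ,
    ∑ d ∈ (Icc 1 N).filter (fun d : ℕ => y < d), (d:ℝ)^(-(6/5):ℝ) ≤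
      C*y^(-(1/5):ℝ) := by
  obtain ⟨J, K, hK, H⟩ := exists_sum_rpow_neg (u := 6/5) (by norm_num) (by norm_num)
  refine ⟨5+2*K, by positivity, fun y hy N => ?_⟩
  have y0 : 0 < y := by linarith
  by_cases hN : (N:ℝ) < y
  · rw [filter_false_of_mem]
    · simp; positivity
    · intro d hd
      have : (d:ℝ) ≤ N := mod_cast (mem_Icc.1 hd).2
      push Not; linarith
  push Not at hN
  have hsub : (Icc 1 N).filter (fun d : ℕ => y < d) = Icc 1 N \ Icc 1 ⌊y⌋₊ := by
    ext d
    simp only [mem_filter, mem_sdiff, mem_Icc, not_and, not_le, floor_lt y0.le]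
    tauto
  have hle : Icc 1 ⌊y⌋₊ ⊆ Icc 1 N :=
    Icc_subset_Icc_right (by rw [← floor_natCast (R := ℝ) N]; exact Nat.floor_le_floor hN)
  have hs := sum_sdiff hle (f := fun d : ℕ => (d:ℝ)^(-(6/5):ℝ))
  rw [hsub]
  have h1 := abs_le.1 (H y hy)
  have h2 := abs_le.1 (H N (hy.trans hN))
  rw [floor_natCast] at h2
  have h3 : (N:ℝ)^(-(6/5):ℝ) ≤ y^(-(6/5):ℝ) := rpow_le_rpow_of_nonpos y0 hN (by norm_num)
  have h4 : y^(-(6/5):ℝ) ≤ y^(-(1/5):ℝ) := rpow_le_rpow_of_exponent_le hy (by norm_num)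
  have h5 : (0:ℝ) ≤ (N:ℝ)^(1-6/5:ℝ) := by positivity
  have e : (1-6/5:ℝ) = -(1/5) := by norm_num
  rw [e] at h1 h2 h5
  have h6 : K*(N:ℝ)^(-(6/5):ℝ) ≤ K*y^(-(1/5):ℝ) := mul_le_mul_of_nonneg_left (h3.trans h4) hK.le
  have h7 : K*y^(-(6/5):ℝ) ≤ K*y^(-(1/5):ℝ) := mul_le_mul_of_nonneg_left h4 hK.le
  linarith [h1.1, h2.2]

lemma exists_sum_errSize_le : ∃ C : ℝ, 0 < C ∧ ∀ Z X : ℝ, 0 < Z → Z ≤ X → 1 ≤ X → ∀ N : ℕ,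
    ∑ d ∈ Icc 1 N, errSize (Z/(d:ℝ)^6) ≤ C*(Z^((1:ℝ)/6)*(1+log X)^2) := by
  obtain ⟨C, hC, HC⟩ := exists_sum_tail_le
  obtain ⟨D, hD, HD⟩ := exists_sum_rpow_le (u := 6/5) (by norm_num)
  refine ⟨1+C+D, by positivity, fun Z X hZ hZX hX N => ?_⟩
  have hlX : 0 ≤ log X := log_nonneg hX
  have q1 : (1:ℝ) ≤ (1+log X)^2 := one_le_pow₀ (by linarith)
  have hdpow : ∀ d : ℕ, ((d:ℝ)^6)^((1:ℝ)/6) = d := fun d => by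
    rw [← rpow_natCast, ← rpow_mul (by positivity)]; norm_num
  have hdpow5 : ∀ d : ℕ, (Z/(d:ℝ)^6)^((1:ℝ)/5) = Z^((1:ℝ)/5)*(d:ℝ)^(-(6/5):ℝ) := fun d => by
    rw [div_rpow hZ.le (by positivity), ← rpow_natCast, ← rpow_mul (by positivity),
      div_eq_mul_inv, ← rpow_neg (by positivity)]
    norm_num
  have iff1 : ∀ d ∈ Icc 1 N, (1 ≤ Z/(d:ℝ)^6 ↔ (d:ℝ) ≤ Z^((1:ℝ)/6)) := fun d hd => by
    have d0 : (0:ℝ) < d := mod_cast (mem_Icc.1 hd).1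
    rw [one_le_div (by positivity)]
    have := le_root_iff (q := 6) (by norm_num) hZ.le d0.le
    exact_mod_cast this.symm
  by_cases hZ1 : 1 ≤ Z
  · set y := Z^((1:ℝ)/6) with hy
    have y1 : 1 ≤ y := one_le_rpow hZ1 (by norm_num)
    rw [← sum_filter_add_sum_filter_not (Icc 1 N) (fun d : ℕ => y < d), add_comm]
    have hlZ : log Z ≤ log X := log_le_log hZ hZX
    have hly : log y ≤ log X := by rw [hy, log_rpow hZ]; have := log_nonneg hZ1; linarith
    have p1 : ∑ d ∈ (Icc 1 N).filter (fun d : ℕ => ¬ y < d), errSize (Z/(d:ℝ)^6) ≤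
        y*(1+log X)^2 := by
      have b : ∀ d ∈ (Icc 1 N).filter (fun d : ℕ => ¬ y < d), errSize (Z/(d:ℝ)^6) ≤
          y*(1+log X)*(d:ℝ)⁻¹ := by
        intro d hd
        rw [mem_filter, not_lt] at hd
        have h1 := (iff1 d hd.1).2 hd.2
        have d1 : (1:ℝ) ≤ d := mod_cast (mem_Icc.1 hd.1).1
        rw [errSize, if_pos h1, div_rpow hZ.le (by positivity), hdpow, ← hy, div_eq_mul_inv]
        have : log (Z/(d:ℝ)^6) ≤ log X := by
          refine (log_le_log (by positivity) ?_).trans hlZ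
          exact div_le_self hZ.le (one_le_pow₀ d1)
        calc _ ≤ y*(d:ℝ)⁻¹*(1+log X) := by gcongr
          _ = _ := by ring
      refine (sum_le_sum b).trans ?_
      rw [← mul_sum]
      have hsub : (Icc 1 N).filter (fun d : ℕ => ¬ y < d) ⊆ Icc 1 ⌊y⌋₊ := by
        intro d hd
        rw [mem_filter, not_lt, mem_Icc] at hd
        exact mem_Icc.2 ⟨hd.1.1, le_floor hd.2⟩
      have hh : ∑ d ∈ Icc 1 ⌊y⌋₊, (d:ℝ)⁻¹ ≤ 1+log y := by
        have h1 := harmonic_floor_le_one_add_log y y1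
        rw [harmonic_eq_sum_Icc] at h1
        push_cast at h1
        exact h1
      have h2 := sum_le_sum_of_subset_of_nonneg hsub
        (f := fun d : ℕ => (d:ℝ)⁻¹) (fun _ _ _ => by positivity)
      calc _ ≤ y*(1+log X)*(1+log X) := by
            refine mul_le_mul_of_nonneg_left ?_ (by positivity); linarith
        _ = _ := by ring
    have p2 : ∑ d ∈ (Icc 1 N).filter (fun d : ℕ => y < d), errSize (Z/(d:ℝ)^6) ≤ C*y := by
      have b : ∀ d ∈ (Icc 1 N).filter (fun d : ℕ => y < d), errSize (Z/(d:ℝ)^6) =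
          Z^((1:ℝ)/5)*(d:ℝ)^(-(6/5):ℝ) := by
        intro d hd
        rw [mem_filter] at hd
        rw [errSize, if_neg, hdpow5]
        rw [iff1 d hd.1]; push Not; exact hd.2
      rw [sum_congr rfl b, ← mul_sum]
      refine (mul_le_mul_of_nonneg_left (HC y y1 N) (by positivity)).trans (le_of_eq ?_)
      have : Z^((1:ℝ)/5)*y^(-(1/5):ℝ) = y := by rw [hy, ← rpow_mul hZ.le, ← rpow_add hZ]; norm_num
      linear_combination C*this
    have p3 : C*y ≤ C*(y*(1+log X)^2) := by refine mul_le_mul_of_nonneg_left ?_ hC.le; nlinarith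
    have p4 : 0 ≤ D*(y*(1+log X)^2) := by positivity
    linarith
  · have b : ∀ d ∈ Icc 1 N, errSize (Z/(d:ℝ)^6) = Z^((1:ℝ)/5)*(d:ℝ)^(-(6/5):ℝ) := by
      intro d hd
      rw [errSize, if_neg, hdpow5]
      rw [iff1 d hd]
      have d1 : (1:ℝ) ≤ d := mod_cast (mem_Icc.1 hd).1
      push Not at hZ1 ⊢
      exact (Real.rpow_lt_one hZ.le hZ1 (by norm_num)).trans_le d1
    rw [sum_congr rfl b, ← mul_sum]
    push Not at hZ1
    have h1 : Z^((1:ℝ)/5) ≤ Z^((1:ℝ)/6) := Real.rpow_le_rpow_of_exponent_ge hZ hZ1.le (by norm_num)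
    have h2 := HD (Icc 1 N)
    have z0 : 0 < Z^((1:ℝ)/6) := by positivity
    calc _ ≤ Z^((1:ℝ)/6)*D := by gcongr
      _ ≤ D*(Z^((1:ℝ)/6)*(1+log X)^2) := by
        rw [mul_comm]; refine mul_le_mul_of_nonneg_left ?_ hD.le; nlinarith
      _ ≤ _ := by refine mul_le_mul_of_nonneg_right ?_ (by positivity); linarith

/-- The hypothesis on the convolution factor: it is dominated by the convolution of the indicator
function of sixth powers with a function `κ` whose Dirichlet series converges at `1/6`. -/
def SixthDominated (h : ℕ → ℝ) : Prop := ∃ (κ : ℕ → ℝ) (B:ℝ), (∀ e, 0 ≤ κ e) ∧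
  (∀ N : ℕ, ∑ e ∈ Icc 1 N, κ e*(e:ℝ)^(-(1/6):ℝ) ≤ B) ∧
  ∀ m : ℕ, 1 ≤ m → |h m| ≤ ∑ d ∈ Icc 1 m, ∑ e ∈ Icc 1 m, if d^6*e = m then κ e else 0

lemma sum_dominated_le {h κ : ℕ → ℝ} (hκ : ∀ e, 0 ≤ κ e)
    (hh : ∀ m : ℕ, 1 ≤ m → |h m| ≤ ∑ d ∈ Icc 1 m, ∑ e ∈ Icc 1 m, if d^6*e = m then κ e else 0)
    (w : ℕ → ℝ) (hw : ∀ m, 1 ≤ m → 0 ≤ w m) (N:ℕ) :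
    ∑ m ∈ Icc 1 N, |h m| * w m ≤ ∑ e ∈ Icc 1 N, κ e*∑ d ∈ Icc 1 N, w (d^6*e) := by
  have h1 : ∀ m ∈ Icc 1 N, |h m| * w m ≤
      ∑ e ∈ Icc 1 N, ∑ d ∈ Icc 1 N, if d^6*e = m then κ e*w m else 0 := by
    intro m hm
    rw [mem_Icc] at hm
    refine (mul_le_mul_of_nonneg_right (hh m hm.1) (hw m hm.1)).trans ?_
    rw [sum_mul, sum_comm]
    have hs : Icc 1 m ⊆ Icc 1 N := Icc_subset_Icc_right hm.2
    have nn : ∀ d e : ℕ, 0 ≤ if d^6*e = m then κ e*w m else 0 := fun d e => by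
      split_ifs
      · exact mul_nonneg (hκ e) (hw m hm.1)
      · exact le_rfl
    calc ∑ d ∈ Icc 1 m, (∑ e ∈ Icc 1 m, if d^6*e = m then κ e else 0)*w m
        = ∑ d ∈ Icc 1 m, ∑ e ∈ Icc 1 m, if d^6*e = m then κ e*w m else 0 := by
          refine sum_congr rfl fun d _ => ?_
          rw [sum_mul]
          exact sum_congr rfl fun e _ => by split_ifs <;> simp
      _ ≤ ∑ d ∈ Icc 1 N, ∑ e ∈ Icc 1 m, if d^6*e = m then κ e*w m else 0 :=
          sum_le_sum_of_subset_of_nonneg hs fun d _ _ => sum_nonneg fun e _ => nn d e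
      _ ≤ _ := sum_le_sum fun d _ =>
          sum_le_sum_of_subset_of_nonneg hs fun e _ _ => nn d e
  refine (sum_le_sum h1).trans ?_
  rw [sum_comm]
  refine sum_le_sum fun e he => ?_
  rw [sum_comm, mul_sum]
  refine sum_le_sum fun d hd => ?_
  rw [sum_ite_eq]
  have : 1 ≤ d^6*e := Nat.mul_pos (pow_pos (mem_Icc.1 hd).1 6) (mem_Icc.1 he).1
  split_ifs
  · exact le_rfl
  · exact mul_nonneg (hκ e) (hw _ this)

lemma SixthDominated.summable {h : ℕ → ℝ} (H : SixthDominated h) {s : ℝ} (hs : 1/5 ≤ s) :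
    Summable fun m : ℕ => h m*(m:ℝ)^(-s) := by
  obtain ⟨κ, B, hκ, hB, hh⟩ := H
  obtain ⟨D, hD, HD⟩ := exists_sum_rpow_le (u := 6*s) (by linarith)
  rw [← summable_nat_add_iff 1]
  refine Summable.of_norm (summable_of_sum_range_le (c := B*D) (fun _ => norm_nonneg _) fun N => ?_)
  have e1 : ∑ i ∈ range N, ‖h (i+1)*((i+1:ℕ):ℝ)^(-s)‖ =
      ∑ m ∈ Icc 1 N, |h m| * (m:ℝ)^(-s) := by
    rw [range_eq_Ico, sum_Ico_add' (fun m : ℕ => ‖h m*(m:ℝ)^(-s)‖) 0 N 1]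
    refine sum_congr (by ext; simp [Nat.lt_succ_iff]) fun m _ => ?_
    rw [norm_mul, norm_eq_abs, norm_of_nonneg (by positivity)]
  rw [e1]
  refine (sum_dominated_le hκ hh (fun m => (m:ℝ)^(-s)) (fun m _ => by positivity) N).trans ?_
  have : ∀ e ∈ Icc 1 N, κ e*∑ d ∈ Icc 1 N, ((d^6*e:ℕ):ℝ)^(-s) ≤ κ e*(e:ℝ)^(-(1/6):ℝ)*D := by
    intro e he
    have e1 : (1:ℝ) ≤ e := mod_cast (mem_Icc.1 he).1
    rw [mul_assoc]
    refine mul_le_mul_of_nonneg_left ?_ (hκ e)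
    have : ∀ d ∈ Icc 1 N, ((d^6*e:ℕ):ℝ)^(-s) = (e:ℝ)^(-s)*(d:ℝ)^(-(6*s)) := by
      intro d _
      push_cast
      rw [mul_rpow (by positivity) (by positivity), ← rpow_natCast, ← rpow_mul (by positivity)]
      push_cast; rw [mul_comm]; congr 2; ring
    rw [sum_congr rfl this, ← mul_sum]
    exact mul_le_mul (rpow_le_rpow_of_exponent_le e1 (by linarith)) (HD _)
      (sum_nonneg fun _ _ => by positivity) (by positivity)
  refine (sum_le_sum this).trans ?_
  rw [← sum_mul]
  exact mul_le_mul_of_nonneg_right (hB N) hD.le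

/-- The shape of the main terms. -/
def mainTerm (c3 c4 c5 Y:ℝ) : ℝ := c3*Y^((1:ℝ)/3)+c4*Y^((1:ℝ)/4)+c5*Y^((1:ℝ)/5)

theorem SixthDominated.exists_asymp {h : ℕ → ℝ} (H : SixthDominated h) {T : ℝ → ℝ} {c3 c4 c5 K : ℝ}
    (hT0 : ∀ Y < 1, T Y = 0) (hT : ∀ Y, 1 ≤ Y → |T Y-mainTerm c3 c4 c5 Y| ≤
      K*(Y^((1:ℝ)/6)*(1+log Y))) :
    ∃ d3 d4 d5 K' : ℝ, 0 < K' ∧ ∀ X, 1 ≤ X → |∑ m ∈ Icc 1 ⌊X⌋₊, h m*T (X/m)-mainTerm d3 d4 d5 X| ≤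
        K'*(X^((1:ℝ)/6)*(1+log X)^2) := by
  have s3 := H.summable (s := 1/3) (by norm_num)
  have s4 := H.summable (s := 1/4) (by norm_num)
  have s5 := H.summable (s := 1/5) (by norm_num)
  obtain ⟨κ, B, hκ, hB, hh⟩ := H
  obtain ⟨C, hC, HC⟩ := exists_sum_errSize_le
  set K1 := |K| + |c3| + |c4| + |c5| with hK1
  have B0 : 0 ≤ B := by simpa using hB 0
  have hK10 : 0 ≤ K1 := by positivity
  refine ⟨c3*∑' m, h m*(m:ℝ)^(-(1/3):ℝ), c4*∑' m, h m*(m:ℝ)^(-(1/4):ℝ),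
    c5*∑' m, h m*(m:ℝ)^(-(1/5):ℝ), K1*C*B+1, by positivity, fun X hX => ?_⟩
  have X0 : 0 < X := by linarith
  have herr : ∀ Y, 0 < Y → |T Y-mainTerm c3 c4 c5 Y| ≤ K1*errSize Y := by
    intro Y hY
    unfold errSize
    split_ifs with h1
    · have := log_nonneg h1
      refine (hT Y h1).trans (mul_le_mul_of_nonneg_right ?_ (by positivity))
      have := le_abs_self K
      have := abs_nonneg c3; have := abs_nonneg c4; have := abs_nonneg c5
      linarith
    · push Not at h1
      rw [hT0 Y h1, zero_sub, abs_neg, mainTerm]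
      have m : ∀ c e : ℝ, 1/5 ≤ e → |c*Y^e| ≤ |c| * Y^((1:ℝ)/5) := fun c e he => by
        rw [abs_mul, abs_of_pos (rpow_pos_of_pos hY e)]
        exact mul_le_mul_of_nonneg_left (Real.rpow_le_rpow_of_exponent_ge hY h1.le he) (abs_nonneg _)
      have := m c3 (1/3) (by norm_num)
      have := m c4 (1/4) (by norm_num)
      have := m c5 (1/5) (by norm_num)
      have : 0 ≤ |K| * Y^((1:ℝ)/5) := by positivity
      refine (abs_add_three _ _ _).trans ?_
      rw [hK1]; linarith
  -- truncated sums
  have fin : ∀ N : ℕ, ⌊X⌋₊ ≤ N → |∑ m ∈ Icc 1 ⌊X⌋₊, h m*T (X/m) -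
      ∑ m ∈ Icc 1 N, h m*mainTerm c3 c4 c5 (X/m)| ≤
      (K1*C*B)*(X^((1:ℝ)/6)*(1+log X)^2) := by
    intro N hN
    have e1 : ∑ m ∈ Icc 1 ⌊X⌋₊, h m*T (X/m) = ∑ m ∈ Icc 1 N, h m*T (X/m) := by
      refine sum_subset (Icc_subset_Icc_right hN) fun m hm hm' => ?_
      rw [mem_Icc] at hm hm'
      have : ⌊X⌋₊ < m := by omega
      rw [floor_lt X0.le] at this
      rw [hT0, mul_zero]
      rw [div_lt_one (by linarith)]; exact this
    rw [e1, ← sum_sub_distrib]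
    refine (abs_sum_le_sum_abs _ _).trans ?_
    have b1 : ∀ m ∈ Icc 1 N, |h m*T (X/m)-h m*mainTerm c3 c4 c5 (X/m)| ≤
        |h m| * (K1*errSize (X/m)) := by
      intro m hm
      have m0 : (0:ℝ) < m := mod_cast (mem_Icc.1 hm).1
      rw [← mul_sub, abs_mul]
      exact mul_le_mul_of_nonneg_left (herr _ (by positivity)) (abs_nonneg _)
    refine (sum_le_sum b1).trans ?_
    refine (sum_dominated_le hκ hh (fun m => K1*errSize (X/m)) (fun m hm => ?_) N).trans ?_
    · have m0 : (0:ℝ) < m := mod_cast hm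
      exact mul_nonneg hK10 (errSize_nonneg (by positivity))
    have b2 : ∀ e ∈ Icc 1 N, κ e*∑ d ∈ Icc 1 N, K1*errSize (X/((d^6*e:ℕ):ℝ)) ≤
        κ e*(e:ℝ)^(-(1/6):ℝ)*(K1*C*(X^((1:ℝ)/6)*(1+log X)^2)) := by
      intro e he
      have e1 : (1:ℝ) ≤ e := mod_cast (mem_Icc.1 he).1
      rw [mul_assoc]
      refine mul_le_mul_of_nonneg_left ?_ (hκ e)
      rw [← mul_sum]
      have := HC (X/e) X (by positivity) (div_le_self X0.le e1) hX N
      have e2 : ∀ d ∈ Icc 1 N, errSize (X/((d^6*e:ℕ):ℝ)) = errSize (X/e/(d:ℝ)^6) := by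
        intro d _; push_cast; rw [div_div, mul_comm]
      rw [sum_congr rfl e2]
      refine (mul_le_mul_of_nonneg_left this hK10).trans (le_of_eq ?_)
      rw [div_rpow X0.le (by positivity), rpow_neg (by positivity)]
      ring
    refine (sum_le_sum b2).trans ?_
    rw [← sum_mul]
    refine (mul_le_mul_of_nonneg_right (hB N) (by positivity)).trans (le_of_eq ?_)
    ring
  have lim : Tendsto (fun N : ℕ => ∑ m ∈ Icc 1 N, h m*mainTerm c3 c4 c5 (X/m)) atTop
      (nhds (mainTerm (c3*∑' m, h m*(m:ℝ)^(-(1/3):ℝ)) (c4*∑' m, h m*(m:ℝ)^(-(1/4):ℝ))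
        (c5*∑' m, h m*(m:ℝ)^(-(1/5):ℝ)) X)) := by
    have hs : ∀ (c s:ℝ), s ≠ 0 → Summable (fun m : ℕ => h m*(m:ℝ)^(-s)) →
        Tendsto (fun N : ℕ => ∑ m ∈ Icc 1 N, c*(X^s*(h m*(m:ℝ)^(-s)))) atTop
        (nhds (c*(X^s*∑' m, h m*(m:ℝ)^(-s)))) := by
      intro c s hs0 hs
      have := (((hs.hasSum.tendsto_sum_nat).comp (Filter.tendsto_add_atTop_nat 1)).const_mul (X^s)).const_mul c
      refine this.congr fun N => ?_
      simp only [Function.comp, mul_sum]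
      rw [range_eq_Ico, sum_eq_sum_Ico_succ_bot (by omega)]
      simp [Real.zero_rpow (neg_ne_zero.2 hs0)]
      rfl
    have := ((hs c3 (1/3) (by norm_num) s3).add (hs c4 (1/4) (by norm_num) s4)).add
      (hs c5 (1/5) (by norm_num) s5)
    refine (this.congr fun N => ?_).trans (le_of_eq ?_)
    · rw [← sum_add_distrib, ← sum_add_distrib]
      refine sum_congr rfl fun m _ => ?_
      rw [mainTerm]
      simp only [div_rpow X0.le (cast_nonneg m), rpow_neg (cast_nonneg m)]
      ring
    · rw [mainTerm]; congr 1; ring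
  have := le_of_tendsto ((tendsto_const_nhds.sub lim).abs) (Filter.eventually_atTop.2 ⟨⌊X⌋₊, fin⟩)
  refine this.trans (mul_le_mul_of_nonneg_right (by linarith) (by positivity))

/-- The norm form of the Eisenstein integers in the basis `1, ζ₆`. -/
def eisNorm (z : ℤ × ℤ) : ℤ := z.1^2+z.1*z.2+z.2^2

/-- Multiplication of Eisenstein integers in the basis `1, ζ₆`. -/
def eisMul (z w : ℤ × ℤ) : ℤ × ℤ := (z.1*w.1-z.2*w.2, z.1*w.2+z.2*w.1+z.2*w.2)

/-- Conjugation of Eisenstein integers in the basis `1, ζ₆`. -/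
def eisConj (z : ℤ × ℤ) : ℤ × ℤ := (z.1+z.2, -z.2)

lemma eisNorm_mul (z w : ℤ × ℤ) : eisNorm (eisMul z w) = eisNorm z*eisNorm w := by
  simp only [eisNorm, eisMul]; ring

lemma eisNorm_conj (z : ℤ × ℤ) : eisNorm (eisConj z) = eisNorm z := by
  simp only [eisNorm, eisConj]; ring

lemma eisNorm_nonneg (z : ℤ × ℤ) : 0 ≤ eisNorm z := by
  simp only [eisNorm]; nlinarith [sq_nonneg (z.1+z.2), sq_nonneg z.1, sq_nonneg z.2]

lemma eisMul_injective {π : ℤ × ℤ} (hπ : eisNorm π ≠ 0) : Injective (eisMul π) := by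
  intro z w h
  simp only [eisMul, Prod.mk.injEq] at h
  obtain ⟨h1, h2⟩ := h
  simp only [eisNorm] at hπ
  refine Prod.ext (mul_left_cancel₀ hπ ?_) (mul_left_cancel₀ hπ ?_)
  · linear_combination (π.1+π.2)*h1+π.2*h2
  · linear_combination -π.2*h1+π.1*h2

/-- The Gauss and Jacobi sums of a cubic character. -/
lemma exists_cubic_gaussSum {K : Type} [Field K] [CharZero K] {ω : K} (hω : IsPrimitiveRoot ω 3)
    {p : ℕ} [Fact p.Prime] (hp : p % 3 = 1) :
    ∃ (χ : MulChar (ZMod p) K) (π : ℤ × ℤ), χ^3 = 1 ∧ eisNorm π = p ∧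
      ∀ ψ : AddChar (ZMod p) K, ψ.IsPrimitive → gaussSum χ ψ^3 = p*(π.1-π.2*ω^2) := by
  have pp : p.Prime := Fact.out
  have w3 := hω.pow_eq_one
  have wz : ω^2+ω+1 = 0 := by
    have := hω.geom_sum_eq_zero (by norm_num)
    simp [sum_range_succ] at this
    linear_combination this
  obtain ⟨χ, hχ⟩ := MulChar.exists_mulChar_orderOf (ZMod p) (n := 3) (by rw [ZMod.card]; omega) hω
  have c3 : χ^3 = 1 := hχ ▸ pow_orderOf_eq_one χ
  have v3 : ∀ x, χ x = 0 ∨ χ x = 1 ∨ χ x = ω ∨ χ x = ω^2 := by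
    intro x
    rcases eq_or_ne x 0 with rfl | hx
    · exact inl (MulChar.map_zero χ)
    · obtain ⟨k, hk, h⟩ := MulChar.exists_apply_eq_pow c3 hω hx
      rw [h]
      interval_cases k <;> simp
  have sums : ∀ s : Finset (ZMod p), ∃ c d : ℤ, ∑ x ∈ s, χ x*χ (1-x) = c+d*ω ∧
      ∑ x ∈ s, χ⁻¹ x*χ⁻¹ (1-x) = c+d*ω^2 := by
    intro s
    induction s using Finset.induction_on with
    | empty => exact ⟨0, 0, by simp, by simp⟩
    | insert a s ha ih =>
      obtain ⟨c, d, h1, h2⟩ := ih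
      rw [sum_insert ha, sum_insert ha, h1, h2]
      have w0 : ω ≠ 0 := hω.ne_zero (by norm_num)
      have i1 : ω⁻¹ = ω^2 := by field_simp; exact w3.symm
      have key : ∃ u v : ℤ, χ a*χ (1-a) = u+v*ω ∧ χ⁻¹ a*χ⁻¹ (1-a) = u+v*ω^2 := by
        rw [← map_mul, ← map_mul, MulChar.inv_apply_eq_inv']
        rcases v3 (a*(1-a)) with h | h | h | h <;> rw [h]
        · exact ⟨0, 0, by simp, by simp⟩
        · exact ⟨1, 0, by simp, by simp⟩
        · exact ⟨0, 1, by simp, by simp [i1]⟩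
        · refine ⟨-1, -1, by push_cast; linear_combination wz, ?_⟩
          rw [← inv_pow, i1]; push_cast; linear_combination ω*w3+wz
      obtain ⟨u, v, k1, k2⟩ := key
      rw [k1, k2]
      exact ⟨u+c, v+d, by push_cast; ring, by push_cast; ring⟩
  obtain ⟨c, d, h1, h2⟩ := sums univ
  have n1 : χ ≠ 1 := by rintro rfl; simp at hχ
  have n2 : χ*χ ≠ 1 := by
    intro h
    have := orderOf_dvd_of_pow_eq_one (x := χ) (n := 2) (by rw [pow_two, h])
    rw [hχ] at this; omega
  have J := jacobiSum_mul_jacobiSum_inv (F := ZMod p) (F' := K) (by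
    rw [ZMod.ringChar_zmod_n, ringChar.eq_zero]; exact pp.ne_zero.symm) n1 n1 n2
  rw [jacobiSum, jacobiSum, h1, h2, ZMod.card] at J
  refine ⟨χ, (c-d, d), c3, ?_, fun ψ hψ => ?_⟩
  · have : ((c^2-c*d+d^2:ℤ) : K) = (p:ℤ) := by
      push_cast
      linear_combination J-d^2*w3-c*d*wz
    have := Int.cast_injective this
    simp only [eisNorm]; linear_combination this
  · have := gaussSum_pow_eq_prod_jacobiSum (χ := χ) (ψ := ψ) (by omega) hψ
    have m1 : χ (-1) = 1 := by
      have : χ (-1) = (χ^3) (-1) := by rw [MulChar.pow_apply' _ (by norm_num), ← map_pow]; norm_num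
      rw [this, c3, MulChar.one_apply (by simp)]
    rw [hχ] at this
    simp only [show Ico 1 (3-1) = {1} by decide, prod_singleton, pow_one] at this
    rw [this, m1, jacobiSum, h1, ZMod.card]
    push_cast
    linear_combination (p:K)*d*wz

/-- A prime dividing an Eisenstein norm divides the number or splits. -/
lemma prime_dvd_eisNorm {p : ℕ} (pp : p.Prime) {z : ℤ × ℤ} (h : (p:ℤ) ∣ eisNorm z)
    (h3 : p % 3 = 2) : (p:ℤ) ∣ z.1 ∧ (p:ℤ) ∣ z.2 := by
  have := Fact.mk pp
  have hy : (p:ℤ) ∣ z.2 := by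
    by_contra hy
    have e : ((eisNorm z:ℤ) : ZMod p) = 0 := (ZMod.intCast_zmod_eq_zero_iff_dvd _ _).2 h
    have y0 : ((z.2:ℤ) : ZMod p) ≠ 0 := fun h => hy ((ZMod.intCast_zmod_eq_zero_iff_dvd _ _).1 h)
    simp only [eisNorm] at e
    push_cast at e
    set t : ZMod p := z.1/z.2 with ht
    have t2 : t^2+t+1 = 0 := by rw [ht]; field_simp; linear_combination e
    have t3 : t^3 = 1 := by linear_combination (t-1)*t2
    have t1 : t ≠ 1 := by
      intro h; rw [h] at t2
      have : ((3:ℕ) : ZMod p) = 0 := by push_cast; linear_combination t2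
      rw [ZMod.natCast_eq_zero_iff] at this
      have := (Nat.prime_dvd_prime_iff_eq pp prime_three).1 this
      omega
    have o : orderOf t = 3 := orderOf_eq_prime t3 t1
    have t0 : t ≠ 0 := by rintro h; rw [h] at t3; norm_num at t3
    have := ZMod.orderOf_dvd_card_sub_one t0
    rw [o] at this
    omega
  refine ⟨?_, hy⟩
  have : (p:ℤ) ∣ z.1^2 := by
    have e : z.1^2 = eisNorm z-z.2*(z.1+z.2) := by simp only [eisNorm]; ring
    rw [e]; exact dvd_sub h (hy.mul_right _)
  exact (prime_iff_prime_int.1 pp).dvd_of_dvd_pow this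

lemma eisMul_of_dvd {p : ℕ} (pp : p.Prime) {π z : ℤ × ℤ} (hπ : eisNorm π = p)
    (hz : (p:ℤ) ∣ eisNorm z) (h : (p:ℤ) ∣ π.1*z.2-π.2*z.1) : ∃ w, z = eisMul π w := by
  have hp := prime_iff_prime_int.1 pp
  have p0 : (p:ℤ) ≠ 0 := mod_cast pp.ne_zero
  have h2 : (p:ℤ) ∣ π.1*z.1+π.2*z.1+π.2*z.2 := by
    refine hp.dvd_of_dvd_pow (n := 2) ?_
    have e : (π.1*z.1+π.2*z.1+π.2*z.2)^2 = eisNorm π*eisNorm z -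
      (π.1*z.2-π.2*z.1)*(π.1*z.1+π.2*z.1+π.2*z.2+(π.1*z.2-π.2*z.1)) := by
      simp only [eisNorm]; ring
    rw [e]; exact dvd_sub (hz.mul_left _) (h.mul_right _)
  obtain ⟨v, hv⟩ := h
  obtain ⟨u, hu⟩ := h2
  simp only [eisNorm] at hπ
  refine ⟨(u, v), Prod.ext (mul_left_cancel₀ p0 ?_) (mul_left_cancel₀ p0 ?_)⟩ <;>
    simp only [eisMul]
  · linear_combination (-z.1)*hπ+π.1*hu-π.2*hv
  · linear_combination (-z.2)*hπ+π.2*hu+(π.1+π.2)*hv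

lemma eisMul_of_prime_dvd {p : ℕ} (pp : p.Prime) {π z : ℤ × ℤ} (hπ : eisNorm π = p)
    (hz : (p:ℤ) ∣ eisNorm z) : ∃ w, z = eisMul π w ∨ z = eisMul (eisConj π) w := by
  have hp := prime_iff_prime_int.1 pp
  have h : (p:ℤ) ∣ (π.1*z.2-π.2*z.1) * ((eisConj π).1*z.2-(eisConj π).2*z.1) := by
    have e : (π.1*z.2-π.2*z.1)*((eisConj π).1*z.2-(eisConj π).2*z.1) =
      z.2^2*eisNorm π-π.2^2*eisNorm z := by simp only [eisNorm, eisConj]; ring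
    rw [e, hπ]; exact dvd_sub (dvd_mul_left _ _) (hz.mul_left _)
  rcases hp.dvd_or_dvd h with h | h
  · obtain ⟨w, hw⟩ := eisMul_of_dvd pp hπ hz h
    exact ⟨w, inl hw⟩
  · obtain ⟨w, hw⟩ := eisMul_of_dvd pp (by rw [eisNorm_conj, hπ]) hz h
    exact ⟨w, inr hw⟩

lemma exists_eisNorm_eq_prime {p : ℕ} (pp : p.Prime) (h : p % 3 = 1) : ∃ π, eisNorm π = p := by
  have := Fact.mk pp
  obtain ⟨_, π, -, h, -⟩ := exists_cubic_gaussSum (Complex.isPrimitiveRoot_exp 3 (by norm_num)) h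
  exact ⟨π, h⟩

/-- The Eisenstein integers of norm `n`. -/
def eisSphere (n:ℕ) : Finset (ℤ × ℤ) :=
  (latSet_finite n).toFinset.filter fun z => eisNorm z = n

lemma mem_eisSphere {n : ℕ} {z : ℤ × ℤ} : z ∈ eisSphere n ↔ eisNorm z = n := by
  simp only [eisSphere, mem_filter, Set.Finite.mem_toFinset, latSet, mem_setOf_eq,
    and_iff_right_iff_imp]
  intro h
  simp only [eisNorm] at h
  exact_mod_cast h.le

lemma rr_eq (n:ℕ) : rr n = ((eisSphere n).card:ℝ)/6 := by
  have : latN n = latN ((n:ℝ)-1)+(eisSphere n).card := by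
    rw [latN, latN, ← card_union_of_disjoint]
    · congr 1
      ext z
      rw [mem_union, mem_eisSphere]
      simp only [Set.Finite.mem_toFinset, latSet, mem_setOf_eq, eisNorm]
      have e : ((z.1:ℝ)^2+z.1*z.2+z.2^2) = ((z.1^2+z.1*z.2+z.2^2:ℤ):ℝ) := by push_cast; ring
      have e2 : ((n:ℝ)-1) = ((n-1:ℤ):ℝ) := by push_cast; ring
      have e3 : (n:ℝ) = ((n:ℤ):ℝ) := by norm_cast
      rw [e, e2, e3, Int.cast_le, Int.cast_le]
      omega
    · rw [disjoint_left]
      intro z h1 h2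
      rw [mem_eisSphere, eisNorm] at h2
      simp only [Set.Finite.mem_toFinset, latSet, mem_setOf_eq] at h1
      have : ((z.1^2+z.1*z.2+z.2^2:ℤ):ℝ) = n := mod_cast congrArg (Int.cast (R := ℝ)) h2
      push_cast at this
      linarith
  rw [rr, this]; push_cast; ring

lemma eisNorm_eq_one {z : ℤ × ℤ} (h : eisNorm z = 1) :
    z ∈ ({(1, 0), (-1, 0), (0, 1), (0, -1), (1, -1), (-1, 1)} : Finset (ℤ × ℤ)) := by
  obtain ⟨x, y⟩ := z
  simp only [eisNorm] at h
  have hx : x^2 ≤ 1 := by nlinarith [sq_nonneg (x+2*y)]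
  have : -1 ≤ x ∧ x ≤ 1 := by constructor <;> nlinarith
  have : -1 ≤ y ∧ y ≤ 1 := by constructor <;> nlinarith
  obtain ⟨⟨_, _⟩, _, _⟩ := And.intro ‹-1 ≤ x ∧ x ≤ 1› this
  interval_cases x <;> interval_cases y <;> simp_all

lemma rr_one : rr 1 = 1 := by
  have : eisSphere 1 = {(1, 0), (-1, 0), (0, 1), (0, -1), (1, -1), (-1, 1)} := by
    ext z
    rw [mem_eisSphere]
    refine ⟨fun h => eisNorm_eq_one (mod_cast h), fun h => ?_⟩
    simp only [mem_insert, mem_singleton] at h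
    rcases h with h | h | h | h | h | h <;> rw [h] <;> rfl
  rw [rr_eq, this]
  norm_num [card_insert_of_notMem]

/-- The nontrivial Dirichlet character modulo 3. -/
def chi3 (n:ℕ) : ℝ := if n % 3 = 1 then 1 else if n % 3 = 2 then -1 else 0

lemma eisSphere_mul_image {p n : ℕ} (p0 : p ≠ 0) {π : ℤ × ℤ} (hπ : eisNorm π = p) {z : ℤ × ℤ} :
    z ∈ (eisSphere n).image (eisMul π) ↔ z ∈ eisSphere (p*n) ∧ ∃ w, z = eisMul π w := by
  rw [mem_image, mem_eisSphere]
  constructor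
  · rintro ⟨w, hw, rfl⟩
    rw [mem_eisSphere] at hw
    exact ⟨by rw [eisNorm_mul, hπ, hw]; push_cast; ring, w, rfl⟩
  · rintro ⟨h, w, rfl⟩
    refine ⟨w, ?_, rfl⟩
    rw [mem_eisSphere]
    rw [eisNorm_mul, hπ] at h
    push_cast at h
    exact mul_left_cancel₀ (mod_cast p0) h

lemma card_eisMul_image {p : ℕ} (p0 : p ≠ 0) {π : ℤ × ℤ} (hπ : eisNorm π = p) (n:ℕ) :
    ((eisSphere n).image (eisMul π)).card = (eisSphere n).card :=
  card_image_of_injective _ (eisMul_injective (by rw [hπ]; exact_mod_cast p0))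

lemma card_eisSphere_filter_dvd {p : ℕ} (p0 : p ≠ 0) (n:ℕ) :
    (((eisSphere (p*n)).filter fun z => (p:ℤ) ∣ z.1 ∧ (p:ℤ) ∣ z.2).card:ℝ)/6 =
      if p ∣ n then rr (n/p) else 0 := by
  have pz : (p:ℤ) ≠ 0 := mod_cast p0
  split_ifs with h
  · obtain ⟨k, rfl⟩ := h
    rw [Nat.mul_div_cancel_left _ (Nat.pos_of_ne_zero p0), rr_eq]
    congr 2
    symm
    refine card_bij (fun z _ => ((p:ℤ)*z.1, (p:ℤ)*z.2)) ?_ ?_ ?_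
    · intro z hz
      rw [mem_eisSphere] at hz
      rw [mem_filter, mem_eisSphere]
      refine ⟨?_, dvd_mul_right _ _, dvd_mul_right _ _⟩
      simp only [eisNorm] at hz ⊢
      push_cast
      linear_combination (p:ℤ)^2*hz
    · intro z _ w _ h
      rw [Prod.mk.injEq] at h
      exact Prod.ext (mul_left_cancel₀ pz h.1) (mul_left_cancel₀ pz h.2)
    · rintro ⟨x, y⟩ hz
      rw [mem_filter, mem_eisSphere] at hz
      obtain ⟨hz, ⟨a, rfl⟩, b, rfl⟩ := hz
      refine ⟨(a, b), ?_, rfl⟩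
      rw [mem_eisSphere]
      simp only [eisNorm] at hz ⊢
      refine mul_left_cancel₀ (pow_ne_zero 2 pz) ?_
      push_cast at hz
      linear_combination hz
  · rw [filter_false_of_mem]; · simp
    rintro ⟨x, y⟩ hz ⟨⟨a, ha⟩, b, hb⟩
    simp only at ha hb
    subst ha hb
    rw [mem_eisSphere] at hz
    refine h (Int.natCast_dvd_natCast.1 ⟨eisNorm (a, b), mul_left_cancel₀ pz ?_⟩)
    simp only [eisNorm] at hz ⊢
    push_cast at hz
    linear_combination -hz

lemma rr_prime_mul {p : ℕ} (pp : p.Prime) (n:ℕ) :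
    rr (p*n) = (1+chi3 p)*rr n-chi3 p*if p ∣ n then rr (n/p) else 0 := by
  have p0 := pp.ne_zero
  have pZ := prime_iff_prime_int.1 pp
  have dvdN : ∀ z ∈ eisSphere (p*n), (p:ℤ) ∣ eisNorm z := fun z hz => by
    rw [mem_eisSphere.1 hz]; push_cast; exact dvd_mul_right _ _
  rcases (by omega : p % 3 = 0 ∨ p % 3 = 1 ∨ p % 3 = 2) with h | h | h
  · obtain rfl : 3 = p := (Nat.prime_dvd_prime_iff_eq prime_three pp).1 (Nat.dvd_of_mod_eq_zero h)
    have hπ : eisNorm (1, 1) = ((3:ℕ):ℤ) := rfl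
    have : eisSphere (3*n) = (eisSphere n).image (eisMul (1, 1)) := by
      ext z
      rw [eisSphere_mul_image (by norm_num) hπ, iff_self_and]
      intro hz
      refine eisMul_of_dvd pp hπ (dvdN z hz) ?_
      refine pZ.dvd_of_dvd_pow (n := 2) ?_
      have e : (((1, 1) : ℤ × ℤ).1*z.2-((1, 1) : ℤ × ℤ).2*z.1)^2 =
        eisNorm z-(3:ℕ)*(z.1*z.2) := by simp only [eisNorm]; push_cast; ring
      rw [e]
      exact dvd_sub (dvdN z hz) (dvd_mul_right _ _)
    have c : chi3 3 = 0 := by simp [chi3]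
    rw [rr_eq, this, card_eisMul_image (by norm_num) hπ, c, rr_eq n]; ring
  · obtain ⟨π, hπ⟩ := exists_eisNorm_eq_prime pp h
    have hπ' : eisNorm (eisConj π) = p := by rw [eisNorm_conj, hπ]
    have c : chi3 p = 1 := by simp [chi3, h]
    have hu : eisSphere (p*n) =
        (eisSphere n).image (eisMul π) ∪ (eisSphere n).image (eisMul (eisConj π)) := by
      ext z
      rw [mem_union, eisSphere_mul_image p0 hπ, eisSphere_mul_image p0 hπ', ← and_or_left,
        iff_self_and]
      intro hz
      obtain ⟨w, hw⟩ := eisMul_of_prime_dvd pp hπ (dvdN z hz)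
      exact hw.imp (⟨w, ·⟩) (⟨w, ·⟩)
    have hi : (eisSphere n).image (eisMul π) ∩ (eisSphere n).image (eisMul (eisConj π)) =
        (eisSphere (p*n)).filter fun z => (p:ℤ) ∣ z.1 ∧ (p:ℤ) ∣ z.2 := by
      ext z
      rw [mem_inter, eisSphere_mul_image p0 hπ, eisSphere_mul_image p0 hπ',
        mem_filter, ← and_and_left, and_congr_right_iff]
      intro hz
      constructor
      · rintro ⟨⟨w, hw⟩, v, hv⟩
        have n2 : ¬ (p:ℤ) ∣ 2*π.1+π.2 := by
          intro hd
          have h4 : 4*(p:ℤ) = (2*π.1+π.2)^2+3*π.2^2 := by rw [← hπ, eisNorm]; ring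
          have hb : (p:ℤ) ∣ π.2 := by
            have : (p:ℤ) ∣ 3*π.2^2 := by
              rw [show 3*π.2^2 = 4*(p:ℤ)-(2*π.1+π.2)*(2*π.1+π.2) by
                rw [h4]; ring]
              exact dvd_sub (dvd_mul_left _ _) (hd.mul_right _)
            rcases pZ.dvd_or_dvd this with h' | h'
            · have := (Nat.prime_dvd_prime_iff_eq pp prime_three).1 (mod_cast h')
              omega
            · exact pZ.dvd_of_dvd_pow h'
          obtain ⟨u, hu⟩ := hd
          obtain ⟨v, hv⟩ := hb
          rw [hu, hv] at h4
          have : (p:ℤ) ∣ 4 := ⟨u^2+3*v^2, mul_left_cancel₀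
            (mod_cast p0 : (p:ℤ) ≠ 0) (by linear_combination h4)⟩
          have : p ∣ 2^2 := mod_cast this
          have := (Nat.prime_dvd_prime_iff_eq pp prime_two).1 (pp.dvd_of_dvd_pow this)
          omega
        have e1 : (p:ℤ) ∣ π.1*z.2-π.2*z.1 := ⟨w.2, by
          rw [hw, ← hπ]; simp only [eisMul, eisNorm]; ring⟩
        have e2 : (p:ℤ) ∣ π.1*z.1+π.2*z.1+π.2*z.2 := ⟨w.1, by
          rw [hw, ← hπ]; simp only [eisMul, eisNorm]; ring⟩
        have e3 : (p:ℤ) ∣ (π.1+π.2)*z.2+π.2*z.1 := ⟨v.2, by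
          rw [hv, ← hπ]; simp only [eisMul, eisNorm, eisConj]; ring⟩
        have e4 : (p:ℤ) ∣ π.1*z.1-π.2*z.2 := ⟨v.1, by
          rw [hv, ← hπ]; simp only [eisMul, eisNorm, eisConj]; ring⟩
        have f1 := dvd_add e2 e4
        have f2 := dvd_add e1 e3
        rw [show π.1*z.1+π.2*z.1+π.2*z.2+(π.1*z.1-π.2*z.2) =
          (2*π.1+π.2)*z.1 by ring] at f1
        rw [show π.1*z.2-π.2*z.1+((π.1+π.2)*z.2+π.2*z.1) = (2*π.1+π.2)*z.2 by ring] at f2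
        exact ⟨(pZ.dvd_or_dvd f1).resolve_left n2, (pZ.dvd_or_dvd f2).resolve_left n2⟩
      · rintro ⟨h1, h2⟩
        exact ⟨eisMul_of_dvd pp hπ (dvdN z hz) (dvd_sub (h2.mul_left _) (h1.mul_left _)),
          eisMul_of_dvd pp hπ' (dvdN z hz) (dvd_sub (h2.mul_left _) (h1.mul_left _))⟩
    have := card_union_add_card_inter ((eisSphere n).image (eisMul π))
      ((eisSphere n).image (eisMul (eisConj π)))
    rw [← hu, hi, card_eisMul_image p0 hπ, card_eisMul_image p0 hπ'] at this
    have t : ((eisSphere (p*n)).card:ℝ)+((eisSphere (p*n)).filter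
      fun z => (p:ℤ) ∣ z.1 ∧ (p:ℤ) ∣ z.2).card = (eisSphere n).card+(eisSphere n).card := by
      exact_mod_cast this
    rw [c, ← card_eisSphere_filter_dvd p0, rr_eq, rr_eq]
    linarith
  · have c : chi3 p = -1 := by simp [chi3, h]
    rw [c, ← card_eisSphere_filter_dvd p0, rr_eq, filter_true_of_mem]; · ring
    exact fun z hz => prime_dvd_eisNorm pp (dvdN z hz) h

lemma rr_mul : ∀ {m n : ℕ}, 1 ≤ m → m.Coprime n → rr (m*n) = rr m*rr n := by
  intro m
  induction m using Nat.strong_induction_on with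
  | _ m ih =>
    intro n hm hmn
    rcases hm.eq_or_lt with rfl | h1
    · simp [rr_one]
    obtain ⟨p, pp, k, rfl⟩ := Nat.exists_prime_and_dvd h1.ne'
    have k1 : 1 ≤ k := Nat.pos_of_ne_zero (by rintro rfl; simp at hm)
    have pn : p.Coprime n := Coprime.coprime_dvd_left (dvd_mul_right _ _) hmn
    have kn : k.Coprime n := Coprime.coprime_dvd_left (dvd_mul_left _ _) hmn
    have kl : k < p*k := by nlinarith [pp.two_le]
    rw [mul_assoc, rr_prime_mul pp, rr_prime_mul pp, ih k kl k1 kn]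
    by_cases hk : p ∣ k
    · rw [if_pos hk, if_pos (hk.mul_right _), Nat.mul_div_right_comm hk]
      obtain ⟨j, rfl⟩ := hk
      rw [Nat.mul_div_cancel_left _ pp.pos, ih j (by nlinarith [pp.two_le])
        (Nat.pos_of_ne_zero (by rintro rfl; simp at k1))
        (Coprime.coprime_dvd_left (dvd_mul_left _ _) kn)]
      ring
    · rw [if_neg hk, if_neg (fun h => hk ((Coprime.dvd_mul_right pn).1 h))]
      ring

section
open ArithmeticFunction

/-- The multiplicative function with prescribed values at prime powers. -/
def mulOf (c : ℕ → ℕ → ℝ) : ArithmeticFunction ℝ :=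
  ⟨fun n => if n = 0 then 0 else n.factorization.prod c, by simp⟩

lemma mulOf_apply (c : ℕ → ℕ → ℝ) {n : ℕ} (hn : n ≠ 0) : mulOf c n = n.factorization.prod c := by
  change (if n = 0 then 0 else _) = _
  rw [if_neg hn]

lemma isMultiplicative_mulOf (c : ℕ → ℕ → ℝ) : (mulOf c).IsMultiplicative := by
  rw [IsMultiplicative.iff_ne_zero]
  refine ⟨by simp [mulOf_apply], fun {m n} hm hn h => ?_⟩
  rw [mulOf_apply _ hm, mulOf_apply _ hn, mulOf_apply _ (mul_ne_zero hm hn),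
    Nat.factorization_mul_of_coprime h, Finsupp.prod_add_index_of_disjoint]
  simpa using h.disjoint_primeFactors

lemma mulOf_pow {c : ℕ → ℕ → ℝ} {p : ℕ} (pp : p.Prime) (hc : c p 0 = 1) (k:ℕ) :
    mulOf c (p^k) = c p k := by
  rw [mulOf_apply _ (pow_ne_zero _ pp.ne_zero), pp.factorization_pow, Finsupp.prod_single_index hc]

/-- The Bell series of an arithmetic function. -/
def bell (p:ℕ) (f : ArithmeticFunction ℝ) : PowerSeries ℝ :=
  PowerSeries.mk fun k => f (p^k)

lemma bell_mul {p : ℕ} (pp : p.Prime) (f g : ArithmeticFunction ℝ) :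
    bell p (f*g) = bell p f*bell p g := by
  ext k
  rw [coeff_mul, bell, coeff_mk, mul_apply, ← Nat.map_div_right_divisors,
    sum_map, Nat.divisors_prime_pow pp, sum_map,
    Finset.Nat.sum_antidiagonal_eq_sum_range_succ_mk]
  refine sum_congr rfl fun i hi => ?_
  have : i ≤ k := by rw [mem_range] at hi; omega
  change f (p^i)*g (p^k/p^i) = _
  simp [bell, Nat.pow_div this pp.pos]

lemma eq_of_bell {f g : ArithmeticFunction ℝ} (hf : f.IsMultiplicative) (hg : g.IsMultiplicative)
    (h : ∀ p, p.Prime → bell p f = bell p g) : f = g := by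
  rw [IsMultiplicative.eq_iff_eq_on_prime_powers f hf g hg]
  intro p k pp
  have := congrArg (PowerSeries.coeff k) (h p pp)
  simpa [bell] using this

/-- The arithmetic function supported on `k`-th powers with value `f d` at `d ^ k`. -/
def powFn (k:ℕ) (f : ArithmeticFunction ℝ) : ArithmeticFunction ℝ :=
  mulOf fun p j => if k ∣ j then f (p^(j/k)) else 0

lemma powFn_pow {k : ℕ} (hk : k ≠ 0) {f : ArithmeticFunction ℝ} (hf : f.IsMultiplicative)
    {d : ℕ} (hd : d ≠ 0) : powFn k f (d^k) = f d := by
  rw [powFn, mulOf_apply _ (pow_ne_zero _ hd), Nat.factorization_pow,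
    IsMultiplicative.multiplicative_factorization f hf hd, Finsupp.prod, Finsupp.prod,
    Finsupp.support_smul_eq hk]
  refine prod_congr rfl fun p _ => ?_
  simp [hk]

lemma powFn_of_ne {k : ℕ} {f : ArithmeticFunction ℝ} {n : ℕ} (hn : n ≠ 0)
    (h : ∀ d, d^k ≠ n) : powFn k f n = 0 := by
  rw [powFn, mulOf_apply _ hn]
  by_contra h0
  have h0 := prod_ne_zero_iff.1 h0
  refine h (n.factorization.prod fun p j => p^(j/k)) ?_
  conv_rhs => rw [← Nat.prod_factorization_pow_eq_self hn]
  rw [Finsupp.prod, Finsupp.prod, ← prod_pow]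
  refine prod_congr rfl fun p hp => ?_
  have : k ∣ n.factorization p := by by_contra h'; exact h0 p hp (if_neg h')
  rw [← pow_mul, Nat.div_mul_cancel this]

lemma sum_powFn {k : ℕ} (hk : k ≠ 0) {f : ArithmeticFunction ℝ} (hf : f.IsMultiplicative)
    (G : ℕ → ℝ) (N:ℕ) : ∑ m ∈ Ioc 0 N, powFn k f m*G m =
      ∑ d ∈ Ioc 0 N with d^k ≤ N, f d*G (d^k) := by
  have inj : InjOn (fun d : ℕ => d^k) (filter (fun d => d^k ≤ N) (Ioc 0 N)) :=
    fun a _ b _ h => Nat.pow_left_injective hk h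
  have : ∑ d ∈ Ioc 0 N with d^k ≤ N, f d*G (d^k) =
      ∑ m ∈ (filter (fun d => d^k ≤ N) (Ioc 0 N)).image (fun d => d^k),
        powFn k f m*G m := by
    rw [sum_image inj]
    refine sum_congr rfl fun d hd => ?_
    rw [mem_filter, mem_Ioc] at hd
    rw [powFn_pow hk hf (by omega)]
  rw [this]
  symm
  refine sum_subset ?_ ?_
  · intro m hm
    rw [mem_image] at hm
    obtain ⟨d, hd, rfl⟩ := hm
    rw [mem_filter, mem_Ioc] at hd
    rw [mem_Ioc]
    exact ⟨Nat.pow_pos hd.1.1, hd.2⟩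
  · intro m hm hm'
    rw [mem_Ioc] at hm
    rw [powFn_of_ne (by omega), zero_mul]
    rintro d rfl
    refine hm' (mem_image.2 ⟨d, ?_, rfl⟩)
    have : d ≠ 0 := by rintro rfl; simp [hk] at hm
    rw [mem_filter, mem_Ioc]
    exact ⟨⟨by omega, (Nat.le_self_pow hk d).trans hm.2⟩, hm.2⟩

lemma bell_powFn {k : ℕ} {p : ℕ} (pp : p.Prime) {f : ArithmeticFunction ℝ}
    (hf : f.IsMultiplicative) : bell p (powFn k f) =
      PowerSeries.mk fun j => if k ∣ j then f (p^(j/k)) else 0 := by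
  ext j
  simp only [bell, coeff_mk]
  rw [powFn, mulOf_pow pp (by simp [hf.1])]

/-- The summatory function. -/
def summ (f : ArithmeticFunction ℝ) (X:ℝ) : ℝ := ∑ n ∈ Icc 1 ⌊X⌋₊, f n

lemma summ_mul (f g : ArithmeticFunction ℝ) (X:ℝ) :
    summ (f*g) X = ∑ n ∈ Icc 1 ⌊X⌋₊, f n*summ g (X/n) := by
  have e : ∀ N : ℕ, Icc 1 N = Ioc 0 N := fun N => rfl
  simp only [summ, e]
  rw [sum_Ioc_mul_eq_sum_sum]
  simp only [Nat.floor_div_natCast]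

lemma summ_powFn_mul {k : ℕ} (hk : k ≠ 0) {f : ArithmeticFunction ℝ} (hf : f.IsMultiplicative)
    (g : ArithmeticFunction ℝ) {X : ℝ} (hX : 0 ≤ X) :
    summ (powFn k f*g) X = ∑ d ∈ Icc 1 ⌊X⌋₊, f d*summ g (X/(d:ℝ)^k) := by
  rw [summ_mul]
  refine (sum_powFn hk hf (fun m => summ g (X/m)) _).trans ?_
  rw [sum_filter]
  refine sum_congr rfl fun d hd => ?_
  have d1 : 1 ≤ d := (mem_Icc.1 hd).1
  push_cast
  split_ifs with h
  · rfl
  · have : ⌊X/(d:ℝ)^k⌋₊ = 0 := by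
      rw [Nat.floor_eq_zero, div_lt_one (by positivity)]
      have h : ⌊X⌋₊ < d^k := not_le.1 h
      exact_mod_cast (floor_lt hX).1 h
    simp [summ, this]

lemma summ_of_lt_one (f : ArithmeticFunction ℝ) {X : ℝ} (h : X < 1) : summ f X = 0 := by
  simp [summ, Nat.floor_eq_zero.2 h]

/-- `rr` as an arithmetic function. -/
def rrF : ArithmeticFunction ℝ := ⟨fun n => if n = 0 then 0 else rr n, by simp⟩

lemma rrF_apply {n : ℕ} (hn : n ≠ 0) : rrF n = rr n := by
  change (if n = 0 then 0 else _) = _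
  rw [if_neg hn]

lemma isMultiplicative_rrF : rrF.IsMultiplicative := by
  rw [IsMultiplicative.iff_ne_zero]
  refine ⟨by rw [rrF_apply one_ne_zero, rr_one], fun {m n} hm hn h => ?_⟩
  rw [rrF_apply hm, rrF_apply hn, rrF_apply (mul_ne_zero hm hn), rr_mul (by omega) h]

/-- The constant function one. -/
def oneF : ArithmeticFunction ℝ := mulOf fun _ _ => 1

lemma oneF_apply {n : ℕ} (hn : n ≠ 0) : oneF n = 1 := by
  rw [oneF, mulOf_apply _ hn]; simp [Finsupp.prod]

lemma isMultiplicative_oneF : oneF.IsMultiplicative := isMultiplicative_mulOf _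

lemma bell_oneF {p : ℕ} (pp : p.Prime) {k : ℕ} (hk : k ≠ 0) :
    bell p (powFn k oneF)*(1-PowerSeries.X^k) = 1 := by
  rw [bell_powFn pp isMultiplicative_oneF]
  ext j
  rw [mul_sub, mul_one, map_sub, PowerSeries.coeff_mul_X_pow', coeff_mk, PowerSeries.coeff_one]
  simp only [coeff_mk, oneF_apply (pow_ne_zero _ pp.ne_zero)]
  rcases lt_or_ge j k with h | h
  · rw [if_neg (not_le.2 h)]
    rcases Nat.eq_zero_or_pos j with rfl | h0
    · simp
    · rw [if_neg (Nat.not_dvd_of_pos_of_lt h0 h), if_neg h0.ne', sub_zero]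
  · rw [if_pos h, if_neg (by omega : ¬ j = 0)]
    have : k ∣ j-k ↔ k ∣ j := (Nat.dvd_sub_iff_left h dvd_rfl)
    simp [this]

lemma bell_rrF {p : ℕ} (pp : p.Prime) {k : ℕ} (hk : k ≠ 0) :
    bell p (powFn k rrF)*((1-PowerSeries.X^k)*(1-PowerSeries.C (chi3 p)*PowerSeries.X^k)) = 1 := by
  have h0 : bell p rrF*((1-PowerSeries.X)*(1-PowerSeries.C (chi3 p)*PowerSeries.X)) = 1 := by
    have e : bell p rrF*((1-PowerSeries.X)*(1-PowerSeries.C (chi3 p)*PowerSeries.X)) =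
      bell p rrF-PowerSeries.C (1+chi3 p)*(bell p rrF*PowerSeries.X) +
        PowerSeries.C (chi3 p)*(bell p rrF*PowerSeries.X*PowerSeries.X) := by
      rw [map_add, map_one]; ring
    rw [e]
    have v : ∀ j, PowerSeries.coeff j (bell p rrF) = rr (p^j) := fun j => by
      rw [bell, coeff_mk, rrF_apply (pow_ne_zero _ pp.ne_zero)]
    ext j
    rw [map_add, map_sub, coeff_C_mul, coeff_C_mul, PowerSeries.coeff_one]
    rcases j with _ | _ | j
    · simp [v, rr_one]
    · rw [coeff_succ_mul_X, coeff_succ_mul_X, v, v]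
      have := rr_prime_mul pp 1
      rw [if_neg (by simpa using pp.one_lt.ne'), mul_one, rr_one] at this
      simp [this, rr_one]
    · rw [coeff_succ_mul_X, coeff_succ_mul_X, coeff_succ_mul_X, v, v, v]
      have := rr_prime_mul pp (p^(j+1))
      rw [if_pos (dvd_pow_self _ (by omega)), pow_succ' p j, Nat.mul_div_cancel_left _ pp.pos,
        ← pow_succ', ← pow_succ'] at this
      rw [this, if_neg (by omega)]; ring
  rw [bell_powFn pp isMultiplicative_rrF]
  have := congrArg (PowerSeries.substAlgHom (R := ℝ) (HasSubst.X_pow (R := ℝ) hk)) h0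
  rw [map_mul, map_mul, map_sub, map_sub, map_mul, map_one] at this
  simp only [PowerSeries.coe_substAlgHom] at this
  rw [subst_X (HasSubst.X_pow hk)] at this
  have c : PowerSeries.subst (PowerSeries.X^k : PowerSeries ℝ) (PowerSeries.C (chi3 p)) = PowerSeries.C (chi3 p) := by
    ext i
    rw [coeff_subst_X_pow hk, coeff_C, coeff_C]
    rcases Nat.eq_zero_or_pos i with rfl | h
    · simp
    · rw [if_neg h.ne']
      split_ifs with h1 h2
      · have := Nat.div_eq_zero_iff.1 h2
        exact absurd (le_of_dvd h h1) (by omega)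
      · rfl
      · rfl
  rw [c] at this
  convert this using 2
  ext j
  rw [coeff_subst_X_pow hk, coeff_mk]
  split_ifs <;> simp [bell]

/-- The generating function of the triple sum. -/
def tripleF : ArithmeticFunction ℝ := powFn 3 oneF*(powFn 4 rrF*powFn 5 rrF)

lemma summ_powFn {k : ℕ} (hk : k ≠ 0) {f : ArithmeticFunction ℝ} (hf : f.IsMultiplicative) {X : ℝ} (hX : 0 ≤ X) :
    summ (powFn k f) X = ∑ d ∈ Icc 1 ⌊X^((1:ℝ)/k)⌋₊, f d := by
  have := sum_powFn hk hf (fun _ => 1) ⌊X⌋₊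
  simp only [mul_one] at this
  refine this.trans (sum_congr ?_ fun _ _ => rfl)
  ext d
  rw [mem_filter, mem_Ioc, mem_Icc, le_floor_iff (a := X^_) (by positivity),
    le_root_iff hk hX (by positivity), le_floor_iff hX, le_floor_iff hX]
  push_cast
  constructor
  · rintro ⟨⟨h1, -⟩, h2⟩; exact ⟨h1, h2⟩
  · rintro ⟨h1, h2⟩
    refine ⟨⟨h1, le_trans ?_ h2⟩, h2⟩
    exact_mod_cast Nat.le_self_pow hk d

lemma summ_rr_mul_rr {V : ℝ} (hV : 0 ≤ V) : summ (powFn 4 rrF*powFn 5 rrF) V = pairCount V := by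
  rw [summ_powFn_mul (by norm_num) isMultiplicative_rrF _ hV, pairCount]
  refine Eq.symm ?_
  refine (sum_finset_product' (pairs V) (Icc 1 ⌊V⌋₊)
    (fun b => Icc 1 ⌊(V/(b:ℝ)^4)^((1:ℝ)/(5:ℕ))⌋₊) ?_ (f := fun b c => rr b*rr c)).trans ?_
  · rintro ⟨b, c⟩
    rw [mem_pairs, mem_Icc, mem_Icc, le_floor_iff hV, le_floor_iff (by positivity),
      le_root_iff (by norm_num) (by positivity) (by positivity)]
    simp only
    constructor
    · rintro ⟨h1, h2, h⟩
      have hb : (1:ℝ) ≤ b := mod_cast h1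
      have hc : (1:ℝ) ≤ c := mod_cast h2
      refine ⟨⟨h1, ?_⟩, h2, (le_div_iff₀ (by positivity)).2 (by linarith)⟩
      have e1 := le_self_pow₀ hb (by norm_num : 4 ≠ 0)
      have e2 := one_le_pow₀ hc (n := 5)
      nlinarith
    · rintro ⟨⟨h1, -⟩, h2, h⟩
      have := (le_div_iff₀ (by positivity)).1 h
      exact ⟨h1, h2, by linarith⟩
  · refine sum_congr rfl fun b hb => ?_
    have b1 : 1 ≤ b := (mem_Icc.1 hb).1
    rw [summ_powFn (by norm_num) isMultiplicative_rrF (by positivity), rrF_apply (by omega),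
      mul_sum]
    refine sum_congr rfl fun c hc => ?_
    have c1 : 1 ≤ c := (mem_Icc.1 hc).1
    rw [rrF_apply (by omega)]

lemma summ_tripleF {Y : ℝ} (hY : 0 ≤ Y) : summ tripleF Y = tripleCount Y := by
  rw [tripleF, summ_powFn_mul (by norm_num) isMultiplicative_oneF _ hY, tripleCount]
  refine sum_congr rfl fun a ha => ?_
  have a1 : 1 ≤ a := (mem_Icc.1 ha).1
  rw [oneF_apply (by omega), one_mul, summ_rr_mul_rr (by positivity)]

/-- The generating functions whose summatory functions are known. -/
def HasMainTerm (t : ArithmeticFunction ℝ) : Prop := ∃ c3 c4 c5 K : ℝ, ∀ Y, 1 ≤ Y →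
  |summ t Y-mainTerm c3 c4 c5 Y| ≤ K*(Y^((1:ℝ)/6)*(1+Real.log Y))

lemma hasMainTerm_tripleF : HasMainTerm tripleF := by
  obtain ⟨c3, c4, c5, K, hK, H⟩ := exists_tripleCount_asymp
  refine ⟨c3, c4, c5, K, fun Y hY => ?_⟩
  have h := H (Y^((1:ℝ)/9)) (one_le_rpow hY (by norm_num))
  have Y0 : 0 ≤ Y := by linarith
  rw [← rpow_natCast, ← rpow_natCast, ← rpow_mul Y0, ← rpow_mul Y0, ← rpow_mul Y0,
    ← rpow_mul Y0, ← rpow_mul Y0, log_rpow (by linarith)] at h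
  norm_num at h
  rw [summ_tripleF Y0, mainTerm]
  refine h.trans ?_
  have := log_nonneg hY
  gcongr
  linarith

lemma hasMainTerm_one : HasMainTerm (powFn 3 oneF) := by
  refine ⟨1, 0, 0, 1, fun Y hY => ?_⟩
  have Y0 : 0 ≤ Y := by linarith
  have e : ∑ d ∈ Icc 1 ⌊Y^((1:ℝ)/(3:ℕ))⌋₊, oneF d = (⌊Y^((1:ℝ)/3)⌋₊:ℝ) := by
    rw [sum_congr rfl fun d hd => oneF_apply (n := d) (by rw [mem_Icc] at hd; omega)]
    simp
  rw [summ_powFn (by norm_num) isMultiplicative_oneF Y0, e, mainTerm]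
  have l := log_nonneg hY
  have p := one_le_rpow hY (by norm_num : (0:ℝ) ≤ 1/6)
  have h1 := floor_le (a := Y^((1:ℝ)/3)) (by positivity)
  have h2 := lt_floor_add_one (Y^((1:ℝ)/3))
  rw [abs_le]
  constructor <;> nlinarith

lemma hasMainTerm_rr : HasMainTerm (powFn 4 rrF) := by
  obtain ⟨C, hC, H⟩ := exists_Es_le
  refine ⟨0, kap, 0, 1+C, fun Y hY => ?_⟩
  have Y0 : 0 ≤ Y := by linarith
  have e : ∑ d ∈ Icc 1 ⌊Y^((1:ℝ)/(4:ℕ))⌋₊, rrF d = rrSum 0 (Y^((1:ℝ)/4)) := by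
    rw [rrSum]
    push_cast
    refine sum_congr rfl fun d hd => ?_
    rw [rrF_apply (by rw [mem_Icc] at hd; omega)]; simp
  rw [summ_powFn (by norm_num) isMultiplicative_rrF Y0, e, rrSum_zero (by positivity), mainTerm]
  have l := log_nonneg hY
  have p := one_le_rpow hY (by norm_num : (0:ℝ) ≤ 1/6)
  have h := H (Y^((1:ℝ)/4)) (one_le_rpow hY (by norm_num))
  rw [← rpow_mul Y0] at h
  have h' : Y^((1:ℝ)/4*(1/3)) ≤ Y^((1:ℝ)/6) := rpow_le_rpow_of_exponent_le hY (by norm_num)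
  have h2 := h.trans (mul_le_mul_of_nonneg_left h' hC.le)
  rw [abs_le] at h2 ⊢
  set u := Y^((1:ℝ)/6)
  constructor <;> nlinarith

lemma isMultiplicative_powFn (k:ℕ) (f : ArithmeticFunction ℝ) : (powFn k f).IsMultiplicative :=
  isMultiplicative_mulOf _

lemma mulOf_nonneg {c : ℕ → ℕ → ℝ} (hc : ∀ p k, 0 ≤ c p k) (n:ℕ) : 0 ≤ mulOf c n := by
  rcases eq_or_ne n 0 with rfl | hn
  · simp
  · rw [mulOf_apply _ hn]; exact prod_nonneg fun _ _ => hc _ _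

lemma powFn_oneF_nonneg (k n:ℕ) : 0 ≤ powFn k oneF n := by
  refine mulOf_nonneg (fun p j => ?_) n
  split_ifs
  · exact mulOf_nonneg (fun _ _ => zero_le_one) _
  · rfl

lemma powFn_mul_apply_le {κ : ArithmeticFunction ℝ} (hκ : ∀ n, 0 ≤ κ n) {m : ℕ} (hm : 1 ≤ m) :
    (powFn 6 oneF*κ) m ≤ ∑ d ∈ Icc 1 m, ∑ e ∈ Icc 1 m, if d^6*e = m then κ e else 0 := by
  rw [mul_apply, Nat.divisorsAntidiagonal_eq_prod_filter_of_le (by omega) le_rfl, sum_filter,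
    sum_product]
  have G0 : ∀ a : ℕ, 0 ≤ ∑ e ∈ Ioc 0 m, if a*e = m then κ e else 0 := fun a =>
    sum_nonneg fun e _ => by split_ifs <;> simp [hκ]
  calc _ = ∑ a ∈ Ioc 0 m, powFn 6 oneF a*∑ e ∈ Ioc 0 m, if a*e = m then κ e else 0 := by
        refine sum_congr rfl fun a _ => ?_
        rw [mul_sum]
        exact sum_congr rfl fun e _ => by split_ifs <;> simp
    _ = _ := sum_powFn (by norm_num) isMultiplicative_oneF _ m
    _ ≤ ∑ d ∈ Ioc 0 m, oneF d*∑ e ∈ Ioc 0 m, if d^6*e = m then κ e else 0 :=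
        sum_le_sum_of_subset_of_nonneg (filter_subset _ _) fun d _ _ =>
          mul_nonneg (mulOf_nonneg (fun _ _ => zero_le_one) _) (G0 _)
    _ = _ := sum_congr rfl fun d hd => by
        rw [oneF_apply (by rw [mem_Ioc] at hd; omega), one_mul]; rfl

/-- Bounded local factors give a convergent Dirichlet series at `1 / 6`. -/
lemma exists_sum_mulOf_le {c : ℕ → ℕ → ℝ} {D : ℕ} {C : ℝ} (hc : ∀ p k, 0 ≤ c p k) (h0 : ∀ p, c p 0 = 1)
    (hD : ∀ p k, D < k → c p k = 0) (hC : ∀ p k, c p k ≤ C) (h5 : ∀ p k, 5 ≤ p → 1 ≤ k → k ≤ 6 → c p k = 0) :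
    ∃ B, ∀ N, ∑ e ∈ Icc 1 N, mulOf c e*(e:ℝ)^(-(1/6):ℝ) ≤ B := by
  have C0 : 0 ≤ C := (hc 0 0).trans (hC 0 0)
  set f : ℕ → ℝ := fun n => mulOf c n*(n:ℝ)^(-(1/6):ℝ) with hf
  have f0 : ∀ n, 0 ≤ f n := fun n => mul_nonneg (mulOf_nonneg hc n) (by positivity)
  have fp : ∀ p k : ℕ, p.Prime → f (p^k) = c p k*((p^k:ℕ):ℝ)^(-(1/6):ℝ) := fun p k pp => by
    rw [hf]; simp only; rw [mulOf_pow pp (h0 p)]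
  have fz : ∀ p k : ℕ, p.Prime → k ∉ range (D+1) → f (p^k) = 0 := fun p k pp hk => by
    rw [fp p k pp, hD p k (by rw [mem_range] at hk; omega), zero_mul]
  have bd : ∀ p : ℕ, p.Prime → ∑' k, f (p^k) ≤ 1+D*C*16*(p:ℝ)^(-(7/6):ℝ) := fun p pp => by
    have p1 : (1:ℝ) ≤ p := mod_cast pp.one_lt.le
    rw [tsum_eq_sum (s := range (D+1)) fun k hk => fz p k pp hk, sum_range_succ', add_comm]
    refine add_le_add (by rw [fp p 0 pp, h0]; simp) ?_
    have : ∀ k ∈ range D, f (p^(k+1)) ≤ C*16*(p:ℝ)^(-(7/6):ℝ) := fun k _ => by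
      rw [fp p _ pp]
      push_cast
      rw [← rpow_natCast, ← rpow_mul (by linarith)]
      by_cases h : 5 ≤ p ∧ k+1 ≤ 6
      · rw [h5 p _ h.1 (by omega) h.2, zero_mul]; positivity
      rw [mul_assoc]
      refine mul_le_mul (hC _ _) ?_ (by positivity) C0
      rw [not_and_or] at h
      rcases h with h | h
      · have : (p:ℝ) ≤ 4 := mod_cast (by omega : p ≤ 4)
        have l : ((p:ℝ))^((k+1:ℕ)*(-(1/6)):ℝ) ≤ 1 :=
          Real.rpow_le_one_of_one_le_of_nonpos p1 (by push_cast; nlinarith [(k.cast_nonneg : (0:ℝ) ≤ k)])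
        have u : (p:ℝ)^((7:ℝ)/6) ≤ 16 := by
          calc (p:ℝ)^((7:ℝ)/6) ≤ (p:ℝ)^(2:ℝ) := rpow_le_rpow_of_exponent_le p1 (by norm_num)
            _ = (p:ℝ)^2 := by norm_cast
            _ ≤ 16 := by nlinarith
        refine l.trans ?_
        rw [rpow_neg (by linarith), ← div_eq_mul_inv, one_le_div (by positivity)]
        exact u
      · have : (6:ℝ) ≤ k := mod_cast (by omega : 6 ≤ k)
        have := rpow_le_rpow_of_exponent_le p1
          (by push_cast; linarith : ((k+1:ℕ)*(-(1/6)):ℝ) ≤ -(7/6))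
        have h2 : 0 ≤ (p:ℝ)^(-(7/6):ℝ) := by positivity
        linarith
    refine (sum_le_sum this).trans (le_of_eq ?_)
    rw [sum_const, card_range, nsmul_eq_mul]; ring
  have sz : Summable fun n : ℕ => D*C*16*(n:ℝ)^(-(7/6):ℝ) :=
    (Real.summable_nat_rpow.2 (by norm_num)).mul_left _
  refine ⟨Real.exp (∑' n : ℕ, D*C*16*(n:ℝ)^(-(7/6):ℝ)), fun N => ?_⟩
  have sm := EulerProduct.summable_and_hasSum_smoothNumbers_prod_primesBelow_tsum (f := f)
    (by simp [hf, (isMultiplicative_mulOf c).1]) (fun {m n} h => by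
      rw [hf]; simp only
      rw [(isMultiplicative_mulOf c).2 h, Nat.cast_mul, mul_rpow (by positivity) (by positivity)]; ring)
    (fun {p} pp => summable_of_ne_finset_zero (s := range (D+1)) fun k hk => by
      rw [fz p k pp hk, norm_zero]) (N+1)
  have hs := sm.2
  have mem : ∀ e ∈ Icc 1 N, e ∈ (N+1).smoothNumbers := fun e he => by
    rw [mem_Icc] at he
    exact Nat.mem_smoothNumbers_of_lt (by omega) (by omega)
  calc _ = ∑ e ∈ (Icc 1 N).subtype (· ∈ (N+1).smoothNumbers), f e := by
        rw [sum_subtype_of_mem _ mem]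
    _ ≤ _ := sum_le_hasSum _ (fun e _ => f0 e) hs
    _ ≤ ∏ p ∈ (N+1).primesBelow, (1+D*C*16*(p:ℝ)^(-(7/6):ℝ)) :=
        prod_le_prod (fun p _ => tsum_nonneg fun k => f0 _) fun p hp =>
          bd p (Nat.prime_of_mem_primesBelow hp)
    _ ≤ _ := Real.prod_one_add_le_exp_sum _ fun p => by positivity
    _ ≤ _ := Real.exp_le_exp.2 (sz.sum_le_tsum _ fun p _ => by positivity)

lemma sixthDominated_mulOf {c : ℕ → ℕ → ℝ} {D : ℕ} {C : ℝ} (h0 : ∀ p, c p 0 = 1)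
    (hD : ∀ p k, D < k → c p k = 0) (hC : ∀ p k, |c p k| ≤ C)
    (h5 : ∀ p k, 5 ≤ p → 1 ≤ k → k ≤ 5 → c p k = 0) (h6 : ∀ p, 5 ≤ p → |c p 6| ≤ 1) :
    SixthDominated (mulOf c) := by
  have C1 : 1 ≤ C := by simpa [h0] using hC 0 0
  set k0 : ℕ → ℕ → ℝ := fun p k => if k = 0 then 1 else if D < k ∨ 5 ≤ p ∧ k ≤ 6 then 0 else C with hk0
  have kn : ∀ p k, 0 ≤ k0 p k := fun p k => by simp only [hk0]; split_ifs <;> linarith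
  obtain ⟨B, hB⟩ := exists_sum_mulOf_le (c := k0) (D := D) (C := C) kn (fun p => by simp [hk0])
    (fun p k h => by simp only [hk0]; rw [if_neg (by omega), if_pos (inl h)])
    (fun p k => by simp only [hk0]; split_ifs <;> linarith)
    (fun p k h h1 h6 => by simp only [hk0]; rw [if_neg (by omega), if_pos (inr ⟨h, h6⟩)])
  refine ⟨mulOf k0, B, mulOf_nonneg kn, hB, fun m hm => ?_⟩
  refine le_trans ?_ (powFn_mul_apply_le (mulOf_nonneg kn) hm)
  have F0 : ∀ n, 0 ≤ (powFn 6 oneF*mulOf k0) n := fun n => by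
    rw [mul_apply]
    exact sum_nonneg fun x _ => mul_nonneg (powFn_oneF_nonneg _ _) (mulOf_nonneg kn _)
  have hm0 : m ≠ 0 := by omega
  rw [IsMultiplicative.multiplicative_factorization _
    ((isMultiplicative_powFn 6 oneF).mul (isMultiplicative_mulOf k0)) hm0, mulOf_apply _ hm0,
    Finsupp.prod, Finsupp.prod, abs_prod]
  refine prod_le_prod (fun _ _ => abs_nonneg _) fun p hp => ?_
  have pp : p.Prime := Nat.prime_of_mem_primeFactors (by simpa using hp)
  set k := m.factorization p
  have e : (powFn 6 oneF*mulOf k0) (p^k) =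
      ∑ x ∈ HasAntidiagonal.antidiagonal k, powFn 6 oneF (p^x.1)*k0 p x.2 := by
    have := congrArg (PowerSeries.coeff k) (bell_mul pp (powFn 6 oneF) (mulOf k0))
    rw [coeff_mul] at this
    simp only [bell, coeff_mk] at this
    rw [this]
    refine sum_congr rfl fun x _ => ?_
    rw [mulOf_pow pp (by simp [hk0])]
  have nn : ∀ x ∈ HasAntidiagonal.antidiagonal k, 0 ≤ powFn 6 oneF (p^x.1)*k0 p x.2 := fun x _ =>
    mul_nonneg (powFn_oneF_nonneg _ _) (kn _ _)
  have h1 : k0 p k ≤ (powFn 6 oneF*mulOf k0) (p^k) := by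
    rw [e]
    refine le_trans (le_of_eq ?_) (single_le_sum nn (a := (0, k)) (by simp))
    simp [(isMultiplicative_powFn 6 oneF).1]
  rcases Nat.eq_zero_or_pos k with hk | hk
  · refine le_trans ?_ h1
    rw [hk, h0]; simp [hk0]
  by_cases h : 5 ≤ p ∧ k ≤ 6
  · rcases Nat.lt_or_ge k 6 with h' | h'
    · rw [h5 p k h.1 hk (by omega), abs_zero]; exact F0 _
    · have k6 : k = 6 := by omega
      rw [e]
      refine le_trans ?_ (single_le_sum nn (a := (6, 0)) (by simp [k6]))
      simp only
      rw [powFn_pow (by norm_num) isMultiplicative_oneF pp.ne_zero, oneF_apply pp.ne_zero, k6]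
      simpa [hk0] using h6 p h.1
  · refine le_trans ?_ h1
    simp only [hk0]
    rw [if_neg hk.ne']
    split_ifs with h2
    · rw [hD p k (by tauto), abs_zero]
    · exact hC p k

theorem exists_asymp_of_bell {g t : ArithmeticFunction ℝ} (hg : g.IsMultiplicative)
    (ht : t.IsMultiplicative) (HM : HasMainTerm t) {H : ℕ → Polynomial ℝ} (fin : (Set.range H).Finite)
    (h0 : ∀ p, (H p).coeff 0 = 1)
    (h5 : ∀ p, 5 ≤ p → ∃ R : Polynomial ℝ, H p = 1+Polynomial.X^6*R ∧ |R.coeff 0| ≤ 1)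
    (hb : ∀ p, p.Prime → bell p g = (H p : PowerSeries ℝ)*bell p t) :
    ∃ d3 d4 d5 K' : ℝ, 0 < K' ∧ ∀ X, 1 ≤ X →
      |summ g X-mainTerm d3 d4 d5 X| ≤ K'*(X^((1:ℝ)/6)*(1+Real.log X)^2) := by
  obtain ⟨D, hD⟩ := (fin.image natDegree).bddAbove
  have hD' : ∀ p, (H p).natDegree ≤ D := fun p => hD ⟨_, ⟨p, rfl⟩, rfl⟩
  obtain ⟨C, hC⟩ := (fin.image fun P => ∑ i ∈ range (D+1), |P.coeff i|).bddAbove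
  have hC' : ∀ p, ∑ i ∈ range (D+1), |(H p).coeff i| ≤ C := fun p => hC ⟨_, ⟨p, rfl⟩, rfl⟩
  have hz : ∀ p k, D < k → (H p).coeff k = 0 := fun p k h =>
    Polynomial.coeff_eq_zero_of_natDegree_lt ((hD' p).trans_lt h)
  have SD : SixthDominated (mulOf fun p k => (H p).coeff k) := by
    refine sixthDominated_mulOf (D := D) (C := C) h0 hz (fun p k => ?_) (fun p k h h1 h2 => ?_) fun p h => ?_
    · rcases Nat.lt_or_ge D k with h | h
      · rw [hz p k h, abs_zero]
        exact (sum_nonneg fun _ _ => abs_nonneg _).trans (hC' p)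
      · exact (single_le_sum (f := fun i => |(H p).coeff i|) (fun _ _ => abs_nonneg _)
          (mem_range.2 (by omega))).trans (hC' p)
    · obtain ⟨R, e, -⟩ := h5 p h
      rw [e, coeff_add, coeff_X_pow_mul', if_neg (by omega), Polynomial.coeff_one,
        if_neg (by omega), add_zero]
    · obtain ⟨R, e, h⟩ := h5 p h
      rw [e, coeff_add, coeff_X_pow_mul', if_pos le_rfl, Polynomial.coeff_one,
        if_neg (by omega), zero_add]
      exact h
  have eg : g = (mulOf fun p k => (H p).coeff k)*t := by
    refine eq_of_bell hg ((isMultiplicative_mulOf _).mul ht) fun p pp => ?_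
    rw [bell_mul pp, hb p pp]
    congr 1
    ext k
    rw [bell, coeff_mk, mulOf_pow pp (h0 p), Polynomial.coeff_coe]
  obtain ⟨c3, c4, c5, K, hK⟩ := HM
  obtain ⟨d3, d4, d5, K', h, h'⟩ := SD.exists_asymp (fun Y hY => summ_of_lt_one t hY) hK
  refine ⟨d3, d4, d5, K', h, fun X hX => ?_⟩
  rw [eg, summ_mul]
  exact h' X hX

/-- The shape of the error term in the counting functions. -/
def HasAsymp (g : ArithmeticFunction ℝ) : Prop := ∃ d3 d4 d5 K' : ℝ, 0 < K' ∧ ∀ X, 1 ≤ X →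
  |summ g X-mainTerm d3 d4 d5 X| ≤ K'*(X^((1:ℝ)/6)*(1+Real.log X)^2)

open Polynomial in
lemma hasAsymp_of_local {c : ℕ → ℕ → ℝ} {D : ℕ} {t : ArithmeticFunction ℝ} {Q U R : ℝ → ℝ[X]}
    (ht : t.IsMultiplicative) (HM : HasMainTerm t) (h0 : ∀ p, c p 0 = 1)
    (hD : ∀ k, D < k → c 2 k = 0 ∧ c 3 k = 0)
    (hU : ∀ p, p.Prime → 5 ≤ p → ∀ k, c p k = (U (chi3 p)).coeff k)
    (hQ : ∀ p, p.Prime → bell p t*(Q (chi3 p) : PowerSeries ℝ) = 1)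
    (hR : ∀ e, U e*Q e = 1+X^6*R e) (hR0 : ∀ e, |(R e).coeff 0| ≤ 1) (hQ0 : ∀ e, (Q e).coeff 0 = 1) :
    HasAsymp (mulOf c) := by
  set S : ℕ → ℝ[X] := fun p => ∑ k ∈ range (D+1), monomial k (c p k) with hS
  have Sc : ∀ p k, (S p).coeff k = if k ≤ D then c p k else 0 := fun p k => by
    rw [hS]; simp only [finset_sum_coeff, coeff_monomial]
    simp [Nat.lt_succ_iff]
  set H : ℕ → ℝ[X] := fun p => if p < 5 then S p*Q (chi3 p) else U (chi3 p)*Q (chi3 p) with hH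
  refine exists_asymp_of_bell (isMultiplicative_mulOf c) ht HM (H := H) ?_ (fun p => ?_) (fun p hp => ?_)
    fun p pp => ?_
  · refine Set.Finite.subset (((Set.finite_Iio 5).image fun p => S p*Q (chi3 p)).union
      ((Set.toFinite {(0:ℝ), 1, -1}).image fun e => U e*Q e)) ?_
    rintro _ ⟨p, rfl⟩
    simp only [hH]
    split_ifs with h
    · exact inl ⟨p, h, rfl⟩
    · refine inr ⟨chi3 p, ?_, rfl⟩
      rw [chi3]; split_ifs <;> simp
  · simp only [hH]
    split_ifs with h
    · rw [mul_coeff_zero, Sc, hQ0, if_pos (by omega), h0, one_mul]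
    · rw [hR]; simp
  · refine ⟨R (chi3 p), ?_, hR0 _⟩
    simp only [hH]
    rw [if_neg (by omega), hR]
  · have e : ((H p : ℝ[X]) : PowerSeries ℝ) = bell p (mulOf c)*(Q (chi3 p) : PowerSeries ℝ) := by
      simp only [hH]
      split_ifs with h
      · rw [Polynomial.coe_mul]; congr 1
        ext k
        rw [bell, coeff_mk, mulOf_pow pp (h0 p), coeff_coe, Sc]
        split_ifs with hk
        · rfl
        · have := hD k (by omega)
          have : p = 2 ∨ p = 3 := by interval_cases p <;> revert pp <;> norm_num
          rcases this with rfl | rfl <;> simp [*]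
      · rw [Polynomial.coe_mul]; congr 1
        ext k
        rw [bell, coeff_mk, mulOf_pow pp (h0 p), coeff_coe, hU p pp (by omega)]
    rw [e, mul_assoc, mul_comm _ (bell p t), hQ p pp, mul_one]

/-- The three counting functions: all characters, quadratic characters, cubic characters. -/
lemma hasAsymp_mulOf {c : ℕ → ℕ → ℝ} {D : ℕ} (h0 : ∀ p, c p 0 = 1)
    (hD : ∀ k, D < k → c 2 k = 0 ∧ c 3 k = 0) {a b : ℝ} (hab : a = 1 ∧ b = 1 ∨ a = 1 ∧ b = 0 ∨ a = 0 ∧ b = 1)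
    (hU : ∀ p, p.Prime → 5 ≤ p → ∀ k, 0 < k → c p k = (if k = 3 then a else 0) +
      (if k = 4 then b*(1+chi3 p) else 0)+(if k = 5 then a*b*(1+chi3 p) else 0)) :
    HasAsymp (mulOf c) := by
  set U : ℝ → Polynomial ℝ := fun e => 1+Polynomial.C a*Polynomial.X^3 +
    Polynomial.C (b*(1+e))*Polynomial.X^4+Polynomial.C (a*b*(1+e))*Polynomial.X^5 with hUd
  have hU' : ∀ p, p.Prime → 5 ≤ p → ∀ k, c p k = (U (chi3 p)).coeff k := fun p pp h5 k => by
    rw [hUd]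
    simp only [coeff_add, Polynomial.coeff_C_mul_X_pow, Polynomial.coeff_one]
    rcases Nat.eq_zero_or_pos k with rfl | hk
    · simp [h0]
    · rw [hU p pp h5 k hk, if_neg hk.ne', zero_add]
  set T : ℝ → Polynomial ℝ := fun e => let x := Polynomial.X; let d := Polynomial.C e; let s := 1+d;
    -s-s*x+d*x-s*x*(s+s*x-x^2-s*x^3-s*x^4) +
      d*x*(s*x^4+s*x^5-x^6-s*x^7-s*x^8) with hT
  set R : ℝ → Polynomial ℝ := fun e => let x := Polynomial.X; let d := Polynomial.C e; let s := 1+d;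
    -1+x*T e+d*x^4-s*x^4*(s-x+x^2*T e)+d*x^4*(s*x^5-x^6+x^7*T e) with hR
  have m1 := isMultiplicative_powFn 3 oneF
  have m4 := isMultiplicative_powFn 4 rrF
  have m5 := isMultiplicative_powFn 5 rrF
  rcases hab with ⟨rfl, rfl⟩ | ⟨rfl, rfl⟩ | ⟨rfl, rfl⟩
  · refine hasAsymp_of_local (t := tripleF) (U := U) (m1.mul (m4.mul m5)) hasMainTerm_tripleF h0 hD hU'
      (Q := fun e => (1-Polynomial.X^3)*(((1-Polynomial.X^4)*(1-Polynomial.C e*Polynomial.X^4)) *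
        ((1-Polynomial.X^5)*(1-Polynomial.C e*Polynomial.X^5))))
      (R := R) (fun p pp => ?_) (fun e => ?_) (fun e => ?_) fun e => by simp [Polynomial.mul_coeff_zero]
    · have e1 := bell_oneF pp (k := 3) (by norm_num)
      have e2 := bell_rrF pp (k := 4) (by norm_num)
      have e3 := bell_rrF pp (k := 5) (by norm_num)
      rw [tripleF, bell_mul pp, bell_mul pp]
      push_cast
      rw [mul_mul_mul_comm, e1, one_mul, mul_mul_mul_comm, e2, one_mul, e3]
    · simp only [hUd, hR, hT]
      simp only [map_mul, map_add, map_one]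
      ring
    · simp [hR, Polynomial.mul_coeff_zero]
  · refine hasAsymp_of_local (t := powFn 3 oneF) (U := U) m1 hasMainTerm_one h0 hD hU'
      (Q := fun e => 1-Polynomial.X^3) (R := fun _ => -1) (fun p pp => ?_) (fun e => ?_) (fun e => by simp)
      fun e => by simp
    · have e1 := bell_oneF pp (k := 3) (by norm_num)
      push_cast
      exact e1
    · simp only [hUd]; simp; ring
  · refine hasAsymp_of_local (t := powFn 4 rrF) (U := U) m4 hasMainTerm_rr h0 hD hU'
      (Q := fun e => (1-Polynomial.X^4)*(1-Polynomial.C e*Polynomial.X^4))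
      (R := fun e => Polynomial.X^2*(Polynomial.C e-(1+Polynomial.C e)^2 +
        Polynomial.C e*(1+Polynomial.C e)*Polynomial.X^4)) (fun p pp => ?_) (fun e => ?_)
      (fun e => by simp [Polynomial.mul_coeff_zero]) fun e => by simp [Polynomial.mul_coeff_zero]
    · have e1 := bell_rrF pp (k := 4) (by norm_num)
      push_cast
      exact e1
    · simp only [hUd]; simp; ring

end

section
open NumberField in
lemma padicValNat_discr_of_adjoin_root {L M : Type} [Field L] [NumberField L] [Field M]
    [NumberField M] [Algebra L M] {m p : ℕ} (pp : p.Prime) (hpm : ¬ p ∣ m) {ζ : M} (hζ : ζ^m = 1)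
    (hadj : adjoin L {ζ} = ⊤) :
    padicValNat p (discr M).natAbs = finrank L M*padicValNat p (discr L).natAbs := by
  have := Fact.mk pp
  have hm : 0 < m := Nat.pos_of_ne_zero fun h => hpm (h ▸ dvd_zero p)
  have hInt : IsIntegral ℤ ζ := IsIntegral.of_pow hm (hζ ▸ isIntegral_one)
  let z : 𝓞 M := ⟨ζ, hInt⟩
  have hzζ : algebraMap (𝓞 M) M z = ζ := rfl
  have hz : z^m = 1 := by ext; simpa [hzζ] using hζ
  have hzL : IsIntegral (𝓞 L) z := Algebra.IsIntegral.isIntegral z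
  have hadj' : Algebra.adjoin L {algebraMap (𝓞 M) M z} = ⊤ := by
    have := adjoin_simple_toSubalgebra_of_isAlgebraic
      (Algebra.IsAlgebraic.isAlgebraic (R := L) ζ)
    rw [hadj] at this
    simpa [hzζ] using this.symm
  have hmem := aeval_derivative_mem_differentIdeal (𝓞 L) L M z hadj'
  have hdvd : minpoly (𝓞 L) z ∣ Polynomial.X^m-1 :=
    minpoly.isIntegrallyClosed_dvd hzL (by simp [hz])
  have hm_mem : (m : 𝓞 M) ∈ differentIdeal (𝓞 L) (𝓞 M) := by
    obtain ⟨q, hq⟩ := hdvd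
    have h1 := congrArg (fun f => aeval z (Polynomial.derivative f)) hq
    simp only [Polynomial.derivative_mul, map_add, map_mul, minpoly.aeval, zero_mul, add_zero] at h1
    have h2 : (m : 𝓞 M) = (aeval z (Polynomial.derivative (minpoly (𝓞 L) z)) * aeval z q)*z := by
      rw [← h1]
      simp only [Polynomial.derivative_sub, Polynomial.derivative_X_pow, Polynomial.derivative_one,
        sub_zero, map_mul, map_pow, aeval_X, mul_assoc]
      rw [← pow_succ, Nat.sub_add_cancel hm, hz]
      simp
    rw [h2]
    exact Ideal.mul_mem_right _ _ (Ideal.mul_mem_right _ _ hmem)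
  have hnorm : ¬ p ∣ absNorm (differentIdeal (𝓞 L) (𝓞 M)) := by
    intro h
    have h3 := h.trans (Ideal.absNorm_dvd_absNorm_of_le
      ((Ideal.span_singleton_le_iff_mem _).mpr hm_mem))
    rw [Ideal.absNorm_span_natCast] at h3
    exact hpm (pp.dvd_of_dvd_pow h3)
  have key := natAbs_discr_eq_absNorm_differentIdeal_mul_natAbs_discr_pow L (𝓞 L) M (𝓞 M)
  have hL : (discr L).natAbs ≠ 0 := by simpa using discr_ne_zero L
  have h0 : absNorm (differentIdeal (𝓞 L) (𝓞 M)) ≠ 0 := fun h => hnorm (by rw [h]; exact dvd_zero p)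
  rw [key, padicValNat.mul h0 (pow_ne_zero _ hL),
    padicValNat.eq_zero_of_not_dvd hnorm, padicValNat.pow, zero_add]

open NumberField in
lemma padicValNat_discr_add_one {L W : Type} [Field L] [NumberField L] [Field W]
    [NumberField W] [Algebra L W] {p : ℕ} (pp : p.Prime) [hW : IsCyclotomicExtension {p} ℚ W] :
    padicValNat p (discr L).natAbs+1 = finrank ℚ L := by
  have := Fact.mk pp
  set f := finrank L W with hf
  set e := finrank ℚ L with he
  have hfpos : 0 < f := finrank_pos
  have htower : e*f = p-1 := by
    rw [he, hf, Module.finrank_mul_finrank, IsCyclotomicExtension.Rat.finrank p W,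
      Nat.totient_prime pp]
  have hL : (discr L).natAbs ≠ 0 := by simpa using discr_ne_zero L
  have hp2 := pp.two_le
  -- upper bound
  have hupper : f*padicValNat p (discr L).natAbs ≤ p-2 := by
    have key := natAbs_discr_eq_absNorm_differentIdeal_mul_natAbs_discr_pow L (𝓞 L) W (𝓞 W)
    rw [IsCyclotomicExtension.Rat.discr_prime p W] at key
    have h1 : (discr L).natAbs^f ∣ p^(p-2) := by
      refine ⟨absNorm (differentIdeal (𝓞 L) (𝓞 W)), ?_⟩
      rw [mul_comm, ← key]
      simp [Int.natAbs_mul, Int.natAbs_pow]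
    have h2 := (padicValNat_dvd_iff_le (p := p) (pow_ne_zero _ pp.ne_zero)).mp
      ((pow_padicValNat_dvd (p := p) (n := (discr L).natAbs^f)).trans h1)
    rwa [padicValNat.pow, padicValNat.prime_pow] at h2
  -- lower bound
  obtain ⟨P, hPp, hPl⟩ : ∃ P : Ideal (𝓞 W), P.IsPrime ∧ P.LiesOver (span {(p:ℤ)}) := by
    obtain ⟨⟨P, h1, h2⟩⟩ := (span {(p:ℤ)}).nonempty_primesOver (S := 𝓞 W)
    exact ⟨P, h1, h2⟩
  have hpb : span {(p:ℤ)} ≠ ⊥ := by simpa using pp.ne_zero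
  let Q := P.under (𝓞 L)
  have hPQ : P.LiesOver Q := inferInstance
  have hram := IsCyclotomicExtension.Rat.ramificationIdx_eq_of_prime p W P
  rw [Ideal.ramificationIdx_tower (R := ℤ) Q P] at hram
  have hle : P.ramificationIdx (𝓞 L) ≤ f := by
    have hfin : Finite (Q.primesOver (𝓞 W)) := Algebra.QuasiFinite.finite_primesOver Q
    have := Fintype.ofFinite (Q.primesOver (𝓞 W))
    have h1 := Ideal.sum_ramification_inertia_eq_finrank Q (𝓞 W)
    rw [← IsFractionRing.finrank_eq (𝓞 L) L (𝓞 W) W] at h1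
    rw [hf, ← h1]
    have h2 := single_le_sum (f := fun q : Q.primesOver (𝓞 W) =>
      q.1.ramificationIdx (𝓞 L)*q.1.inertiaDeg (𝓞 L)) (fun _ _ => Nat.zero_le _)
      (mem_univ (⟨P, hPp, hPQ⟩ : Q.primesOver (𝓞 W)))
    refine le_trans ?_ h2
    exact Nat.le_mul_of_pos_right _ (Ideal.inertiaDeg_pos ..)
  have hlower : e ≤ Q.ramificationIdx ℤ := by
    have : e*f ≤ Q.ramificationIdx ℤ*f := by rw [htower, ← hram]; exact Nat.mul_le_mul_left _ hle
    exact Nat.le_of_mul_le_mul_right this hfpos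
  have hmapb : (span {(p:ℤ)}).map (algebraMap ℤ (𝓞 L)) ≠ ⊥ := by
    rw [Ne, Ideal.map_eq_bot_iff_of_injective (FaithfulSMul.algebraMap_injective ℤ (𝓞 L))]
    exact hpb
  have hdvd : Q^e ∣ (span {(p:ℤ)}).map (algebraMap ℤ (𝓞 L)) := by
    refine (pow_dvd_pow Q hlower).trans ?_
    rw [Ideal.IsDedekindDomain.ramificationIdx_eq_multiplicity (span {(p:ℤ)}) Q hmapb]
    exact pow_multiplicity_dvd _ _
  have hdiff := pow_sub_one_dvd_differentIdeal (A := ℤ) Q e hpb hdvd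
  have hn : p^(e-1) ∣ (discr L).natAbs := by
    rw [← absNorm_differentIdeal L (𝓞 L)]
    refine dvd_trans ?_ (Ideal.absNorm_dvd_absNorm_of_le (Ideal.le_of_dvd hdiff))
    rw [map_pow]
    refine pow_dvd_pow_of_dvd ?_ _
    rw [← Ideal.natAbs_pow_inertiaDeg (p:ℤ) Q, Int.natAbs_natCast]
    exact dvd_pow_self _ (Ideal.inertiaDeg_pos ..).ne'
  have hn' := (padicValNat_dvd_iff_le hL).mp hn
  have : f*padicValNat p (discr L).natAbs < f*e := by rw [mul_comm f e, htower]; omega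
  have := Nat.lt_of_mul_lt_mul_left this
  omega

/-- A fixed algebraic closure of `ℚ`. -/
abbrev Om := AlgebraicClosure ℚ

/-- The absolute Galois group of `ℚ`. -/
abbrev Gm := Om ≃ₐ[ℚ] Om

instance : Algebra.IsAlgebraic ℚ Om := AlgebraicClosure.isAlgebraic ℚ

instance : IsAlgClosure ℚ Om := ⟨inferInstance, inferInstance⟩

instance : Normal ℚ Om := IsAlgClosure.normal ℚ Om

instance : IsGalois ℚ Om where

lemma exists_zt (m:ℕ) : ∃ ζ : Om, m ≠ 0 → IsPrimitiveRoot ζ m := by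
  by_cases h : m = 0
  · exact ⟨1, fun h' => absurd h h'⟩
  · have := NeZero.mk h
    obtain ⟨ζ, hζ⟩ := HasEnoughRootsOfUnity.exists_primitiveRoot Om m
    exact ⟨ζ, fun _ => hζ⟩

/-- A primitive `m`-th root of unity. -/
def zt (m:ℕ) : Om := (exists_zt m).choose

lemma zt_spec {m : ℕ} (hm : m ≠ 0) : IsPrimitiveRoot (zt m) m := (exists_zt m).choose_spec hm

/-- The mod `m` cyclotomic character. -/
def cyc (m:ℕ) : Gm →* (ZMod m)ˣ :=
  if h : m = 0 then 1 else have := NeZero.mk h; (zt_spec h).autToPow ℚ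

lemma cyc_zt {m : ℕ} (hm : m ≠ 0) (σ : Gm) : σ (zt m) = zt m^((cyc m σ : ZMod m).val) := by
  have := NeZero.mk hm
  rw [cyc, dif_neg hm]
  exact ((zt_spec hm).autToPow_spec ℚ σ).symm

lemma cyc_spec {m : ℕ} (hm : m ≠ 0) (σ : Gm) {x : Om} (hx : x^m = 1) :
    σ x = x^((cyc m σ : ZMod m).val) := by
  have := NeZero.mk hm
  obtain ⟨i, -, rfl⟩ := (zt_spec hm).eq_pow_of_pow_eq_one hx
  rw [map_pow, cyc_zt hm, ← pow_mul, ← pow_mul, mul_comm]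

lemma cyc_val_eq {m : ℕ} (hm : m ≠ 0) (σ : Gm) {k : ℕ} (h : σ (zt m) = zt m^k) :
    (cyc m σ : ZMod m) = k := by
  have := NeZero.mk hm
  obtain ⟨u, hu⟩ := (zt_spec hm).isUnit hm
  have ho : orderOf u = m := by rw [← orderOf_units, hu, ← (zt_spec hm).eq_orderOf]
  rw [cyc_zt hm, ← hu, ← Units.val_pow_eq_pow_val, ← Units.val_pow_eq_pow_val, Units.val_inj,
    pow_eq_pow_iff_modEq, ho, ← natCast_eq_natCast_iff] at h
  rw [← h, natCast_zmod_val]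

lemma cyc_dvd {m n : ℕ} (hn : n ≠ 0) (hmn : m ∣ n) (σ : Gm) :
    (cyc m σ : ZMod m) = (cyc n σ : ZMod n).val := by
  refine cyc_val_eq (fun h => hn (by rw [h] at hmn; exact zero_dvd_iff.mp hmn)) σ ?_
  refine cyc_spec hn σ ?_
  obtain ⟨k, rfl⟩ := hmn
  rw [pow_mul, (zt_spec (left_ne_zero_of_mul hn)).pow_eq_one, one_pow]

lemma cyc_eq_one_of_dvd {m n : ℕ} (hn : n ≠ 0) (hmn : m ∣ n) {σ : Gm} (h : cyc n σ = 1) :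
    cyc m σ = 1 := by
  refine Units.ext ?_
  have hm : m ≠ 0 := fun h => hn (by rw [h] at hmn; exact zero_dvd_iff.mp hmn)
  rw [Units.val_one, cyc_val_eq hm σ (k := 1), cast_one]
  have h1 : (zt m)^n = 1 := by
    obtain ⟨k, rfl⟩ := hmn
    rw [pow_mul, (zt_spec hm).pow_eq_one, one_pow]
  obtain ⟨i, -, hi⟩ := (have := NeZero.mk hn; (zt_spec hn).eq_pow_of_pow_eq_one h1)
  have h2 : σ (zt n) = zt n := by
    rw [cyc_zt hn, h]
    rcases eq_or_ne n 1 with rfl | h1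
    · have : zt 1 = 1 := by simpa using (zt_spec hn).pow_eq_one
      rw [this, one_pow]
    · have : Fact (1 < n) := ⟨by omega⟩
      rw [Units.val_one, ZMod.val_one, pow_one]
  rw [← hi, map_pow, h2, pow_one]

lemma exists_cyc_eq {n : ℕ} (hn : n ≠ 0) {k : ℕ} (hk : k.Coprime n) :
    ∃ σ : Gm, (cyc n σ : ZMod n) = k := by
  have hp : 0 < n := Nat.pos_of_ne_zero hn
  have h1 := zt_spec hn
  have h2 := h1.pow_of_coprime k hk
  obtain ⟨σ, hσ⟩ := minpoly.exists_algEquiv_of_root' (K := ℚ) (x := zt n^k) (y := zt n)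
    (Algebra.IsAlgebraic.isAlgebraic _) (by
      rw [← Polynomial.cyclotomic_eq_minpoly_rat h1 hp, Polynomial.cyclotomic_eq_minpoly_rat h2 hp]
      exact minpoly.aeval _ _)
  exact ⟨σ, cyc_val_eq hn σ hσ⟩

/-- The field generated by the `m`-th roots of unity. -/
def Wf (m:ℕ) : IntermediateField ℚ Om := adjoin ℚ {zt m}

lemma isCyclotomic_Wf {m : ℕ} (hm : m ≠ 0) : IsCyclotomicExtension {m} ℚ (Wf m) :=
  have := NeZero.mk hm
  (zt_spec hm).intermediateField_adjoin_isCyclotomicExtension ℚ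

lemma mem_Wf {m : ℕ} (hm : m ≠ 0) {x : Om} (hx : x^m = 1) : x ∈ Wf m := by
  have := NeZero.mk hm
  obtain ⟨i, -, rfl⟩ := (zt_spec hm).eq_pow_of_pow_eq_one hx
  exact pow_mem (mem_adjoin_simple_self ℚ _) i

lemma mem_ker_cyc {m : ℕ} (hm : m ≠ 0) {σ : Gm} : cyc m σ = 1 ↔ σ (zt m) = zt m := by
  constructor
  · intro h
    rw [cyc_zt hm, h]
    rcases eq_or_ne m 1 with rfl | h1
    · have : zt 1 = 1 := by simpa using (zt_spec hm).pow_eq_one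
      rw [this, one_pow]
    · have : Fact (1 < m) := ⟨by omega⟩
      rw [Units.val_one, ZMod.val_one, pow_one]
  · intro h
    refine Units.ext ?_
    rw [cyc_val_eq hm σ (k := 1) (by rwa [pow_one])]; simp

lemma fixingSubgroup_Wf {m : ℕ} (hm : m ≠ 0) : (Wf m).fixingSubgroup = (cyc m).ker := by
  ext σ
  rw [mem_ker, mem_ker_cyc hm, IntermediateField.mem_fixingSubgroup_iff]
  constructor
  · intro h; exact h _ (mem_adjoin_simple_self ℚ _)
  · intro h x hx
    have : Wf m ≤ fixedField (zpowers σ) := by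
      rw [Wf, adjoin_simple_le_iff, mem_fixedField_iff]
      intro τ hτ
      exact (Subgroup.zpowers_le (H := MulAction.stabilizer Gm (zt m)).mpr h) hτ
    exact (mem_fixedField_iff _ _).mp (this hx) σ (Subgroup.mem_zpowers σ)

instance (m:ℕ) : FiniteDimensional ℚ (Wf m) :=
  adjoin.finiteDimensional (Algebra.IsIntegral.isIntegral _)

lemma fixingSubgroup_fixedField_of_le {E : IntermediateField ℚ Om} [FiniteDimensional ℚ E]
    {H : Subgroup Gm} (h : E.fixingSubgroup ≤ H) :
    (fixedField H).fixingSubgroup = H := by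
  have h1 : IsOpen (E.fixingSubgroup : Set Gm) := fixingSubgroup_isOpen E
  have h2 : IsOpen (H : Set Gm) := Subgroup.isOpen_mono h h1
  have h3 : IsClosed (H : Set Gm) := Subgroup.isClosed_of_isOpen H h2
  exact InfiniteGalois.fixingSubgroup_fixedField ⟨H, h3⟩

lemma finiteDimensional_of_le {L M : IntermediateField ℚ Om} [FiniteDimensional ℚ M] (h : L ≤ M) :
    FiniteDimensional ℚ L :=
  FiniteDimensional.of_injective (inclusion h).toLinearMap (inclusion_injective h)

lemma absDisc_eq (L : IntermediateField ℚ Om) [NumberField L] :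
    absDisc L = (NumberField.discr L).natAbs := by
  have : FiniteDimensional ℚ L := NumberField.to_finiteDimensional
  rw [absDisc, dif_pos this]

lemma absDisc_ne_zero (L : IntermediateField ℚ Om) [FiniteDimensional ℚ L] : absDisc L ≠ 0 := by
  have : NumberField L := ⟨⟩
  rw [absDisc_eq]
  simpa using NumberField.discr_ne_zero L

lemma finrank_mul_padicValNat_absDisc (L : IntermediateField ℚ Om) [FiniteDimensional ℚ L]
    {m p : ℕ} (pp : p.Prime) (hpm : ¬ p ∣ m) :
    finrank ℚ L*padicValNat p (absDisc (L ⊔ Wf m)) =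
      finrank ℚ ↥(L ⊔ Wf m)*padicValNat p (absDisc L) := by
  have hm : m ≠ 0 := fun h => hpm (h ▸ dvd_zero p)
  have : NumberField L := ⟨⟩
  have : NumberField ↥(L ⊔ Wf m) := ⟨⟩
  let M : IntermediateField L Om := adjoin L {zt m}
  have hfin : FiniteDimensional L M := adjoin.finiteDimensional (Algebra.IsIntegral.isIntegral _)
  have hfin' : FiniteDimensional ℚ M := FiniteDimensional.trans ℚ L M
  have : NumberField M := ⟨⟩
  have hM : M.restrictScalars ℚ = L ⊔ Wf m := by
    exact restrictScalars_adjoin_eq_sup ℚ L {zt m}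
  let e : M ≃ₐ[ℚ] ↥(L ⊔ Wf m) := equivOfEq hM
  have h1 := NumberField.discr_eq_discr_of_algEquiv M e
  let z : M := IntermediateField.AdjoinSimple.gen L (zt m)
  have hz : z^m = 1 := by ext; simpa [z] using (zt_spec hm).pow_eq_one
  have h2 := padicValNat_discr_of_adjoin_root (L := L) (M := M) pp hpm hz (lift_injective M (by
      rw [lift_adjoin_simple, lift_top]; rfl))
  rw [absDisc_eq, absDisc_eq, ← h1, h2, ← e.toLinearEquiv.finrank_eq,
    ← Module.finrank_mul_finrank ℚ L M, mul_assoc]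

lemma absDisc_bot : absDisc (⊥ : IntermediateField ℚ Om) = 1 := by
  have : NumberField (⊥ : IntermediateField ℚ Om) := ⟨⟩
  rw [absDisc_eq, NumberField.discr_eq_discr_of_algEquiv _ (botEquiv ℚ Om), Rat.numberField_discr]
  rfl

lemma padicValNat_absDisc_eq_zero {L : IntermediateField ℚ Om}
    {m p : ℕ} (pp : p.Prime) (hpm : ¬ p ∣ m) (hL : L ≤ Wf m) :
    padicValNat p (absDisc L) = 0 := by
  have : FiniteDimensional ℚ L := finiteDimensional_of_le hL
  have h1 := finrank_mul_padicValNat_absDisc (⊥ : IntermediateField ℚ Om) pp hpm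
  rw [absDisc_bot, bot_sup_eq, padicValNat.one, mul_zero] at h1
  have h2 := finrank_mul_padicValNat_absDisc L pp hpm
  rw [sup_eq_right.mpr hL] at h2
  have hb : 0 < finrank ℚ (⊥ : IntermediateField ℚ Om) := finrank_pos
  have hW : 0 < finrank ℚ (Wf m) := finrank_pos
  rw [(Nat.mul_eq_zero.mp h1).resolve_left hb.ne', mul_zero] at h2
  exact (Nat.mul_eq_zero.mp h2.symm).resolve_left hW.ne'

lemma padicValNat_absDisc_add_one {L : IntermediateField ℚ Om} {p : ℕ} (pp : p.Prime)
    (hL : L ≤ Wf p) : padicValNat p (absDisc L)+1 = finrank ℚ L := by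
  have : FiniteDimensional ℚ L := finiteDimensional_of_le hL
  have : NumberField L := ⟨⟩
  have : NumberField (Wf p) := ⟨⟩
  have := isCyclotomic_Wf pp.ne_zero
  letI : Algebra L (Wf p) := (inclusion hL).toAlgebra
  rw [absDisc_eq]
  exact padicValNat_discr_add_one (W := Wf p) pp

/-- The field cut out by a homomorphism from the absolute Galois group. -/
def fld {A : Type} [Group A] (ψ : Gm →* A) : IntermediateField ℚ Om :=
  fixedField ψ.ker

section
variable {A : Type} [Group A] {ψ : Gm →* A} {n : ℕ}

lemma fixingSubgroup_fld (hn : n ≠ 0) (h : (cyc n).ker ≤ ψ.ker) :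
    (fld ψ).fixingSubgroup = ψ.ker := by
  rw [← fixingSubgroup_Wf hn] at h
  exact fixingSubgroup_fixedField_of_le h

lemma fld_le_Wf (hn : n ≠ 0) (h : (cyc n).ker ≤ ψ.ker) : fld ψ ≤ Wf n := by
  rw [← fixedField_fixingSubgroup (Wf n), fixingSubgroup_Wf hn, fld]
  exact fixedField_antitone h

lemma finrank_fld (hn : n ≠ 0) (h : (cyc n).ker ≤ ψ.ker) :
    finrank ℚ (fld ψ) = Nat.card ψ.range := by
  rw [finrank_eq_fixingSubgroup_index, fixingSubgroup_fld hn h, Subgroup.index_ker]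

lemma finiteDimensional_fld (hn : n ≠ 0) (h : (cyc n).ker ≤ ψ.ker) : FiniteDimensional ℚ (fld ψ) :=
  finiteDimensional_of_le (fld_le_Wf hn h)

lemma card_range_mul_padicValNat {B : Type} [Group B] {ψ' : Gm →* B} {p m n' : ℕ} (pp : p.Prime)
    (hpm : ¬ p ∣ m) (hn : n ≠ 0) (h : (cyc n).ker ≤ ψ.ker) (hn' : n' ≠ 0)
    (h' : (cyc n').ker ≤ ψ'.ker) (heq : ψ.ker ⊓ (cyc m).ker = ψ'.ker ⊓ (cyc m).ker) :
    Nat.card ψ'.range*padicValNat p (absDisc (fld ψ)) =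
      Nat.card ψ.range*padicValNat p (absDisc (fld ψ')) := by
  have hm : m ≠ 0 := fun h => hpm (h ▸ dvd_zero p)
  have := finiteDimensional_fld hn h
  have := finiteDimensional_fld hn' h'
  have hsup : fld ψ ⊔ Wf m = fld ψ' ⊔ Wf m := by
    rw [← fixedField_fixingSubgroup (fld ψ ⊔ Wf m), ← fixedField_fixingSubgroup (fld ψ' ⊔ Wf m),
      fixingSubgroup_sup, fixingSubgroup_sup,
      fixingSubgroup_fld hn h, fixingSubgroup_fld hn' h', fixingSubgroup_Wf hm, heq]
  have h1 := finrank_mul_padicValNat_absDisc (fld ψ) pp hpm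
  have h2 := finrank_mul_padicValNat_absDisc (fld ψ') pp hpm
  rw [← hsup] at h2
  rw [← finrank_fld hn h, ← finrank_fld hn' h']
  have hM : 0 < finrank ℚ ↥(fld ψ ⊔ Wf m) := finrank_pos
  refine Nat.eq_of_mul_eq_mul_left hM ?_
  calc _ = finrank ℚ (fld ψ')*(finrank ℚ ↥(fld ψ ⊔ Wf m) *
        padicValNat p (absDisc (fld ψ))) := by ring
    _ = finrank ℚ (fld ψ)*(finrank ℚ (fld ψ') *
        padicValNat p (absDisc (fld ψ ⊔ Wf m))) := by rw [← h1]; ring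
    _ = _ := by rw [h2]; ring

end

/-- The cyclic group of order six. -/
abbrev Csix := Multiplicative (ZMod 6)

/-- The conductor bound at `p` for abelian extensions of exponent dividing six. -/
def qq (p:ℕ) : ℕ := if p = 2 then 8 else if p = 3 then 9 else if p.Prime then p else 1

lemma qq_ne_zero (p:ℕ) : qq p ≠ 0 := by
  rw [qq]; split_ifs with _ _ h
  · norm_num
  · norm_num
  · exact h.ne_zero
  · norm_num

instance (p:ℕ) : NeZero (qq p) := ⟨qq_ne_zero p⟩

lemma qq_of_five_le {p : ℕ} (pp : p.Prime) (h : 5 ≤ p) : qq p = p := by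
  rw [qq, if_neg (by omega), if_neg (by omega), if_pos pp]

lemma dvd_qq {p : ℕ} (pp : p.Prime) : p ∣ qq p := by
  rw [qq]; split_ifs with h h'
  · subst h; norm_num
  · subst h'; norm_num
  · rfl

lemma qq_dvd (p:ℕ) : qq p ∣ p^3 := by
  rw [qq]; split_ifs with h h'
  · subst h; norm_num
  · subst h'; norm_num
  · exact dvd_pow_self _ (by norm_num)
  · exact one_dvd _

lemma coprime_qq {p q : ℕ} (pp : p.Prime) (pq : q.Prime) (h : p ≠ q) : (qq p).Coprime (qq q) :=
  (((Nat.coprime_primes pp pq).mpr h).pow 3 3).coprime_dvd_left (qq_dvd p) |>.coprime_dvd_right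
    (qq_dvd q)

/-- The product of the conductor bounds over a set of primes. -/
def nS (S : Finset ℕ) : ℕ := ∏ p ∈ S, qq p

lemma nS_ne_zero (S : Finset ℕ) : nS S ≠ 0 := prod_ne_zero_iff.mpr fun p _ => qq_ne_zero p

lemma not_dvd_nS {S : Finset ℕ} (hS : ∀ p ∈ S, p.Prime) {p : ℕ} (pp : p.Prime) (h : p ∉ S) :
    ¬ p ∣ nS S := by
  rw [nS, pp.prime.dvd_finset_prod_iff]
  rintro ⟨q, hq, hpq⟩
  have := (Nat.prime_dvd_prime_iff_eq pp (hS q hq)).mp (pp.dvd_of_dvd_pow (hpq.trans (qq_dvd q)))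
  exact h (this ▸ hq)

lemma qq_dvd_nS {S : Finset ℕ} {p : ℕ} (h : p ∈ S) : qq p ∣ nS S := dvd_prod_of_mem _ h

lemma cyc_nS_eq_one {S : Finset ℕ} (hS : ∀ p ∈ S, p.Prime) {σ : Gm} :
    cyc (nS S) σ = 1 ↔ ∀ p ∈ S, cyc (qq p) σ = 1 := by
  constructor
  · intro h p hp
    exact cyc_eq_one_of_dvd (nS_ne_zero S) (qq_dvd_nS hp) h
  · intro h
    have := NeZero.mk (nS_ne_zero S)
    refine Units.ext ?_
    rw [← natCast_zmod_val ((cyc (nS S) σ : ZMod (nS S))), Units.val_one,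
      ← cast_one, natCast_eq_natCast_iff]
    have h2 : ∀ p ∈ S, qq p ∣ ((cyc (nS S) σ : ZMod (nS S)).val-1:ℤ).natAbs := by
      intro p hp
      have h1 := cyc_dvd (nS_ne_zero S) (qq_dvd_nS hp) σ
      rw [h p hp, Units.val_one, ← cast_one, natCast_eq_natCast_iff] at h1
      exact Int.natCast_dvd.mp (by simpa using h1.dvd)
    have h3 : nS S ∣ ((cyc (nS S) σ : ZMod (nS S)).val-1:ℤ).natAbs :=
      prod_dvd_of_isRelPrime (fun p hp q hq hpq =>
        Nat.coprime_iff_isRelPrime.mp (coprime_qq (hS p hp) (hS q hq) hpq)) h2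
    exact ((Nat.modEq_iff_dvd).mpr (by simpa using Int.natCast_dvd.mpr h3)).symm

lemma exists_cyc_qq {S : Finset ℕ} (hS : ∀ p ∈ S, p.Prime) (u : ∀ p : ℕ, (ZMod (qq p))ˣ) :
    ∃ σ : Gm, ∀ p ∈ S, cyc (qq p) σ = u p := by
  obtain ⟨k, hk⟩ := Nat.chineseRemainderOfFinset (fun p => (u p : ZMod (qq p)).val) qq S
    (fun p _ => qq_ne_zero p) (fun p hp q hq h => coprime_qq (hS p hp) (hS q hq) h)
  have hk' : ∀ p ∈ S, (k : ZMod (qq p)) = u p := by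
    intro p hp
    rw [(natCast_eq_natCast_iff _ _ _).mpr (hk p hp), natCast_zmod_val]
  have hc : k.Coprime (nS S) := by
    refine Coprime.prod_right fun p hp => ?_
    rw [← ZMod.isUnit_iff_coprime, hk' p hp]
    exact Units.isUnit _
  obtain ⟨σ, hσ⟩ := exists_cyc_eq (nS_ne_zero S) hc
  refine ⟨σ, fun p hp => Units.ext ?_⟩
  rw [cyc_dvd (nS_ne_zero S) (qq_dvd_nS hp), hσ, ← hk' p hp, ZMod.val_natCast,
    natCast_eq_natCast_iff]
  exact (Nat.mod_modEq _ _).of_dvd (qq_dvd_nS hp)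

/-- Local characters at `p`. -/
abbrev Xp (p:ℕ) := (ZMod (qq p))ˣ →* Csix

/-- The global character with given local components. -/
def psi {S : Finset ℕ} (χ : ∀ p : S, Xp p) : Gm →* Csix :=
  ∏ p : S, (χ p).comp (cyc (qq p))

lemma psi_apply {S : Finset ℕ} (χ : ∀ p : S, Xp p) (σ : Gm) :
    psi χ σ = ∏ p : S, χ p (cyc (qq p) σ) := by
  rw [psi, MonoidHom.finset_prod_apply]; rfl

lemma psi_pow {S : Finset ℕ} (χ : ∀ p : S, Xp p) (r:ℕ) : psi (χ^r) = psi χ^r := by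
  ext σ
  rw [psi_apply, MonoidHom.pow_apply, psi_apply, ← prod_pow]
  rfl

lemma ker_le_psi {S : Finset ℕ} (hS : ∀ p ∈ S, p.Prime) (χ : ∀ p : S, Xp p) :
    (cyc (nS S)).ker ≤ (psi χ).ker := by
  intro σ h
  rw [mem_ker, cyc_nS_eq_one hS] at h
  rw [mem_ker, psi_apply]
  exact prod_eq_one fun p _ => by rw [h p p.2, map_one]

lemma psi_injective {S : Finset ℕ} (hS : ∀ p ∈ S, p.Prime) : Injective (psi (S := S)) := by
  intro χ χ' h
  funext p
  ext u : 1
  obtain ⟨σ, hσ⟩ := exists_cyc_qq hS (fun q => if h : p.1 = q then h ▸ u else 1)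
  have hp : cyc (qq p) σ = u := by rw [hσ p p.2]; simp
  have h1 : ∀ χ : ∀ p : S, Xp p, psi χ σ = χ p u := by
    intro χ
    rw [psi_apply, prod_eq_single p, hp]
    · intro q _ hq
      rw [hσ q q.2, dif_neg (fun h => hq (Subtype.ext h.symm)), map_one]
    · simp
  rw [← h1, h, h1]

lemma exists_psi_eq {S : Finset ℕ} (hS : ∀ p ∈ S, p.Prime) {ψ : Gm →* Csix}
    (h : (cyc (nS S)).ker ≤ ψ.ker) : ∃ χ : ∀ p : S, Xp p, psi χ = ψ := by
  let Φ : Gm →* ∀ p : S, (ZMod (qq p))ˣ := Pi.monoidHom fun p => cyc (qq p)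
  have hΦ : Surjective Φ := by
    intro u
    obtain ⟨σ, hσ⟩ := exists_cyc_qq hS (fun p => if h : p ∈ S then u ⟨p, h⟩ else 1)
    exact ⟨σ, funext fun p => by rw [show Φ σ p = cyc (qq p) σ from rfl, hσ p p.2, dif_pos p.2]⟩
  have hk : Φ.ker ≤ ψ.ker := by
    refine le_trans (fun σ hσ => ?_) h
    rw [mem_ker, cyc_nS_eq_one hS]
    intro p hp
    exact congrFun (mem_ker.mp hσ) ⟨p, hp⟩
  let g := MonoidHom.liftOfSurjective Φ hΦ ⟨ψ, hk⟩
  have hg : ∀ σ, g (Φ σ) = ψ σ := MonoidHom.liftOfRightInverse_comp_apply _ _ _ ⟨ψ, hk⟩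
  refine ⟨fun p => g.comp (MonoidHom.mulSingle (fun p : S => (ZMod (qq p))ˣ) p), ?_⟩
  ext1 σ
  rw [psi_apply, ← hg]
  conv_rhs => rw [← univ_prod_mulSingle (Φ σ), map_prod]
  rfl

/-- The exponent of `p` contributed by a local character. -/
def locV (p:ℕ) (χ : Xp p) : ℕ :=
  6*padicValNat p (absDisc (fld (χ.comp (cyc (qq p)))))/Nat.card (χ.comp (cyc (qq p))).range

lemma ker_le_comp {p : ℕ} (χ : Xp p) : (cyc (qq p)).ker ≤ (χ.comp (cyc (qq p))).ker := by
  intro σ h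
  rw [mem_ker, MonoidHom.comp_apply, mem_ker.mp h, map_one]

lemma padicValNat_psi {S : Finset ℕ} (hS : ∀ p ∈ S, p.Prime) {χ : ∀ p : S, Xp p}
    (hχ : Surjective (psi χ)) (p : S) :
    padicValNat p (absDisc (fld (psi χ))) = locV p (χ p) := by
  have pp := hS p p.2
  have h1 := card_range_mul_padicValNat (ψ := psi χ) (ψ' := (χ p).comp (cyc (qq p)))
    (m := nS (S.erase p)) pp
    (not_dvd_nS (fun q hq => hS q (mem_of_mem_erase hq)) pp (notMem_erase _ _))
    (nS_ne_zero S) (ker_le_psi hS χ) (qq_ne_zero p) (ker_le_comp (χ p)) (by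
      ext σ
      rw [mem_inf, mem_inf, and_congr_left_iff]
      intro hσ
      rw [mem_ker, cyc_nS_eq_one (fun q hq => hS q (mem_of_mem_erase hq))] at hσ
      rw [mem_ker, mem_ker, psi_apply, prod_eq_single p]
      · rfl
      · intro q _ hq
        rw [hσ q (mem_erase.mpr ⟨fun h => hq (Subtype.ext h), q.2⟩), map_one]
      · simp)
  rw [range_eq_top.mpr hχ, Subgroup.card_top, show Nat.card Csix = 6 from card_zmod 6] at h1
  rw [locV, ← h1, Nat.mul_div_cancel_left]
  exact Nat.card_pos

lemma absDisc_psi {S : Finset ℕ} (hS : ∀ p ∈ S, p.Prime) {χ : ∀ p : S, Xp p}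
    (hχ : Surjective (psi χ)) :
    absDisc (fld (psi χ)) = ∏ p : S, (p:ℕ)^locV p (χ p) := by
  have := finiteDimensional_fld (nS_ne_zero S) (ker_le_psi hS χ)
  have h0 := absDisc_ne_zero (fld (psi χ))
  have hsub : (absDisc (fld (psi χ))).factorization.support ⊆ S := by
    intro p hp
    by_contra hpS
    have pp : p.Prime := Nat.prime_of_mem_primeFactors hp
    have := padicValNat_absDisc_eq_zero pp (not_dvd_nS hS pp hpS)
      (fld_le_Wf (nS_ne_zero S) (ker_le_psi hS χ))
    rw [Finsupp.mem_support_iff, Nat.factorization_def _ pp] at hp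
    exact hp this
  conv_lhs => rw [← Nat.factorization_prod_pow_eq_self h0]
  rw [prod_of_support_subset _ hsub _ (fun _ _ => pow_zero _), ← prod_coe_sort]
  refine prod_congr rfl fun p _ => ?_
  rw [Nat.factorization_def _ (hS p p.2), padicValNat_psi hS hχ]

lemma cyc_qq_surjective {p : ℕ} (pp : p.Prime) : Surjective (cyc (qq p)) := by
  intro u
  obtain ⟨σ, hσ⟩ := exists_cyc_qq (S := {p}) (by simpa using pp)
    (fun q => if h : p = q then h ▸ u else 1)
  exact ⟨σ, by rw [hσ p (by simp)]; simp⟩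

lemma range_comp_cyc {p : ℕ} (pp : p.Prime) (χ : Xp p) : (χ.comp (cyc (qq p))).range = χ.range := by
  rw [MonoidHom.range_comp, range_eq_top.mpr (cyc_qq_surjective pp), range_eq_map χ]

lemma locV_eq {p : ℕ} (pp : p.Prime) (h5 : 5 ≤ p) (χ : Xp p) :
    locV p χ = 6*(Nat.card χ.range-1)/Nat.card χ.range := by
  have h := padicValNat_absDisc_add_one pp (L := fld (χ.comp (cyc (qq p))))
    (by simpa only [qq_of_five_le pp h5] using fld_le_Wf (qq_ne_zero p) (ker_le_comp χ))
  rw [finrank_fld (qq_ne_zero p) (ker_le_comp χ), range_comp_cyc pp] at h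
  rw [locV, range_comp_cyc pp, ← h, Nat.add_sub_cancel]

lemma card_range_dvd {G : Type} [Group G] (χ : G →* Csix) : Nat.card χ.range ∣ 6 := by
  have := Subgroup.card_subgroup_dvd_card χ.range
  rwa [show Nat.card Csix = 6 from card_zmod 6] at this

lemma locV_eq_zero {p : ℕ} (pp : p.Prime) {χ : Xp p} : locV p χ = 0 ↔ χ = 1 := by
  constructor
  · intro h
    set L := fld (χ.comp (cyc (qq p))) with hL
    have hLW : L ≤ Wf (qq p) := fld_le_Wf (qq_ne_zero p) (ker_le_comp χ)
    have := finiteDimensional_fld (qq_ne_zero p) (ker_le_comp χ)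
    have : NumberField L := ⟨⟩
    have hc := card_range_dvd (χ.comp (cyc (qq p)))
    have hle := le_of_dvd (by norm_num) hc
    have hv : padicValNat p (absDisc L) = 0 := by
      rw [locV, Nat.div_eq_zero_iff] at h
      rcases h with h | h
      · rw [h] at hc; omega
      · rw [← hL] at h
        omega
    have h1 : absDisc L = 1 := by
      by_contra h1
      obtain ⟨q, hq, hqd⟩ := Nat.exists_prime_and_dvd h1
      have hz : padicValNat q (absDisc L) = 0 := by
        by_cases hqp : q = p
        · rw [hqp, hv]
        · refine padicValNat_absDisc_eq_zero hq (fun hd => hqp ?_) hLW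
          exact (Nat.prime_dvd_prime_iff_eq hq pp).mp (hq.dvd_of_dvd_pow (hd.trans (qq_dvd p)))
      have := Fact.mk hq
      exact absurd (one_le_padicValNat_of_dvd (absDisc_ne_zero L) hqd) (by omega)
    have h2 : finrank ℚ L = 1 := by
      by_contra h2
      have h3 := NumberField.abs_discr_gt_two (K := L) (by
        have : 0 < finrank ℚ L := finrank_pos
        omega)
      rw [absDisc_eq] at h1
      rw [Int.abs_eq_natAbs, h1] at h3
      norm_num at h3
    rw [finrank_fld (qq_ne_zero p) (ker_le_comp χ), range_comp_cyc pp,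
      Subgroup.card_eq_one, MonoidHom.range_eq_bot_iff] at h2
    exact h2
  · rintro rfl
    have hb : fld ((1 : Xp p).comp (cyc (qq p))) = ⊥ := by
      rw [fld, one_comp, ker_one]
      exact InfiniteGalois.fixedField_bot
    rw [locV, hb, absDisc_bot, padicValNat.one, mul_zero, Nat.zero_div]

/-- The number of local characters at `p` killed by `r` with given exponent. -/
def locCount (r p k:ℕ) : ℕ :=
  if p.Prime then Nat.card {χ : Xp p // χ^r = 1 ∧ locV p χ = k} else if k = 0 then 1 else 0

lemma locCount_zero (r p:ℕ) : locCount r p 0 = 1 := by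
  rw [locCount]
  by_cases pp : p.Prime
  swap
  · rw [if_neg pp, if_pos rfl]
  · rw [if_pos pp, Nat.card_eq_one_iff_unique]
    exact ⟨⟨fun a b => Subtype.ext (((locV_eq_zero pp).mp a.2.2).trans
      ((locV_eq_zero pp).mp b.2.2).symm)⟩, ⟨⟨1, one_pow r, (locV_eq_zero pp).mpr rfl⟩⟩⟩
instance (p:ℕ) : Finite (Xp p) := DFunLike.finite _

lemma exists_locCount_eq_zero (r p:ℕ) : ∃ D, ∀ k, D < k → locCount r p k = 0 := by
  by_cases pp : p.Prime
  · obtain ⟨D, hD⟩ := (Set.finite_range (locV p)).bddAbove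
    refine ⟨D, fun k hk => ?_⟩
    rw [locCount, if_pos pp, Nat.card_eq_zero]
    left
    exact ⟨fun χ => absurd (hD ⟨χ.1, χ.2.2⟩) (not_le.mpr hk)⟩
  · exact ⟨0, fun k hk => by rw [locCount, if_neg pp, if_neg hk.ne']⟩

/-- The discriminant exponent of a tame character as a function of its value on a generator. -/
def csixV : ZMod 6 → ℕ := ![0, 5, 4, 3, 4, 5]

lemma card_zpowers_csix (x : Csix) : 6*(orderOf x-1)/orderOf x = csixV x.toAdd := by
  have h : orderOf x = 6/Nat.gcd 6 (x.toAdd : ZMod 6).val := by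
    rw [← ZMod.addOrderOf_coe _ (by norm_num), natCast_zmod_val]; rfl
  rw [h]
  clear h
  revert x
  decide

lemma locCount_eq_card {p : ℕ} (pp : p.Prime) (h5 : 5 ≤ p) (r k:ℕ) :
    locCount r p k = Nat.card {x : ZMod 6 // (p-1) • x = 0 ∧ r • x = 0 ∧ csixV x = k} := by
  rw [locCount, if_pos pp]
  have hq := qq_of_five_le pp h5
  have := Fact.mk pp
  have : IsCyclic (ZMod (qq p))ˣ := by rw [hq]; infer_instance
  have hcard : Nat.card (ZMod (qq p))ˣ = p-1 := by
    rw [hq, Nat.card_eq_fintype_card, ZMod.card_units]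
  obtain ⟨g, hg⟩ := IsCyclic.exists_generator (α := (ZMod (qq p))ˣ)
  have ho : orderOf g = p-1 := by rw [orderOf_eq_card_of_forall_mem_zpowers hg, hcard]
  have hV : ∀ χ : Xp p, locV p χ = csixV (χ g).toAdd := by
    intro χ
    have : χ.range = zpowers (χ g) := by
      rw [range_eq_map, ← (Subgroup.eq_top_iff' _).mpr hg, MonoidHom.map_zpowers]
    rw [locV_eq pp h5, ← card_zpowers_csix, this, Nat.card_zpowers]
  have hx : ∀ x : {x : ZMod 6 // (p-1) • x = 0 ∧ r • x = 0 ∧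
      csixV x = k}, orderOf (ofAdd x.1) ∣ orderOf g := by
    intro x
    rw [ho, orderOf_dvd_iff_pow_eq_one, ← ofAdd_nsmul, x.2.1, ofAdd_zero]
  refine card_congr ⟨fun χ => ⟨(χ.1 g).toAdd, ?_, ?_, ?_⟩, fun x =>
    ⟨monoidHomOfForallMemZpowers hg (hx x), ?_, ?_⟩, ?_, ?_⟩
  · rw [← toAdd_pow, ← map_pow, ← ho, pow_orderOf_eq_one, map_one, toAdd_one]
  · rw [← toAdd_pow, ← MonoidHom.pow_apply, χ.2.1]; rfl
  · rw [← hV, χ.2.2]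
  · refine (MonoidHom.eq_iff_eq_on_generator hg _ _).mpr ?_
    rw [MonoidHom.pow_apply, monoidHomOfForallMemZpowers_apply_gen, ← ofAdd_nsmul, x.2.2.1]
    rfl
  · rw [hV, monoidHomOfForallMemZpowers_apply_gen, toAdd_ofAdd, x.2.2.2]
  · intro χ
    refine Subtype.ext ((MonoidHom.eq_iff_eq_on_generator hg _ _).mpr ?_)
    rw [monoidHomOfForallMemZpowers_apply_gen, ofAdd_toAdd]
  · intro x
    refine Subtype.ext ?_
    change toAdd (monoidHomOfForallMemZpowers hg (hx x) g) = x.1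
    rw [monoidHomOfForallMemZpowers_apply_gen, toAdd_ofAdd]

lemma locCount_eq {r : ℕ} {a b : ℕ} (hr : r = 6 ∧ a = 1 ∧ b = 1 ∨ r = 2 ∧ a = 1 ∧ b = 0 ∨
    r = 3 ∧ a = 0 ∧ b = 1) {p : ℕ} (pp : p.Prime) (h5 : 5 ≤ p) {k : ℕ} (hk : 0 < k) :
    (locCount r p k:ℝ) = (if k = 3 then (a:ℝ) else 0) +
      (if k = 4 then (b:ℝ)*(1+chi3 p) else 0) +
      (if k = 5 then (a:ℝ)*b*(1+chi3 p) else 0) := by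
  rw [locCount_eq_card pp h5]
  have h6 : p % 6 = 1 ∨ p % 6 = 5 := by
    have h2 : ¬ 2 ∣ p := fun h => by have := (Nat.prime_dvd_prime_iff_eq prime_two pp).mp h; omega
    have h3 : ¬ 3 ∣ p := fun h => by have := (Nat.prime_dvd_prime_iff_eq prime_three pp).mp h; omega
    omega
  have hs : ∀ x : ZMod 6, (p-1) • x = ((p-1) % 6) • x := by
    intro x
    rw [nsmul_eq_mul, nsmul_eq_mul, ZMod.natCast_mod]
  by_cases hk6 : 6 ≤ k
  · have hemp : IsEmpty {x : ZMod 6 // (p-1) • x = 0 ∧ r • x = 0 ∧ csixV x = k} := ⟨fun x => by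
        have h : ∀ x : ZMod 6, csixV x < 6 := by decide
        have := h x.1
        omega⟩
    rw [Nat.card_of_isEmpty, if_neg (by omega), if_neg (by omega), if_neg (by omega)]
    simp
  · simp only [hs]
    rcases h6 with h6 | h6
    · have hN : Nat.card {x : ZMod 6 // ((p-1) % 6) • x = 0 ∧ r • x = 0 ∧
          csixV x = k} = (if k = 3 then a else 0) +
          (if k = 4 then b*2 else 0)+(if k = 5 then a*b*2 else 0) := by
        rw [show (p-1) % 6 = 0 by omega]
        rcases hr with ⟨rfl, rfl, rfl⟩ | ⟨rfl, rfl, rfl⟩ | ⟨rfl, rfl, rfl⟩ <;>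
        interval_cases k <;> first
          | exact subtype_card ∅ (by decide)
          | exact subtype_card {3} (by decide)
          | exact subtype_card {2, 4} (by decide)
          | exact subtype_card {1, 5} (by decide)
      have hc : chi3 p = 1 := by rw [chi3, if_pos (by omega)]
      rw [hN, hc]
      push_cast
      norm_num
    · have hN : Nat.card {x : ZMod 6 // ((p-1) % 6) • x = 0 ∧ r • x = 0 ∧
          csixV x = k} = (if k = 3 then a else 0) := by
        rw [show (p-1) % 6 = 4 by omega]
        rcases hr with ⟨rfl, rfl, rfl⟩ | ⟨rfl, rfl, rfl⟩ | ⟨rfl, rfl, rfl⟩ <;>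
        interval_cases k <;> first
          | exact subtype_card ∅ (by decide)
          | exact subtype_card {3} (by decide)
          | exact subtype_card {2, 4} (by decide)
          | exact subtype_card {1, 5} (by decide)
      have hm : p % 3 = 2 := by omega
      have hc : chi3 p = -1 := by simp [chi3, hm]
      rw [hN, hc]
      push_cast
      norm_num

/-- The discriminant attached to a family of local characters. -/
def charDisc {S : Finset ℕ} (χ : ∀ p : S, Xp p) : ℕ := ∏ p : S, (p:ℕ)^locV p (χ p)

lemma charDisc_ne_zero {S : Finset ℕ} (hS : ∀ p ∈ S, p.Prime) (χ : ∀ p : S, Xp p) :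
    charDisc χ ≠ 0 :=
  prod_ne_zero_iff.mpr fun p _ => pow_ne_zero _ (hS p p.2).ne_zero

lemma charDisc_eq_iff {S : Finset ℕ} (hS : ∀ p ∈ S, p.Prime) (χ : ∀ p : S, Xp p) {n : ℕ}
    (hn : n ≠ 0) (hnS : n.primeFactors ⊆ S) :
    charDisc χ = n ↔ ∀ p : S, locV p (χ p) = n.factorization p := by
  constructor
  · rintro rfl p
    rw [charDisc, Nat.factorization_prod (fun (q : S) _ => pow_ne_zero _ (hS q q.2).ne_zero),
      Finsupp.finset_sum_apply, sum_eq_single p]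
    · rw [(hS p p.2).factorization_pow, Finsupp.single_eq_same]
    · intro q _ hq
      rw [(hS q q.2).factorization_pow, Finsupp.single_eq_of_ne]
      exact fun h => hq (Subtype.ext h.symm)
    · simp
  · intro h
    conv_rhs => rw [← Nat.factorization_prod_pow_eq_self hn]
    rw [prod_of_support_subset _ hnS _ (fun _ _ => pow_zero _), ← prod_coe_sort]
    exact prod_congr rfl fun p _ => by rw [h p]

/-- The Dirichlet coefficients counting families of local characters killed by `r`. -/
def charCount (r:ℕ) : ArithmeticFunction ℝ := mulOf fun p k => locCount r p k

lemma card_charDisc_eq {S : Finset ℕ} (hS : ∀ p ∈ S, p.Prime) (r:ℕ) {n : ℕ}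
    (hn : n ≠ 0) (hnS : n.primeFactors ⊆ S) :
    (Nat.card {χ : ∀ p : S, Xp p // χ^r = 1 ∧ charDisc χ = n}:ℝ) = charCount r n := by
  have h1 : ∀ χ : ∀ p : S, Xp p, (χ^r = 1 ∧ charDisc χ = n) ↔
      ∀ p : S, χ p^r = 1 ∧ locV p (χ p) = n.factorization p := by
    intro χ
    rw [charDisc_eq_iff hS χ hn hnS, forall_and, funext_iff]
    rfl
  rw [card_congr (Equiv.subtypeEquivRight h1), card_congr (Equiv.subtypePiEquivPi
      (p := fun (p : S) (χ : Xp p) => χ^r = 1 ∧ locV p χ = n.factorization p)),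
    Nat.card_pi, charCount, mulOf_apply _ hn,
    prod_of_support_subset _ hnS _ (fun p _ => by rw [locCount_zero, cast_one]),
    ← prod_coe_sort S fun p => (locCount r p (n.factorization p):ℝ), Nat.cast_prod]
  refine prod_congr rfl fun p _ => ?_
  rw [locCount, if_pos (hS p p.2)]

instance (S : Finset ℕ) : Finite (∀ p : S, Xp p) := Pi.finite

instance (S : Finset ℕ) : Fintype (∀ p : S, Xp p) := Fintype.ofFinite _

lemma card_charDisc_le {S : Finset ℕ} (hS : ∀ p ∈ S, p.Prime) (r:ℕ) {X : ℝ}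
    (hX : ∀ p : ℕ, p.Prime → (p:ℝ) ≤ X → p ∈ S) :
    ((univ.filter fun χ : ∀ p : S, Xp p => χ^r = 1 ∧ (charDisc χ:ℝ) ≤ X).card:ℝ) =
      summ (charCount r) X := by
  have hm : Set.MapsTo (charDisc (S := S))
      ((univ.filter fun χ : ∀ p : S, Xp p => χ^r = 1 ∧ (charDisc χ:ℝ) ≤ X :
        Finset (∀ p : S, Xp p)) : Set _)
      ((Icc 1 ⌊X⌋₊ : Finset ℕ) : Set ℕ) := by
    intro χ hχ
    have h := (mem_filter.mp hχ).2.2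
    exact mem_Icc.mpr ⟨Nat.one_le_iff_ne_zero.mpr (charDisc_ne_zero hS χ), le_floor h⟩
  rw [card_eq_sum_card_fiberwise hm, summ, Nat.cast_sum]
  refine sum_congr rfl fun n hn => ?_
  rw [mem_Icc] at hn
  have hn0 : n ≠ 0 := by omega
  have hnX : (n:ℝ) ≤ X := (Nat.le_floor_iff' hn0).mp hn.2
  rw [← card_charDisc_eq hS r hn0, Nat.card_eq_fintype_card, Fintype.card_subtype,
    filter_filter]
  · congr 2
    ext χ
    simp only [mem_filter, mem_univ, true_and]
    constructor
    · rintro ⟨⟨h1, -⟩, h2⟩; exact ⟨h1, h2⟩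
    · rintro ⟨h1, h2⟩; exact ⟨⟨h1, h2 ▸ hnX⟩, h2⟩
  · intro p hp
    have hd := le_of_dvd (by omega) (Nat.dvd_of_mem_primeFactors hp)
    exact hX p (Nat.prime_of_mem_primeFactors hp) (le_trans (mod_cast hd) hnX)

lemma csix_pow_six (x : Csix) : x^6 = 1 := by revert x; decide

lemma surjective_csix_iff {G : Type*} [Group G] {f : G →* Csix} :
    Surjective f ↔ f^2 ≠ 1 ∧ f^3 ≠ 1 := by
  constructor
  · intro hf
    obtain ⟨σ, hσ⟩ := hf (ofAdd 1)
    constructor <;> intro h <;> have h1 := DFunLike.congr_fun h σ <;>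
      rw [MonoidHom.pow_apply, hσ] at h1 <;> revert h1
    · change ¬ ((ofAdd (1 : ZMod 6))^2 = 1); decide
    · change ¬ ((ofAdd (1 : ZMod 6))^3 = 1); decide
  · intro ⟨h2, h3⟩
    have hd := Subgroup.card_subgroup_dvd_card f.range
    rw [show Nat.card Csix = 6 from card_zmod 6] at hd
    have hp : f^Nat.card f.range = 1 := by
      ext1 σ
      have := pow_card_eq_one' (x := (⟨f σ, σ, rfl⟩ : f.range))
      simpa [Subtype.ext_iff] using this
    have hle := le_of_dvd (by norm_num) hd
    have h6 : Nat.card f.range = 6 := by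
      interval_cases hN : Nat.card f.range
      · omega
      · rw [pow_one] at hp; exact absurd (by rw [hp, one_pow]) h2
      · exact absurd hp h2
      · exact absurd hp h3
      · omega
      · omega
      · rfl
    rw [← range_eq_top]
    exact Subgroup.eq_top_of_card_eq _ (by rw [h6, show Nat.card Csix = 6 from card_zmod 6])

lemma eq_or_eq_inv_of_ker_eq {G : Type*} [Group G] {f f' : G →* Csix} (hf : Surjective f)
    (hf' : Surjective f') (h : f.ker = f'.ker) : f' = f ∨ f' = f⁻¹ := by
  obtain ⟨σ, hσ⟩ := hf (ofAdd 1)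
  have key : ∀ τ, f' τ = f' σ^(f τ).toAdd.val := by
    intro τ
    have h1 : τ*(σ^(f τ).toAdd.val)⁻¹ ∈ f.ker := by
      rw [mem_ker, map_mul, map_inv, map_pow, hσ, mul_inv_eq_one, ← ofAdd_nsmul,
        nsmul_eq_mul, natCast_zmod_val, mul_one, ofAdd_toAdd]
    rw [h, mem_ker, map_mul, map_inv, map_pow, mul_inv_eq_one] at h1
    exact h1
  rw [surjective_csix_iff] at hf'
  have hx : ∀ r, f' σ^r = 1 → f'^r = 1 := by
    intro r hr
    ext1 τ
    rw [MonoidHom.pow_apply, key, ← pow_mul, mul_comm, pow_mul, hr, one_pow]; rfl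
  have h0 : ∀ x y : Csix, x^2 ≠ 1 → x^3 ≠ 1 → ((x = ofAdd 1 ∧ x^(y.toAdd : ZMod 6).val = y) ∨
        (x = ofAdd 5 ∧ x^(y.toAdd : ZMod 6).val = y⁻¹)) := by decide
  have h5 : (ofAdd (1 : ZMod 6)) ≠ ofAdd 5 := by decide
  have h7 := fun y => h0 (f' σ) y (fun h => hf'.1 (hx 2 h)) (fun h => hf'.2 (hx 3 h))
  rcases h7 1 with h8 | h8
  · left; ext1 τ
    rw [key]
    rcases h7 (f τ) with h9 | h9
    · exact h9.2
    · exact absurd (h8.1.symm.trans h9.1) h5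
  · right; ext1 τ
    rw [key]
    rcases h7 (f τ) with h9 | h9
    · exact absurd (h9.1.symm.trans h8.1) h5
    · exact h9.2

lemma isGalois_of_fixingSubgroup_eq_ker {k K A : Type*} [Field k] [Field K] [Algebra k K]
    [IsGalois k K] [Group A] (L : IntermediateField k K) {ψ : (K ≃ₐ[k] K) →* A}
    (hψ : Surjective ψ) (h : L.fixingSubgroup = ψ.ker) :
    IsGalois k L ∧ Nonempty ((L ≃ₐ[k] L) ≃* A) := by
  have hgal : IsGalois k L := by rw [← InfiniteGalois.normal_iff_isGalois, h]; infer_instance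
  have hk : (AlgEquiv.restrictNormalHom (F := k) (K₁ := K) L).ker = ψ.ker := by
    rw [restrictNormalHom_ker, h]
  exact ⟨hgal, ⟨(QuotientGroup.quotientKerEquivOfSurjective _
    (AlgEquiv.restrictNormalHom_surjective K)).symm.trans
      ((QuotientGroup.quotientMulEquivOfEq hk).trans
        (QuotientGroup.quotientKerEquivOfSurjective _ hψ))⟩⟩

lemma exists_hom_of_isGalois {k K A : Type*} [Field k] [Field K] [Algebra k K]
    [IsGalois k K] [Group A] (L : IntermediateField k K) (h : IsGalois k L)
    (e : (L ≃ₐ[k] L) ≃* A) :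
    ∃ ψ : (K ≃ₐ[k] K) →* A, Surjective ψ ∧ ψ.ker = L.fixingSubgroup := by
  refine ⟨e.toMonoidHom.comp (AlgEquiv.restrictNormalHom (F := k) (K₁ := K) L),
    e.surjective.comp (AlgEquiv.restrictNormalHom_surjective K), ?_⟩
  rw [← restrictNormalHom_ker]
  ext σ
  rw [mem_ker, mem_ker]
  exact e.map_eq_one_iff

/-- Families of local characters gluing to a surjective character of bounded discriminant. -/
def surjChars (S : Finset ℕ) (X:ℝ) : Finset (∀ p : S, Xp p) :=
  univ.filter fun χ => Surjective (psi χ) ∧ (charDisc χ:ℝ) ≤ X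

/-- The sextic cyclic fields of bounded discriminant cut out by characters over `S`. -/
def fieldSet (S : Finset ℕ) (X:ℝ) : Finset (IntermediateField ℚ Om) :=
  (surjChars S X).image fun χ => fld (psi χ)

section
variable {S : Finset ℕ} (hS : ∀ p ∈ S, p.Prime)

lemma psi_one : psi (1 : ∀ p : S, Xp p) = 1 := by
  have := psi_pow (1 : ∀ p : S, Xp p) 0
  rwa [pow_zero, pow_zero] at this

include hS

lemma surjective_psi_iff (χ : ∀ p : S, Xp p) : Surjective (psi χ) ↔ χ^2 ≠ 1 ∧ χ^3 ≠ 1 := by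
  have h : ∀ r : ℕ, psi χ^r = 1 ↔ χ^r = 1 := fun r => by
    rw [← psi_pow, ← psi_one, (psi_injective hS).eq_iff]
  rw [surjective_csix_iff, Ne, Ne, h, h]

lemma card_surjChars {X : ℝ} (hX1 : 1 ≤ X) (hX : ∀ p : ℕ, p.Prime → (p:ℝ) ≤ X → p ∈ S) :
    ((surjChars S X).card:ℝ) = summ (charCount 6) X-summ (charCount 2) X -
      summ (charCount 3) X+1 := by
  rw [← card_charDisc_le hS 6 hX, ← card_charDisc_le hS 2 hX, ← card_charDisc_le hS 3 hX]
  set A : ℕ → Finset (∀ p : S, Xp p) := fun r =>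
    univ.filter fun χ => χ^r = 1 ∧ (charDisc χ:ℝ) ≤ X with hA
  have h6 : ∀ χ : ∀ p : S, Xp p, χ^6 = 1 := by intro χ; funext p; ext1 u; exact csix_pow_six (χ p u)
  have hd1 : charDisc (1 : ∀ p : S, Xp p) = 1 := prod_eq_one fun p _ => by
      rw [Pi.one_apply, (locV_eq_zero (hS p p.2)).mpr rfl, pow_zero]
  have hInt : A 2 ∩ A 3 = {1} := by
    ext χ
    simp only [hA, mem_inter, mem_filter, mem_univ, true_and, mem_singleton]
    constructor
    · rintro ⟨⟨h2, -⟩, h3, -⟩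
      rwa [pow_succ, h2, one_mul] at h3
    · rintro rfl
      rw [hd1]
      simpa using hX1
  have hun : surjChars S X ∪ (A 2 ∪ A 3) = A 6 := by
    ext χ
    simp only [hA, surjChars, mem_union, mem_filter, mem_univ, true_and, h6, surjective_psi_iff hS]
    tauto
  have hdis : Disjoint (surjChars S X) (A 2 ∪ A 3) := by
    rw [disjoint_left]
    intro χ
    simp only [hA, surjChars, mem_union, mem_filter, mem_univ, true_and, surjective_psi_iff hS]
    tauto
  have e1 := card_union_of_disjoint hdis
  have e2 := card_union_add_card_inter (A 2) (A 3)
  rw [hun] at e1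
  rw [hInt, card_singleton] at e2
  have e1' : ((A 6).card:ℝ) = (surjChars S X).card+(A 2 ∪ A 3).card := mod_cast e1
  have e2' : ((A 2 ∪ A 3).card:ℝ)+1 = (A 2).card+(A 3).card := mod_cast e2
  linarith

lemma card_surjChars_eq (X:ℝ) : (surjChars S X).card = 2*(fieldSet S X).card := by
  rw [card_eq_sum_card_image (fun χ => fld (psi χ)) (surjChars S X)]
  refine (sum_const_nat fun L hL => ?_).trans (mul_comm _ _)
  obtain ⟨χ, hχ, rfl⟩ := mem_image.mp hL
  have hχ' := (mem_filter.mp hχ).2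
  have hinv : psi χ⁻¹ = (psi χ)⁻¹ := by
    ext1 σ
    rw [MonoidHom.inv_apply, psi_apply, psi_apply, ← prod_inv_distrib]; rfl
  have hker : (psi χ⁻¹).ker = (psi χ).ker := by
    rw [hinv]; ext σ; rw [mem_ker, mem_ker, MonoidHom.inv_apply, inv_eq_one]
  have hsinv : Surjective (psi χ⁻¹) := by
    rw [surjective_psi_iff hS] at hχ' ⊢
    rw [inv_pow, inv_pow, Ne, Ne, inv_eq_one, inv_eq_one]; exact hχ'.1
  have hfld : fld (psi χ⁻¹) = fld (psi χ) := by rw [fld, fld, hker]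
  have hfib : (surjChars S X).filter (fun χ' => fld (psi χ') = fld (psi χ)) = {χ, χ⁻¹} := by
    ext χ'
    simp only [surjChars, mem_filter, mem_univ, true_and, mem_insert, mem_singleton]
    constructor
    · rintro ⟨⟨h1, -⟩, h2⟩
      have h3 := congrArg IntermediateField.fixingSubgroup h2
      rw [fixingSubgroup_fld (nS_ne_zero S) (ker_le_psi hS _),
        fixingSubgroup_fld (nS_ne_zero S) (ker_le_psi hS _)] at h3
      rcases eq_or_eq_inv_of_ker_eq hχ'.1 h1 h3.symm with h | h
      · exact inl (psi_injective hS h)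
      · rw [← hinv] at h; exact inr (psi_injective hS h)
    · rintro (rfl | rfl)
      · exact ⟨hχ', rfl⟩
      · refine ⟨⟨hsinv, ?_⟩, hfld⟩
        rw [charDisc, ← absDisc_psi hS hsinv, hfld, absDisc_psi hS hχ'.1]
        exact hχ'.2
  rw [hfib, card_pair]
  intro h
  refine ((surjective_psi_iff hS χ).mp hχ'.1).1 ?_
  rw [pow_two]; nth_rewrite 1 [h]; exact inv_mul_cancel χ

lemma mem_fieldSet {X : ℝ} {L : IntermediateField ℚ Om} : L ∈ fieldSet S X ↔
    L ≤ Wf (nS S) ∧ IsGalois ℚ L ∧ Nonempty ((L ≃ₐ[ℚ] L) ≃* Csix) ∧ (absDisc L:ℝ) ≤ X := by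
  simp only [fieldSet, surjChars, mem_image, mem_filter, mem_univ, true_and]
  constructor
  · rintro ⟨χ, ⟨hχ, hX⟩, rfl⟩
    have hfix := fixingSubgroup_fld (nS_ne_zero S) (ker_le_psi hS χ)
    have hgal := isGalois_of_fixingSubgroup_eq_ker _ hχ hfix
    refine ⟨fld_le_Wf (nS_ne_zero S) (ker_le_psi hS χ), hgal.1, hgal.2, ?_⟩
    rw [absDisc_psi hS hχ]; exact hX
  · rintro ⟨hL, hgal, ⟨e⟩, hX⟩
    obtain ⟨ψ, hψ, hk⟩ := exists_hom_of_isGalois L hgal e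
    obtain ⟨χ, hχ⟩ := exists_psi_eq hS (ψ := ψ) (by
      rw [hk, ← fixingSubgroup_Wf (nS_ne_zero S)]
      exact IntermediateField.fixingSubgroup_antitone hL)
    have hfld : fld (psi χ) = L := by rw [hχ, fld, hk, fixedField_fixingSubgroup]
    rw [← hχ] at hψ
    refine ⟨χ, ⟨hψ, ?_⟩, hfld⟩
    rw [charDisc, ← absDisc_psi hS hψ, hfld]
    exact hX

end

lemma Wf_mono {m n : ℕ} (hn : n ≠ 0) (h : m ∣ n) : Wf m ≤ Wf n := by
  have hm : m ≠ 0 := fun h' => hn (by rw [h'] at h; exact zero_dvd_iff.mp h)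
  rw [Wf, adjoin_simple_le_iff]
  obtain ⟨k, rfl⟩ := h
  exact mem_Wf hn (by rw [pow_mul, (zt_spec hm).pow_eq_one, one_pow])

lemma two_mul_galoisCount (KW : ∀ L : IntermediateField ℚ Om, FiniteDimensional ℚ L →
      IsGalois ℚ L → Nonempty ((L ≃ₐ[ℚ] L) ≃* Csix) →
      ∃ S : Finset ℕ, (∀ p ∈ S, p.Prime) ∧ L ≤ Wf (nS S)) {X : ℝ} (hX1 : 1 ≤ X) :
    2*(galoisCount Csix X:ℝ) = summ (charCount 6) X-summ (charCount 2) X -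
      summ (charCount 3) X+1 := by
  set S₀ := (range (⌊X⌋₊ + 1)).filter Nat.Prime with hS₀
  have hp0 : ∀ p ∈ S₀, p.Prime := fun p hp => (mem_filter.mp hp).2
  have hX0 : ∀ p : ℕ, p.Prime → (p:ℝ) ≤ X → p ∈ S₀ := fun p pp h =>
    mem_filter.mpr ⟨mem_range_succ_iff.mpr (le_floor h), pp⟩
  have hcard : ∀ S : Finset ℕ, (∀ p ∈ S, p.Prime) → S₀ ⊆ S → 2*((fieldSet S X).card:ℝ) =
      summ (charCount 6) X-summ (charCount 2) X-summ (charCount 3) X+1 := by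
    intro S hS h
    rw [← card_surjChars hS hX1 fun p pp hp => h (hX0 p pp hp), card_surjChars_eq hS]
    push_cast; rfl
  rw [← hcard S₀ hp0 subset_rfl, galoisCount, subtype_card (fieldSet S₀ X)]
  intro L
  constructor
  · intro h
    have h' := (mem_fieldSet hp0).mp h
    exact ⟨finiteDimensional_of_le h'.1, h'.2⟩
  · rintro ⟨hfin, hgal, he, hX⟩
    obtain ⟨S, hS, hL⟩ := KW L hfin hgal he
    have hSu : ∀ p ∈ S₀ ∪ S, p.Prime := fun p hp =>
      (mem_union.mp hp).elim (hp0 p) (hS p)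
    have hW : ∀ T ⊆ S₀ ∪ S, Wf (nS T) ≤ Wf (nS (S₀ ∪ S)) := fun T hT =>
      Wf_mono (nS_ne_zero _) (prod_dvd_prod_of_subset _ _ _ hT)
    have hsub : fieldSet S₀ X ⊆ fieldSet (S₀ ∪ S) X := fun M hM => by
      have h := (mem_fieldSet hp0).mp hM
      exact (mem_fieldSet hSu).mpr ⟨h.1.trans (hW _ subset_union_left), h.2⟩
    have hc : ((fieldSet (S₀ ∪ S) X).card:ℝ) = (fieldSet S₀ X).card := by
      have := hcard S₀ hp0 subset_rfl
      have := hcard (S₀ ∪ S) hSu subset_union_left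
      linarith
    rw [eq_of_subset_of_card_le hsub (mod_cast hc.le)]
    exact (mem_fieldSet hSu).mpr ⟨hL.trans (hW _ subset_union_right), hgal, he, hX⟩

lemma hasAsymp_charCount {r a b : ℕ} (hr : r = 6 ∧ a = 1 ∧ b = 1 ∨ r = 2 ∧ a = 1 ∧ b = 0 ∨
    r = 3 ∧ a = 0 ∧ b = 1) : HasAsymp (charCount r) := by
  obtain ⟨D₂, h2⟩ := exists_locCount_eq_zero r 2
  obtain ⟨D₃, h3⟩ := exists_locCount_eq_zero r 3
  refine hasAsymp_mulOf (D := max D₂ D₃) (a := a) (b := b)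
    (fun p => by rw [locCount_zero, cast_one]) (fun k hk => ?_) ?_ ?_
  · rw [h2 k ((le_max_left _ _).trans_lt hk), h3 k ((le_max_right _ _).trans_lt hk)]
    simp
  · rcases hr with ⟨-, rfl, rfl⟩ | ⟨-, rfl, rfl⟩ | ⟨-, rfl, rfl⟩ <;> simp
  · intro p pp h5 k hk
    exact locCount_eq hr pp h5 hk

/-- The number of surjective families of local characters with discriminant at most `X`. -/
def surjCount (X:ℝ) : ℝ :=
  summ (charCount 6) X-summ (charCount 2) X-summ (charCount 3) X+1

lemma exists_asymp_surjCount : ∃ c3 c4 c5 K : ℝ, 0 < K ∧ ∀ X : ℝ, 1 ≤ X →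
    |surjCount X-mainTerm c3 c4 c5 X| ≤ K*(X^((1:ℝ)/6)*(1+log X)^2) := by
  obtain ⟨a3, a4, a5, A, hA, h6⟩ := hasAsymp_charCount (r := 6) (a := 1) (b := 1) (by simp)
  obtain ⟨b3, b4, b5, B, hB, h2⟩ := hasAsymp_charCount (r := 2) (a := 1) (b := 0) (by simp)
  obtain ⟨d3, d4, d5, D, hD, h3⟩ := hasAsymp_charCount (r := 3) (a := 0) (b := 1) (by simp)
  refine ⟨a3-b3-d3, a4-b4-d4, a5-b5-d5, A+B+D+1, by positivity, fun X hX => ?_⟩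
  have h1 : 1 ≤ X^((1:ℝ)/6)*(1+log X)^2 := by
    have h := one_le_rpow hX (by norm_num : (0:ℝ) ≤ 1/6)
    have h' : 1 ≤ (1+log X)^2 := one_le_pow₀ (by linarith [log_nonneg hX])
    nlinarith
  have e6 := abs_le.mp (h6 X hX)
  have e2 := abs_le.mp (h2 X hX)
  have e3 := abs_le.mp (h3 X hX)
  have hm : mainTerm (a3-b3-d3) (a4-b4-d4) (a5-b5-d5) X =
      mainTerm a3 a4 a5 X-mainTerm b3 b4 b5 X-mainTerm d3 d4 d5 X := by
    simp only [mainTerm]; ring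
  rw [hm, surjCount, abs_le]
  constructor <;> linarith

lemma surjCount_mono {X Y : ℝ} (hX : 1 ≤ X) (h : X ≤ Y) : surjCount X ≤ surjCount Y := by
  set S := (range (⌊Y⌋₊ + 1)).filter Nat.Prime with hS
  have hp : ∀ p ∈ S, p.Prime := fun p hp => (mem_filter.mp hp).2
  have hY : ∀ p : ℕ, p.Prime → (p:ℝ) ≤ Y → p ∈ S := fun p pp h =>
    mem_filter.mpr ⟨mem_range_succ_iff.mpr (le_floor h), pp⟩
  rw [surjCount, surjCount, ← card_surjChars hp hX fun p pp h' => hY p pp (h'.trans h),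
    ← card_surjChars hp (hX.trans h) hY]
  exact_mod_cast card_le_card fun χ hχ => by
    rw [surjChars, mem_filter] at hχ ⊢
    exact ⟨hχ.1, hχ.2.1, hχ.2.2.trans h⟩

lemma summ_succ (f : ArithmeticFunction ℝ) (n:ℕ) : summ f (n+1:ℕ) = summ f n+f (n+1) := by
  rw [summ, summ, floor_natCast, floor_natCast, sum_Icc_succ_top (by omega)]

lemma charCount_jump_nonneg {n : ℕ} (hn : 2 ≤ n) :
    0 ≤ charCount 6 n-charCount 2 n-charCount 3 n := by
  obtain ⟨m, rfl⟩ : ∃ m, n = m+1 := ⟨n-1, by omega⟩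
  have h := surjCount_mono (X := m) (Y := (m+1:ℕ)) (mod_cast (by omega : 1 ≤ m))
    (by push_cast; linarith)
  rw [surjCount, surjCount, summ_succ, summ_succ, summ_succ] at h
  linarith

lemma charCount_one (r:ℕ) : charCount r 1 = 1 := (isMultiplicative_mulOf _).map_one

lemma charCount_jump_eq_two {p : ℕ} (pp : p.Prime) (h : 11 ≤ p) :
    charCount 6 (7^4*p^3)-charCount 2 (7^4*p^3)-charCount 3 (7^4*p^3) = 2 := by
  have p7 : Nat.Prime 7 := by norm_num
  have hc : Coprime (7^4) (p^3) := ((Nat.coprime_primes p7 pp).mpr (by omega)).pow 4 3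
  have h7 : chi3 7 = 1 := by norm_num [chi3]
  have hm : ∀ {r a b : ℕ}, (r = 6 ∧ a = 1 ∧ b = 1 ∨ r = 2 ∧ a = 1 ∧ b = 0 ∨
      r = 3 ∧ a = 0 ∧ b = 1) → charCount r (7^4*p^3) = 2*b*a := by
    intro r a b hr
    rw [charCount, (isMultiplicative_mulOf _).map_mul_of_coprime hc,
      mulOf_pow p7 (by rw [locCount_zero, cast_one]),
      mulOf_pow pp (by rw [locCount_zero, cast_one]),
      locCount_eq hr p7 (by norm_num) (by norm_num), locCount_eq hr pp (by omega) (by norm_num)]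
    obtain ⟨-, rfl, rfl⟩ | ⟨-, rfl, rfl⟩ | ⟨-, rfl, rfl⟩ := hr <;> norm_num [h7]
  rw [hm (r := 6) (a := 1) (b := 1) (by simp), hm (r := 2) (a := 1) (b := 0) (by simp),
    hm (r := 3) (a := 0) (b := 1) (by simp)]
  norm_num

lemma le_surjCount {n : ℕ} (hn : 1 ≤ n) :
    2*((n.primeCounting:ℝ)-11) ≤ surjCount ((7^4*n^3:ℕ):ℝ) := by
  set N := 7^4*n^3 with hN
  have hN1 : 1 ≤ N := Nat.one_le_iff_ne_zero.mpr (by positivity)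
  set f : ℕ → ℝ := fun m => charCount 6 m-charCount 2 m-charCount 3 m with hf
  have h1 : surjCount (N:ℝ) = ∑ m ∈ Icc 2 N, f m := by
    rw [surjCount, summ, summ, summ, floor_natCast, ← sum_sub_distrib,
      ← sum_sub_distrib, ← add_sum_Ioc_eq_sum_Icc hN1]
    simp only [charCount_one]
    have : Ioc 1 N = Icc 2 N := by ext; simp [mem_Ioc, mem_Icc]; omega
    rw [this]; ring
  set P := (range (n+1)).filter Nat.Prime with hP
  have hPc : P.card = n.primeCounting := by
    rw [Nat.primeCounting, Nat.primeCounting', Nat.count_eq_card_filter_range]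
  set Q := P.filter (fun p => 11 ≤ p) with hQ
  have hQc : n.primeCounting ≤ Q.card+11 := by
    have h := card_filter_add_card_filter_not (s := P) (fun p => 11 ≤ p)
    have h' : (P.filter fun p => ¬ 11 ≤ p).card ≤ 11 := by
      refine (card_le_card (t := range 11) fun p hp => ?_).trans (by simp)
      rw [mem_filter] at hp
      exact mem_range.mpr (by omega)
    have h3 : Q.card = (P.filter fun p => 11 ≤ p).card := by rw [hQ]
    rw [← hPc, ← h, h3]
    convert Nat.add_le_add_left h' _
  have hinj : InjOn (fun p : ℕ => 7^4*p^3) Q := by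
    intro p _ q _ h
    exact Nat.pow_left_injective (by norm_num : 3 ≠ 0) (Nat.eq_of_mul_eq_mul_left (by norm_num) h)
  have h2 : ∑ m ∈ Q.image (fun p : ℕ => 7^4*p^3), f m ≤ ∑ m ∈ Icc 2 N, f m := by
    refine sum_le_sum_of_subset_of_nonneg ?_ fun m hm _ =>
      charCount_jump_nonneg (mem_Icc.mp hm).1
    intro m hm
    obtain ⟨p, hp, rfl⟩ := mem_image.mp hm
    rw [hQ, mem_filter, hP, mem_filter, mem_range] at hp
    rw [mem_Icc]
    have hp3 : 1 ≤ p^3 := Nat.one_le_pow _ _ (by omega)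
    exact ⟨by omega, Nat.mul_le_mul_left _ (Nat.pow_le_pow_left (by omega) 3)⟩
  have h3 : ∑ p ∈ Q, f (7^4*p^3) = ∑ p ∈ Q, (2:ℝ) := sum_congr rfl fun p hp => by
    rw [hQ, mem_filter, hP, mem_filter] at hp
    exact charCount_jump_eq_two hp.1.2 hp.2
  rw [sum_image hinj, h3, sum_const, nsmul_eq_mul] at h2
  have hQc' : (n.primeCounting:ℝ) ≤ Q.card+11 := mod_cast hQc
  rw [h1]; linarith

lemma one_add_log_sq_le {X : ℝ} (hX : 1 ≤ X) : X^((1:ℝ)/6)*(1+log X)^2 ≤ 625*X^((1:ℝ)/4) := by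
  have h0 : 0 < X := by linarith
  have h := Real.log_le_rpow_div h0.le (by norm_num : (0:ℝ) < 1/24)
  have h1 := one_le_rpow hX (by norm_num : (0:ℝ) ≤ 1/24)
  have h2 : (1+log X)^2 ≤ (25*X^((1:ℝ)/24))^2 :=
    pow_le_pow_left₀ (by linarith [log_nonneg hX]) (by linarith) 2
  refine (mul_le_mul_of_nonneg_left h2 (rpow_nonneg h0.le _)).trans (le_of_eq ?_)
  rw [mul_pow, ← rpow_natCast (X^((1:ℝ)/24)), ← rpow_mul h0.le, mul_left_comm, ← rpow_add h0]
  norm_num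

lemma rpow_le_primeCounting_false {C : ℝ}
    (h : ∀ n : ℕ, 1 ≤ n → (n.primeCounting:ℝ) ≤ C*(n:ℝ)^((3:ℝ)/4)) : False := by
  have hC : 0 ≤ C := by simpa using h 1 le_rfl
  have hb : ∀ n : ℕ, 1 ≤ n → (n:ℝ)^((1:ℝ)/8) ≤ (9+8*C)/log 2 := by
    intro n hn
    have hn1 : (1:ℝ) ≤ n := mod_cast hn
    have n0 : (0:ℝ) < n := by linarith
    have hl := Real.log_le_rpow_div n0.le (by norm_num : (0:ℝ) < 1/8)
    have h1 := (Chebyshev.psi_ge n).trans (Chebyshev.psi_le_primeCounting_mul_log n)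
    have h2 : log (n+1) ≤ 1+log n := by
      have : (n:ℝ)+1 ≤ Real.exp 1*n := by nlinarith [Real.add_one_le_exp (1:ℝ)]
      calc _ ≤ log (Real.exp 1*n) := log_le_log (by linarith) this
        _ = _ := by rw [Real.log_mul (exp_pos 1).ne' n0.ne', log_exp]
    have h3 := mul_le_mul (h n hn) hl (log_nonneg hn1) (by positivity)
    set t := (n:ℝ)^((1:ℝ)/8) with ht
    have t1 : 1 ≤ t := one_le_rpow hn1 (by norm_num)
    have e6 : (n:ℝ)^((3:ℝ)/4) = t^6 := by rw [ht, ← rpow_natCast, ← rpow_mul n0.le]; norm_num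
    have e8 : (n:ℝ) = t^8 := by rw [ht, ← rpow_natCast, ← rpow_mul n0.le]; norm_num
    rw [e6] at h3
    have h4 : t^7*(t*log 2) ≤ t^7*(9+8*C) := by
      have h5 : t ≤ t^7 := le_self_pow₀ t1 (by norm_num)
      have h6 : t^7*(t*log 2) = n*log 2 := by rw [e8]; ring
      rw [h6]
      linarith
    rw [le_div_iff₀ (Real.log_pos (by norm_num))]
    exact le_of_mul_le_mul_left h4 (by positivity)
  obtain ⟨n, hn, hn1⟩ := ((((tendsto_rpow_atTop (by norm_num : (0:ℝ) < 1/8)).comp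
    tendsto_natCast_atTop_atTop).eventually_gt_atTop ((9+8*C)/log 2)).and
    (Filter.eventually_ge_atTop 1)).exists
  exact absurd (hb n hn1) (not_le.mpr hn)

lemma coeff_pos_of_asymp {c3 c4 c5 K : ℝ} (hK : 0 < K) (h : ∀ X : ℝ, 1 ≤ X →
    |surjCount X-mainTerm c3 c4 c5 X| ≤ K*(X^((1:ℝ)/6)*(1+log X)^2)) :
    0 < c3 := by
  by_contra! hc
  refine rpow_le_primeCounting_false (C := 11+(|c4| + |c5| + K*625)*7) fun n hn => ?_
  have hn1 : (1:ℝ) ≤ n := mod_cast hn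
  have n0 : (0:ℝ) < n := by linarith
  have hX : (1:ℝ) ≤ ((7^4*n^3:ℕ):ℝ) := mod_cast Nat.one_le_iff_ne_zero.mpr (by positivity)
  have h1 := le_surjCount hn
  set X := ((7^4*n^3:ℕ):ℝ) with hXd
  have h2 := (abs_le.mp (h X hX)).2
  have h3 := mul_le_mul_of_nonneg_left (one_add_log_sq_le hX) hK.le
  have e : X^((1:ℝ)/4) = 7*(n:ℝ)^((3:ℝ)/4) := by
    have h7 : X = (7*(n:ℝ)^((3:ℝ)/4))^(4:ℝ) := by
      rw [hXd, mul_rpow (by norm_num) (by positivity), ← rpow_mul n0.le]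
      norm_num
    rw [h7, ← rpow_mul (by positivity)]
    norm_num
  have h4 : c4*X^((1:ℝ)/4) ≤ |c4| * X^((1:ℝ)/4) := by gcongr; exact le_abs_self _
  have h5 : c5*X^((1:ℝ)/5) ≤ |c5| * X^((1:ℝ)/4) :=
    mul_le_mul (le_abs_self _) (rpow_le_rpow_of_exponent_le hX (by norm_num))
      (by positivity) (abs_nonneg _)
  have h6 : c3*X^((1:ℝ)/3) ≤ 0 := mul_nonpos_of_nonpos_of_nonneg hc (by positivity)
  have h7 : 1 ≤ (n:ℝ)^((3:ℝ)/4) := one_le_rpow hn1 (by norm_num)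
  replace h2 := h2.trans h3
  rw [mainTerm] at h2
  rw [e] at h2 h4 h5
  have h8 : 0 ≤ (|c4| + |c5| + K*625)*(n:ℝ)^((3:ℝ)/4) := by positivity
  linarith

/-- The union of the fields `Wf (nS S)`. -/
def cycUnion : IntermediateField ℚ Om :=
  ⨆ S : {S : Finset ℕ // ∀ p ∈ S, p.Prime}, Wf (nS S)

lemma Wf_nS_mono {S T : Finset ℕ} (h : S ⊆ T) : Wf (nS S) ≤ Wf (nS T) :=
  Wf_mono (nS_ne_zero _) (prod_dvd_prod_of_subset _ _ _ h)

lemma mem_cycUnion {x : Om} :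
    x ∈ cycUnion ↔ ∃ S : Finset ℕ, (∀ p ∈ S, p.Prime) ∧ x ∈ Wf (nS S) := by
  have : Nonempty {S : Finset ℕ // ∀ p ∈ S, p.Prime} := ⟨∅, by simp⟩
  rw [cycUnion, ← SetLike.mem_coe, coe_iSup_of_directed]
  · simp
  · intro S T
    refine ⟨⟨S.1 ∪ T.1, fun p hp => (mem_union.mp hp).elim (S.2 p) (T.2 p)⟩,
      Wf_nS_mono subset_union_left, Wf_nS_mono subset_union_right⟩

lemma mem_cycUnion_of_pow_prime {p : ℕ} (pp : p.Prime) {x : Om} (h : x^p = 1) : x ∈ cycUnion := by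
  refine mem_cycUnion.mpr ⟨{p}, by simpa using pp, mem_Wf (nS_ne_zero _) ?_⟩
  obtain ⟨k, hk⟩ := (dvd_qq pp).trans (qq_dvd_nS (mem_singleton_self p))
  rw [hk, pow_mul, h, one_pow]

lemma mem_cycUnion_of_pow {x : Om} (h : x^72 = 1) : x ∈ cycUnion := by
  refine mem_cycUnion.mpr ⟨{2, 3}, by simp [prime_two, prime_three],
    mem_Wf (nS_ne_zero _) ?_⟩
  rwa [show nS {2, 3} = 72 by norm_num [nS, qq]]

lemma gaussSum_mem_cycUnion {p : ℕ} [hp : Fact p.Prime] {χ : MulChar (ZMod p) Om}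
    {ψ : AddChar (ZMod p) Om} (h : ∀ a, χ a ∈ cycUnion) : gaussSum χ ψ ∈ cycUnion := by
  refine sum_mem fun a _ => mul_mem (h a) (mem_cycUnion_of_pow_prime hp.out ?_)
  rw [← AddChar.map_nsmul_eq_pow, nsmul_eq_mul, CharP.cast_eq_zero, zero_mul,
    AddChar.map_zero_eq_one]

lemma exists_sq_eq_natCast (n:ℕ) : ∃ s ∈ cycUnion, s^2 = (n : Om) := by
  obtain ⟨i, hi⟩ := IsAlgClosed.exists_pow_nat_eq (-1 : Om) (by norm_num : 0 < 2)
  have hi' : i ∈ cycUnion := mem_cycUnion_of_pow (by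
    rw [show 72 = 2*36 by rfl, pow_mul, hi]; norm_num)
  induction n using Nat.recOnMul with
  | zero => exact ⟨0, zero_mem _, by simp⟩
  | one => exact ⟨1, one_mem _, by simp⟩
  | mul a b ha hb =>
    obtain ⟨s, hs, h⟩ := ha
    obtain ⟨t, ht, h'⟩ := hb
    exact ⟨s*t, mul_mem hs ht, by rw [mul_pow, h, h', Nat.cast_mul]⟩
  | prime p pp =>
    rcases eq_or_ne p 2 with rfl | h2
    · obtain ⟨z, hz⟩ := IsAlgClosed.exists_pow_nat_eq (-1 : Om) (by norm_num : 0 < 4)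
      have hz' : z ∈ cycUnion := mem_cycUnion_of_pow (by
        rw [show 72 = 4*18 by rfl, pow_mul, hz]; norm_num)
      exact ⟨z-z^3, sub_mem hz' (pow_mem hz' 3), by
        push_cast; linear_combination (z^2-2)*hz⟩
    · have := Fact.mk pp
      have hr : ringChar (ZMod p) ≠ 2 := by rwa [ZMod.ringChar_zmod_n]
      set χ := (quadraticChar (ZMod p)).ringHomComp (Int.castRingHom Om) with hχ
      have hinj : Injective (Int.castRingHom Om) := Int.cast_injective
      have h1 : χ ≠ 1 := (MulChar.ringHomComp_ne_one_iff hinj).mpr (quadraticChar_ne_one hr)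
      have hq : χ.IsQuadratic := (quadraticChar_isQuadratic (ZMod p)).comp _
      have hm : ∀ a, χ a ∈ cycUnion := fun a => by
        rcases hq a with h | h | h <;> rw [h]
        exacts [zero_mem _, one_mem _, neg_mem (one_mem _)]
      have hg := gaussSum_sq h1 hq (AddChar.zmodChar_primitive_of_primitive_root p
        (zt_spec pp.ne_zero))
      set g := gaussSum χ _
      have hgm : g ∈ cycUnion := gaussSum_mem_cycUnion hm
      rw [ZMod.card] at hg
      rcases hq (-1) with h | h | h <;> rw [h] at hg
      · rw [zero_mul] at hg
        have h0 : (χ (-1))^2 = 1 := by rw [← map_pow, neg_one_sq, map_one]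
        rw [h] at h0; norm_num at h0
      · exact ⟨g, hgm, by rw [hg, one_mul]⟩
      · exact ⟨i*g, mul_mem hi' hgm, by rw [mul_pow, hg, hi]; ring⟩

lemma mem_cycUnion_of_sq {y : Om} {r : ℚ} (h : y^2 = algebraMap ℚ Om r) : y ∈ cycUnion := by
  obtain ⟨s, hs, e⟩ := exists_sq_eq_natCast (r.num.natAbs*r.den)
  obtain ⟨i, hi⟩ := IsAlgClosed.exists_pow_nat_eq (-1 : Om) (by norm_num : 0 < 2)
  have hi' : i ∈ cycUnion := mem_cycUnion_of_pow (by
    rw [show 72 = 2*36 by rfl, pow_mul, hi]; norm_num)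
  have d0 : (r.den : Om) ≠ 0 := mod_cast r.den_nz
  have hr : (r.den : Om)^2*y^2 = r.num*r.den := by
    rw [h, eq_ratCast]; nth_rw 2 [← Rat.num_div_den r]; push_cast; field_simp
  have key : ∀ t ∈ cycUnion, (r.den*y)^2 = t^2 → y ∈ cycUnion := by
    intro t ht h'
    have hd : (r.den : Om)*y ∈ cycUnion := by
      rcases sq_eq_sq_iff_eq_or_eq_neg.mp h' with h' | h' <;> rw [h']
      exacts [ht, neg_mem ht]
    have := div_mem hd (natCast_mem cycUnion r.den)
    rwa [mul_div_cancel_left₀ _ d0] at this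
  rcases Int.natAbs_eq r.num with hn | hn
  · refine key s hs ?_
    rw [mul_pow, hr, e, hn]; push_cast; simp
  · refine key (i*s) (mul_mem hi' hs) ?_
    rw [mul_pow, mul_pow, hr, e, hn, hi]; push_cast; simp

/-- The element `x + yζ` of `ℚ(ω)`, where `ζ = -ω²`. -/
def eisVal (ω : Om) (z : ℤ × ℤ) : Om := z.1-z.2*ω^2

/-- `z ^ 2 * conj z` is a cube of an element of `cycUnion`. -/
def IsCycCube (ω : Om) (z : ℤ × ℤ) : Prop := ∃ t ∈ cycUnion, t^3 = eisVal ω z^2*eisVal ω (eisConj z)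

section
variable {ω : Om} (hω : IsPrimitiveRoot ω 3)
include hω

lemma omega_sq_add : ω^2+ω+1 = 0 := by
  have h := hω.geom_sum_eq_zero (by norm_num)
  simp only [sum_range_succ, sum_range_zero, pow_zero, pow_one] at h
  linear_combination h

lemma eisVal_conj (z : ℤ × ℤ) : eisVal ω (eisConj z) = z.1-z.2*ω := by
  simp only [eisVal, eisConj]; push_cast
  linear_combination (z.2 : Om)*omega_sq_add hω

lemma eisVal_mul_conj (z : ℤ × ℤ) : eisVal ω z*eisVal ω (eisConj z) = eisNorm z := by
  rw [eisVal_conj hω, eisVal, eisNorm]; push_cast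
  linear_combination (-(z.1*z.2 : Om)+z.2^2*(ω-1))*omega_sq_add hω

lemma eisVal_mul (z w : ℤ × ℤ) : eisVal ω (eisMul z w) = eisVal ω z*eisVal ω w := by
  simp only [eisVal, eisMul]; push_cast
  linear_combination -(z.2*w.2 : Om)*(ω^2-ω+1)*omega_sq_add hω

lemma IsCycCube.mul {z w : ℤ × ℤ} (hz : IsCycCube ω z) (hw : IsCycCube ω w) :
    IsCycCube ω (eisMul z w) := by
  obtain ⟨s, hs, h⟩ := hz
  obtain ⟨t, ht, h'⟩ := hw
  refine ⟨s*t, mul_mem hs ht, ?_⟩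
  have : eisConj (eisMul z w) = eisMul (eisConj z) (eisConj w) := by
    simp only [eisConj, eisMul]; ext <;> ring
  rw [this, eisVal_mul hω, eisVal_mul hω, mul_pow, h, h']; ring

lemma IsCycCube.conj {z : ℤ × ℤ} (h0 : eisNorm z ≠ 0) (hz : IsCycCube ω z) :
    IsCycCube ω (eisConj z) := by
  obtain ⟨t, ht, h⟩ := hz
  have hc : eisConj (eisConj z) = z := by simp [eisConj]
  have hn : (eisNorm z : Om) ≠ 0 := mod_cast h0
  have hm := eisVal_mul_conj hω z
  have ht0 : t ≠ 0 := by
    rintro rfl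
    refine hn ?_
    rw [← hm]
    by_contra h'
    have := mul_ne_zero (left_ne_zero_of_mul h') h'
    refine this ?_
    linear_combination -h
  refine ⟨eisNorm z/t, div_mem (intCast_mem _ _) ht, ?_⟩
  rw [div_pow, div_eq_iff (pow_ne_zero 3 ht0), h, hc, ← hm]; ring

lemma isCycCube_int (n:ℤ) : IsCycCube ω (n, 0) :=
  ⟨n, intCast_mem _ _, by simp [eisVal, eisConj]; ring⟩

lemma isCycCube_of_norm_one {z : ℤ × ℤ} (h : eisNorm z = 1) : IsCycCube ω z := by
  have h3 := hω.pow_eq_one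
  obtain ⟨t, ht⟩ := IsAlgClosed.exists_pow_nat_eq (eisVal ω z) (by norm_num : 0 < 3)
  have h6 : eisVal ω z^6 = 1 := by
    have h12 : (ω^2)^6 = 1 := by rw [← pow_mul, show 2*6 = 3*4 by rfl, pow_mul, h3, one_pow]
    have hw : 1+ω^2 = -ω := by linear_combination omega_sq_add hω
    have h6' : ω^6 = 1 := by rw [show 6 = 3*2 by rfl, pow_mul, h3, one_pow]
    have hz := eisNorm_eq_one h
    simp only [mem_insert, mem_singleton] at hz
    rcases hz with rfl | rfl | rfl | rfl | rfl | rfl <;> simp only [eisVal] <;> push_cast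
    · norm_num
    · norm_num
    · linear_combination h12
    · linear_combination h12
    · linear_combination h6'+((1+ω^2)^3+(-ω)^3)*((1+ω^2)^2+(1+ω^2)*(-ω)+ω^2)*hw
    · linear_combination h6'+((1+ω^2)^3+(-ω)^3)*((1+ω^2)^2+(1+ω^2)*(-ω)+ω^2)*hw
  refine ⟨t, mem_cycUnion_of_pow ?_, ?_⟩
  · rw [show 72 = 3*(6*4) by rfl, pow_mul, ht, pow_mul, h6, one_pow]
  · rw [ht, sq, mul_assoc, eisVal_mul_conj hω, h]; simp

lemma isCycCube_three : IsCycCube ω (1, 1) := by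
  obtain ⟨t, ht⟩ := IsAlgClosed.exists_pow_nat_eq (-ω) (by norm_num : 0 < 3)
  have hωm : ω ∈ cycUnion := mem_cycUnion_of_pow_prime prime_three hω.pow_eq_one
  have htm : t ∈ cycUnion := mem_cycUnion_of_pow (by
    rw [show 72 = 3*24 by rfl, pow_mul, ht, show 24 = 2*(3*4) by rfl, pow_mul, neg_sq,
      ← pow_mul, ← mul_assoc, mul_comm 2 3, mul_assoc, pow_mul, hω.pow_eq_one, one_pow])
  refine ⟨t*(1-ω^2), mul_mem htm (sub_mem (one_mem _) (pow_mem hωm 2)), ?_⟩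
  rw [mul_pow, ht, eisVal_conj hω, eisVal]; push_cast
  linear_combination (1-ω^2)^2*hω.pow_eq_one

lemma exists_isCycCube_prime {p : ℕ} (pp : p.Prime) (h : p = 3 ∨ p % 3 = 1) :
    ∃ π, eisNorm π = p ∧ IsCycCube ω π := by
  rcases h with rfl | h
  · exact ⟨(1, 1), by norm_num [eisNorm], isCycCube_three hω⟩
  · have := Fact.mk pp
    obtain ⟨χ, π, h3, hn, hg⟩ := exists_cubic_gaussSum hω h
    refine ⟨π, hn, gaussSum χ _, gaussSum_mem_cycUnion fun a => ?_,
      (hg _ (AddChar.zmodChar_primitive_of_primitive_root p (zt_spec pp.ne_zero))).trans ?_⟩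
    · by_cases ha : IsUnit a
      · refine mem_cycUnion_of_pow_prime prime_three ?_
        rw [← MulChar.pow_apply' _ (by norm_num), h3, MulChar.one_apply ha]
      · rw [χ.map_nonunit ha]; exact zero_mem _
    · have := eisVal_mul_conj hω π
      rw [hn] at this
      rw [sq (eisVal ω π), mul_assoc, this, eisVal]; push_cast; ring

lemma isCycCube {z : ℤ × ℤ} (hz : eisNorm z ≠ 0) : IsCycCube ω z := by
  induction h : (eisNorm z).natAbs using Nat.strong_induction_on generalizing z with
  | _ n ih =>
  subst h
  have hn : eisNorm z = (eisNorm z).natAbs := (Int.natAbs_of_nonneg (eisNorm_nonneg z)).symm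
  rcases eq_or_ne (eisNorm z).natAbs 1 with h1 | h1
  · exact isCycCube_of_norm_one hω (by rw [hn, h1]; rfl)
  have step : ∀ π w, z = eisMul π w → 1 < eisNorm π → IsCycCube ω π → IsCycCube ω z := by
    rintro π w rfl hπ hc
    rw [eisNorm_mul] at hz ih
    refine hc.mul hω (ih _ ?_ (right_ne_zero_of_mul hz) rfl)
    rw [Int.natAbs_mul]
    have : 0 < (eisNorm w).natAbs := Int.natAbs_pos.mpr (right_ne_zero_of_mul hz)
    have : 1 < (eisNorm π).natAbs := by omega
    nlinarith
  obtain ⟨p, pp, hp⟩ := Nat.exists_prime_and_dvd h1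
  have hpz : (p:ℤ) ∣ eisNorm z := Int.natCast_dvd.mpr hp
  have hp1 : (1:ℤ) < p := mod_cast pp.one_lt
  by_cases h3 : p = 3 ∨ p % 3 = 1
  · obtain ⟨π, hπ, hc⟩ := exists_isCycCube_prime hω pp h3
    obtain ⟨w, hw | hw⟩ := eisMul_of_prime_dvd pp hπ hpz
    · exact step π w hw (by omega) hc
    · exact step _ w hw (by rw [eisNorm_conj]; omega) (hc.conj hω (by omega))
  · have h2 : p % 3 = 2 := by
      have : ¬ 3 ∣ p := fun h => h3 (inl ((Nat.prime_dvd_prime_iff_eq prime_three pp).mp h).symm)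
      omega
    obtain ⟨⟨x, hx⟩, y, hy⟩ := prime_dvd_eisNorm pp hpz h2
    refine step (p, 0) (x, y) ?_ ?_ (isCycCube_int hω p)
    · ext <;> simp [eisMul, hx, hy]
    · simp only [eisNorm]; nlinarith

end

lemma mem_cycUnion_of_cube {ω : Om} (hω : IsPrimitiveRoot ω 3) {θ θ' : Om} {a b β : ℚ}
    (h : θ^3 = a+b*ω) (h' : θ'^3 = a+b*ω^2) (hβ : θ*θ' = β) : θ ∈ cycUnion := by
  have hw := omega_sq_add hω
  have hωm : ω ∈ cycUnion := mem_cycUnion_of_pow_prime prime_three hω.pow_eq_one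
  set m : Om := a.den*b.den with hm
  have hm0 : m ≠ 0 := mul_ne_zero (mod_cast a.den_nz) (mod_cast b.den_nz)
  have ha : (a : Om)*a.den = a.num := mod_cast Rat.mul_den_eq_num a
  have hb : (b : Om)*b.den = b.num := mod_cast Rat.mul_den_eq_num b
  set z : ℤ × ℤ := (a.num*b.den-b.num*a.den, b.num*a.den) with hz
  have e1 : eisVal ω z = m*θ^3 := by
    rw [h, eisVal, hz, hm]; push_cast; rw [← ha, ← hb]
    linear_combination (-(a.den*b.den*b : Om))*hw
  have e2 : eisVal ω (eisConj z) = m*θ'^3 := by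
    rw [h', eisVal_conj hω, hz, hm]; push_cast; rw [← ha, ← hb]
    linear_combination (-(a.den*b.den*b : Om))*hw
  have hn := eisVal_mul_conj hω z
  by_cases h0 : eisNorm z = 0
  · have h2 : z.2 = 0 := by rw [eisNorm] at h0; nlinarith [sq_nonneg (2*z.1+z.2)]
    have h1 : z.1 = 0 := by rw [eisNorm, h2] at h0; simpa using h0
    rw [eisVal, h1, h2, Int.cast_zero, zero_mul, sub_zero, eq_comm] at e1
    rw [pow_eq_zero_iff (by norm_num : 3 ≠ 0) |>.mp ((mul_eq_zero.mp e1).resolve_left hm0)]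
    exact zero_mem _
  · have hβ0 : (β : Om) ≠ 0 := by
      intro hb0
      have : (eisNorm z : Om) ≠ 0 := mod_cast h0
      refine this ?_
      rw [← hn, e1, e2, show m*θ^3*(m*θ'^3) = m^2*(θ*θ')^3 by ring, hβ, hb0]
      ring
    obtain ⟨t, ht, hc⟩ := isCycCube hω h0
    have h3 : (m*θ*β-t)*(m*θ*β-ω*t)*(m*θ*β-ω^2*t) = 0 := by
      have hc' : t^3 = (m*θ*β)^3 := by rw [hc, e1, e2, ← hβ]; ring
      linear_combination (-(m*θ*β)^2*t+(m*θ*β)*ω*t^2)*hw-t^3*hω.pow_eq_one-hc'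
    have hmβ : m*θ*β ∈ cycUnion := by
      rcases mul_eq_zero.mp h3 with h3 | h3
      · rcases mul_eq_zero.mp h3 with h3 | h3 <;> rw [sub_eq_zero.mp h3]
        exacts [ht, mul_mem hωm ht]
      · rw [sub_eq_zero.mp h3]; exact mul_mem (pow_mem hωm 2) ht
    have hd : m*β ∈ cycUnion := mul_mem (mul_mem (natCast_mem _ _) (natCast_mem _ _))
      (by simpa using cycUnion.algebraMap_mem β)
    have := div_mem hmβ hd
    rwa [mul_right_comm, mul_div_cancel_left₀ _ (mul_ne_zero hm0 hβ0)] at this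

section
variable {L : Type} [Field L] {i : L →+* Om} {σ : L →+* L}
  (hfix : ∀ x, σ x = x → ∃ q : ℚ, i x = q)
include hfix

lemma mem_cycUnion_of_cubic {x : L} (hx : σ (σ (σ x)) = x) : i x ∈ cycUnion := by
  obtain ⟨ω, hω⟩ := HasEnoughRootsOfUnity.exists_primitiveRoot Om 3
  have hω2 : IsPrimitiveRoot (ω^2) 3 := hω.pow_of_coprime 2 (by norm_num)
  have hw := omega_sq_add hω
  have h3 := hω.pow_eq_one
  obtain ⟨c, hc⟩ := hfix (x+σ x+σ (σ x)) (by simp only [map_add, hx]; ring)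
  obtain ⟨β, hβ⟩ := hfix (x^2+σ x^2+σ (σ x)^2-x*σ x-σ x*σ (σ x)-σ (σ x)*x)
    (by simp only [map_add, map_sub, map_mul, map_pow, hx]; ring)
  obtain ⟨C, hC⟩ := hfix (3*(x^2*σ (σ x)+σ x^2*x+σ (σ x)^2*σ x))
    (by simp only [map_add, map_mul, map_pow, map_ofNat, hx]; ring)
  obtain ⟨a, ha⟩ := hfix (x^3+σ x^3+σ (σ x)^3+6*(x*σ x*σ (σ x)))
    (by simp only [map_add, map_mul, map_pow, map_ofNat, hx]; ring)
  obtain ⟨b, hb⟩ := hfix (3*(x^2*σ x+σ x^2*σ (σ x)+σ (σ x)^2*x))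
    (by simp only [map_add, map_mul, map_pow, map_ofNat, hx]; ring)
  simp only [map_add, map_sub, map_mul, map_pow, map_ofNat] at hc hβ hC ha hb
  generalize i x = x₀ at *
  generalize i (σ x) = x₁ at *
  generalize i (σ (σ x)) = x₂ at *
  have key : ∀ w : Om, w^3 = 1 → w^2+w+1 = 0 → (x₀+w*x₁+w^2*x₂)^3 =
      ((a-C:ℚ) : Om)+((b-C:ℚ) : Om)*w := by
    intro w h3 hw
    push_cast
    rw [← ha, ← hb, ← hC]
    linear_combination (x₁^3+x₂^3*(w^3+1)+6*x₀*x₁*x₂+3*x₁^2*x₂*w +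
      3*x₂^2*x₀*w+3*x₂^2*x₁*w^2)*h3 +
      3*(x₀^2*x₂+x₁^2*x₀+x₂^2*x₁)*hw
  have k1 := key ω h3 hw
  have k2 := key (ω^2) hω2.pow_eq_one (omega_sq_add hω2)
  have e4 : (ω^2)^2 = ω := by linear_combination ω*h3
  have e : (x₀+ω*x₁+ω^2*x₂)*(x₀+ω^2*x₁+(ω^2)^2*x₂) = β := by
    rw [e4, ← hβ]
    linear_combination (x₁^2+x₂^2+x₁*x₂*ω)*h3+(x₀*x₁+x₀*x₂+x₁*x₂)*hw
  have m1 := mem_cycUnion_of_cube hω k1 k2 e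
  have m2 := mem_cycUnion_of_cube hω2 k2 (by rw [e4]; exact k1) (by rw [mul_comm]; exact e)
  have m3 := div_mem (add_mem (add_mem (show (c : Om) ∈ cycUnion by
    simpa using cycUnion.algebraMap_mem c) m1) m2) (natCast_mem cycUnion 3)
  convert m3 using 1
  rw [← hc, e4, eq_div_iff (by norm_num)]
  push_cast
  linear_combination -(x₁+x₂)*hw

lemma mem_cycUnion_of_sextic {y : L} (hy0 : y ≠ 0) (hy : σ y = -y) {x : L}
    (hx : σ (σ (σ (σ (σ (σ x))))) = x) : i x ∈ cycUnion := by
  have hyi : i y ∈ cycUnion := by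
    obtain ⟨q, hq⟩ := hfix (y^2) (by rw [map_pow, hy, neg_sq])
    exact mem_cycUnion_of_sq (r := q) (by rw [← map_pow, hq, eq_ratCast])
  have hu := mem_cycUnion_of_cubic hfix (x := x+σ (σ (σ x))) (by simp only [map_add, hx]; ring)
  have hv := mem_cycUnion_of_cubic hfix (x := (x-σ (σ (σ x)))*y) (by
    simp only [map_sub, map_mul, map_neg, hy, hx]; ring)
  have hi0 : i y ≠ 0 := (map_ne_zero i).mpr hy0
  have := div_mem (add_mem hu (div_mem hv hyi)) (natCast_mem cycUnion 2)
  convert this using 1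
  rw [map_mul, mul_div_cancel_right₀ _ hi0, map_add, map_sub]
  push_cast; ring

end

lemma mem_cycUnion_of_csix {L : Type} [Field L] [Algebra ℚ L] [FiniteDimensional ℚ L]
    [IsGalois ℚ L] (e : (L ≃ₐ[ℚ] L) ≃* Csix) (i : L →+* Om) (x : L) : i x ∈ cycUnion := by
  set σ : L ≃ₐ[ℚ] L := e.symm (ofAdd 1) with hσ
  have hpow : ∀ f : L ≃ₐ[ℚ] L, ∃ k : ℕ, f = σ^k := by
    intro f
    refine ⟨(toAdd (e f)).val, ?_⟩
    rw [hσ, ← map_pow, MulEquiv.eq_symm_apply, ← ofAdd_nsmul, nsmul_one, natCast_zmod_val,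
      ofAdd_toAdd]
  have h6 : σ^6 = 1 := by
    rw [hσ, ← map_pow, ← ofAdd_nsmul, show (6 • (1 : ZMod 6)) = 0 by decide, ofAdd_zero, map_one]
  have h6' : ∀ x, σ (σ (σ (σ (σ (σ x))))) = x := fun x => by
    simpa [pow_succ] using DFunLike.congr_fun h6 x
  have hfix : ∀ x, (σ : L →+* L) x = x → ∃ q : ℚ, i x = q := by
    intro x hx
    obtain ⟨q, hq⟩ := (IsGalois.mem_range_algebraMap_iff_fixed (F := ℚ) x).mpr fun f => by
      obtain ⟨k, rfl⟩ := hpow f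
      induction k with
      | zero => rfl
      | succ k ih => rw [pow_succ, AlgEquiv.mul_apply]; exact (congrArg _ hx).trans ih
    exact ⟨q, by rw [← hq, eq_ratCast, map_ratCast]⟩
  obtain ⟨y, hy0, hy⟩ : ∃ y, y ≠ 0 ∧ (σ : L →+* L) y = -y := by
    by_contra! hne
    have h0 : ∀ x, x-σ x+σ (σ x)-σ (σ (σ x))+σ (σ (σ (σ x)))-σ (σ (σ (σ (σ x)))) = 0 := by
      intro x
      by_contra h
      refine hne _ h ?_
      simp only [map_add, map_sub, RingHom.coe_coe, h6']; ring
    set v : Fin 6 → (L →* L) := fun k => ((σ^(k:ℕ) : L ≃ₐ[ℚ] L) : L →* L) with hv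
    have hinj : Injective v := by
      intro k l hkl
      have h1 : σ^(k:ℕ) = σ^(l:ℕ) := AlgEquiv.ext fun x => DFunLike.congr_fun hkl x
      rw [hσ, ← map_pow e.symm, ← map_pow e.symm, e.symm.injective.eq_iff, ← ofAdd_nsmul, ← ofAdd_nsmul,
        ofAdd.injective.eq_iff, nsmul_one, nsmul_one, ZMod.natCast_eq_natCast_iff',
        Nat.mod_eq_of_lt k.2, Nat.mod_eq_of_lt l.2] at h1
      exact Fin.ext h1
    have hli := (linearIndependent_monoidHom L L).comp v hinj
    have := Fintype.linearIndependent_iff.mp hli (fun k => (-1)^(k:ℕ)) (funext fun x => by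
      refine Eq.trans ?_ (h0 x)
      simp [Fin.sum_univ_six, hv, pow_succ]; ring) 0
    simp at this
  exact mem_cycUnion_of_sextic hfix hy0 hy (h6' x)

lemma exists_le_Wf (L : IntermediateField ℚ Om) (h1 : FiniteDimensional ℚ L)
    (h2 : IsGalois ℚ L) (h3 : Nonempty ((L ≃ₐ[ℚ] L) ≃* Csix)) :
    ∃ S : Finset ℕ, (∀ p ∈ S, p.Prime) ∧ L ≤ Wf (nS S) := by
  obtain ⟨e⟩ := h3
  have hm : ∀ x : L, (x : Om) ∈ cycUnion := mem_cycUnion_of_csix e L.val.toRingHom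
  choose S hS hmem using fun x : L => mem_cycUnion.mp (hm x)
  set b := Module.finBasis ℚ L
  refine ⟨univ.biUnion fun k => S (b k), fun p hp => ?_, fun x hx => ?_⟩
  · obtain ⟨k, -, hk⟩ := mem_biUnion.mp hp
    exact hS _ p hk
  · have := congrArg L.val (b.sum_repr ⟨x, hx⟩)
    rw [map_sum] at this
    change _ = x at this
    rw [← this]
    refine sum_mem fun k _ => ?_
    rw [Algebra.smul_def, map_mul, eq_ratCast, map_ratCast]
    exact mul_mem (SubfieldClass.ratCast_mem _ _) (Wf_nS_mono (subset_biUnion_of_mem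
      (fun k => S (b k)) (mem_univ k)) (hmem (b k)))

end

end

end CSix

/-- asymptotic count of C₆-extensions of ℚ with square-root saving error. -/
theorem count_C6_fields :
    ∃ c₃ c₄ c₅ : ℝ, 0 < c₃ ∧
      (fun X : ℝ => (galoisCount (Multiplicative (ZMod 6)) X : ℝ)
          - c₃ * X ^ ((1:ℝ)/3) - c₄ * X ^ ((1:ℝ)/4) - c₅ * X ^ ((1:ℝ)/5))
        =O[Filter.atTop] fun X : ℝ => X ^ ((1:ℝ)/6) * Real.log X ^ 5 := by
  obtain ⟨c3, c4, c5, K, hK, h⟩ := CSix.exists_asymp_surjCount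
  refine ⟨c3 / 2, c4 / 2, c5 / 2, half_pos (CSix.coeff_pos_of_asymp hK h), ?_⟩
  refine Asymptotics.IsBigO.of_bound (2 * K) ?_
  filter_upwards [Filter.eventually_ge_atTop (Real.exp 1)] with X hX
  have hX1 : 1 ≤ X := (Real.one_le_exp (by norm_num)).trans hX
  have hl : 1 ≤ Real.log X := by
    rw [← Real.log_exp 1]; exact Real.log_le_log (Real.exp_pos 1) hX
  have hc := CSix.two_mul_galoisCount CSix.exists_le_Wf hX1
  have hb := h X hX1
  rw [CSix.surjCount, ← hc, CSix.mainTerm] at hb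
  have h2 : (1 + Real.log X) ^ 2 ≤ 4 * Real.log X ^ 5 := by
    have : Real.log X ^ 2 ≤ Real.log X ^ 5 := pow_le_pow_right₀ hl (by norm_num)
    nlinarith
  have h3 : K * (X ^ ((1:ℝ)/6) * (1 + Real.log X) ^ 2) ≤
      K * (X ^ ((1:ℝ)/6) * (4 * Real.log X ^ 5)) := by gcongr
  have h4 : 0 ≤ X ^ ((1:ℝ)/6) * Real.log X ^ 5 := by positivity
  rw [Real.norm_eq_abs, Real.norm_of_nonneg h4, abs_le]
  obtain ⟨h5, h6⟩ := abs_le.mp (hb.trans h3)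
  constructor <;> linarith
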